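/- Let G be a finite nonsolvable group such that the set of orders of elements of G has at least 6 distinct values. Then either G is simple or ω(G) ≥ 7. -/

import Mathlib

open scoped MatrixGroups

/-- The number of orbits of the natural action of the automorphism group `Aut G`
on the group `G`. -/
noncomputable def omegaAut (G : Type*) [Group G] : ℕ :=
  Nat.card (MulAction.orbitRel.Quotient (MulAut G) G)

/-- An algebraic integer which is an average of roots of unity is either zero or has absolute value one. -/
theorem norm_eq_one_of_isIntegral_average {n d : ℕ} (hn : 0 < n) (hd : 0 < d) (s : Multiset ℂ)
    (hs : ∀ z ∈ s, z ^ n = 1) (hcard : Multiset.card s = d) {a : ℂ} (ha : a * d = s.sum)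
    (hia : IsIntegral ℤ a) : a = 0 ∨ ‖a‖ = 1 := by
  by_cases h0 : a = 0
  · exact Or.inl h0
  right
  let S : Set ℂ := {z | z ^ n = 1}
  have hSfin : S.Finite := by
    have : S = {z | z ∈ Polynomial.nthRoots n (1 : ℂ)} := by
      ext z; simp [S, Polynomial.mem_nthRoots hn]
    rw [this]
    exact Multiset.finite_toSet _
  let K := IntermediateField.adjoin ℚ S
  have hKfin : FiniteDimensional ℚ K := by
    have := hSfin.to_subtype
    refine IntermediateField.finiteDimensional_adjoin ?_
    intro z hz
    exact IsIntegral.of_pow hn (by rw [show z ^ n = 1 from hz]; exact isIntegral_one)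
  have hNF : NumberField K := ⟨⟩
  have hmemK : ∀ z ∈ s, z ∈ K := fun z hz => IntermediateField.subset_adjoin ℚ S (hs z hz)
  have hd' : (d : ℂ) ≠ 0 := by exact_mod_cast hd.ne'
  have haK : a ∈ K := by
    have : a = s.sum / d := by field_simp; exact ha
    rw [this]
    exact K.div_mem (multiset_sum_mem _ hmemK) (natCast_mem K d)
  let t : Multiset K := s.attach.map fun z => ⟨z.1, hmemK z.1 z.2⟩
  have htmap : t.map (fun z : K => (z : ℂ)) = s := by
    simp [t, Multiset.map_map]
  have htsum : (⟨a, haK⟩ : K) * (d : K) = t.sum := by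
    apply Subtype.ext
    have h1 : ((t.sum : K) : ℂ) = (t.map (fun z : K => (z : ℂ))).sum :=
      map_multiset_sum (K.val : K →+* ℂ) t
    rw [h1, htmap, ← ha]
    simp
  have hia' : IsIntegral ℤ (⟨a, haK⟩ : K) := by
    rw [← isIntegral_algHom_iff (K.val.restrictScalars ℤ) Subtype.val_injective]
    exact hia
  obtain ⟨m, hm, h1⟩ := NumberField.Embeddings.pow_eq_one_of_norm_le_one K ℂ
    (x := ⟨a, haK⟩) (by simpa [Subtype.ext_iff] using h0) hia' (by
      intro σ
      have e1 : σ ⟨a, haK⟩ * d = (t.map σ).sum := by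
        rw [← map_multiset_sum, ← htsum]; simp
      have e2 : ‖(t.map σ).sum‖ ≤ d := by
        refine (norm_multiset_sum_le _).trans ?_
        have : ((t.map σ).map fun x => ‖x‖) = (t.map fun _ => (1 : ℝ)) := by
          rw [Multiset.map_map]
          refine Multiset.map_congr rfl fun x hx => ?_
          have hx1 : (x : ℂ) ∈ s := by
            rw [← htmap]; exact Multiset.mem_map_of_mem _ hx
          have hx2 : x ^ n = 1 := Subtype.ext (hs _ hx1)
          have : (σ x) ^ n = 1 := by rw [← map_pow, hx2, map_one]
          exact Complex.norm_eq_one_of_pow_eq_one this hn.ne'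
        rw [this]
        simp [t, hcard]
      rw [← e1, norm_mul, Complex.norm_natCast] at e2
      have hdr : (0 : ℝ) < d := by exact_mod_cast hd
      nlinarith)
  have h2 : a ^ m = 1 := congrArg Subtype.val h1
  exact Complex.norm_eq_one_of_pow_eq_one h2 hm.ne'

/-- Equality in the triangle inequality: if unit complex numbers average to a unit number they agree. -/
theorem eq_of_norm_average_eq_one (s : Multiset ℂ) (hs : ∀ z ∈ s, ‖z‖ = 1) {a : ℂ}
    (ha : a * (Multiset.card s : ℂ) = s.sum) (hnorm : ‖a‖ = 1) : ∀ z ∈ s, z = a := by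
  have hre : ∀ z ∈ s, (z * starRingEnd ℂ a).re ≤ 1 := by
    intro z hz
    refine (Complex.re_le_norm _).trans ?_
    simp [hs z hz, hnorm]
  have hsum : (s.map fun z => (1 : ℝ) - (z * starRingEnd ℂ a).re).sum = 0 := by
    have haa : a * starRingEnd ℂ a = 1 := by
      rw [Complex.mul_conj, Complex.normSq_eq_norm_sq, hnorm]; simp
    have h1 : (s.map fun z => (z * starRingEnd ℂ a).re).sum = Multiset.card s := by
      have : (s.map fun z => (z * starRingEnd ℂ a).re).sum = (s.sum * starRingEnd ℂ a).re := by
        exact (map_multiset_sum (Complex.reAddGroupHom.comp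
          (AddMonoidHom.mulRight (starRingEnd ℂ a))) s).symm
      rw [this, ← ha, mul_right_comm, haa]; simp
    rw [Multiset.sum_map_sub, h1]; simp
  intro z hz
  have h2 : (1 : ℝ) - (z * starRingEnd ℂ a).re = 0 := by
    have hnn : ∀ x ∈ (s.map fun z => (1 : ℝ) - (z * starRingEnd ℂ a).re), 0 ≤ x := by
      intro x hx
      obtain ⟨w, hw, rfl⟩ := Multiset.mem_map.1 hx
      linarith [hre w hw]
    exact le_antisymm ((Multiset.single_le_sum hnn _ (Multiset.mem_map_of_mem _ hz)).trans hsum.le)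
      (hnn _ (Multiset.mem_map_of_mem _ hz))
  have h3 : ‖z - a‖ ^ 2 = 0 := by
    rw [← Complex.normSq_eq_norm_sq, Complex.normSq_sub, Complex.normSq_eq_norm_sq,
      Complex.normSq_eq_norm_sq, hs z hz, hnorm]
    linarith
  exact sub_eq_zero.1 (norm_eq_zero.1 (pow_eq_zero_iff two_ne_zero |>.1 h3))

theorem Matrix.pow_eq_one_of_mem_roots_charpoly {d n : ℕ} (M : Matrix (Fin d) (Fin d) ℂ)
    (hM : M ^ n = 1) {z : ℂ} (hz : z ∈ M.charpoly.roots) : z ^ n = 1 := by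
  have hdvd : minpoly ℂ M ∣ Polynomial.X ^ n - 1 := by
    apply minpoly.dvd; simp [hM]
  have h1 : (minpoly ℂ M).IsRoot z := by
    rw [← Matrix.minpoly_toLin', ← Module.End.hasEigenvalue_iff_isRoot]
    rw [Module.End.hasEigenvalue_iff_isRoot_charpoly]
    simpa using Polynomial.isRoot_of_mem_roots hz
  have h2 := h1.dvd hdvd
  simpa [sub_eq_zero] using h2

/-- A complex matrix of finite order whose normalised trace is an algebraic integer has trace zero or
is scalar. -/
theorem Matrix.trace_eq_zero_or_scalar {d n : ℕ} [NeZero d] (hn : 0 < n)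
    (M : Matrix (Fin d) (Fin d) ℂ) (hM : M ^ n = 1) {a : ℂ} (ha : a * d = M.trace)
    (hia : IsIntegral ℤ a) : M.trace = 0 ∨ ∃ c : ℂ, M = Matrix.scalar (Fin d) c := by
  have hd : 0 < d := Nat.pos_of_ne_zero (NeZero.ne d)
  rw [Matrix.trace_eq_sum_roots_charpoly] at ha
  have hdvd : minpoly ℂ M ∣ Polynomial.X ^ n - 1 := by
    apply minpoly.dvd; simp [hM]
  have hroot := fun z hz => M.pow_eq_one_of_mem_roots_charpoly hM (z := z) hz
  have hcard : Multiset.card M.charpoly.roots = d := by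
    rw [← (IsAlgClosed.splits M.charpoly).natDegree_eq_card_roots, Matrix.charpoly_natDegree_eq_dim]
    simp
  rcases norm_eq_one_of_isIntegral_average hn hd _ hroot hcard ha hia with h | h
  · left
    rw [Matrix.trace_eq_sum_roots_charpoly, ← ha, h, zero_mul]
  right
  have hall := eq_of_norm_average_eq_one M.charpoly.roots
    (fun z hz => Complex.norm_eq_one_of_pow_eq_one (hroot z hz) hn.ne') (by rw [hcard]; exact ha) h
  have hch : M.charpoly = (Polynomial.X - Polynomial.C a) ^ d := by
    have := (IsAlgClosed.splits M.charpoly).eq_prod_roots_of_monic M.charpoly_monic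
    rw [this, Multiset.eq_replicate.2 ⟨hcard, hall⟩]
    simp
  have hsep : Squarefree (Polynomial.X ^ n - 1 : Polynomial ℂ) :=
    (Polynomial.X_pow_sub_one_separable_iff.2 (by exact_mod_cast hn.ne')).squarefree
  have h4 : minpoly ℂ M ∣ Polynomial.X - Polynomial.C a := by
    rw [← (hsep.squarefree_of_dvd hdvd).dvd_pow_iff_dvd hd.ne', ← hch]
    exact Matrix.minpoly_dvd_charpoly M
  refine ⟨a, ?_⟩
  have h5 := Polynomial.aeval_eq_zero_of_dvd_aeval_eq_zero h4 (minpoly.aeval ℂ M)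
  simp only [map_sub, Polynomial.aeval_X, Polynomial.aeval_C, sub_eq_zero] at h5
  rw [h5]; rfl

section CharacterTheory

variable {G : Type*} [Group G] {n : ℕ} {d : Fin n → ℕ}
  (Φ : MonoidAlgebra ℂ G ≃ₐ[ℂ] ((i : Fin n) → Matrix (Fin (d i)) (Fin (d i)) ℂ))

theorem exists_scalar_of_central {x : MonoidAlgebra ℂ G} (hx : ∀ y, x * y = y * x) (i : Fin n) :
    ∃ c : ℂ, Φ x i = Matrix.scalar _ c := by
  obtain ⟨c, hc⟩ : Φ x i ∈ Set.range (Matrix.scalar (Fin (d i)) (α := ℂ)) := by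
    apply Matrix.mem_range_scalar_of_commute_single
    intro a b _
    have h := hx (Φ.symm (Pi.single i (Matrix.single a b 1)))
    have h2 := congrFun (congrArg Φ h) i
    simp only [map_mul, AlgEquiv.apply_symm_apply, Pi.mul_apply, Pi.single_eq_same] at h2
    exact h2.symm
  exact ⟨c, hc.symm⟩

theorem isIntegral_of_eq_scalar [Finite G] (x : MonoidAlgebra ℤ G) (i : Fin n) [NeZero (d i)] {c : ℂ}
    (hc : Φ (MonoidAlgebra.mapRingHom G (Int.castRingHom ℂ) x) i = Matrix.scalar _ c) :
    IsIntegral ℤ c := by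
  have hx : IsIntegral ℤ x := IsIntegral.of_finite ℤ x
  have h1 := map_isIntegral_int ((Pi.evalRingHom (fun i => Matrix (Fin (d i)) (Fin (d i)) ℂ) i).comp
    ((Φ : _ →+* _).comp (MonoidAlgebra.mapRingHom G (Int.castRingHom ℂ)))) hx
  have h2 : IsIntegral ℤ ((Matrix.scalar (Fin (d i)) : ℂ →+* _).toIntAlgHom c) := by
    have : (Matrix.scalar (Fin (d i)) : ℂ →+* _).toIntAlgHom c = Matrix.scalar (Fin (d i)) c := rfl
    rw [this, ← hc]; exact h1
  exact (isIntegral_algHom_iff _ (fun a b h => Matrix.scalar_inj.1 h)).1 h2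

theorem sum_mul_trace_eq_zero [Finite G] {g : G} (hg : g ≠ 1) :
    ∑ i, (d i : ℂ) * (Φ (MonoidAlgebra.single g 1) i).trace = 0 := by
  classical
  have := Fintype.ofFinite G
  have h1 : LinearMap.trace ℂ _ (LinearMap.mulLeft ℂ (MonoidAlgebra.single g (1 : ℂ))) = 0 := by
    rw [LinearMap.trace_eq_matrix_trace ℂ (MonoidAlgebra.basis G ℂ), Matrix.trace]
    refine Finset.sum_eq_zero fun x _ => ?_
    rw [Matrix.diag_apply, LinearMap.toMatrix_apply]
    simp only [MonoidAlgebra.basis_apply, LinearMap.mulLeft_apply, MonoidAlgebra.single_mul_single]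
    rw [one_mul, ← MonoidAlgebra.basis_apply, Module.Basis.repr_self]
    simp [hg]
  have h2 : LinearMap.trace ℂ _ (LinearMap.mulLeft ℂ (Φ (MonoidAlgebra.single g (1 : ℂ)))) = 0 := by
    rw [← h1, ← LinearMap.trace_conj' _ Φ.toLinearEquiv]
    congr 1
    refine LinearMap.ext fun x => ?_
    simp [LinearEquiv.conj_apply]
  rw [← h2, LinearMap.trace_eq_matrix_trace ℂ
    (Pi.basis fun i => Matrix.stdBasis ℂ (Fin (d i)) (Fin (d i)))]
  rw [Matrix.trace, Fintype.sum_sigma]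
  refine Finset.sum_congr rfl fun i _ => ?_
  rw [Fintype.sum_prod_type]
  have h3 : ∀ a b : Fin (d i), (LinearMap.toMatrix
      (Pi.basis fun i => Matrix.stdBasis ℂ (Fin (d i)) (Fin (d i)))
      (Pi.basis fun i => Matrix.stdBasis ℂ (Fin (d i)) (Fin (d i)))
      (LinearMap.mulLeft ℂ (Φ (MonoidAlgebra.single g (1 : ℂ))))).diag ⟨i, (a, b)⟩ =
      Φ (MonoidAlgebra.single g (1 : ℂ)) i a a := by
    intro a b
    rw [Matrix.diag_apply, LinearMap.toMatrix_apply, Pi.basis_repr, Pi.basis_apply,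
      LinearMap.mulLeft_apply, Pi.mul_apply, Pi.single_eq_same, Matrix.stdBasis_eq_single]
    exact (Matrix.mul_single_apply_same (1 : ℂ) a b a (Φ (MonoidAlgebra.single g 1) i)).trans
      (mul_one _)
  simp only [h3, Finset.sum_const, Finset.card_univ, Fintype.card_fin, nsmul_eq_mul]
  rw [← Finset.mul_sum]
  rfl

theorem exists_component_trivial [Finite G] : ∃ i, ∀ h : G, Φ (MonoidAlgebra.single h 1) i = 1 := by
  classical
  have := Fintype.ofFinite G
  let s : MonoidAlgebra ℂ G := ∑ x : G, MonoidAlgebra.single x 1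
  have hl : ∀ h : G, MonoidAlgebra.single h 1 * s = s := by
    intro h
    simp only [s, Finset.mul_sum, MonoidAlgebra.single_mul_single, one_mul]
    exact Fintype.sum_equiv (Equiv.mulLeft h) _ _ fun x => rfl
  have hr : ∀ h : G, s * MonoidAlgebra.single h 1 = s := by
    intro h
    simp only [s, Finset.sum_mul, MonoidAlgebra.single_mul_single, one_mul]
    exact Fintype.sum_equiv (Equiv.mulRight h) _ _ fun x => rfl
  have hs : s ≠ 0 := by
    intro h0
    have h1 := congrArg (fun x => MonoidAlgebra.coeff x 1) h0
    simp [s, MonoidAlgebra.coeff_sum, Finsupp.single_apply] at h1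
  have hc : ∀ y, s * y = y * s := by
    intro y
    induction y using MonoidAlgebra.induction_linear with
    | zero => simp
    | add f g hf hg => rw [mul_add, add_mul, hf, hg]
    | single a b =>
      have : (MonoidAlgebra.single a b : MonoidAlgebra ℂ G) = b • MonoidAlgebra.single a 1 := by
        simp
      rw [this, mul_smul_comm, smul_mul_assoc, hl, hr]
  obtain ⟨i, hi⟩ : ∃ i, Φ s i ≠ 0 := by
    by_contra! hcon
    exact hs (Φ.injective (by rw [map_zero]; exact funext hcon))
  refine ⟨i, fun h => ?_⟩
  obtain ⟨c, hcs⟩ := exists_scalar_of_central Φ hc i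
  have hc0 : c ≠ 0 := by
    rintro rfl
    exact hi (by rw [hcs, map_zero])
  have h1 := congrFun (congrArg Φ (hl h)) i
  rw [map_mul, Pi.mul_apply, hcs] at h1
  have h2 := congrArg (· * Matrix.scalar (Fin (d i)) c⁻¹) h1
  simp only [mul_assoc, ← map_mul, mul_inv_cancel₀ hc0, map_one, mul_one] at h2
  exact h2

theorem component_trivial_span {i : Fin n} (hi : ∀ h : G, Φ (MonoidAlgebra.single h 1) i = 1)
    (x : MonoidAlgebra ℂ G) (j : Fin n) (hj : ∀ h : G, Φ (MonoidAlgebra.single h 1) j = 1) :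
    ∃ c : ℂ, Φ x i = Matrix.scalar _ c ∧ Φ x j = Matrix.scalar _ c := by
  induction x using MonoidAlgebra.induction_linear with
  | zero => exact ⟨0, by simp, by simp⟩
  | add f g hf hg =>
    obtain ⟨c, h1, h2⟩ := hf
    obtain ⟨e, h3, h4⟩ := hg
    exact ⟨c + e, by rw [map_add, Pi.add_apply, h1, h3, map_add],
      by rw [map_add, Pi.add_apply, h2, h4, map_add]⟩
  | single a b =>
    have : (MonoidAlgebra.single a b : MonoidAlgebra ℂ G) = b • MonoidAlgebra.single a 1 := by simp
    refine ⟨b, ?_, ?_⟩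
    · rw [this, map_smul, Pi.smul_apply, hi, Matrix.smul_one_eq_diagonal]; rfl
    · rw [this, map_smul, Pi.smul_apply, hj, Matrix.smul_one_eq_diagonal]; rfl

theorem component_trivial_unique [∀ i, NeZero (d i)] {i j : Fin n}
    (hi : ∀ h : G, Φ (MonoidAlgebra.single h 1) i = 1)
    (hj : ∀ h : G, Φ (MonoidAlgebra.single h 1) j = 1) : i = j := by
  by_contra hij
  obtain ⟨c, h1, h2⟩ := component_trivial_span Φ hi (Φ.symm (Pi.single i 1)) j hj
  rw [AlgEquiv.apply_symm_apply, Pi.single_eq_same] at h1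
  rw [AlgEquiv.apply_symm_apply, Pi.single_eq_of_ne (Ne.symm hij)] at h2
  have e1 : c = 1 := Matrix.scalar_inj.1 (h1.symm.trans (map_one _).symm)
  have e2 : c = 0 := Matrix.scalar_inj.1 (h2.symm.trans (map_zero _).symm)
  exact one_ne_zero (e1.symm.trans e2)

theorem component_trivial_dim [∀ i, NeZero (d i)] {i : Fin n}
    (hi : ∀ h : G, Φ (MonoidAlgebra.single h 1) i = 1) : d i = 1 := by
  by_contra hd
  have h0 : 0 < d i := Nat.pos_of_ne_zero (NeZero.ne _)
  have h1 : 1 < d i := by omega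
  let a : Fin (d i) := ⟨0, h0⟩
  let b : Fin (d i) := ⟨1, h1⟩
  have hab : a ≠ b := by simp [a, b]
  obtain ⟨c, h2, -⟩ := component_trivial_span Φ hi
    (Φ.symm (Pi.single i (Matrix.single a b 1))) i hi
  rw [AlgEquiv.apply_symm_apply, Pi.single_eq_same] at h2
  have := congrFun (congrFun h2 a) b
  simp [Matrix.scalar_apply, hab] at this

/-- A finite simple group with a nontrivial conjugacy class of prime power size is abelian. -/
theorem IsSimpleGroup.comm_of_card_class_eq_prime_pow [Finite G] [IsSimpleGroup G] {p a : ℕ}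
    (hp : p.Prime) {g : G} (hg : g ≠ 1) (hcl : (conjugatesOf g).ncard = p ^ a) (x y : G) :
    x * y = y * x := by
  classical
  have := Fintype.ofFinite G
  by_contra hxy
  obtain ⟨n, d, hd, ⟨Φ⟩⟩ :=
    IsSemisimpleRing.exists_algEquiv_pi_matrix_of_isAlgClosed ℂ (MonoidAlgebra ℂ G)
  let ρ : (i : Fin n) → G →* Matrix (Fin (d i)) (Fin (d i)) ℂ := fun i =>
    ((Pi.evalMonoidHom (fun i => Matrix (Fin (d i)) (Fin (d i)) ℂ) i).comp
      (Φ : _ →* _)).comp (MonoidAlgebra.of ℂ G)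
  have hρ : ∀ i h, ρ i h = Φ (MonoidAlgebra.single h 1) i := fun i h => rfl
  have hχ : ∀ i, IsIntegral ℤ (ρ i g).trace := by
    intro i
    rw [Matrix.trace_eq_sum_roots_charpoly]
    refine multiset_sum_mem (S := integralClosure ℤ ℂ) _ fun z hz => ?_
    have h1 := (ρ i g).pow_eq_one_of_mem_roots_charpoly (n := Nat.card G)
      (by rw [← map_pow, pow_card_eq_one', map_one]) hz
    exact IsIntegral.of_pow Nat.card_pos (by rw [h1]; exact isIntegral_one)
  have hscal : ∀ i, (∃ c, ρ i g = Matrix.scalar _ c) → ∀ h, ρ i h = 1 := by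
    rintro i ⟨c, hc⟩
    let N : Subgroup G := (Subgroup.centralizer (Set.range (ρ i).toHomUnits)).comap (ρ i).toHomUnits
    have hmem : ∀ h, h ∈ N ↔ ∀ k, ρ i k * ρ i h = ρ i h * ρ i k := by
      intro h
      simp only [N, Subgroup.mem_comap, Subgroup.mem_centralizer_iff, Set.forall_mem_range,
        Units.ext_iff]
      rfl
    have hN : N.Normal := by
      refine ⟨fun h hh k => ?_⟩
      rw [hmem] at hh ⊢
      have : ρ i (k * h * k⁻¹) = ρ i h := by
        rw [map_mul, map_mul, hh k, mul_assoc, ← map_mul, mul_inv_cancel, map_one, mul_one]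
      intro l
      rw [this, hh l]
    have hNtop : N = ⊤ := by
      refine hN.eq_bot_or_eq_top.resolve_left fun hbot => hg ?_
      rw [← Subgroup.mem_bot, ← hbot, hmem]
      intro k
      rw [hc]
      exact (Matrix.scalar_commute c (fun _ => Commute.all _ _) _).symm
    have hker : (ρ i).toHomUnits.ker = ⊤ := by
      refine (MonoidHom.normal_ker _).eq_bot_or_eq_top.resolve_left fun hbot => hxy ?_
      have hinj := (MonoidHom.ker_eq_bot_iff _).1 hbot
      apply hinj
      apply Units.ext
      rw [map_mul, map_mul]
      have : y ∈ N := by rw [hNtop]; trivial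
      exact (hmem y).1 this x
    intro h
    have : h ∈ (ρ i).toHomUnits.ker := by rw [hker]; trivial
    exact congrArg Units.val (MonoidHom.mem_ker.1 this)
  have hcentral : ∀ i, ¬ p ∣ d i → (∀ h, ρ i h = 1) ∨ (ρ i g).trace = 0 := by
    intro i hpd
    let z : MonoidAlgebra ℤ G := ∑ x ∈ (conjugatesOf g).toFinset, MonoidAlgebra.single x 1
    have hz : MonoidAlgebra.mapRingHom G (Int.castRingHom ℂ) z =
        ∑ x ∈ (conjugatesOf g).toFinset, MonoidAlgebra.single x 1 := by
      simp [z]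
    have hzc : ∀ y, MonoidAlgebra.mapRingHom G (Int.castRingHom ℂ) z * y =
        y * MonoidAlgebra.mapRingHom G (Int.castRingHom ℂ) z := by
      rw [hz]
      intro y
      induction y using MonoidAlgebra.induction_linear with
      | zero => simp
      | add f g hf hg => rw [mul_add, add_mul, hf, hg]
      | single a b =>
        simp only [Finset.sum_mul, Finset.mul_sum, MonoidAlgebra.single_mul_single, one_mul, mul_one]
        refine Finset.sum_bij' (fun x _ => a⁻¹ * x * a) (fun x _ => a * x * a⁻¹) ?_ ?_ ?_ ?_ ?_
        · intro x hx
          rw [Set.mem_toFinset] at hx ⊢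
          exact IsConj.trans hx (isConj_iff.2 ⟨a⁻¹, by simp⟩)
        · intro x hx
          rw [Set.mem_toFinset] at hx ⊢
          exact IsConj.trans hx (isConj_iff.2 ⟨a, rfl⟩)
        · intro x _; group
        · intro x _; group
        · intro x _
          congr 1; group
    obtain ⟨c, hc⟩ := exists_scalar_of_central Φ hzc i
    have hcint := isIntegral_of_eq_scalar Φ z i hc
    have hd0 : (d i : ℂ) ≠ 0 := by exact_mod_cast NeZero.ne (d i)
    have htr : (p ^ a : ℂ) * (ρ i g).trace = c * d i := by
      have h1 : (Φ (MonoidAlgebra.mapRingHom G (Int.castRingHom ℂ) z) i).trace = c * d i := by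
        rw [hc]; simp [Matrix.scalar_apply, Matrix.trace, mul_comm]
      rw [← h1, hz, map_sum, Finset.sum_apply, Matrix.trace_sum]
      rw [Finset.sum_congr rfl (g := fun _ => (ρ i g).trace)]
      · rw [Finset.sum_const, ← Set.ncard_eq_toFinset_card', hcl, nsmul_eq_mul]
        push_cast; rfl
      · intro x hx
        rw [Set.mem_toFinset] at hx
        have hx : IsConj g x := hx
        obtain ⟨k, rfl⟩ := isConj_iff.1 hx
        rw [← hρ, map_mul, Matrix.trace_mul_comm, ← map_mul]
        congr 2; group
    have hcop : IsCoprime ((p ^ a : ℕ) : ℤ) (d i : ℤ) :=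
      Nat.isCoprime_iff_coprime.2 (((Nat.Prime.coprime_iff_not_dvd hp).2 hpd).pow_left a)
    obtain ⟨u, v, huv⟩ := hcop
    have huv' : (u : ℂ) * (p ^ a : ℂ) + v * d i = 1 := by exact_mod_cast congrArg (Int.cast : ℤ → ℂ) huv
    have hav : ((u : ℂ) * c + v * (ρ i g).trace) * d i = (ρ i g).trace := by
      linear_combination (ρ i g).trace * huv' - (u : ℂ) * htr
    have havint : IsIntegral ℤ ((u : ℂ) * c + v * (ρ i g).trace) :=
      ((isIntegral_algebraMap (R := ℤ) (x := u)).mul hcint).add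
        ((isIntegral_algebraMap (R := ℤ) (x := v)).mul (hχ i))
    rcases Matrix.trace_eq_zero_or_scalar (Nat.card_pos (α := G)) (ρ i g)
      (by rw [← map_pow, pow_card_eq_one', map_one]) hav havint with h | h
    · exact Or.inr h
    · exact Or.inl (hscal i h)
  obtain ⟨i₀, hi₀⟩ := exists_component_trivial Φ
  have hsum := sum_mul_trace_eq_zero Φ hg
  rw [← Finset.add_sum_erase _ _ (Finset.mem_univ i₀)] at hsum
  have hia : IsIntegral ℤ ((p : ℂ)⁻¹) := by
    have h1 : ∑ i ∈ Finset.univ.erase i₀, (d i : ℂ) * (ρ i g).trace = 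
        p * ∑ i ∈ Finset.univ.erase i₀, ((d i / p : ℕ) : ℂ) * (ρ i g).trace := by
      rw [Finset.mul_sum]
      refine Finset.sum_congr rfl fun i hi => ?_
      by_cases hpd : p ∣ d i
      · obtain ⟨k, hk⟩ := hpd
        have h2 : (d i : ℂ) = p * ((d i / p : ℕ) : ℂ) := by
          rw [hk, Nat.mul_div_cancel_left _ hp.pos]; push_cast; rfl
        rw [← mul_assoc, ← h2]
      · rcases hcentral i hpd with h | h
        · exact absurd (component_trivial_unique Φ h hi₀) (Finset.ne_of_mem_erase hi)
        · rw [h]; simp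
    have h2 : IsIntegral ℤ (∑ i ∈ Finset.univ.erase i₀, ((d i / p : ℕ) : ℂ) * (ρ i g).trace) := by
      refine IsIntegral.sum _ fun i _ => ?_
      exact (isIntegral_algebraMap (R := ℤ) (x := ((d i / p : ℕ) : ℤ))).mul (hχ i)
    have h3 : (d i₀ : ℂ) * (Φ (MonoidAlgebra.single g 1) i₀).trace = 1 := by
      rw [hi₀, Matrix.trace_one, component_trivial_dim Φ hi₀]; simp
    rw [h3] at hsum
    change 1 + ∑ i ∈ Finset.univ.erase i₀, (d i : ℂ) * (ρ i g).trace = 0 at hsum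
    rw [h1] at hsum
    have hp0 : (p : ℂ) ≠ 0 := by exact_mod_cast hp.ne_zero
    have h4 : (p : ℂ)⁻¹ = - ∑ i ∈ Finset.univ.erase i₀, ((d i / p : ℕ) : ℂ) * (ρ i g).trace := by
      field_simp
      linear_combination hsum
    rw [h4]
    exact h2.neg
  have hint2 : IsIntegral ℤ ((p : ℚ)⁻¹) := by
    rw [← isIntegral_algHom_iff ((algebraMap ℚ ℂ).toIntAlgHom) (algebraMap ℚ ℂ).injective]
    simpa using hia
  obtain ⟨z, hz⟩ := IsIntegrallyClosed.isIntegral_iff.1 hint2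
  have hp0 : (p : ℚ) ≠ 0 := by exact_mod_cast hp.ne_zero
  have h5 : (z : ℚ) * p = 1 := by
    have : (z : ℚ) = (p : ℚ)⁻¹ := by simpa using hz
    rw [this, inv_mul_cancel₀ hp0]
  have h6 : z * (p : ℤ) = 1 := by exact_mod_cast h5
  have h7 : (p : ℤ) ∣ 1 := ⟨z, by rw [mul_comm, h6]⟩
  exact hp.one_lt.ne' (by exact_mod_cast Int.eq_one_of_dvd_one (by positivity) h7)

end CharacterTheory

theorem ncard_conjugatesOf {G : Type*} [Group G] (g : G) :
    (conjugatesOf g).ncard = (Subgroup.centralizer {g}).index := by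
  have h1 : (conjugatesOf g) = MulAction.orbit (ConjAct G) g := by
    ext x
    rw [ConjAct.mem_orbit_conjAct]
    exact isConj_comm
  rw [h1, ← MulAction.index_stabilizer, ConjAct.stabilizer_eq_centralizer]
  rfl

theorem isSolvable_of_prime_dvd_card_eq_or_eq {p q : ℕ} : ∀ {G : Type*} [Group G] [Finite G]
    (_ : ∀ ℓ : ℕ, ℓ.Prime → ℓ ∣ Nat.card G → ℓ = p ∨ ℓ = q), Group.IsSolvable G := by
  suffices H : ∀ n, ∀ {G : Type _} [Group G] [Finite G], Nat.card G = n →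
      (∀ ℓ : ℕ, ℓ.Prime → ℓ ∣ Nat.card G → ℓ = p ∨ ℓ = q) → Group.IsSolvable G from
    fun {G} _ _ h => H _ rfl h
  intro n
  induction n using Nat.strong_induction_on with
  | _ n ih =>
  intro G _ _ hn h
  rcases subsingleton_or_nontrivial G with hss | hnt
  · infer_instance
  by_cases hs : IsSimpleGroup G
  · apply Group.isSolvable_of_comm
    obtain ⟨ℓ, hℓ, hdvd⟩ := Nat.exists_prime_and_dvd (Finite.one_lt_card (α := G)).ne'
    have := Fact.mk hℓ
    obtain ⟨P⟩ := Sylow.nonempty (p := ℓ) (G := G)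
    have hPnt : Nontrivial P := by
      rw [← Finite.one_lt_card_iff_nontrivial]
      have := P.dvd_card_of_dvd_card hdvd
      exact lt_of_lt_of_le hℓ.one_lt (Nat.le_of_dvd Nat.card_pos this)
    have hZ := P.isPGroup'.center_nontrivial
    obtain ⟨⟨z, hz⟩, hz1⟩ := exists_ne (1 : Subgroup.center P)
    have hPC : (P : Subgroup G) ≤ Subgroup.centralizer {(z : G)} := by
      intro x hx
      rw [Subgroup.mem_centralizer_singleton_iff]
      have := Subgroup.mem_center_iff.1 hz ⟨x, hx⟩
      exact congrArg Subtype.val this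
    have hidx := Subgroup.index_dvd_of_le hPC
    have hnd : ¬ ℓ ∣ (Subgroup.centralizer {(z : G)}).index := fun hd =>
      P.not_dvd_index (hd.trans hidx)
    have hne : (Subgroup.centralizer {(z : G)}).index ≠ 0 := Subgroup.index_ne_zero_of_finite
    obtain ⟨m, hm, hall⟩ : ∃ m, m.Prime ∧
        ∀ r : ℕ, r.Prime → r ∣ (Subgroup.centralizer {(z : G)}).index → r = m := by
      by_cases h1 : ∃ r : ℕ, r.Prime ∧ r ∣ (Subgroup.centralizer {(z : G)}).index
      · obtain ⟨m, hm, hmd⟩ := h1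
        refine ⟨m, hm, fun r hr hrd => ?_⟩
        have e1 := h ℓ hℓ hdvd
        have e2 := h m hm (hmd.trans (Subgroup.index_dvd_card _))
        have e3 := h r hr (hrd.trans (Subgroup.index_dvd_card _))
        have e4 : m ≠ ℓ := by rintro rfl; exact hnd hmd
        have e5 : r ≠ ℓ := by rintro rfl; exact hnd hrd
        omega
      · push Not at h1
        exact ⟨2, Nat.prime_two, fun r hr hrd => absurd hrd (h1 r hr)⟩
    have hpow := Nat.eq_prime_pow_of_unique_prime_dvd hne (fun {r} hr hrd => hall r hr hrd)
    rw [← ncard_conjugatesOf] at hpow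
    refine IsSimpleGroup.comm_of_card_class_eq_prime_pow hm ?_ hpow
    intro h1
    apply hz1
    exact Subtype.ext (Subtype.ext h1)
  · obtain ⟨N, hN, hNb, hNt⟩ : ∃ N : Subgroup G, N.Normal ∧ N ≠ ⊥ ∧ N ≠ ⊤ := by
      by_contra! hcon
      exact hs ⟨fun N hN => or_iff_not_imp_left.2 (hcon N hN)⟩
    have hcard := N.card_mul_index
    have hpos : 0 < N.index := Nat.pos_of_ne_zero Subgroup.index_ne_zero_of_finite
    have h1 : 1 < N.index := by
      have : N.index ≠ 1 := fun h => hNt (Subgroup.index_eq_one.1 h)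
      omega
    have h2 : 1 < Nat.card N := by
      rw [Subgroup.one_lt_card_iff_ne_bot]; exact hNb
    rw [Group.isSolvable_iff_subgroup_quotient N]
    constructor
    · refine ih (Nat.card N) ?_ rfl fun r hr hrd => h r hr (hrd.trans N.card_subgroup_dvd_card)
      rw [← hn, ← hcard]
      nlinarith
    · refine ih (Nat.card (G ⧸ N)) ?_ rfl fun r hr hrd => h r hr (hrd.trans ?_)
      · rw [← hn, ← hcard, ← Subgroup.index_eq_card]
        nlinarith
      · rw [← Subgroup.index_eq_card]; exact N.index_dvd_card

section RelativeSylow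

set_option linter.unusedSectionVars false

variable {G : Type*} [Group G]

/-- The conjugate `k P k⁻¹`. -/
def Subgroup.conjBy (k : G) (P : Subgroup G) : Subgroup G := P.map (MulAut.conj k).toMonoidHom

theorem Subgroup.mem_conjBy {k x : G} {P : Subgroup G} : x ∈ P.conjBy k ↔ k⁻¹ * x * k ∈ P := by
  simp only [Subgroup.conjBy, Subgroup.mem_map_equiv, MulAut.conj_symm_apply]

theorem Subgroup.conj_mem_conjBy {k x : G} {P : Subgroup G} : k * x * k⁻¹ ∈ P.conjBy k ↔ x ∈ P := by
  rw [Subgroup.mem_conjBy]; simp [mul_assoc]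

theorem Subgroup.card_conjBy (k : G) (P : Subgroup G) : Nat.card (P.conjBy k) = Nat.card P :=
  Subgroup.card_map_of_injective (MulAut.conj k).injective

theorem Subgroup.conjBy_le {k : G} {P K : Subgroup G} (hP : P ≤ K) (hk : k ∈ K) : P.conjBy k ≤ K := by
  intro x hx
  have h1 := hP (Subgroup.mem_conjBy.1 hx)
  have := K.mul_mem (K.mul_mem hk h1) (K.inv_mem hk)
  simpa [mul_assoc] using this

/-- The normalizer of `P` in `K`. -/
def Subgroup.nor (K P : Subgroup G) : Subgroup G := K ⊓ Subgroup.normalizer (P : Set G)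

/-- The centralizer of the element `x` in `K`. -/
def Subgroup.cen (K : Subgroup G) (x : G) : Subgroup G := K ⊓ Subgroup.centralizer {x}

theorem Subgroup.mem_nor {K P : Subgroup G} {x : G} :
    x ∈ K.nor P ↔ x ∈ K ∧ ∀ h, h ∈ P ↔ x * h * x⁻¹ ∈ P := by
  rw [Subgroup.nor, Subgroup.mem_inf, Subgroup.mem_normalizer_iff]

theorem Subgroup.nor_le {K P : Subgroup G} : K.nor P ≤ K := inf_le_left

theorem Subgroup.le_nor {K P : Subgroup G} (h : P ≤ K) : P ≤ K.nor P :=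
  le_inf h Subgroup.le_normalizer

theorem Subgroup.mem_cen {K : Subgroup G} {x y : G} : y ∈ K.cen x ↔ y ∈ K ∧ y * x = x * y := by
  rw [Subgroup.cen, Subgroup.mem_inf, Subgroup.mem_centralizer_singleton_iff]

theorem Subgroup.cen_le {K : Subgroup G} {x : G} : K.cen x ≤ K := inf_le_left

theorem Subgroup.mem_nor_of_conj_mem [Finite G] {K P : Subgroup G} {x : G} (hx : x ∈ K)
    (h : ∀ y ∈ P, x * y * x⁻¹ ∈ P) : x ∈ K.nor P := by
  refine ⟨hx, ?_⟩
  have h1 : P.conjBy x ≤ P := by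
    intro y hy
    have := h _ (Subgroup.mem_conjBy.1 hy)
    simpa [mul_assoc] using this
  have h2 : P.conjBy x = P :=
    Subgroup.eq_of_le_of_card_ge h1 (Subgroup.card_conjBy x P).ge
  refine Subgroup.mem_normalizer_iff.2 fun y => ⟨h y, fun hy => ?_⟩
  rw [← h2] at hy
  exact Subgroup.conj_mem_conjBy.1 hy

theorem Subgroup.conjBy_eq_iff [Finite G] {K P : Subgroup G} {x : G} (hx : x ∈ K) :
    P.conjBy x = P ↔ x ∈ K.nor P := by
  constructor
  · intro h
    refine Subgroup.mem_nor_of_conj_mem hx fun y hy => ?_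
    rw [← h]
    exact Subgroup.conj_mem_conjBy.2 hy
  · intro h
    ext y
    rw [Subgroup.mem_conjBy, (Subgroup.mem_nor.1 h).2]
    simp [mul_assoc]

/-- `P` is a Sylow `p`-subgroup of the subgroup `K`. -/
def SylIn (p : ℕ) (P K : Subgroup G) : Prop :=
  P ≤ K ∧ Nat.card P = p ^ (Nat.card K).factorization p

variable [Finite G] {p : ℕ}

theorem SylIn.le {P K : Subgroup G} (h : SylIn p P K) : P ≤ K := h.1

theorem SylIn.isPGroup {P K : Subgroup G} (h : SylIn p P K) : IsPGroup p P := IsPGroup.of_card h.2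

theorem IsPGroup.exists_le_sylIn (hp : p.Prime) {Q K : Subgroup G} (hQ : IsPGroup p Q) (hQK : Q ≤ K) :
    ∃ P, SylIn p P K ∧ Q ≤ P := by
  have := Fact.mk hp
  obtain ⟨R, hR⟩ := (hQ.comap_of_injective K.subtype K.subtype_injective :
    IsPGroup p (Q.comap K.subtype)).exists_le_sylow
  refine ⟨(R : Subgroup K).map K.subtype, ⟨Subgroup.map_subtype_le _, ?_⟩, ?_⟩
  · rw [Subgroup.card_map_of_injective K.subtype_injective, R.card_eq_multiplicity]
  · intro x hx
    exact ⟨⟨x, hQK hx⟩, hR hx, rfl⟩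

theorem exists_sylIn (hp : p.Prime) (K : Subgroup G) : ∃ P, SylIn p P K := by
  obtain ⟨P, hP, -⟩ := IsPGroup.exists_le_sylIn hp (IsPGroup.of_bot (G := G)) (bot_le : ⊥ ≤ K)
  exact ⟨P, hP⟩

/-- The Sylow subgroup of `↥K` attached to a relative Sylow subgroup. -/
noncomputable def SylIn.toSylow [Fact p.Prime] {P K : Subgroup G} (h : SylIn p P K) : Sylow p K :=
  Sylow.ofCard (P.subgroupOf K) (by
    rw [← h.2]; exact Nat.card_congr (Subgroup.subgroupOfEquivOfLe h.1).toEquiv)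

theorem SylIn.conjBy {P K : Subgroup G} (h : SylIn p P K) {k : G} (hk : k ∈ K) :
    SylIn p (P.conjBy k) K :=
  ⟨Subgroup.conjBy_le h.1 hk, by rw [Subgroup.card_conjBy, h.2]⟩

theorem SylIn.exists_conjBy_eq (hp : p.Prime) {P Q K : Subgroup G} (hP : SylIn p P K)
    (hQ : SylIn p Q K) : ∃ k ∈ K, P.conjBy k = Q := by
  have := Fact.mk hp
  obtain ⟨⟨k, hk⟩, h⟩ := MulAction.exists_smul_eq K hP.toSylow hQ.toSylow
  refine ⟨k, hk, ?_⟩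
  have h1 : ((⟨k, hk⟩ : K) • hP.toSylow : Sylow p K).toSubgroup = hQ.toSylow.toSubgroup := by rw [h]
  refine Subgroup.eq_of_le_of_card_ge ?_ (by rw [Subgroup.card_conjBy, hP.2, hQ.2])
  intro x hx
  rw [Subgroup.mem_conjBy] at hx
  have hxK : x ∈ K := by
    have := K.mul_mem (K.mul_mem hk (hP.1 hx)) (K.inv_mem hk)
    simpa [mul_assoc] using this
  have h2 : (⟨x, hxK⟩ : K) ∈ ((⟨k, hk⟩ : K) • hP.toSylow : Sylow p K).toSubgroup := by
    rw [Sylow.coe_subgroup_smul, Subgroup.mem_pointwise_smul_iff_inv_smul_mem]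
    change ((MulAut.conj (⟨k, hk⟩ : K))⁻¹ ⟨x, hxK⟩ : K) ∈ P.subgroupOf K
    rw [Subgroup.mem_subgroupOf, ← map_inv]
    simpa using hx
  rw [h1] at h2
  exact h2

theorem SylIn.of_le_of_le {P N K : Subgroup G} (hp : p.Prime) (hP : SylIn p P K) (hPN : P ≤ N)
    (hNK : N ≤ K) : SylIn p P N := by
  refine ⟨hPN, ?_⟩
  have h1 : Nat.card P ∣ Nat.card N := Subgroup.card_dvd_of_le hPN
  have h2 : Nat.card N ∣ Nat.card K := Subgroup.card_dvd_of_le hNK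
  have h3 : (Nat.card N).factorization p ≤ (Nat.card K).factorization p :=
    (Nat.factorization_le_iff_dvd Nat.card_pos.ne' Nat.card_pos.ne').2 h2 p
  have h4 : (Nat.card K).factorization p ≤ (Nat.card N).factorization p := by
    rw [hP.2] at h1
    exact (hp.pow_dvd_iff_le_factorization Nat.card_pos.ne').1 h1
  rw [hP.2, le_antisymm h3 h4]

theorem IsPGroup.exists_conjBy_le (hp : p.Prime) {Q P K : Subgroup G} (hQ : IsPGroup p Q) (hQK : Q ≤ K)
    (hP : SylIn p P K) : ∃ k ∈ K, Q.conjBy k ≤ P := by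
  obtain ⟨R, hR, hQR⟩ := hQ.exists_le_sylIn hp hQK
  obtain ⟨k, hk, rfl⟩ := hR.exists_conjBy_eq hp hP
  refine ⟨k, hk, ?_⟩
  exact Subgroup.map_mono hQR

theorem SylIn.eq_of_le (hp : p.Prime) {Q P K : Subgroup G} (hP : SylIn p P K) (hQ : IsPGroup p Q)
    (hPQ : P ≤ Q) (hQK : Q ≤ K) : P = Q := by
  obtain ⟨R, hR, hQR⟩ := hQ.exists_le_sylIn hp hQK
  refine Subgroup.eq_of_le_of_card_ge hPQ ?_
  rw [hP.2, ← hR.2]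
  exact Nat.card_le_card_of_injective _ (Subgroup.inclusion_injective hQR)

/-- A `p`-subgroup normalising a Sylow `p`-subgroup is contained in it. -/
theorem SylIn.le_of_isPGroup_of_le_nor (hp : p.Prime) {Q P K : Subgroup G} (hP : SylIn p P K)
    (hQ : IsPGroup p Q) (hQn : Q ≤ K.nor P) : Q ≤ P := by
  have h1 : IsPGroup p (Q ⊔ P : Subgroup G) :=
    hQ.to_sup_of_normal_right' hP.isPGroup (hQn.trans inf_le_right)
  have h2 := hP.eq_of_le hp h1 le_sup_right (sup_le (hQn.trans Subgroup.nor_le) hP.1)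
  rw [h2]; exact le_sup_left

theorem isPGroup_zpowers {x : G} {k : ℕ} (hx : orderOf x = p ^ k) :
    IsPGroup p (Subgroup.zpowers x) := by
  refine IsPGroup.of_card (n := k) ?_
  rw [Nat.card_zpowers, hx]

theorem SylIn.mem_of_mem_nor (hp : p.Prime) {P K : Subgroup G} (hP : SylIn p P K) {x : G} {k : ℕ}
    (hx : orderOf x = p ^ k) (hxn : x ∈ K.nor P) : x ∈ P :=
  (Subgroup.zpowers_le.1 (hP.le_of_isPGroup_of_le_nor hp (isPGroup_zpowers hx)
    (Subgroup.zpowers_le.2 hxn)))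

/-- Frattini argument. -/
theorem SylIn.exists_mul_mem_normalizer (hp : p.Prime) {P N : Subgroup G} (hP : SylIn p P N) {g : G}
    (hg : g ∈ Subgroup.normalizer (N : Set G)) :
    ∃ n ∈ N, n * g ∈ Subgroup.normalizer (P : Set G) := by
  have h1 : SylIn p (P.conjBy g) N := by
    refine ⟨fun x hx => ?_, by rw [Subgroup.card_conjBy, hP.2]⟩
    rw [Subgroup.mem_normalizer_iff.1 (inv_mem hg)] 
    exact hP.1 (by simpa using Subgroup.mem_conjBy.1 hx)
  obtain ⟨n, hn, h⟩ := h1.exists_conjBy_eq hp hP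
  refine ⟨n, hn, ?_⟩
  have : P.conjBy (n * g) = P := by
    conv_rhs => rw [← h]
    ext x
    simp [Subgroup.mem_conjBy, mul_assoc]
  have h2 := (Subgroup.conjBy_eq_iff (K := ⊤) (Subgroup.mem_top _)).1 this
  exact h2.2

theorem SylIn.exists_mul_mem_nor (hp : p.Prime) {P N K : Subgroup G} (hP : SylIn p P N) (hNK : N ≤ K)
    (hN : K ≤ Subgroup.normalizer (N : Set G)) {g : G} (hg : g ∈ K) : ∃ n ∈ N, n * g ∈ K.nor P := by
  obtain ⟨n, hn, h⟩ := hP.exists_mul_mem_normalizer hp (hN hg)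
  exact ⟨n, hn, K.mul_mem (hNK hn) hg, h⟩

theorem SylIn.ne_bot (hp : p.Prime) {P K : Subgroup G} (hP : SylIn p P K) (h : p ∣ Nat.card K) :
    P ≠ ⊥ := by
  rw [← Subgroup.one_lt_card_iff_ne_bot, hP.2]
  exact Nat.one_lt_pow (hp.factorization_pos_of_dvd Nat.card_pos.ne' h).ne' hp.one_lt

theorem exists_mem_orderOf_eq_prime (hp : p.Prime) {K : Subgroup G} (h : p ∣ Nat.card K) :
    ∃ x ∈ K, orderOf x = p := by
  have := Fact.mk hp
  obtain ⟨x, hx⟩ := exists_prime_orderOf_dvd_card' p h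
  exact ⟨x, x.2, by rw [Subgroup.orderOf_coe, hx]⟩

theorem Subgroup.orderOf_dvd_card {K : Subgroup G} {x : G} (hx : x ∈ K) : orderOf x ∣ Nat.card K := by
  rw [← Nat.card_zpowers]
  exact Subgroup.card_dvd_of_le (Subgroup.zpowers_le.2 hx)

theorem SylIn.card_eq {P Q K : Subgroup G} (hP : SylIn p P K) (hQ : SylIn p Q K) :
    Nat.card P = Nat.card Q := by rw [hP.2, hQ.2]

theorem IsPGroup.orderOf_eq (hp : p.Prime) {P : Subgroup G} (hP : IsPGroup p P) {x : G} (hx : x ∈ P) :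
    ∃ k, orderOf x = p ^ k := by
  have := Fact.mk hp
  obtain ⟨k, hk⟩ := IsPGroup.iff_orderOf.1 hP ⟨x, hx⟩
  exact ⟨k, by rw [← hk, Subgroup.orderOf_mk]⟩

theorem IsPGroup.exists_orderOf_eq_prime (hp : p.Prime) {P : Subgroup G} (hP : IsPGroup p P)
    (h : P ≠ ⊥) : ∃ x ∈ P, orderOf x = p := by
  have := Fact.mk hp
  refine exists_mem_orderOf_eq_prime hp ?_
  rcases hP.card_eq_or_dvd with h1 | h1
  · exact absurd (Subgroup.card_eq_one.1 h1) h
  · exact h1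

theorem IsPGroup.mem_center_exists_orderOf_eq_prime (hp : p.Prime) {P : Subgroup G} (hP : IsPGroup p P)
    (h : P ≠ ⊥) : ∃ x ∈ P, orderOf x = p ∧ ∀ y ∈ P, y * x = x * y := by
  have := Fact.mk hp
  have hnt : Nontrivial P := (Subgroup.nontrivial_iff_ne_bot P).2 h
  have h1 := hP.center_nontrivial
  have h2 : IsPGroup p ((Subgroup.center P).map P.subtype) :=
    hP.to_le (Subgroup.map_subtype_le _)
  obtain ⟨x, ⟨y, hy, rfl⟩, hx2⟩ := h2.exists_orderOf_eq_prime hp (by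
    rw [Ne, Subgroup.map_eq_bot_iff_of_injective _ P.subtype_injective]
    exact (Subgroup.nontrivial_iff_ne_bot _).1 h1)
  refine ⟨_, y.2, hx2, fun z hz => ?_⟩
  exact congrArg Subtype.val (Subgroup.mem_center_iff.1 hy ⟨z, hz⟩)

end RelativeSylow

section Counting

set_option linter.unusedSectionVars false

variable {G : Type*} [Group G]

theorem mem_of_pow_mem_of_coprime {S : Subgroup G} {x : G} {a b : ℕ} (h : Nat.Coprime a b)
    (ha : x ^ a ∈ S) (hb : x ^ b ∈ S) : x ∈ S := by
  have h1 : (x ^ a) ^ (a.gcdA b) * (x ^ b) ^ (a.gcdB b) = x := by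
    rw [← zpow_natCast, ← zpow_natCast, ← zpow_mul, ← zpow_mul, ← zpow_add, ← Nat.gcd_eq_gcd_ab,
      h.gcd_eq_one]
    simp
  rw [← h1]
  exact S.mul_mem (S.zpow_mem ha _) (S.zpow_mem hb _)

variable [Finite G]

/-- If a prime power of `h` lies in `S` and `h` does not, some power of `h` of prime power order
is outside `S`. -/
theorem exists_pow_not_mem_of_pow_mem {S : Subgroup G} {h : G} {ℓ k : ℕ} (hℓ : ℓ.Prime) (hS : h ∉ S)
    (hk : h ^ ℓ ^ k ∈ S) : ∃ i j, h ^ i ∉ S ∧ orderOf (h ^ i) = ℓ ^ j := by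
  obtain ⟨e, n, hn, hord⟩ := Nat.exists_eq_pow_mul_and_not_dvd (orderOf_pos h).ne' ℓ hℓ.ne_one
  refine ⟨n, e, fun hmem => hS (mem_of_pow_mem_of_coprime ?_ hk hmem), ?_⟩
  · exact ((Nat.Prime.coprime_iff_not_dvd hℓ).2 hn).pow_left k
  · have hn0 : n ≠ 0 := by rintro rfl; simp at hn
    rw [orderOf_pow_of_dvd hn0 (by rw [hord]; exact Dvd.intro_left _ rfl), hord,
      Nat.mul_div_cancel _ (Nat.pos_of_ne_zero hn0)]

theorem exists_pow_not_mem_prime_pow_mem {S : Subgroup G} {g : G} (hS : g ∉ S) :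
    ∃ m k j, m.Prime ∧ g ^ k ∉ S ∧ (g ^ k) ^ m ∈ S ∧ orderOf (g ^ k) = m ^ j := by
  classical
  have hex : ∃ n, 0 < n ∧ g ^ n ∈ S := ⟨orderOf g, orderOf_pos g, by rw [pow_orderOf_eq_one]; exact S.one_mem⟩
  set n := Nat.find hex
  obtain ⟨hn0, hn⟩ := Nat.find_spec hex
  have hn1 : n ≠ 1 := by
    intro h
    apply hS
    change g ^ n ∈ S at hn
    rwa [h, pow_one] at hn
  obtain ⟨m, hm, k, hk⟩ := Nat.exists_prime_and_dvd hn1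
  have hk0 : 0 < k := by
    rcases Nat.eq_zero_or_pos k with h | h
    · rw [h, mul_zero] at hk; change 0 < n at hn0; omega
    · exact h
  have hkn : k < n := by rw [hk]; nlinarith [hm.two_le]
  have h1 : g ^ k ∉ S := fun hmem => Nat.find_min hex hkn ⟨hk0, hmem⟩
  have h2 : (g ^ k) ^ m ∈ S := by rw [← pow_mul, mul_comm, ← hk]; exact hn
  obtain ⟨i, j, h3, h4⟩ := exists_pow_not_mem_of_pow_mem (k := 1) hm h1 (by rwa [pow_one])
  refine ⟨m, k * i, j, hm, by rwa [pow_mul], ?_, by rwa [pow_mul]⟩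
  rw [pow_mul, ← pow_mul, mul_comm, pow_mul]
  exact S.pow_mem h2 i

theorem exists_not_mem_of_dvd_index {S : Subgroup G} {ℓ : ℕ} (hℓ : ℓ.Prime) (h : ℓ ∣ S.index) :
    ∃ g k, g ∉ S ∧ orderOf g = ℓ ^ k := by
  obtain ⟨P, hP⟩ := exists_sylIn hℓ (⊤ : Subgroup G)
  have hPS : ¬ P ≤ S := by
    intro hle
    have := Fact.mk hℓ
    have h1 := hP.2
    have h2 := (Subgroup.card_dvd_of_le hle).trans (Nat.dvd_of_mul_dvd_mul_right (k := 1) one_pos (dvd_refl _))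
    have h3 : Nat.card P * ℓ ∣ Nat.card G := by
      rw [← S.card_mul_index]; exact mul_dvd_mul (Subgroup.card_dvd_of_le hle) h
    rw [h1, Subgroup.card_top, ← pow_succ] at h3
    have := (hℓ.pow_dvd_iff_le_factorization Nat.card_pos.ne').1 h3
    omega
  obtain ⟨g, hgP, hgS⟩ := SetLike.not_le_iff_exists.1 hPS
  obtain ⟨k, hk⟩ := hP.isPGroup.orderOf_eq hℓ hgP
  exact ⟨g, k, hgS, hk⟩

theorem pow_mem_of_mul_inv_mem {S : Subgroup G} [S.Normal] {g h n : G} (hn : n ∈ S) (hh : h = n * g)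
    {k : ℕ} (hg : g ^ k = 1) : h ^ k ∈ S := by
  rw [← QuotientGroup.eq_one_iff, QuotientGroup.mk_pow, hh, QuotientGroup.mk_mul,
    (QuotientGroup.eq_one_iff n).2 hn, one_mul, ← QuotientGroup.mk_pow, hg, QuotientGroup.mk_one]

/-- A double Frattini argument producing `ℓ`-elements outside a normal subgroup which normalise
a Sylow subgroup `L` and a Sylow subgroup of its normalizer. -/
theorem exists_not_mem_normalizing {S : Subgroup G} [S.Normal] {ℓ a b : ℕ} (hℓ : ℓ.Prime)
    (ha : a.Prime) (hb : b.Prime) (h : ℓ ∣ S.index) {L M : Subgroup G} (hL : SylIn a L S)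
    (hM : SylIn b M (S.nor L)) :
    ∃ y k, y ∉ S ∧ orderOf y = ℓ ^ k ∧ y ∈ Subgroup.normalizer (L : Set G) ∧
      y ∈ Subgroup.normalizer (M : Set G) := by
  obtain ⟨g, k, hgS, hk⟩ := exists_not_mem_of_dvd_index hℓ h
  have hSn : Subgroup.normalizer (S : Set G) = ⊤ := Subgroup.normalizer_eq_top_iff.2 inferInstance
  obtain ⟨n, hn, hng⟩ := hL.exists_mul_mem_normalizer ha (g := g) (by rw [hSn]; trivial)
  have h1 : n * g ∈ Subgroup.normalizer (S.nor L : Set G) := by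
    refine (Subgroup.mem_nor_of_conj_mem (K := ⊤) (P := S.nor L) (Subgroup.mem_top _)
      fun y hy => Subgroup.mem_inf.2 ⟨?_, ?_⟩).2
    · exact Subgroup.Normal.conj_mem inferInstance _ hy.1 _
    · exact mul_mem (mul_mem hng hy.2) (inv_mem hng)
  obtain ⟨n', hn', hng'⟩ := hM.exists_mul_mem_normalizer hb h1
  set x := n' * (n * g) with hx
  have hxL : x ∈ Subgroup.normalizer (L : Set G) := mul_mem hn'.2 hng
  have hxS : x ∉ S := by
    intro hmem
    apply hgS
    have h2 := S.mul_mem (S.inv_mem (S.mul_mem hn'.1 hn)) hmem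
    simpa [hx, mul_assoc] using h2
  have hxk : x ^ ℓ ^ k ∈ S := pow_mem_of_mul_inv_mem (n := n' * n) (g := g)
    (S.mul_mem hn'.1 hn) (by rw [hx, mul_assoc]) (by rw [← hk, pow_orderOf_eq_one])
  obtain ⟨i, j, h3, h4⟩ := exists_pow_not_mem_of_pow_mem hℓ hxS hxk
  exact ⟨x ^ i, j, h3, h4, pow_mem hxL i, pow_mem hng' i⟩

theorem ncard_mul_card_le_of_conj {A U : Set G} {N K : Subgroup G} (hN : N ≤ K)
    (hA : ∀ n ∈ N, ∀ a ∈ A, n * a * n⁻¹ ∈ A) (hU : ∀ u ∈ U, ∃ k ∈ K, ∃ a ∈ A, u = k * a * k⁻¹) :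
    U.ncard * Nat.card N ≤ Nat.card K * A.ncard := by
  choose! k hk a ha hu using hU
  rw [← Nat.card_coe_set_eq U, ← Nat.card_coe_set_eq A, ← Nat.card_prod, ← Nat.card_prod]
  refine Nat.card_le_card_of_injective
    (fun x : U × N => ((⟨k x.1 * (x.2 : G)⁻¹, K.mul_mem (hk _ x.1.2) (K.inv_mem (hN x.2.2))⟩ : K),
      (⟨x.2 * a x.1 * (x.2 : G)⁻¹, hA _ x.2.2 _ (ha _ x.1.2)⟩ : A))) ?_
  rintro ⟨⟨u, hu1⟩, ⟨n, hn⟩⟩ ⟨⟨v, hv1⟩, ⟨m, hm⟩⟩ h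
  simp only [Prod.mk.injEq, Subtype.mk.injEq] at h ⊢
  obtain ⟨h1, h2⟩ := h
  have e1 : u = v := by
    have e2 : u = (k u * n⁻¹) * (n * a u * n⁻¹) * (k u * n⁻¹)⁻¹ := by
      conv_lhs => rw [hu u hu1]
      group
    have e3 : v = (k v * m⁻¹) * (m * a v * m⁻¹) * (k v * m⁻¹)⁻¹ := by
      conv_lhs => rw [hu v hv1]
      group
    rw [e2, h1, h2, ← e3]
  subst e1
  exact ⟨rfl, inv_injective (mul_left_cancel h1)⟩

theorem card_mul_le_ncard_of_conj {A U : Set G} {N K : Subgroup G}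
    (hU : ∀ k ∈ K, ∀ a ∈ A, k * a * k⁻¹ ∈ U)
    (hN : ∀ k ∈ K, ∀ a ∈ A, k * a * k⁻¹ ∈ A → k ∈ N) :
    Nat.card K * A.ncard ≤ U.ncard * Nat.card N := by
  classical
  let V : Set G := {u | ∃ k ∈ K, ∃ a ∈ A, u = k * a * k⁻¹}
  have hVU : V ⊆ U := by
    rintro u ⟨k, hk, a, ha, rfl⟩; exact hU k hk a ha
  refine le_trans ?_ (Nat.mul_le_mul_right _ (Set.ncard_le_ncard hVU (Set.toFinite _)))
  have hV : ∀ u ∈ V, ∃ k ∈ K, ∃ a ∈ A, u = k * a * k⁻¹ := fun u hu => hu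
  choose! k hk a ha hu using hV
  rw [← Nat.card_coe_set_eq V, ← Nat.card_coe_set_eq A, ← Nat.card_prod, ← Nat.card_prod]
  have hmem : ∀ x : K × A, (x.1 : G) * x.2 * (x.1 : G)⁻¹ ∈ V := fun x => ⟨x.1, x.1.2, x.2, x.2.2, rfl⟩
  refine Nat.card_le_card_of_injective
    (fun x : K × A => ((⟨_, hmem x⟩ : V), (⟨(k ((x.1 : G) * x.2 * (x.1 : G)⁻¹))⁻¹ * x.1, ?_⟩ : N))) ?_
  · refine hN _ (K.mul_mem (K.inv_mem (hk _ (hmem x))) x.1.2) x.2 x.2.2 ?_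
    have := hu _ (hmem x)
    have e : (k ((x.1 : G) * x.2 * (x.1 : G)⁻¹))⁻¹ * x.1 * x.2 *
        ((k ((x.1 : G) * x.2 * (x.1 : G)⁻¹))⁻¹ * x.1)⁻¹ = a ((x.1 : G) * x.2 * (x.1 : G)⁻¹) := by
      calc _ = (k ((x.1 : G) * x.2 * (x.1 : G)⁻¹))⁻¹ * ((x.1 : G) * x.2 * (x.1 : G)⁻¹) *
            k ((x.1 : G) * x.2 * (x.1 : G)⁻¹) := by group
        _ = _ := by
            generalize (x.1 : G) * x.2 * (x.1 : G)⁻¹ = w at this ⊢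
            conv_lhs => enter [1, 2]; rw [this]
            group
    rw [e]
    exact ha _ (hmem x)
  · rintro ⟨⟨u, hu1⟩, ⟨n, hn⟩⟩ ⟨⟨v, hv1⟩, ⟨m, hm⟩⟩ h
    simp only [Prod.mk.injEq, Subtype.mk.injEq] at h ⊢
    obtain ⟨h1, h2⟩ := h
    rw [h1] at h2
    have e1 : u = v := mul_left_cancel h2
    subst e1
    exact ⟨rfl, mul_left_cancel (mul_right_cancel h1)⟩

/-- The elements of `K` of order `n`. -/
def Subgroup.ordSet (K : Subgroup G) (n : ℕ) : Set G := {x | x ∈ K ∧ orderOf x = n}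

theorem Subgroup.card_eq_sum_ordSet {K : Subgroup G} (s : Finset ℕ) (hs : ∀ x ∈ K, orderOf x ∈ s) :
    Nat.card K = ∑ n ∈ s, (K.ordSet n).ncard := by
  classical
  have hf : (K : Set G).Finite := Set.toFinite _
  rw [show Nat.card K = (K : Set G).ncard from (Nat.card_coe_set_eq (K : Set G)).symm.symm]
  rw [Set.ncard_eq_toFinset_card _ hf,
    Finset.card_eq_sum_card_fiberwise (f := orderOf) (t := s) (fun x hx => hs x (by simpa using hx))]
  refine Finset.sum_congr rfl fun n _ => ?_
  rw [← Set.ncard_coe_finset]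
  congr 1
  ext x
  simp [Subgroup.ordSet]

theorem Subgroup.ncard_ordSet_one (K : Subgroup G) : (K.ordSet 1).ncard = 1 := by
  rw [Set.ncard_eq_one]
  refine ⟨1, ?_⟩
  ext x
  simp only [Subgroup.ordSet, Set.mem_ofPred_eq, orderOf_eq_one_iff, Set.mem_singleton_iff]
  exact ⟨fun h => h.2, fun h => ⟨h ▸ K.one_mem, h⟩⟩

theorem Subgroup.ncard_diff_one (P : Subgroup G) : ((P : Set G) \ {1}).ncard = Nat.card P - 1 := by
  rw [Set.ncard_sdiff_singleton_of_mem P.one_mem]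
  rfl

/-- The trivial bound on the number of elements of order a power of `l`. -/
theorem SylIn.ncard_ordSet_mul_le {l j : ℕ} (hl : l.Prime) (hj : j ≠ 0) {L K : Subgroup G} (hL : SylIn l L K) :
    (K.ordSet (l ^ j)).ncard * Nat.card (K.nor L) ≤ Nat.card K * (Nat.card L - 1) := by
  rw [← Subgroup.ncard_diff_one]
  refine ncard_mul_card_le_of_conj Subgroup.nor_le ?_ ?_
  · intro n hn a ha
    refine ⟨((Subgroup.mem_nor.1 hn).2 a).1 ha.1, fun h => ha.2 ?_⟩
    exact conj_eq_one_iff.1 h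
  · rintro u ⟨huK, huo⟩
    obtain ⟨k, hk, hle⟩ := (isPGroup_zpowers huo).exists_conjBy_le hl (Subgroup.zpowers_le.2 huK) hL
    refine ⟨k⁻¹, K.inv_mem hk, k * u * k⁻¹, ⟨hle (Subgroup.conj_mem_conjBy.2
      (Subgroup.mem_zpowers u)), fun h => ?_⟩, by group⟩
    have h1 : u = 1 := conj_eq_one_iff.1 h
    rw [h1, orderOf_one] at huo
    exact (Nat.one_lt_pow hj hl.one_lt).ne huo

end Counting

section Action

variable {X A : Type*} [Group X] [CommGroup A] [MulDistribMulAction X A]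

theorem pow_card_smul_eq {M : Subgroup X} [Finite M] {g : X} {n : ℕ} (hn : 0 < n)
    (hg : ∀ m ∈ M, g * m * g⁻¹ ∈ M)
    (hfree : ∀ m ∈ M, ∀ i, 0 < i → i < n → m * g ^ i = g ^ i * m → m = 1)
    (hprod : ∀ a : A, ∏ i ∈ Finset.range n, g ^ i • a = 1) (a : A) {m : X} (hm : m ∈ M) :
    m • a ^ Nat.card M = a ^ Nat.card M := by
  classical
  have := Fintype.ofFinite M
  have hgi : ∀ i : ℕ, ∀ m ∈ M, g ^ i * m * (g ^ i)⁻¹ ∈ M := by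
    intro i
    induction i with
    | zero => intro m hm; simpa using hm
    | succ i ih =>
      intro m hm
      have := hg _ (ih m hm)
      have e : g ^ (i + 1) * m * (g ^ (i + 1))⁻¹ = g * (g ^ i * m * (g ^ i)⁻¹) * g⁻¹ := by
        rw [pow_succ']; group
      rwa [e]
  let W : ℕ → A := fun i => ∏ k : M, ((k : X) * g ^ i) • a
  have hW : ∀ i, ∀ m ∈ M, m • W i = W i := by
    intro i m hm
    rw [Finset.smul_prod']
    refine Fintype.prod_equiv (Equiv.mulLeft (⟨m, hm⟩ : M)) _ _ fun k => ?_
    simp [smul_smul, mul_assoc]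
  have hconj : ∀ i, 0 < i → i < n → ∏ k : M, ((k : X) * g ^ i * (k : X)⁻¹) • a = W i := by
    intro i hi hin
    let f : M → M := fun k => ⟨k * (g ^ i * (k : X)⁻¹ * (g ^ i)⁻¹),
      M.mul_mem k.2 (hgi i _ (M.inv_mem k.2))⟩
    have hf : Function.Injective f := by
      intro k l hkl
      have h1 : (k : X) * (g ^ i * (k : X)⁻¹ * (g ^ i)⁻¹) = l * (g ^ i * (l : X)⁻¹ * (g ^ i)⁻¹) :=
        congrArg Subtype.val hkl
      have h3 : (k : X) * g ^ i * (k : X)⁻¹ = l * g ^ i * (l : X)⁻¹ := by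
        have h4 := congrArg (fun z => z * g ^ i) h1
        simpa [mul_assoc] using h4
      have h2 : (l : X)⁻¹ * k * g ^ i = g ^ i * ((l : X)⁻¹ * k) := by
        calc (l : X)⁻¹ * k * g ^ i = (l : X)⁻¹ * ((k : X) * g ^ i * (k : X)⁻¹) * k := by group
          _ = g ^ i * ((l : X)⁻¹ * k) := by rw [h3]; group
      have h5 := hfree _ (M.mul_mem (M.inv_mem l.2) k.2) i hi hin h2
      exact (Subtype.ext (inv_mul_eq_one.1 h5)).symm
    refine Fintype.prod_equiv (Equiv.ofBijective f (Finite.injective_iff_bijective.1 hf)) _ _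
      fun k => ?_
    simp [f, mul_assoc]
  have h1 : ∏ i ∈ Finset.range n, ∏ k : M, ((k : X) * g ^ i * (k : X)⁻¹) • a = 1 := by
    rw [Finset.prod_comm]
    refine Finset.prod_eq_one fun k _ => ?_
    have h2 := congrArg (fun z => (k : X) • z) (hprod ((k : X)⁻¹ • a))
    simpa [Finset.smul_prod', smul_smul, mul_assoc] using h2
  obtain ⟨n, rfl⟩ : ∃ n', n = n' + 1 := ⟨n - 1, by omega⟩
  rw [Finset.prod_range_succ'] at h1
  have h3 : ∏ k : M, ((k : X) * g ^ 0 * (k : X)⁻¹) • a = a ^ Nat.card M := by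
    simp [Nat.card_eq_fintype_card]
  rw [h3, Finset.prod_congr rfl fun i hi => hconj (i + 1) (by omega)
    (by have := Finset.mem_range.1 hi; omega)] at h1
  rw [eq_inv_of_mul_eq_one_right h1, smul_inv', Finset.smul_prod']
  congr 1
  exact Finset.prod_congr rfl fun i _ => hW _ _ hm

theorem pow_eq_one_of_prod_smul_eq_one {a b : X} (hab : Commute a b) {q : ℕ} (hq : 0 < q)
    (h1 : ∀ i, ∀ v : A, ∏ j ∈ Finset.range q, (a * b ^ i) ^ j • v = 1)
    (h2 : ∀ j, 0 < j → j < q → ∀ v : A, ∏ i ∈ Finset.range q, (b ^ j) ^ i • v = 1) (v : A) :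
    v ^ q = 1 := by
  have h3 : ∏ i ∈ Finset.range q, ∏ j ∈ Finset.range q, (a * b ^ i) ^ j • v = 1 :=
    Finset.prod_eq_one fun i _ => h1 i v
  rw [Finset.prod_comm] at h3
  obtain ⟨q, rfl⟩ : ∃ n', q = n' + 1 := ⟨q - 1, by omega⟩
  rw [Finset.prod_range_succ'] at h3
  rw [Finset.prod_eq_one, one_mul] at h3
  · simpa using h3
  · intro j hj
    have h4 := h2 (j + 1) (by omega) (by have := Finset.mem_range.1 hj; omega) v
    have h5 := congrArg (fun z => a ^ (j + 1) • z) h4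
    simp only [Finset.smul_prod', smul_one] at h5
    rw [← h5]
    refine Finset.prod_congr rfl fun i _ => ?_
    rw [smul_smul, (hab.pow_right i).mul_pow, ← pow_mul, ← pow_mul, mul_comm i]

end Action

section Normalizer

universe u

variable {G : Type u} [Group G]

theorem mul_pow_eq_pow_of_free {V : Subgroup G} (hV : ∀ x ∈ V, ∀ y ∈ V, x * y = y * x) {g : G} {n : ℕ}
    (hgV : g ∈ Subgroup.normalizer (V : Set G)) (hgn : ∀ v ∈ V, g ^ n * v = v * g ^ n)
    (hfree : ∀ v ∈ V, g * v = v * g → v = 1) {v : G} (hv : v ∈ V) : (v * g) ^ n = g ^ n := by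
  have hmem : ∀ k : ℕ, (v * g) ^ k * (g ^ k)⁻¹ ∈ V := by
    intro k
    induction k with
    | zero => simp
    | succ k ih =>
      have h1 : (v * g) ^ (k + 1) * (g ^ (k + 1))⁻¹ =
        v * (g * ((v * g) ^ k * (g ^ k)⁻¹) * g⁻¹) := by rw [pow_succ', pow_succ']; group
      rw [h1]
      exact V.mul_mem hv ((Subgroup.mem_normalizer_iff.1 hgV _).1 ih)
  set c := (v * g) ^ n * (g ^ n)⁻¹ with hc
  have h1 : v * g * c = c * (v * g) := by
    have h2 := hgn v hv
    have h3 : v * g * (g ^ n)⁻¹ = (g ^ n)⁻¹ * (v * g) := by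
      have : Commute (v * g) (g ^ n) := by
        apply Commute.mul_left
        · exact h2.symm
        · exact (Commute.refl g).pow_right n
      exact this.inv_right.eq
    rw [hc, ← mul_assoc, ← pow_succ', pow_succ, mul_assoc, h3, mul_assoc]
  have h2 : g * c = c * g := by
    have h3 := hV v hv c (hmem n)
    rw [mul_assoc, ← mul_assoc c, ← h3, mul_assoc v c] at h1
    exact mul_left_cancel h1
  have h3 := hfree c (hmem n) h2
  rw [hc] at h3
  exact mul_inv_eq_one.1 h3

/-- The conjugation action of the normalizer on a commutative subgroup. -/
theorem exists_prod_conj {V : Subgroup G} (hV : ∀ x ∈ V, ∀ y ∈ V, x * y = y * x) :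
    ∃ (A : Type u) (_ : CommGroup A) (_ : MulDistribMulAction (Subgroup.normalizer (V : Set G)) A)
      (f : A →* G), Function.Injective f ∧ (∀ v ∈ V, ∃ a, f a = v) ∧
      (∀ (x : Subgroup.normalizer (V : Set G)) (a : A), f (x • a) = x * f a * (x : G)⁻¹) ∧
      ∀ (x : Subgroup.normalizer (V : Set G)) (n : ℕ),
        (∀ v ∈ V, (v * x) ^ n = (x : G) ^ n) → ∀ a : A, ∏ i ∈ Finset.range n, x ^ i • a = 1 := by
  let i1 : CommGroup V := { (inferInstance : Group V) with
    mul_comm := fun x y => Subtype.ext (hV x x.2 y y.2) }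
  let i2 : MulDistribMulAction (Subgroup.normalizer (V : Set G)) V :=
    MulDistribMulAction.compHom V (Subgroup.normalizerMonoidHom V)
  have hsm : ∀ x : Subgroup.normalizer (V : Set G), ∀ v : V, ((x • v : V) : G) = x * v * (x : G)⁻¹ :=
    fun x v => Subgroup.normalizerMonoidHom_apply_apply_coe _ _ _
  refine ⟨V, i1, i2, V.subtype, V.subtype_injective, fun v hv => ⟨⟨v, hv⟩, rfl⟩, hsm, ?_⟩
  intro x n h v
  have key : ∀ k : ℕ, ((v : G) * x) ^ k = ((∏ i ∈ Finset.range k, x ^ i • v : V) : G) * (x : G) ^ k := by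
    intro k
    induction k with
    | zero => simp
    | succ k ih =>
      rw [pow_succ, ih, Finset.prod_range_succ, Subgroup.coe_mul, hsm]
      simp only [Subgroup.coe_pow]
      rw [pow_succ]; group
  have h1 := key n
  rw [h v v.2] at h1
  exact Subtype.ext (by simpa using h1.symm)

theorem conj_pow_card_eq {V M : Subgroup G} [Finite M] (hV : ∀ x ∈ V, ∀ y ∈ V, x * y = y * x) {g : G} {n : ℕ}
    (hn : 0 < n) (hgV : g ∈ Subgroup.normalizer (V : Set G))
    (hMV : M ≤ Subgroup.normalizer (V : Set G)) (hgM : ∀ m ∈ M, g * m * g⁻¹ ∈ M)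
    (hfree : ∀ m ∈ M, ∀ i, 0 < i → i < n → m * g ^ i = g ^ i * m → m = 1)
    (hvg : ∀ v ∈ V, (v * g) ^ n = g ^ n) {v m : G} (hv : v ∈ V) (hm : m ∈ M) :
    m * v ^ Nat.card M = v ^ Nat.card M * m := by
  obtain ⟨A, i1, i2, f, hf, hfV, hsm, hprod⟩ := exists_prod_conj hV
  obtain ⟨v, rfl⟩ := hfV v hv
  let N := Subgroup.normalizer (V : Set G)
  let M' : Subgroup N := M.subgroupOf N
  have hcard : Nat.card M' = Nat.card M := Nat.card_congr (Subgroup.subgroupOfEquivOfLe hMV).toEquiv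
  have : Finite M' := Finite.of_equiv M (Subgroup.subgroupOfEquivOfLe hMV).symm.toEquiv
  have h := pow_card_smul_eq (X := N) (A := A) (M := M') (g := ⟨g, hgV⟩) hn
    (fun m hm => by
      rw [Subgroup.mem_subgroupOf] at hm ⊢
      exact hgM _ hm)
    (fun m hm i hi hin h => Subtype.ext (hfree m (Subgroup.mem_subgroupOf.1 hm) i hi hin
      (by simpa using congrArg Subtype.val h)))
    (hprod ⟨g, hgV⟩ n hvg) v (m := ⟨m, hMV hm⟩) (Subgroup.mem_subgroupOf.2 hm)
  have h2 := congrArg f h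
  rw [hsm, map_pow, hcard] at h2
  exact mul_inv_eq_iff_eq_mul.1 h2

theorem mem_zpowers_of_free_comm [Finite G] {V : Subgroup G} (hV : ∀ x ∈ V, ∀ y ∈ V, x * y = y * x) {q : ℕ} (hq : q.Prime)
    (hqV : Nat.Coprime q (Nat.card V)) (hV1 : V ≠ ⊥) {a b : G}
    (ha : a ∈ Subgroup.normalizer (V : Set G)) (hb : b ∈ Subgroup.normalizer (V : Set G))
    (hab : a * b = b * a) (haq : a ^ q = 1) (hbq : b ^ q = 1) (hb1 : b ≠ 1)
    (hfree : ∀ i j : ℕ, a ^ i * b ^ j ≠ 1 → ∀ v ∈ V, a ^ i * b ^ j * v = v * (a ^ i * b ^ j) → v = 1) :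
    a ∈ Subgroup.zpowers b := by
  by_contra hcon
  obtain ⟨A, i1, i2, f, hf, hfV, hsm, hprod⟩ := exists_prod_conj hV
  let N := Subgroup.normalizer (V : Set G)
  have hbord : orderOf b = q := by
    have := Fact.mk hq
    exact orderOf_eq_prime hbq hb1
  have h1 : ∀ i, ∀ v : A, ∏ j ∈ Finset.range q, ((⟨a, ha⟩ : N) * (⟨b, hb⟩ : N) ^ i) ^ j • v = 1 := by
    intro i
    refine hprod _ q fun v hv => ?_
    have hpw : (a * b ^ i) ^ q = 1 := by
      have hc : Commute a (b ^ i) := (show Commute a b from hab).pow_right i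
      rw [hc.mul_pow, haq, one_mul, ← pow_mul, mul_comm, pow_mul, hbq, one_pow]
    refine mul_pow_eq_pow_of_free hV (g := a * b ^ i) (N.mul_mem ha (N.pow_mem hb i))
      (by intro v _; simp [hpw]) ?_ hv
    intro v hv hc
    refine hfree 1 i ?_ v hv (by simpa using hc)
    intro h
    apply hcon
    rw [pow_one] at h
    rw [eq_inv_of_mul_eq_one_left h]
    exact inv_mem (pow_mem (Subgroup.mem_zpowers b) i)
  have h2 : ∀ j, 0 < j → j < q → ∀ v : A, ∏ i ∈ Finset.range q, ((⟨b, hb⟩ : N) ^ j) ^ i • v = 1 := by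
    intro j hj hjq
    refine hprod _ q fun v hv => ?_
    have hpw : (b ^ j) ^ q = 1 := by rw [← pow_mul, mul_comm, pow_mul, hbq, one_pow]
    refine mul_pow_eq_pow_of_free hV (g := b ^ j) (N.pow_mem hb j) (by intro v _; simp [hpw]) ?_ hv
    intro v hv hc
    refine hfree 0 j ?_ v hv (by simpa using hc)
    intro h
    rw [pow_zero, one_mul] at h
    have := Nat.le_of_dvd hj (hbord ▸ orderOf_dvd_of_pow_eq_one h)
    omega
  obtain ⟨v, hv, hv1⟩ := V.bot_or_exists_ne_one.resolve_left hV1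
  obtain ⟨v, rfl⟩ := hfV v hv
  have h3 := pow_eq_one_of_prod_smul_eq_one (A := A) (a := (⟨a, ha⟩ : N)) (b := ⟨b, hb⟩)
    (Subtype.ext hab) hq.pos h1 h2 v
  have h4 : f v ^ q = 1 := by rw [← map_pow, h3, map_one]
  apply hv1
  have h5 : f v ^ Nat.card V = 1 := orderOf_dvd_iff_pow_eq_one.1 (Subgroup.orderOf_dvd_natCard V hv)
  exact Subgroup.mem_bot.1 (mem_of_pow_mem_of_coprime hqV (Subgroup.mem_bot.2 h4) (Subgroup.mem_bot.2 h5))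

end Normalizer

section Cyclic

universe u

theorem mul_pow_eq_of_conj {P : Type*} [Group P] {g u e : P} (hgu : g * u = u * e * g) (hec : ∀ x, e * x = x * e)
    (n : ℕ) : (u * g) ^ n = u ^ n * g ^ n * e ^ n.choose 2 := by
  have hc : ∀ k : ℕ, ∀ x, e ^ k * x = x * e ^ k := fun k x => (Commute.pow_left (hec x) k).eq
  have h1 : ∀ k : ℕ, g ^ k * u = u * g ^ k * e ^ k := by
    intro k
    induction k with
    | zero => simp
    | succ k ih =>
      calc g ^ (k + 1) * u = g ^ k * (g * u) := by rw [pow_succ]; group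
        _ = g ^ k * u * e * g := by rw [hgu]; group
        _ = u * g ^ k * (e ^ k * e * g) := by rw [ih]; group
        _ = u * g ^ (k + 1) * e ^ (k + 1) := by
          rw [← pow_succ, hc, pow_succ g]; group
  induction n with
  | zero => simp
  | succ n ih =>
    calc (u * g) ^ (n + 1) = u ^ n * g ^ n * (e ^ n.choose 2 * (u * g)) := by
          rw [pow_succ, ih]; group
      _ = u ^ n * (g ^ n * u) * (g * e ^ n.choose 2) := by rw [hc]; group
      _ = u ^ n * u * g ^ n * (e ^ n * g) * e ^ n.choose 2 := by rw [h1]; group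
      _ = u ^ (n + 1) * g ^ (n + 1) * (e ^ n * e ^ n.choose 2) := by
          rw [hc, pow_succ, pow_succ]; group
      _ = _ := by
          rw [← pow_add, Nat.choose_succ_succ' n 1, Nat.choose_one_right]

theorem IsPGroup.isCyclic_of_unique_prime_order {p : ℕ} (hp : p.Prime) (hp2 : p ≠ 2) (n : ℕ) :
    ∀ (P : Type u) [Group P] [Finite P], Nat.card P = p ^ n →
      (∀ x y : P, orderOf x = p → orderOf y = p → y ∈ Subgroup.zpowers x) → IsCyclic P := by
  have := Fact.mk hp
  induction n with
  | zero =>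
    intro P _ _ hc _
    have : Subsingleton P := (Nat.card_eq_one_iff_unique.1 (by simpa using hc)).1
    infer_instance
  | succ n ih =>
    intro P _ _ hc hU
    rcases Nat.eq_zero_or_pos n with rfl | hn
    · exact isCyclic_of_prime_card (p := p) (by simpa using hc)
    obtain ⟨K, hK⟩ := Sylow.exists_subgroup_card_pow_prime p (G := P) (n := n)
      (by rw [hc]; exact pow_dvd_pow _ (by omega))
    have hidx : K.index = p := by
      have h1 := K.card_mul_index
      rw [hK, hc, pow_succ] at h1
      exact Nat.eq_of_mul_eq_mul_left (pow_pos hp.pos n) h1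
    have hKn : K.Normal := Subgroup.normal_of_index_eq_minFac_card
      (by rw [hidx, hc, hp.pow_minFac (by omega)])
    have hKc : IsCyclic K := by
      refine ih K hK fun x y hx hy => ?_
      obtain ⟨j, hj⟩ := Subgroup.mem_zpowers_iff.1
        (hU x y (by rwa [Subgroup.orderOf_coe]) (by rwa [Subgroup.orderOf_coe]))
      exact Subgroup.mem_zpowers_iff.2 ⟨j, Subtype.ext (by simpa using hj)⟩
    obtain ⟨⟨k, hkK⟩, hk⟩ := hKc.exists_generator
    have hKk : ∀ x ∈ K, ∃ j : ℕ, k ^ j = x := by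
      intro x hx
      obtain ⟨j, hj⟩ := mem_powers_iff_mem_zpowers.2 (hk ⟨x, hx⟩)
      exact ⟨j, by simpa using congrArg Subtype.val hj⟩
    have hKcomm : ∀ x ∈ K, ∀ y ∈ K, x * y = y * x := by
      intro x hx y hy
      obtain ⟨i, rfl⟩ := hKk x hx
      obtain ⟨j, rfl⟩ := hKk y hy
      rw [← pow_add, ← pow_add, add_comm]
    have hPp : IsPGroup p (⊤ : Subgroup P) := IsPGroup.of_card (n := n + 1) (by rw [Subgroup.card_top, hc])
    obtain ⟨g, hg⟩ : ∃ g, g ∉ K := by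
      by_contra! h
      have : K = ⊤ := (Subgroup.eq_top_iff' K).2 h
      rw [this, Subgroup.index_top] at hidx
      exact hp.one_lt.ne hidx
    have hgp : g ^ p ∈ K := by rw [← hidx]; exact K.pow_index_mem g
    obtain ⟨j, hj⟩ := hKk _ hgp
    by_cases hpj : p ∣ j
    · exfalso
      obtain ⟨i, rfl⟩ := hpj
      set u := (k ^ i)⁻¹ with hu
      have huK : u ∈ K := K.inv_mem (K.pow_mem hkK i)
      have hup : u ^ p = (g ^ p)⁻¹ := by rw [hu, inv_pow, ← pow_mul, mul_comm, hj]
      set e := u⁻¹ * (g * u * g⁻¹) with he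
      have heK : e ∈ K := K.mul_mem (K.inv_mem huK) (hKn.conj_mem _ huK _)
      have hep : e ^ p = 1 := by
        have h1 : Commute u⁻¹ (g * u * g⁻¹) := hKcomm _ (K.inv_mem huK) _ (hKn.conj_mem _ huK _)
        rw [he, h1.mul_pow, conj_pow, inv_pow, hup]
        group
      obtain ⟨z, -, hz, hzc⟩ := hPp.mem_center_exists_orderOf_eq_prime hp (by
        intro h
        have h1 := congrArg (fun S : Subgroup P => Nat.card S) h
        simp only [Subgroup.card_top, Subgroup.card_bot, hc] at h1
        exact (Nat.one_lt_pow (by omega) hp.one_lt).ne' h1)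
      have hec : ∀ x, e * x = x * e := by
        intro x
        by_cases h1 : e = 1
        · simp [h1]
        · obtain ⟨a, ha⟩ := Subgroup.mem_zpowers_iff.1 (hU z e hz (orderOf_eq_prime hep h1))
          rw [← ha]
          exact (Commute.zpow_right (hzc x trivial) a).symm.eq
      have h2 : (u * g) ^ p = 1 := by
        rw [mul_pow_eq_of_conj (e := e) (by rw [he]; group) hec, hup]
        have h3 : p ∣ p.choose 2 := hp.dvd_choose_self (by omega)
          (lt_of_le_of_ne hp.two_le (Ne.symm hp2))
        obtain ⟨c, hc⟩ := h3
        rw [hc, pow_mul, hep, one_pow]; group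
      have h3 : u * g ∉ K := fun h => hg ((K.mul_mem_cancel_left huK).1 h)
      have h4 : u * g ≠ 1 := fun h => h3 (h ▸ K.one_mem)
      obtain ⟨x, hxK, hx⟩ := exists_mem_orderOf_eq_prime hp (K := K)
        (by rw [hK]; exact dvd_pow_self _ (by omega))
      exact h3 ((Subgroup.zpowers_le.2 hxK) (hU x _ hx (orderOf_eq_prime h2 h4)))
    · have h1 : k ∈ Subgroup.zpowers g := by
        have hck : k ^ p ^ n = 1 := by
          rw [← hK]; exact orderOf_dvd_iff_pow_eq_one.1 (Subgroup.orderOf_dvd_natCard K hkK)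
        refine mem_of_pow_mem_of_coprime (a := j) (b := p ^ n) ?_ ?_ ?_
        · exact (Nat.Coprime.pow_left n ((Nat.Prime.coprime_iff_not_dvd hp).2 hpj)).symm
        · rw [hj]; exact pow_mem (Subgroup.mem_zpowers g) p
        · rw [hck]; exact one_mem _
      have h2 : K ≤ Subgroup.zpowers g := by
        intro x hx
        obtain ⟨i, rfl⟩ := hKk x hx
        exact pow_mem h1 i
      have h3 : Subgroup.zpowers g = ⊤ := by
        have h4 := Subgroup.relIndex_mul_index h2
        rw [hidx] at h4
        rcases (Nat.dvd_prime hp).1 (Dvd.intro_left _ h4) with h5 | h5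
        · exact Subgroup.index_eq_one.1 h5
        · exfalso
          rw [h5] at h4
          have h6 : K.relIndex (Subgroup.zpowers g) = 1 :=
            Nat.eq_of_mul_eq_mul_right hp.pos (by rw [h4, one_mul])
          exact hg (Subgroup.relIndex_eq_one.1 h6 (Subgroup.mem_zpowers g))
      exact ⟨⟨g, fun x => Subgroup.mem_zpowers_iff.1 (by rw [h3]; trivial)⟩⟩

end Cyclic

section Free

set_option linter.unusedSectionVars false

variable {G : Type*} [Group G] [Finite G]

theorem IsPGroup.exists_comm_le {r : ℕ} (hr : r.Prime) {D : Subgroup G} (hD : IsPGroup r D) (hD1 : D ≠ ⊥) :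
    ∃ V ≤ D, V ≠ ⊥ ∧ (∀ x ∈ V, ∀ y ∈ V, x * y = y * x) ∧
      Subgroup.normalizer (D : Set G) ≤ Subgroup.normalizer (V : Set G) := by
  obtain ⟨x, hx, hxr, hxc⟩ := hD.mem_center_exists_orderOf_eq_prime hr hD1
  refine ⟨D ⊓ Subgroup.centralizer (D : Set G), inf_le_left, ?_, ?_, ?_⟩
  · intro h
    have h1 : x ∈ D ⊓ Subgroup.centralizer (D : Set G) :=
      ⟨hx, Subgroup.mem_centralizer_iff.2 fun y hy => hxc y hy⟩
    rw [h, Subgroup.mem_bot] at h1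
    rw [h1, orderOf_one] at hxr
    exact hr.one_lt.ne hxr
  · intro x hx y hy
    exact (Subgroup.mem_centralizer_iff.1 hx.2 y hy.1).symm
  · intro g hg
    refine (Subgroup.mem_nor_of_conj_mem (K := ⊤) (P := D ⊓ Subgroup.centralizer (D : Set G))
      (Subgroup.mem_top g) fun y hy => Subgroup.mem_inf.2 ⟨?_, ?_⟩).2
    · exact (Subgroup.mem_normalizer_iff.1 hg _).1 hy.1
    · rw [Subgroup.mem_centralizer_iff]
      intro z hz
      have h1 : g⁻¹ * z * g ∈ D := by
        have := (Subgroup.mem_normalizer_iff.1 (inv_mem hg) z).1 hz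
        simpa using this
      have h2 := Subgroup.mem_centralizer_iff.1 hy.2 _ h1
      calc z * (g * y * g⁻¹) = g * ((g⁻¹ * z * g) * y) * g⁻¹ := by group
        _ = _ := by rw [h2]; group

/-- `M` acts fixed point freely by conjugation on `D`. -/
def FreeOn (M D : Subgroup G) : Prop := ∀ m ∈ M, ∀ v ∈ D, m * v = v * m → m = 1 ∨ v = 1

theorem IsPGroup.coprime_card {p q : ℕ} (hp : p.Prime) (hq : q.Prime) (hpq : p ≠ q) {P Q : Subgroup G}
    (hP : IsPGroup p P) (hQ : IsPGroup q Q) : Nat.Coprime (Nat.card P) (Nat.card Q) := by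
  have := Fact.mk hp
  have := Fact.mk hq
  obtain ⟨n, hn⟩ := hP.exists_card_eq
  obtain ⟨m, hm⟩ := hQ.exists_card_eq
  rw [hn, hm]
  exact Nat.coprime_pow_primes n m hp hq hpq

theorem IsPGroup.mem_zpowers_of_free {q r : ℕ} (hq : q.Prime) (hr : r.Prime) (hqr : q ≠ r)
    {M D : Subgroup G} (hM : IsPGroup q M) (hD : IsPGroup r D) (hD1 : D ≠ ⊥)
    (hMD : M ≤ Subgroup.normalizer (D : Set G)) (hfree : FreeOn M D) {x y : G} (hx : x ∈ M) (hy : y ∈ M)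
    (hxq : orderOf x = q) (hyq : orderOf y = q) : y ∈ Subgroup.zpowers x := by
  obtain ⟨V, hVD, hV1, hV, hVn⟩ := hD.exists_comm_le hr hD1
  have hM1 : M ≠ ⊥ := by
    rintro rfl
    rw [Subgroup.mem_bot.1 hx, orderOf_one] at hxq
    exact hq.one_lt.ne hxq
  obtain ⟨z, hz, hzq, hzc⟩ := hM.mem_center_exists_orderOf_eq_prime hq hM1
  have hcop : Nat.Coprime q (Nat.card V) := by
    have h1 := IsPGroup.coprime_card hq hr hqr (isPGroup_zpowers (p := q) (x := x) (k := 1)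
      (by rw [hxq, pow_one])) (hD.to_le hVD)
    rwa [Nat.card_zpowers, hxq] at h1
  have key : ∀ w ∈ M, orderOf w = q → w ∈ Subgroup.zpowers z := by
    intro w hw hwq
    refine mem_zpowers_of_free_comm hV hq hcop hV1 (hVn (hMD hw)) (hVn (hMD hz))
      (hzc w hw) (by rw [← hwq]; exact pow_orderOf_eq_one w) (by rw [← hzq]; exact pow_orderOf_eq_one z)
      ?_ ?_
    · rintro rfl; rw [orderOf_one] at hzq; exact hq.one_lt.ne hzq
    · intro i j h1 v hv hc
      exact (hfree _ (M.mul_mem (M.pow_mem hw i) (M.pow_mem hz j)) v (hVD hv) hc).resolve_left h1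
  have h1 : Subgroup.zpowers x = Subgroup.zpowers z := by
    refine Subgroup.eq_of_le_of_card_ge (Subgroup.zpowers_le.2 (key x hx hxq)) ?_
    rw [Nat.card_zpowers, Nat.card_zpowers, hxq, hzq]
  rw [h1]
  exact key y hy hyq

theorem IsPGroup.eq_zpowers_of_unique {q : ℕ} (hq : q.Prime) (hq2 : q ≠ 2) {M : Subgroup G}
    (hM : IsPGroup q M)
    (hU : ∀ x ∈ M, ∀ y ∈ M, orderOf x = q → orderOf y = q → y ∈ Subgroup.zpowers x) :
    ∃ x ∈ M, M = Subgroup.zpowers x := by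
  have := Fact.mk hq
  obtain ⟨n, hn⟩ := hM.exists_card_eq
  have h := IsPGroup.isCyclic_of_unique_prime_order hq hq2 n M hn (fun x y hx hy => by
    obtain ⟨j, hj⟩ := Subgroup.mem_zpowers_iff.1 (hU x x.2 y y.2 (by rwa [Subgroup.orderOf_coe])
      (by rwa [Subgroup.orderOf_coe]))
    exact Subgroup.mem_zpowers_iff.2 ⟨j, Subtype.ext (by simpa using hj)⟩)
  obtain ⟨⟨x, hx⟩, h1⟩ := h.exists_generator
  refine ⟨x, hx, le_antisymm (fun y hy => ?_) (Subgroup.zpowers_le.2 hx)⟩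
  obtain ⟨j, hj⟩ := h1 ⟨y, hy⟩
  exact Subgroup.mem_zpowers_iff.2 ⟨j, by simpa using congrArg Subtype.val hj⟩

theorem IsPGroup.card_eq_of_unique_of_exponent {q : ℕ} (hq : q.Prime) {M : Subgroup G}
    (hM : IsPGroup q M) (hM1 : M ≠ ⊥) (hexp : ∀ x ∈ M, x ^ q = 1)
    (hU : ∀ x ∈ M, ∀ y ∈ M, orderOf x = q → orderOf y = q → y ∈ Subgroup.zpowers x) :
    Nat.card M = q := by
  have := Fact.mk hq
  obtain ⟨x, hx, hxq⟩ := hM.exists_orderOf_eq_prime hq hM1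
  have h1 : M = Subgroup.zpowers x := by
    refine le_antisymm (fun y hy => ?_) (Subgroup.zpowers_le.2 hx)
    by_cases h : y = 1
    · rw [h]; exact one_mem _
    · exact hU x hx y hy hxq (orderOf_eq_prime (hexp y hy) h)
  rw [h1, Nat.card_zpowers, hxq]

/-- If an element `g` acts on `M` with regular powers and every `v * g` with `v` in `V` has trivial
`n`-th power relative to `g`, then `M` centralises `V`. -/
theorem commute_of_regular {V M : Subgroup G} (hV : ∀ x ∈ V, ∀ y ∈ V, x * y = y * x)
    (hcop : Nat.Coprime (Nat.card M) (Nat.card V)) {g : G} {n : ℕ}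
    (hn : 0 < n) (hgV : g ∈ Subgroup.normalizer (V : Set G))
    (hMV : M ≤ Subgroup.normalizer (V : Set G)) (hgM : g ∈ Subgroup.normalizer (M : Set G))
    (hfree : ∀ m ∈ M, ∀ i, 0 < i → i < n → m * g ^ i = g ^ i * m → m = 1)
    (hvg : ∀ v ∈ V, (v * g) ^ n = g ^ n) {v m : G} (hv : v ∈ V) (hm : m ∈ M) :
    m * v = v * m := by
  have h1 : v ^ Nat.card M ∈ Subgroup.centralizer {m} :=
    Subgroup.mem_centralizer_singleton_iff.2 (conj_pow_card_eq hV hn hgV hMV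
      (fun m hm => (Subgroup.mem_normalizer_iff.1 hgM m).1 hm) hfree hvg hv hm).symm
  have h2 : v ^ Nat.card V ∈ Subgroup.centralizer {m} := by
    rw [orderOf_dvd_iff_pow_eq_one.1 (Subgroup.orderOf_dvd_natCard V hv)]; exact one_mem _
  exact (Subgroup.mem_centralizer_singleton_iff.1 (mem_of_pow_mem_of_coprime hcop h1 h2)).symm

end Free

section Isolated

set_option linter.unusedSectionVars false

variable {G : Type*} [Group G]

/-- Elements of `K` whose order is divisible by `r` have order `r`. -/
def Isolated (r : ℕ) (K : Subgroup G) : Prop := ∀ x ∈ K, r ∣ orderOf x → orderOf x = r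

variable [Finite G]

theorem Isolated.pow_eq_one {r : ℕ} (hr : r.Prime) {K : Subgroup G} (h : Isolated r K) {v x : G} (hv : v ∈ K)
    (hvr : orderOf v = r) (hx : x ∈ K) (hxv : x * v = v * x) : x ^ r = 1 := by
  by_cases hd : r ∣ orderOf x
  · rw [← h x hx hd]; exact pow_orderOf_eq_one x
  · have hco : Nat.Coprime (orderOf x) (orderOf v) := by
      rw [hvr]; exact ((Nat.Prime.coprime_iff_not_dvd hr).2 hd).symm
    have h1 := (show Commute x v from hxv).orderOf_mul_eq_mul_orderOf_of_coprime hco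
    have h2 := h (x * v) (K.mul_mem hx hv) (by rw [h1, hvr]; exact dvd_mul_left _ _)
    rw [h1, hvr] at h2
    have h3 : orderOf x = 1 := Nat.eq_of_mul_eq_mul_right hr.pos (by rw [h2, one_mul])
    rw [orderOf_eq_one_iff.1 h3, one_pow]

theorem Isolated.orderOf_eq {r : ℕ} (hr : r.Prime) {K D : Subgroup G} (h : Isolated r K) (hDK : D ≤ K)
    (hD : IsPGroup r D) {v : G} (hv : v ∈ D) (hv1 : v ≠ 1) : orderOf v = r := by
  obtain ⟨k, hk⟩ := hD.orderOf_eq hr hv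
  refine h v (hDK hv) ?_
  rw [hk]
  refine dvd_pow_self r fun h0 => hv1 ?_
  rw [h0, pow_zero] at hk
  exact orderOf_eq_one_iff.1 hk

theorem Isolated.freeOn {q r : ℕ} (hq : q.Prime) (hr : r.Prime) (hqr : q ≠ r) {K D M : Subgroup G}
    (h : Isolated r K) (hDK : D ≤ K) (hMK : M ≤ K) (hD : IsPGroup r D) (hM : IsPGroup q M) : FreeOn M D := by
  intro m hm v hv hc
  by_contra! hcon
  have h1 := h.pow_eq_one hr (hDK hv) (h.orderOf_eq hr hDK hD hv hcon.2) (hMK hm) hc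
  obtain ⟨k, hk⟩ := hM.orderOf_eq hq hm
  refine hcon.1 (Subgroup.mem_bot.1 (mem_of_pow_mem_of_coprime (a := r) (b := q ^ k) ?_
    (Subgroup.mem_bot.2 h1) (Subgroup.mem_bot.2 (by rw [← hk, pow_orderOf_eq_one]))))
  exact Nat.Coprime.pow_right k ((Nat.coprime_primes hr hq).2 hqr.symm)

/-- In an `r`-by-`r` situation, `v * g` has trivial `r`-th power. -/
theorem Isolated.mul_pow_eq_one {r : ℕ} (hr : r.Prime) {K V : Subgroup G} (h : Isolated r K) (hVK : V ≤ K)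
    (hV : IsPGroup r V) {g v : G} (hg : g ∈ K) (hgV : g ∈ Subgroup.normalizer (V : Set G)) (hv : v ∈ V)
    (hgr : g ^ r = 1) : (v * g) ^ r = 1 := by
  have hmem : ∀ k : ℕ, (v * g) ^ k * (g ^ k)⁻¹ ∈ V := by
    intro k
    induction k with
    | zero => simp
    | succ k ih =>
      have h1 : (v * g) ^ (k + 1) * (g ^ (k + 1))⁻¹ =
        v * (g * ((v * g) ^ k * (g ^ k)⁻¹) * g⁻¹) := by rw [pow_succ', pow_succ']; group
      rw [h1]
      exact V.mul_mem hv ((Subgroup.mem_normalizer_iff.1 hgV _).1 ih)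
  have h1 := hmem r
  rw [hgr, inv_one, mul_one] at h1
  obtain ⟨k, hk⟩ := hV.orderOf_eq hr h1
  by_cases h0 : v * g = 1
  · rw [h0, one_pow]
  have h2 : orderOf (v * g) ∣ r ^ (k + 1) := by
    apply orderOf_dvd_of_pow_eq_one
    rw [pow_succ', pow_mul, ← hk, pow_orderOf_eq_one]
  obtain ⟨j, -, hj⟩ := (Nat.dvd_prime_pow hr).1 h2
  have h3 : r ∣ orderOf (v * g) := by
    rw [hj]
    refine dvd_pow_self r fun hj0 => h0 ?_
    rw [hj0, pow_zero] at hj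
    exact orderOf_eq_one_iff.1 hj
  rw [← h _ (K.mul_mem (hVK hv) hg) h3, pow_orderOf_eq_one]

/-- Key contradiction: an element `g` of prime order `m` acting regularly on a nontrivial `q`-group
`M` which acts on an `r`-group `D`, with `r` isolated. -/
theorem Isolated.false_of_regular {q r m : ℕ} (hq : q.Prime) (hr : r.Prime) (hm : m.Prime) (hqr : q ≠ r)
    {K D M : Subgroup G} (h : Isolated r K) (hDK : D ≤ K) (hMK : M ≤ K) (hD : IsPGroup r D)
    (hD1 : D ≠ ⊥) (hM : IsPGroup q M) (hM1 : M ≠ ⊥) (hMD : M ≤ Subgroup.normalizer (D : Set G)) {g : G}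
    (hgD : g ∈ Subgroup.normalizer (D : Set G)) (hgM : g ∈ Subgroup.normalizer (M : Set G))
    (hgm : g ^ m = 1)
    (hfree : ∀ y ∈ M, ∀ i, 0 < i → i < m → y * g ^ i = g ^ i * y → y = 1)
    (hcase : (m = r ∧ g ∈ K) ∨ ∀ v ∈ D, g * v = v * g → v = 1) : False := by
  obtain ⟨V, hVD, hV1, hV, hVn⟩ := hD.exists_comm_le hr hD1
  have hcop := IsPGroup.coprime_card hq hr hqr hM (hD.to_le hVD)
  obtain ⟨v, hv, hv1⟩ := V.bot_or_exists_ne_one.resolve_left hV1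
  obtain ⟨x, hx, hx1⟩ := M.bot_or_exists_ne_one.resolve_left hM1
  refine ((h.freeOn hq hr hqr hDK hMK hD hM) x hx v (hVD hv) ?_).elim hx1 hv1
  refine commute_of_regular hV hcop hm.pos (hVn hgD) (hMD.trans hVn) hgM hfree ?_ hv hx
  intro w hw
  rw [hgm]
  rcases hcase with ⟨rfl, hgK⟩ | hgf
  · exact h.mul_pow_eq_one hr (hVD.trans hDK) (hD.to_le hVD) hgK (hVn hgD) hw hgm
  · rw [mul_pow_eq_pow_of_free hV (hVn hgD) (by intro v _; simp [hgm])
      (fun v hv hc => hgf v (hVD hv) hc) hw, hgm]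

theorem eq_one_of_commute_pow {M : Subgroup G} {q m : ℕ} (hm : m.Prime) (hMq : Nat.card M = q) (hq : q.Prime) {g y : G}
    (hg : ∃ x ∈ M, g * x ≠ x * g) (hgm : ∀ x ∈ M, g ^ m * x = x * g ^ m) (hy : y ∈ M) {i : ℕ} (hi : 0 < i)
    (him : i < m) (hc : y * g ^ i = g ^ i * y) : y = 1 := by
  by_contra hy1
  obtain ⟨x, hx, hgx⟩ := hg
  have h1 : g ^ i ∈ Subgroup.centralizer {y} := Subgroup.mem_centralizer_singleton_iff.2 hc.symm
  have h2 : g ^ m ∈ Subgroup.centralizer {y} := Subgroup.mem_centralizer_singleton_iff.2 (hgm y hy)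
  have hco : Nat.Coprime i m :=
    ((Nat.Prime.coprime_iff_not_dvd hm).2 fun hd => absurd (Nat.le_of_dvd hi hd) (by omega)).symm
  have h3 := Subgroup.mem_centralizer_singleton_iff.1 (mem_of_pow_mem_of_coprime hco h1 h2)
  have hyq : orderOf y = q := by
    have h4 := Subgroup.orderOf_dvd_card hy
    rw [hMq] at h4
    exact ((Nat.dvd_prime hq).1 h4).resolve_left fun h => hy1 (orderOf_eq_one_iff.1 h)
  have h5 : M = Subgroup.zpowers y := (Subgroup.eq_of_le_of_card_ge (Subgroup.zpowers_le.2 hy)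
    (by rw [Nat.card_zpowers, hyq, hMq])).symm
  rw [h5] at hx
  obtain ⟨j, rfl⟩ := Subgroup.mem_zpowers_iff.1 hx
  exact hgx ((show Commute g y from h3).zpow_right j).eq

/-- Sylow `q`-subgroups of a subgroup `N` normalising an `r`-group, with `r` isolated. -/
theorem Isolated.card_sylow_le_and_centralizes {q r : ℕ} (hq : q.Prime) (hr : r.Prime) (hqr : q ≠ r)
    {K D N M : Subgroup G} (h : Isolated r K) (hDK : D ≤ K) (hNK : N ≤ K) (hD : IsPGroup r D) (hD1 : D ≠ ⊥)
    (hND : N ≤ Subgroup.normalizer (D : Set G)) (hM : SylIn q M N) (hq2 : ∀ x ∈ K, orderOf x ≠ q ^ 2)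
    (hqm : ∀ m, m.Prime → (∃ x ∈ K, orderOf x = q * m) → ∀ x ∈ K, orderOf x ≠ m ^ 2) :
    (M ≠ ⊥ → Nat.card M = q) ∧ ∀ n ∈ N.nor M, ∀ x ∈ M, n * x = x * n := by
  have hexp : ∀ x ∈ M, x ^ q = 1 := by
    intro x hx
    obtain ⟨k, hk⟩ := hM.isPGroup.orderOf_eq hq hx
    have hk2 : k < 2 := by
      by_contra! h2
      refine hq2 (x ^ q ^ (k - 2)) (K.pow_mem (hNK (hM.le hx)) _) ?_
      rw [orderOf_pow_of_dvd (pow_pos hq.pos _).ne' (by rw [hk]; exact pow_dvd_pow _ (by omega)), hk]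
      exact Nat.pow_div (by omega) hq.pos |>.trans (by congr 1; omega)
    apply orderOf_dvd_iff_pow_eq_one.1
    rw [hk]
    conv_rhs => rw [← pow_one q]
    exact pow_dvd_pow q (by omega)
  have hcard : M ≠ ⊥ → Nat.card M = q := fun hM1 =>
    hM.isPGroup.card_eq_of_unique_of_exponent hq hM1 hexp fun x hx y hy hxq hyq =>
      hM.isPGroup.mem_zpowers_of_free hq hr hqr hD hD1 (hM.le.trans hND)
        (h.freeOn hq hr hqr hDK (hM.le.trans hNK) hD hM.isPGroup) hx hy hxq hyq
  refine ⟨hcard, ?_⟩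
  by_contra! hcon
  obtain ⟨n, hn, x, hx, hnx⟩ := hcon
  have hM1 : M ≠ ⊥ := by
    rintro rfl
    rw [Subgroup.mem_bot.1 hx] at hnx
    simp at hnx
  have hMq := hcard hM1
  have hxq : orderOf x = q := by
    have h4 := Subgroup.orderOf_dvd_card hx
    rw [hMq] at h4
    refine ((Nat.dvd_prime hq).1 h4).resolve_left fun h => hnx ?_
    rw [orderOf_eq_one_iff.1 h]; simp
  have hnC : n ∉ Subgroup.centralizer {x} := fun h => hnx (Subgroup.mem_centralizer_singleton_iff.1 h)
  obtain ⟨m, k, j, hm, hg1, hg2, hg3⟩ := exists_pow_not_mem_prime_pow_mem hnC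
  set g := n ^ k with hg
  have hgN : g ∈ N := N.pow_mem hn.1 k
  have hgM : g ∈ Subgroup.normalizer (M : Set G) := pow_mem hn.2 k
  have hgx : g * x ≠ x * g := fun h => hg1 (Subgroup.mem_centralizer_singleton_iff.2 h)
  have hgmx : g ^ m * x = x * g ^ m := Subgroup.mem_centralizer_singleton_iff.1 hg2
  have hMx : M = Subgroup.zpowers x := (Subgroup.eq_of_le_of_card_ge (Subgroup.zpowers_le.2 hx)
    (by rw [Nat.card_zpowers, hxq, hMq])).symm
  have hgmM : ∀ y ∈ M, g ^ m * y = y * g ^ m := by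
    intro y hy
    rw [hMx] at hy
    obtain ⟨i, rfl⟩ := Subgroup.mem_zpowers_iff.1 hy
    exact ((show Commute (g ^ m) x from hgmx).zpow_right i).eq
  have hmq : m ≠ q := by
    rintro rfl
    have h1 : g ∈ M := hM.mem_of_mem_nor hq hg3 ⟨hgN, hgM⟩
    rw [hMx] at h1
    obtain ⟨i, hi⟩ := Subgroup.mem_zpowers_iff.1 h1
    apply hgx
    rw [← hi]
    exact ((Commute.refl x).zpow_left i).eq
  have hgm : g ^ m = 1 := by
    by_contra hgm
    have hj : 2 ≤ j := by
      by_contra! hj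
      apply hgm
      rw [← orderOf_dvd_iff_pow_eq_one, hg3]
      conv_rhs => rw [← pow_one m]
      exact pow_dvd_pow m (by omega)
    have hw : ∀ i ≤ j, orderOf (g ^ m ^ (j - i)) = m ^ i := by
      intro i hi
      rw [orderOf_pow_of_dvd (pow_pos hm.pos _).ne' (by rw [hg3]; exact pow_dvd_pow _ (by omega)), hg3,
        Nat.pow_div (by omega) hm.pos]
      congr 1; omega
    refine hqm m hm ⟨x * g ^ m ^ (j - 1), K.mul_mem (hNK (hM.le hx)) (K.pow_mem (hNK hgN) _), ?_⟩
      (g ^ m ^ (j - 2)) (K.pow_mem (hNK hgN) _) (hw 2 hj)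
    have hc : Commute x (g ^ m ^ (j - 1)) := by
      obtain ⟨i, hi⟩ : ∃ i, j - 1 = i + 1 := ⟨j - 2, by omega⟩
      rw [hi, pow_succ', pow_mul]
      exact Commute.pow_right hgmx.symm _
    rw [hc.orderOf_mul_eq_mul_orderOf_of_coprime, hxq, hw 1 (by omega), pow_one]
    rw [hxq, hw 1 (by omega), pow_one]
    exact (Nat.coprime_primes hq hm).2 hmq.symm
  refine h.false_of_regular hq hr hm hqr hDK (hM.le.trans hNK) hD hD1 hM.isPGroup hM1 (hM.le.trans hND)
    (hND hgN) hgM hgm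
    (fun y hy i hi him hc => eq_one_of_commute_pow hm hMq hq ⟨x, hx, hgx⟩ hgmM hy hi him hc) ?_
  by_cases hmr : m = r
  · exact Or.inl ⟨hmr, hNK hgN⟩
  · refine Or.inr fun v hv hc => ?_
    refine ((h.freeOn (M := Subgroup.zpowers g) hm hr hmr hDK (Subgroup.zpowers_le.2 (hNK hgN)) hD
      (isPGroup_zpowers hg3)) g (Subgroup.mem_zpowers g) v hv hc).resolve_left ?_
    rintro h1
    rw [h1] at hgx
    simp at hgx

end Isolated

section Complement

set_option linter.unusedSectionVars false

universe u

variable {G : Type u} [Group G] [Finite G]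

/-- Burnside's normal complement theorem for a Sylow subgroup `M` of a subgroup `N`. -/
theorem SylIn.exists_complement {q : ℕ} (hq : q.Prime) {M N : Subgroup G} (hM : SylIn q M N)
    (hc : ∀ n ∈ N.nor M, ∀ x ∈ M, n * x = x * n) :
    ∃ Y ≤ N, N ≤ Subgroup.normalizer (Y : Set G) ∧ Nat.card Y * Nat.card M = Nat.card N := by
  have := Fact.mk hq
  have hP : Subgroup.normalizer (hM.toSylow : Set N) ≤ Subgroup.centralizer ((hM.toSylow : Subgroup N) : Set N) := by
    intro n hn
    rw [Subgroup.mem_centralizer_iff]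
    intro x hx
    have hx' : (x : G) ∈ M := hx
    refine Subtype.ext (hc n ?_ x hx').symm
    refine Subgroup.mem_nor_of_conj_mem n.2 fun y hy => ?_
    have := (Subgroup.mem_normalizer_iff.1 hn ⟨y, hM.le hy⟩).1 hy
    exact this
  obtain ⟨Y, hYn, hcomp⟩ : ∃ Y : Subgroup N, Y.Normal ∧ Y.IsComplement' (hM.toSylow : Subgroup N) :=
    ⟨_, inferInstance, MonoidHom.ker_transferSylow_isComplement' hM.toSylow hP⟩
  refine ⟨Y.map N.subtype, Subgroup.map_subtype_le _, ?_, ?_⟩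
  · intro n hn
    refine (Subgroup.mem_nor_of_conj_mem (K := ⊤) (Subgroup.mem_top n) fun y hy => ?_).2
    obtain ⟨y, hy, rfl⟩ := hy
    exact ⟨⟨n, hn⟩ * y * ⟨n, hn⟩⁻¹, hYn.conj_mem y hy _, rfl⟩
  · rw [Subgroup.card_map_of_injective N.subtype_injective]
    have h1 := hcomp.card_mul_card
    rw [← h1]
    congr 1
    exact (Nat.card_congr (Subgroup.subgroupOfEquivOfLe hM.le).toEquiv).symm

theorem mem_of_normal_of_coprime {Y N : Subgroup G} (hYN : Y ≤ N) (hN : N ≤ Subgroup.normalizer (Y : Set G)) {k : ℕ}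
    (hk : Nat.card Y * k = Nat.card N) {x : G} (hx : x ∈ N) (hco : Nat.Coprime k (orderOf x)) : x ∈ Y := by
  have hn : (Y.subgroupOf N).Normal := by
    constructor
    intro y hy g
    exact (Subgroup.mem_normalizer_iff.1 (hN g.2) _).1 hy
  have h1 := (Y.subgroupOf N).card_mul_index
  rw [Nat.card_congr (Subgroup.subgroupOfEquivOfLe hYN).toEquiv, ← hk] at h1
  have h2 : (Y.subgroupOf N).index = k := Nat.eq_of_mul_eq_mul_left Nat.card_pos h1
  have h3 := (Y.subgroupOf N).pow_index_mem ⟨x, hx⟩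
  rw [h2, Subgroup.mem_subgroupOf] at h3
  exact mem_of_pow_mem_of_coprime hco h3 (by rw [pow_orderOf_eq_one]; exact Y.one_mem)

theorem exists_normal_isPGroup_of_comm {X : Type*} [Group X] [Finite X] {A : Subgroup X} [A.Normal]
    (hA : A ≠ ⊥) (hc : ∀ x ∈ A, ∀ y ∈ A, x * y = y * x) :
    ∃ p, p.Prime ∧ ∃ B ≤ A, B ≠ ⊥ ∧ B.Normal ∧ IsPGroup p B := by
  have h1 : Nat.card A ≠ 1 := fun h => hA (Subgroup.card_eq_one.1 h)
  obtain ⟨p, hp, hpA⟩ := Nat.exists_prime_and_dvd h1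
  have := Fact.mk hp
  let B : Subgroup X :=
    { carrier := {x | x ∈ A ∧ ∃ k, x ^ p ^ k = 1}
      one_mem' := ⟨A.one_mem, 0, by simp⟩
      mul_mem' := by
        rintro x y ⟨hx, k, hk⟩ ⟨hy, l, hl⟩
        refine ⟨A.mul_mem hx hy, k + l, ?_⟩
        rw [(show Commute x y from hc x hx y hy).mul_pow, pow_add, pow_mul, hk, one_pow, one_mul, mul_comm,
          pow_mul, hl, one_pow]
      inv_mem' := by
        rintro x ⟨hx, k, hk⟩
        exact ⟨A.inv_mem hx, k, by rw [inv_pow, hk, inv_one]⟩ }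
  refine ⟨p, hp, B, fun x hx => hx.1, ?_, ⟨?_⟩, ?_⟩
  · obtain ⟨x, hx⟩ := exists_prime_orderOf_dvd_card' p hpA
    intro h
    have h2 : (x : X) ∈ B := ⟨x.2, 1, by
      rw [pow_one, ← hx, ← Subgroup.orderOf_coe, pow_orderOf_eq_one]⟩
    rw [h, Subgroup.mem_bot] at h2
    rw [← Subgroup.orderOf_coe, h2, orderOf_one] at hx
    exact hp.one_lt.ne hx
  · rintro x ⟨hx, k, hk⟩ g
    exact ⟨(inferInstance : A.Normal).conj_mem x hx g, k, by rw [conj_pow, hk]; simp⟩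
  · rintro ⟨x, hx, k, hk⟩
    exact ⟨k, Subtype.ext (by simpa using hk)⟩

theorem Group.IsSolvable.exists_normal_isPGroup {X : Type*} [Group X] [Finite X] [Nontrivial X]
    (hX : Group.IsSolvable X) : ∃ p, p.Prime ∧ ∃ B : Subgroup X, B ≠ ⊥ ∧ B.Normal ∧ IsPGroup p B := by
  classical
  obtain ⟨n, hn⟩ := hX.solvable
  have hex : ∃ n, derivedSeries X n = ⊥ := ⟨n, hn⟩
  set m := Nat.find hex with hm
  have hm1 : derivedSeries X m = ⊥ := Nat.find_spec hex
  have hm0 : m ≠ 0 := by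
    intro h
    rw [h, derivedSeries_zero] at hm1
    exact top_ne_bot hm1
  obtain ⟨k, hk⟩ := Nat.exists_eq_succ_of_ne_zero hm0
  have h1 : derivedSeries X k ≠ ⊥ := Nat.find_min hex (by omega)
  have h2 : ∀ x ∈ derivedSeries X k, ∀ y ∈ derivedSeries X k, x * y = y * x := by
    intro x hx y hy
    rw [hk, Nat.succ_eq_add_one, derivedSeries_succ] at hm1
    have := Subgroup.commutator_mem_commutator hx hy
    rw [hm1, Subgroup.mem_bot] at this
    exact commutatorElement_eq_one_iff_mul_comm.1 this
  obtain ⟨p, hp, B, -, hB⟩ := exists_normal_isPGroup_of_comm h1 h2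
  exact ⟨p, hp, B, hB⟩

end Complement

section NormalSylow

set_option linter.unusedSectionVars false

universe u

variable {G : Type u} [Group G] [Finite G]

theorem exists_normal_over {N O : Subgroup G} (hN : Group.IsSolvable N) (hON : O ≤ N)
    (hO : N ≤ Subgroup.normalizer (O : Set G)) (hne : O ≠ N) :
    ∃ p, p.Prime ∧ ∃ B, O < B ∧ B ≤ N ∧ N ≤ Subgroup.normalizer (B : Set G) ∧
      ∀ b ∈ B, ∃ k, b ^ p ^ k ∈ O := by
  have hn : (O.subgroupOf N).Normal := by
    constructor
    intro y hy g
    exact (Subgroup.mem_normalizer_iff.1 (hO g.2) _).1 hy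
  have hnt : Nontrivial (N ⧸ O.subgroupOf N) := by
    rw [QuotientGroup.nontrivial_iff]
    intro h
    apply hne
    refine le_antisymm hON (Subgroup.subgroupOf_eq_top.1 h)
  have := ((Group.isSolvable_iff_subgroup_quotient (G := N) (O.subgroupOf N)).1 hN).2
  obtain ⟨p, hp, B, hB1, hBn, hBp⟩ := Group.IsSolvable.exists_normal_isPGroup this
  refine ⟨p, hp, (B.comap (QuotientGroup.mk' (O.subgroupOf N))).map N.subtype, ?_,
    Subgroup.map_subtype_le _, ?_, ?_⟩
  · rw [lt_iff_le_and_ne]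
    constructor
    · intro x hx
      refine ⟨⟨x, hON hx⟩, ?_, rfl⟩
      change QuotientGroup.mk' _ _ ∈ B
      have : QuotientGroup.mk' (O.subgroupOf N) ⟨x, hON hx⟩ = 1 := (QuotientGroup.eq_one_iff _).2 hx
      rw [this]; exact B.one_mem
    · intro h
      apply hB1
      rw [Subgroup.eq_bot_iff_forall]
      intro b hb
      obtain ⟨x, rfl⟩ := QuotientGroup.mk'_surjective _ b
      have : (x : G) ∈ O := by
        rw [h]; exact ⟨x, hb, rfl⟩
      exact (QuotientGroup.eq_one_iff x).2 this
  · intro n hn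
    refine (Subgroup.mem_nor_of_conj_mem (K := ⊤) (Subgroup.mem_top n) fun y hy => ?_).2
    obtain ⟨y, hy, rfl⟩ := hy
    exact ⟨⟨n, hn⟩ * y * ⟨n, hn⟩⁻¹, (inferInstance :
      (B.comap (QuotientGroup.mk' (O.subgroupOf N))).Normal).conj_mem y hy _, rfl⟩
  · rintro b ⟨x, hx, rfl⟩
    obtain ⟨k, hk⟩ := hBp ⟨_, hx⟩
    refine ⟨k, ?_⟩
    have h1 := congrArg Subtype.val hk
    simp only [Subgroup.coe_pow, OneMemClass.coe_one] at h1
    rw [← map_pow] at h1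
    exact (QuotientGroup.eq_one_iff (x ^ p ^ k)).1 h1

theorem isPGroup_of_pow_mem {p : ℕ} {O B : Subgroup G} (hO : IsPGroup p O) (h : ∀ b ∈ B, ∃ k, b ^ p ^ k ∈ O) :
    IsPGroup p B := by
  rintro ⟨b, hb⟩
  obtain ⟨k, hk⟩ := h b hb
  obtain ⟨l, hl⟩ := hO ⟨_, hk⟩
  refine ⟨k + l, Subtype.ext ?_⟩
  have h1 := congrArg Subtype.val hl
  simpa [pow_add, pow_mul] using h1

theorem exists_max_normal_isPGroup {r : ℕ} {N D : Subgroup G} (hDN : D ≤ N) (hD : IsPGroup r D)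
    (hND : N ≤ Subgroup.normalizer (D : Set G)) :
    ∃ O, D ≤ O ∧ O ≤ N ∧ IsPGroup r O ∧ N ≤ Subgroup.normalizer (O : Set G) ∧
      ∀ O', O ≤ O' → O' ≤ N → IsPGroup r O' → N ≤ Subgroup.normalizer (O' : Set G) → O' = O := by
  obtain ⟨O, h1, h2⟩ := (Set.toFinite {O : Subgroup G | D ≤ O ∧ O ≤ N ∧ IsPGroup r O ∧
    N ≤ Subgroup.normalizer (O : Set G)}).exists_le_maximal ⟨le_refl D, hDN, hD, hND⟩
  obtain ⟨h3, h4, h5, h6⟩ := h2.1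
  exact ⟨O, h3, h4, h5, h6, fun O' h7 h8 h9 h10 => (h2.eq_of_le ⟨h3.trans h7, h8, h9, h10⟩ h7).symm⟩

theorem Isolated.normal_sylIn_of_two_primes {r p : ℕ} (hr : r.Prime) (hp : p.Prime) (hpr : p ≠ r) {K N D : Subgroup G}
    (h : Isolated r K) (hNK : N ≤ K) (hDN : D ≤ N) (hD : IsPGroup r D) (hD1 : D ≠ ⊥)
    (hND : N ≤ Subgroup.normalizer (D : Set G))
    (hpr2 : ∀ ℓ, ℓ.Prime → ℓ ∣ Nat.card N → ℓ = r ∨ ℓ = p) :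
    ∃ R, SylIn r R N ∧ N ≤ Subgroup.normalizer (R : Set G) := by
  have hsol := isSolvable_of_prime_dvd_card_eq_or_eq hpr2
  obtain ⟨O, hDO, hON, hO, hOn, hmax⟩ := exists_max_normal_isPGroup hDN hD hND
  refine ⟨O, ?_, hOn⟩
  have hO1 : O ≠ ⊥ := fun h => hD1 (le_bot_iff.1 (h ▸ hDO))
  obtain ⟨R, hR, hOR⟩ := hO.exists_le_sylIn hr hON
  suffices hRO : R ≤ O by rwa [le_antisymm hOR hRO]
  by_cases hne : O = N
  · rw [hne]; exact hR.le
  obtain ⟨ℓ, hℓ, B, hOB, hBN, hBn, hB⟩ := exists_normal_over hsol hON hOn hne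
  have hℓr : ℓ ≠ r := by
    rintro rfl
    exact hOB.ne' (hmax B hOB.le hBN (isPGroup_of_pow_mem hO hB) hBn)
  obtain ⟨P, hP⟩ := exists_sylIn hℓ B
  have hBPO : ∀ b ∈ B, ∃ z ∈ P, ∃ o ∈ O, b = o * z := by
    have hnB : (O.subgroupOf B).Normal := by
      constructor
      intro y hy g
      exact (Subgroup.mem_normalizer_iff.1 (hOn (hBN g.2)) _).1 hy
    have h2 : (P.subgroupOf B ⊔ O.subgroupOf B) = ⊤ := by
      have := Fact.mk hℓ
      have hPB : Nat.card (P.subgroupOf B) = Nat.card P :=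
        Nat.card_congr (Subgroup.subgroupOfEquivOfLe hP.le).toEquiv
      set W := P.subgroupOf B ⊔ O.subgroupOf B with hW
      have hWi : W.index ∣ (O.subgroupOf B).index := Subgroup.index_dvd_of_le le_sup_right
      have hWp : W.index ∣ (P.subgroupOf B).index := Subgroup.index_dvd_of_le le_sup_left
      have h3 : ∃ j, (O.subgroupOf B).index = ℓ ^ j := by
        rw [Subgroup.index_eq_card]
        refine IsPGroup.exists_card_eq (p := ℓ) fun x => ?_
        obtain ⟨x, rfl⟩ := QuotientGroup.mk'_surjective _ x
        obtain ⟨k, hk⟩ := hB x x.2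
        refine ⟨k, ?_⟩
        rw [← map_pow]
        exact (QuotientGroup.eq_one_iff _).2 hk
      obtain ⟨j, hj⟩ := h3
      rw [hj] at hWi
      obtain ⟨i, -, hi⟩ := (Nat.dvd_prime_pow hℓ).1 hWi
      rcases Nat.eq_zero_or_pos i with h0 | h0
      · rw [h0, pow_zero] at hi
        exact Subgroup.index_eq_one.1 hi
      · exfalso
        have h4 : ℓ ∣ (hP.toSylow : Subgroup B).index :=
          (dvd_pow_self ℓ h0.ne').trans (hi ▸ hWp)
        exact hP.toSylow.not_dvd_index h4
    intro b hb
    have h3 : (⟨b, hb⟩ : B) ∈ P.subgroupOf B ⊔ O.subgroupOf B := by rw [h2]; trivial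
    rw [sup_comm] at h3
    obtain ⟨o, ho, z, hz, hoz⟩ := Subgroup.mem_sup_of_normal_left.1 h3
    exact ⟨z, hz, o, ho, (congrArg Subtype.val hoz).symm⟩
  have hP1 : P ≠ ⊥ := by
    rintro rfl
    apply hOB.not_ge
    intro b hb
    obtain ⟨z, hz, o, ho, rfl⟩ := hBPO b hb
    rw [Subgroup.mem_bot.1 hz, mul_one]; exact ho
  have hPN : P ≤ N := hP.le.trans hBN
  obtain ⟨x, hx, hxℓ⟩ := hP.isPGroup.exists_orderOf_eq_prime hℓ hP1
  have hPfree := h.freeOn hℓ hr hℓr (hON.trans hNK) (hPN.trans hNK) hO hP.isPGroup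
  have hU : ∀ y ∈ P, orderOf y = ℓ → y ∈ Subgroup.zpowers x := fun y hy hyℓ =>
    hP.isPGroup.mem_zpowers_of_free hℓ hr hℓr hO hO1 (hPN.trans hOn) hPfree hx hy hxℓ hyℓ
  have hxP : Subgroup.zpowers x ≤ P := Subgroup.zpowers_le.2 hx
  have hMℓ : IsPGroup ℓ (Subgroup.zpowers x) := hP.isPGroup.to_le hxP
  have hx1 : x ≠ 1 := by rintro rfl; rw [orderOf_one] at hxℓ; exact hℓ.one_lt.ne hxℓ
  have hno : ∀ y ∈ N.nor P, orderOf y ≠ r := by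
    intro y hy hyr
    have hyN : y ∈ N := hy.1
    have hyr1 : y ^ r = 1 := by rw [← hyr, pow_orderOf_eq_one]
    have hfree' : ∀ w ∈ Subgroup.zpowers x, ∀ i, 0 < i → i < r → w * y ^ i = y ^ i * w → w = 1 := by
      intro w hw i hi hir hc
      have hyi : orderOf (y ^ i) = r := by
        refine h.orderOf_eq hr (D := Subgroup.zpowers y) (Subgroup.zpowers_le.2 (hNK hyN))
          (isPGroup_zpowers (k := 1) (by rw [hyr, pow_one])) (pow_mem (Subgroup.mem_zpowers y) i) ?_
        intro h1
        have := Nat.le_of_dvd hi (hyr ▸ orderOf_dvd_of_pow_eq_one h1)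
        omega
      have h2 := h.pow_eq_one hr (K.pow_mem (hNK hyN) i) hyi (hNK (hPN (hxP hw))) hc
      obtain ⟨k, hk⟩ := hMℓ.orderOf_eq hℓ hw
      refine Subgroup.mem_bot.1 (mem_of_pow_mem_of_coprime (a := r) (b := ℓ ^ k) ?_
        (Subgroup.mem_bot.2 h2) (Subgroup.mem_bot.2 (by rw [← hk, pow_orderOf_eq_one])))
      exact Nat.Coprime.pow_right k ((Nat.coprime_primes hr hℓ).2 hℓr.symm)
    refine h.false_of_regular hℓ hr hr hℓr (hON.trans hNK) ((hxP.trans hPN).trans hNK) hO hO1 hMℓ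
      (by rwa [Ne, Subgroup.zpowers_eq_bot]) ((hxP.trans hPN).trans hOn) (hOn hyN) ?_ hyr1 hfree'
      (Or.inl ⟨rfl, hNK hyN⟩)
    refine (Subgroup.mem_nor_of_conj_mem (K := N) (P := Subgroup.zpowers x) hyN fun w hw => ?_).2
    obtain ⟨i, rfl⟩ := Subgroup.mem_zpowers_iff.1 hw
    rw [← conj_zpow]
    refine zpow_mem (hU _ ((Subgroup.mem_normalizer_iff.1 hy.2 x).1 hx) ?_) i
    rw [← MulAut.conj_apply, MulEquiv.orderOf_eq, hxℓ]
  intro z hz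
  have hzN := hR.le hz
  obtain ⟨n, hn, hnz⟩ := hP.exists_mul_mem_normalizer hℓ (g := z) (hBn hzN)
  obtain ⟨w, hw, o, ho, rfl⟩ := hBPO n hn
  have h1 : w⁻¹ * (w * (w⁻¹ * o * w) * z) ∈ Subgroup.normalizer (P : Set G) := by
    refine mul_mem (inv_mem (Subgroup.le_normalizer hw)) ?_
    have e : w * (w⁻¹ * o * w) * z = o * w * z := by group
    rwa [e]
  have ho' : w⁻¹ * o * w ∈ O := by
    have := (Subgroup.mem_normalizer_iff.1 (inv_mem (hOn (hPN hw))) o).1 ho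
    simpa using this
  set o' := w⁻¹ * o * w with hodef
  have h2 : o' * z ∈ R := R.mul_mem (hOR ho') hz
  have h3 : o' * z ∈ N.nor P := ⟨hR.le h2, by
    have e : w⁻¹ * (w * o' * z) = o' * z := by group
    rwa [e] at h1⟩
  by_cases h4 : o' * z = 1
  · rw [← inv_eq_of_mul_eq_one_right h4]; exact O.inv_mem ho'
  · exact absurd (h.orderOf_eq hr (hR.le.trans hNK) hR.isPGroup h2 h4) (hno _ h3)

end NormalSylow

section TrivialIntersection

set_option linter.unusedSectionVars false

universe u

variable {G : Type u} [Group G] [Finite G]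

/-- Order conditions on `K` relative to an isolated prime `r`, allowing one exceptional prime `p`. -/
structure GoodPrime (r p : ℕ) (K : Subgroup G) : Prop where
  prime : r.Prime
  prime' : p.Prime
  ne : p ≠ r
  isolated : Isolated r K
  sq : ∀ q, q.Prime → q ≠ r → q ≠ p → ∀ x ∈ K, orderOf x ≠ q ^ 2
  mul : ∀ q m, q.Prime → m.Prime → q ≠ r → q ≠ p → (∃ x ∈ K, orderOf x = q * m) →
    ∀ x ∈ K, orderOf x ≠ m ^ 2

theorem SylIn.of_normal {r : ℕ} (hr : r.Prime) {Y N R : Subgroup G} (hYN : Y ≤ N) (hR : SylIn r R Y) {k : ℕ}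
    (hk : Nat.card Y * k = Nat.card N) (hrk : ¬ r ∣ k) : SylIn r R N := by
  refine ⟨hR.le.trans hYN, ?_⟩
  have hk0 : k ≠ 0 := by
    rintro rfl
    exact hrk (dvd_zero r)
  rw [hR.2, ← hk, Nat.factorization_mul Nat.card_pos.ne' hk0]
  simp [Nat.factorization_eq_zero_of_not_dvd hrk]

theorem GoodPrime.exists_normal_sylIn {r p : ℕ} {K : Subgroup G} (h : GoodPrime r p K) (n : ℕ) :
    ∀ N D : Subgroup G, Nat.card N = n → N ≤ K → D ≤ N → IsPGroup r D → D ≠ ⊥ →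
      N ≤ Subgroup.normalizer (D : Set G) → ∃ R, SylIn r R N ∧ N ≤ Subgroup.normalizer (R : Set G) := by
  induction n using Nat.strong_induction_on with
  | _ n ih =>
  intro N D hn hNK hDN hD hD1 hND
  by_cases hpr : ∀ ℓ, ℓ.Prime → ℓ ∣ Nat.card N → ℓ = r ∨ ℓ = p
  · exact h.isolated.normal_sylIn_of_two_primes h.prime h.prime' h.ne hNK hDN hD hD1 hND hpr
  push Not at hpr
  obtain ⟨q, hq, hqN, hqr, hqp⟩ := hpr
  obtain ⟨M, hM⟩ := exists_sylIn hq N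
  have hM1 : M ≠ ⊥ := hM.ne_bot hq hqN
  obtain ⟨-, hMc⟩ := h.isolated.card_sylow_le_and_centralizes hq h.prime hqr (hDN.trans hNK) hNK hD hD1 hND hM
    (h.sq q hq hqr hqp) (fun m hm => h.mul q m hq hm hqr hqp)
  obtain ⟨Y, hYN, hNY, hcard⟩ := hM.exists_complement hq hMc
  have hco : ∀ x ∈ N, (∃ k, orderOf x = r ^ k) → x ∈ Y := by
    rintro x hx ⟨k, hk⟩
    refine mem_of_normal_of_coprime hYN hNY hcard hx ?_
    rw [hM.2, hk]
    exact Nat.coprime_pow_primes _ _ hq h.prime hqr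
  have hDY : D ≤ Y := fun x hx => hco x (hDN hx) (hD.orderOf_eq h.prime hx)
  have hMcard : 1 < Nat.card M := by
    rw [Subgroup.one_lt_card_iff_ne_bot]; exact hM1
  obtain ⟨R, hR, hRn⟩ := ih (Nat.card Y) (by
    rw [← hn, ← hcard]
    exact lt_mul_of_one_lt_right Nat.card_pos hMcard) Y D rfl (hYN.trans hNK) hDY hD hD1 (hYN.trans hND)
  have hRN : SylIn r R N := hR.of_normal h.prime hYN hcard (by
    rw [hM.2]
    intro hd
    exact hqr ((Nat.prime_dvd_prime_iff_eq h.prime hq).1 (h.prime.dvd_of_dvd_pow hd)).symm)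
  refine ⟨R, hRN, ?_⟩
  intro x hx
  refine (Subgroup.mem_nor_of_conj_mem (K := N) hx fun y hy => ?_).2
  have hy' : x * y * x⁻¹ ∈ Y := (Subgroup.mem_normalizer_iff.1 (hNY hx) y).1 (hR.le hy)
  obtain ⟨k, hk⟩ := hR.isPGroup.orderOf_eq h.prime hy
  refine hR.mem_of_mem_nor h.prime (k := k) ?_ ⟨hy', hRn hy'⟩
  rw [← MulAut.conj_apply, MulEquiv.orderOf_eq, hk]

/-- Proper subgroups of `p`-groups are properly contained in their normalizers. -/
theorem IsPGroup.lt_nor {p : ℕ} (hp : p.Prime) {P D : Subgroup G} (hP : IsPGroup p P) (hD : D < P) : D < P.nor D := by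
  have := Fact.mk hp
  have hnil : Group.IsNilpotent P := hP.isNilpotent
  have hlt : D.subgroupOf P < ⊤ := by
    rw [lt_top_iff_ne_top, Ne, Subgroup.subgroupOf_eq_top]
    exact hD.not_ge
  have h1 := Group.normalizerCondition_of_isNilpotent (G := P) _ hlt
  obtain ⟨x, hx, hxD⟩ := SetLike.exists_of_lt h1
  refine lt_of_le_of_ne (Subgroup.le_nor hD.le) ?_
  intro heq
  apply hxD
  rw [Subgroup.mem_subgroupOf, heq]
  refine Subgroup.mem_nor_of_conj_mem x.2 fun y hy => ?_
  exact (Subgroup.mem_normalizer_iff.1 hx ⟨y, hD.le hy⟩).1 hy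

theorem GoodPrime.eq_of_inf_ne_bot {r p : ℕ} {K : Subgroup G} (h : GoodPrime r p K) {R S : Subgroup G}
    (hR : SylIn r R K) (hS : SylIn r S K) (hRS : R ⊓ S ≠ ⊥) : R = S := by
  by_contra hne
  obtain ⟨⟨A, B⟩, ⟨hA, hB, hAB, hAB1⟩, hmax⟩ := (Set.toFinite {x : Subgroup G × Subgroup G |
    SylIn r x.1 K ∧ SylIn r x.2 K ∧ x.1 ≠ x.2 ∧ x.1 ⊓ x.2 ≠ ⊥}).exists_maximalFor
      (fun x => Nat.card (x.1 ⊓ x.2 : Subgroup G)) _ ⟨(R, S), hR, hS, hne, hRS⟩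
  simp only at hA hB hAB hAB1
  set D := A ⊓ B with hD
  have hDA : D ≤ A := inf_le_left
  have hDB : D ≤ B := inf_le_right
  have hDA' : D < A := lt_of_le_of_ne hDA fun h1 => hAB (hA.eq_of_le h.prime hB.isPGroup
    (h1 ▸ hDB) hB.le |>.symm ▸ rfl)
  have hDB' : D < B := lt_of_le_of_ne hDB fun h1 => hAB (hB.eq_of_le h.prime hA.isPGroup
    (h1 ▸ hDA) hA.le |>.symm ▸ rfl)
  have hDp : IsPGroup r D := hA.isPGroup.to_le hDA
  have hDK : D ≤ K := hDA.trans hA.le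
  obtain ⟨Q, hQ, hQn⟩ := h.exists_normal_sylIn _ (K.nor D) D rfl Subgroup.nor_le (Subgroup.le_nor hDK) hDp
    hAB1 inf_le_right
  obtain ⟨C, hC, hQC⟩ := hQ.isPGroup.exists_le_sylIn h.prime (hQ.le.trans Subgroup.nor_le)
  have h1 : ∀ A, SylIn r A K → D < A → A.nor D ≤ C := by
    intro A hA hDA x hx
    have hxQ : x ∈ Q := by
      obtain ⟨k, hk⟩ := hA.isPGroup.orderOf_eq h.prime hx.1
      have hxK : x ∈ K.nor D := ⟨hA.le hx.1, hx.2⟩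
      exact hQ.mem_of_mem_nor h.prime hk ⟨hxK, hQn hxK⟩
    exact hQC hxQ
  have h2 : ∀ A, SylIn r A K → D < A → A = C := by
    intro A hA hDA
    by_contra hAC
    have h3 : D < A ⊓ C := lt_of_lt_of_le (hA.isPGroup.lt_nor h.prime hDA)
      (le_inf Subgroup.nor_le (h1 A hA hDA))
    have h4 : (A ⊓ C : Subgroup G) ≠ ⊥ := fun h0 => hAB1 (le_bot_iff.1 (h0 ▸ h3.le))
    have h5 := hmax (j := (A, C)) ⟨hA, hC, hAC, h4⟩ (Subgroup.card_le_of_le h3.le)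
    exact h3.ne (Subgroup.eq_of_le_of_card_ge h3.le h5)
  exact hAB ((h2 A hA hDA').trans (h2 B hB hDB').symm)

/-- If all centralizers of elements of order `r` in `K` have equal size, they are the Sylow subgroups. -/
theorem GoodPrime.cen_eq {r p : ℕ} {K : Subgroup G} (h : GoodPrime r p K)
    (hc : ∀ x ∈ K, ∀ y ∈ K, orderOf x = r → orderOf y = r → Nat.card (K.cen x) = Nat.card (K.cen y))
    {R : Subgroup G} (hR : SylIn r R K) {x : G} (hx : x ∈ R) (hx1 : x ≠ 1) : K.cen x = R := by
  have hr := h.prime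
  have := Fact.mk hr
  have hxr := h.isolated.orderOf_eq hr hR.le hR.isPGroup hx hx1
  have hR1 : R ≠ ⊥ := by rintro rfl; exact hx1 (Subgroup.mem_bot.1 hx)
  have hcr : ∀ y ∈ K, orderOf y = r → IsPGroup r (K.cen y) := by
    rintro y hy hyr ⟨z, hz⟩
    refine ⟨1, Subtype.ext ?_⟩
    simpa using h.isolated.pow_eq_one hr hy hyr hz.1 (Subgroup.mem_cen.1 hz).2
  obtain ⟨z, hz, hzr, hzc⟩ := hR.isPGroup.mem_center_exists_orderOf_eq_prime hr hR1
  have h1 : R ≤ K.cen z := fun y hy => Subgroup.mem_cen.2 ⟨hR.le hy, hzc y hy⟩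
  have h2 : R = K.cen z := by
    exact (hR.eq_of_le hr (hcr z (hR.le hz) hzr) h1 Subgroup.cen_le).symm ▸ rfl
  have h3 : SylIn r (K.cen x) K := by
    refine ⟨Subgroup.cen_le, ?_⟩
    rw [hc x (hR.le hx) z (hR.le hz) hxr hzr, ← h2, hR.2]
  refine h.eq_of_inf_ne_bot h3 hR fun h4 => hx1 ?_
  have h5 : x ∈ K.cen x ⊓ R := ⟨Subgroup.mem_cen.2 ⟨hR.le hx, rfl⟩, hx⟩
  rw [h4] at h5
  exact Subgroup.mem_bot.1 h5

end TrivialIntersection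

section Triple

set_option linter.unusedSectionVars false

universe u

variable {G : Type u} [Group G] [Finite G]

theorem card_modEq_of_fixed_point_free {ℓ : ℕ} (hℓ : ℓ.Prime) {L : Subgroup G} {x : G} (hx : x ^ ℓ = 1)
    (hxL : x ∈ Subgroup.normalizer (L : Set G)) (hfree : ∀ v ∈ L, x * v = v * x → v = 1) :
    Nat.card L ≡ 1 [MOD ℓ] := by
  have := Fact.mk hℓ
  have hle : Subgroup.zpowers x ≤ Subgroup.normalizer (L : Set G) := Subgroup.zpowers_le.2 hxL
  let _ : MulAction (Subgroup.zpowers x) L :=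
    MulAction.compHom L ((Subgroup.normalizerMonoidHom L).comp (Subgroup.inclusion hle))
  have hsm : ∀ y : Subgroup.zpowers x, ∀ v : L, ((y • v : L) : G) = y * v * (y : G)⁻¹ :=
    fun y v => Subgroup.normalizerMonoidHom_apply_apply_coe _ _ _
  have hp : IsPGroup ℓ (Subgroup.zpowers x) := by
    rintro ⟨y, hy⟩
    obtain ⟨i, rfl⟩ := Subgroup.mem_zpowers_iff.1 hy
    refine ⟨1, Subtype.ext ?_⟩
    simp only [pow_one, Subgroup.coe_pow, OneMemClass.coe_one]
    rw [← zpow_natCast, ← zpow_mul, mul_comm, zpow_mul, zpow_natCast, hx, one_zpow]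
  have h1 := hp.card_modEq_card_fixedPoints (α := L)
  have h2 : MulAction.fixedPoints (Subgroup.zpowers x) L = {1} := by
    ext v
    simp only [MulAction.mem_fixedPoints, Set.mem_singleton_iff]
    constructor
    · intro h
      have h3 := congrArg Subtype.val (h ⟨x, Subgroup.mem_zpowers x⟩)
      rw [hsm] at h3
      exact Subtype.ext (hfree v v.2 (mul_inv_eq_iff_eq_mul.1 h3))
    · rintro rfl y
      exact Subtype.ext (by rw [hsm]; simp)
  rw [h2] at h1
  simpa using h1

theorem isSolvable_of_normal {Y N : Subgroup G} (hYN : Y ≤ N) (hN : N ≤ Subgroup.normalizer (Y : Set G))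
    (hY : Group.IsSolvable Y) {a b k : ℕ} (hk : Nat.card Y * k = Nat.card N)
    (hab : ∀ ℓ, ℓ.Prime → ℓ ∣ k → ℓ = a ∨ ℓ = b) : Group.IsSolvable N := by
  have hn : (Y.subgroupOf N).Normal := by
    constructor
    intro y hy g
    exact (Subgroup.mem_normalizer_iff.1 (hN g.2) _).1 hy
  have h1 := (Y.subgroupOf N).card_mul_index
  have e := Subgroup.subgroupOfEquivOfLe hYN
  rw [Nat.card_congr e.toEquiv, ← hk] at h1
  have h2 : (Y.subgroupOf N).index = k := Nat.eq_of_mul_eq_mul_left Nat.card_pos h1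
  rw [Group.isSolvable_iff_subgroup_quotient (Y.subgroupOf N)]
  refine ⟨?_, isSolvable_of_prime_dvd_card_eq_or_eq (p := a) (q := b) ?_⟩
  · exact Group.isSolvable_of_isSolvable_injective (f := e.toMonoidHom) e.injective
  · rw [← Subgroup.index_eq_card, h2]
    exact hab

/-- `K` is nonsolvable with nontrivial element orders among the primes `a`, `b`, `c`, and the size of
a centralizer depends only on the order of the element. -/
structure Triple (a b c : ℕ) (K : Subgroup G) : Prop where
  pa : a.Prime
  pb : b.Prime
  pc : c.Prime
  ab : a ≠ b
  ac : a ≠ c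
  bc : b ≠ c
  ord : ∀ x ∈ K, orderOf x = 1 ∨ orderOf x = a ∨ orderOf x = b ∨ orderOf x = c
  ns : ¬ Group.IsSolvable K
  cen : ∀ x ∈ K, ∀ y ∈ K, orderOf x = orderOf y → Nat.card (K.cen x) = Nat.card (K.cen y)

namespace Triple

variable {a b c : ℕ} {K : Subgroup G}

theorem rotate (h : Triple a b c K) : Triple b c a K :=
  ⟨h.pb, h.pc, h.pa, h.bc, h.ab.symm, h.ac.symm, fun x hx => by have := h.ord x hx; tauto, h.ns, h.cen⟩

theorem swap (h : Triple a b c K) : Triple a c b K :=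
  ⟨h.pa, h.pc, h.pb, h.ac, h.ab, h.bc.symm, fun x hx => by have := h.ord x hx; tauto, h.ns, h.cen⟩

theorem not_mul (h : Triple a b c K) {q m : ℕ} (hq : q.Prime) (hm : m.Prime) : ∀ x ∈ K, orderOf x ≠ q * m := by
  intro x hx he
  have hnp : ¬ (q * m).Prime := Nat.not_prime_mul hq.ne_one hm.ne_one
  rcases h.ord x hx with h1 | h1 | h1 | h1
  · rw [h1] at he
    exact hq.ne_one (Nat.eq_one_of_mul_eq_one_right he.symm)
  · exact hnp (he ▸ h1 ▸ h.pa)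
  · exact hnp (he ▸ h1 ▸ h.pb)
  · exact hnp (he ▸ h1 ▸ h.pc)

theorem isolated (h : Triple a b c K) : Isolated a K := by
  intro x hx hd
  rcases h.ord x hx with h1 | h1 | h1 | h1 <;> rw [h1] at hd
  · exact absurd (Nat.dvd_one.1 hd) h.pa.ne_one
  · exact h1
  · exact absurd ((Nat.prime_dvd_prime_iff_eq h.pa h.pb).1 hd) h.ab
  · exact absurd ((Nat.prime_dvd_prime_iff_eq h.pa h.pc).1 hd) h.ac

theorem goodPrime (h : Triple a b c K) : GoodPrime a b K where
  prime := h.pa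
  prime' := h.pb
  ne := h.ab.symm
  isolated := h.isolated
  sq q hq _ _ x hx := by rw [pow_two]; exact h.not_mul hq hq x hx
  mul q m _ hm _ _ _ x hx := by rw [pow_two]; exact h.not_mul hm hm x hx

theorem cen_eq (h : Triple a b c K) {A : Subgroup G} (hA : SylIn a A K) {x : G} (hx : x ∈ A) (hx1 : x ≠ 1) :
    K.cen x = A :=
  h.goodPrime.cen_eq (fun x hx y hy h1 h2 => h.cen x hx y hy (h1.trans h2.symm)) hA hx hx1

theorem comm (h : Triple a b c K) {A : Subgroup G} (hA : SylIn a A K) {x y : G} (hx : x ∈ A) (hy : y ∈ A) :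
    x * y = y * x := by
  by_cases hy1 : y = 1
  · simp [hy1]
  · rw [← h.cen_eq hA hy hy1] at hx
    exact (Subgroup.mem_cen.1 hx).2

theorem eq_of_mem (h : Triple a b c K) {A B : Subgroup G} (hA : SylIn a A K) (hB : SylIn a B K) {x : G}
    (hx : x ∈ A) (hx' : x ∈ B) (hx1 : x ≠ 1) : A = B :=
  (h.cen_eq hA hx hx1).symm.trans (h.cen_eq hB hx' hx1)

theorem prime_dvd (h : Triple a b c K) {ℓ : ℕ} (hℓ : ℓ.Prime) (hd : ℓ ∣ Nat.card K) : ℓ = a ∨ ℓ = b ∨ ℓ = c := by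
  obtain ⟨x, hx, hxℓ⟩ := exists_mem_orderOf_eq_prime hℓ hd
  rcases h.ord x hx with h1 | h1 | h1 | h1
  · exact absurd (hxℓ.symm.trans h1) hℓ.ne_one
  all_goals rw [hxℓ] at h1; simp [h1]

theorem dvd (h : Triple a b c K) : a ∣ Nat.card K := by
  by_contra hd
  refine h.ns (isSolvable_of_prime_dvd_card_eq_or_eq (p := b) (q := c) fun ℓ hℓ hℓK => ?_)
  rcases h.prime_dvd hℓ hℓK with rfl | h1
  · exact absurd hℓK hd
  · exact h1

theorem ne_bot (h : Triple a b c K) {A : Subgroup G} (hA : SylIn a A K) : A ≠ ⊥ := hA.ne_bot h.pa h.dvd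

theorem le_card (h : Triple a b c K) {A : Subgroup G} (hA : SylIn a A K) : a ≤ Nat.card A := by
  obtain ⟨x, hx, hxa⟩ := hA.isPGroup.exists_orderOf_eq_prime h.pa (h.ne_bot hA)
  exact Nat.le_of_dvd Nat.card_pos (hxa ▸ Subgroup.orderOf_dvd_card hx)

theorem card_eq (h : Triple a b c K) {A B C : Subgroup G} (hA : SylIn a A K) (hB : SylIn b B K)
    (hC : SylIn c C K) : Nat.card K = Nat.card A * Nat.card B * Nat.card C := by
  have h1 := Nat.prod_factorization_pow_eq_self (Nat.card_pos (α := K)).ne'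
  rw [Finsupp.prod_of_support_subset _ (s := {a, b, c}) ?_ _ (by simp)] at h1
  · rw [Finset.prod_insert (by simp [h.ab, h.ac]), Finset.prod_insert (by simp [h.bc]),
      Finset.prod_singleton] at h1
    rw [hA.2, hB.2, hC.2, mul_assoc]
    exact h1.symm
  · intro ℓ hℓ
    have h2 := h.prime_dvd (Nat.prime_of_mem_primeFactors hℓ) (Nat.dvd_of_mem_primeFactors hℓ)
    simpa using h2

theorem card_eq_sum (h : Triple a b c K) :
    Nat.card K = 1 + (K.ordSet a).ncard + (K.ordSet b).ncard + (K.ordSet c).ncard := by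
  rw [Subgroup.card_eq_sum_ordSet {1, a, b, c} (fun x hx => by simpa using h.ord x hx)]
  rw [Finset.sum_insert, Finset.sum_insert, Finset.sum_insert, Finset.sum_singleton,
    Subgroup.ncard_ordSet_one]
  · ring
  · simp [h.bc]
  · simp [h.ab, h.ac]
  · simp [h.pa.ne_one.symm, h.pb.ne_one.symm, h.pc.ne_one.symm]

theorem ncard_ordSet_mul (h : Triple a b c K) {A : Subgroup G} (hA : SylIn a A K) :
    (K.ordSet a).ncard * Nat.card (K.nor A) = Nat.card K * (Nat.card A - 1) := by
  refine le_antisymm ?_ ?_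
  · have := hA.ncard_ordSet_mul_le h.pa one_ne_zero
    rwa [pow_one] at this
  · rw [← Subgroup.ncard_diff_one]
    refine card_mul_le_ncard_of_conj ?_ ?_
    · rintro k hk x ⟨hx, hx1⟩
      refine ⟨K.mul_mem (K.mul_mem hk (hA.le hx)) (K.inv_mem hk), ?_⟩
      rw [← MulAut.conj_apply, MulEquiv.orderOf_eq]
      exact h.isolated.orderOf_eq h.pa hA.le hA.isPGroup hx hx1
    · rintro k hk x ⟨hx, hx1⟩ ⟨hx2, hx3⟩
      refine (Subgroup.conjBy_eq_iff hk).1 ?_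
      exact h.eq_of_mem (hA.conjBy hk) hA (Subgroup.conj_mem_conjBy.2 hx) hx2 hx3

theorem exists_card_nor (h : Triple a b c K) {A : Subgroup G} (hA : SylIn a A K) :
    ∃ w, 2 ≤ w ∧ ¬ a ∣ w ∧ Nat.card (K.nor A) = w * Nat.card A := by
  have hAN : SylIn a A (K.nor A) := hA.of_le_of_le h.pa (Subgroup.le_nor hA.le) Subgroup.nor_le
  obtain ⟨w, hw⟩ := Subgroup.card_dvd_of_le hAN.le
  refine ⟨w, ?_, ?_, by rw [hw, mul_comm]⟩
  · by_contra! hw2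
    have hw1 : w = 1 := by
      have : w ≠ 0 := by rintro rfl; rw [mul_zero] at hw; exact Nat.card_pos.ne' hw
      omega
    rw [hw1, mul_one] at hw
    have hNA : A = K.nor A := Subgroup.eq_of_le_of_card_ge hAN.le hw.le
    obtain ⟨Y, hYK, hKY, hcard⟩ := hA.exists_complement h.pa (fun n hn x hx => by
      rw [← hNA] at hn; exact h.comm hA hn hx)
    refine h.ns (isSolvable_of_normal hYK hKY ?_ (a := a) (b := a) hcard ?_)
    · refine isSolvable_of_prime_dvd_card_eq_or_eq (p := b) (q := c) fun ℓ hℓ hℓY => ?_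
      rcases h.prime_dvd hℓ (hℓY.trans (Dvd.intro _ hcard)) with rfl | h1
      · exfalso
        obtain ⟨B, C, hB, hC⟩ : ∃ B C, SylIn b B K ∧ SylIn c C K :=
          ⟨_, _, (exists_sylIn h.pb K).choose_spec, (exists_sylIn h.pc K).choose_spec⟩
        rw [h.card_eq hA hB hC, mul_assoc, mul_comm] at hcard
        have h2 := Nat.eq_of_mul_eq_mul_left Nat.card_pos hcard
        rw [h2, hB.2, hC.2] at hℓY
        rcases (hℓ.dvd_mul).1 hℓY with h3 | h3
        · exact h.ab ((Nat.prime_dvd_prime_iff_eq hℓ h.pb).1 (hℓ.dvd_of_dvd_pow h3))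
        · exact h.ac ((Nat.prime_dvd_prime_iff_eq hℓ h.pc).1 (hℓ.dvd_of_dvd_pow h3))
      · exact h1
    · intro ℓ hℓ hd
      rw [hA.2] at hd
      exact Or.inl ((Nat.prime_dvd_prime_iff_eq hℓ h.pa).1 (hℓ.dvd_of_dvd_pow hd))
  · rintro ⟨v, rfl⟩
    have h1 : Nat.card A * a ∣ Nat.card K := by
      refine dvd_trans ?_ (Subgroup.card_dvd_of_le (Subgroup.nor_le (K := K) (P := A)))
      rw [hw]
      exact mul_dvd_mul_left _ (dvd_mul_right _ _)
    rw [hA.2, ← pow_succ] at h1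
    have := (h.pa.pow_dvd_iff_le_factorization Nat.card_pos.ne').1 h1
    omega

end Triple

end Triple

section TripleCount

set_option linter.unusedSectionVars false

universe u

variable {G : Type u} [Group G] [Finite G]

namespace Triple

variable {a b c : ℕ} {K : Subgroup G}

theorem exists_card_nor_ncard (h : Triple a b c K) {A B C : Subgroup G} (hA : SylIn a A K)
    (hB : SylIn b B K) (hC : SylIn c C K) :
    ∃ w, 2 ≤ w ∧ ¬ a ∣ w ∧ Nat.card (K.nor A) = w * Nat.card A ∧
      (K.ordSet a).ncard * w + Nat.card B * Nat.card C = Nat.card A * Nat.card B * Nat.card C := by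
  obtain ⟨w, h2, hd, hw⟩ := h.exists_card_nor hA
  refine ⟨w, h2, hd, hw, ?_⟩
  have h1 := h.ncard_ordSet_mul hA
  rw [hw, h.card_eq hA hB hC] at h1
  obtain ⟨m, hm⟩ : ∃ m, Nat.card A = m + 1 := ⟨Nat.card A - 1, by have := Nat.card_pos (α := A); omega⟩
  rw [hm, Nat.add_sub_cancel] at h1
  rw [hm]
  have h3 : (m + 1) * ((K.ordSet a).ncard * w) = (m + 1) * (Nat.card B * Nat.card C * m) := by
    linear_combination h1
  have h4 := Nat.eq_of_mul_eq_mul_left (Nat.succ_pos m) h3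
  linear_combination h4

theorem two_mem (h : Triple a b c K) : a = 2 ∨ b = 2 ∨ c = 2 := by
  by_contra! hne
  obtain ⟨A, hA⟩ := exists_sylIn h.pa K
  obtain ⟨B, hB⟩ := exists_sylIn h.pb K
  obtain ⟨C, hC⟩ := exists_sylIn h.pc K
  have hodd : ¬ 2 ∣ Nat.card K := fun hd => by
    rcases h.prime_dvd Nat.prime_two hd with h1 | h1 | h1
    · exact hne.1 h1.symm
    · exact hne.2.1 h1.symm
    · exact hne.2.2 h1.symm
  have key : ∀ (P : Subgroup G) (w : ℕ), 2 ≤ w → Nat.card (K.nor P) = w * Nat.card P → 3 ≤ w := by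
    intro P w hw2 hw
    by_contra! hlt
    obtain rfl : w = 2 := by omega
    exact hodd ((Dvd.intro _ hw.symm).trans (Subgroup.card_dvd_of_le Subgroup.nor_le))
  obtain ⟨w₁, h1, -, h2, h3⟩ := h.exists_card_nor_ncard hA hB hC
  obtain ⟨w₂, h4, -, h5, h6⟩ := h.rotate.exists_card_nor_ncard hB hC hA
  obtain ⟨w₃, h7, -, h8, h9⟩ := h.rotate.rotate.exists_card_nor_ncard hC hA hB
  have hs := h.card_eq_sum
  rw [h.card_eq hA hB hC] at hs
  have a2 := h.pa.two_le.trans (h.le_card hA)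
  have b2 := h.pb.two_le.trans (h.rotate.le_card hB)
  have c2 := h.pc.two_le.trans (h.rotate.rotate.le_card hC)
  have k1 := Nat.mul_le_mul_left (K.ordSet a).ncard (key A w₁ h1 h2)
  have k2 := Nat.mul_le_mul_left (K.ordSet b).ncard (key B w₂ h4 h5)
  have k3 := Nat.mul_le_mul_left (K.ordSet c).ncard (key C w₃ h7 h8)
  nlinarith [Nat.mul_le_mul a2 b2, Nat.mul_le_mul b2 c2, Nat.mul_le_mul c2 a2]

theorem conj_of_orderOf_eq_two {q r : ℕ} (h : Triple 2 q r K) {s t : G} (hs : s ∈ K) (ht : t ∈ K)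
    (hs2 : orderOf s = 2) (ht2 : orderOf t = 2) : ∃ k ∈ K, k * s * k⁻¹ = t := by
  have sq : ∀ x : G, orderOf x = 2 → x * x = 1 := fun x hx => by
    rw [← pow_two, ← hx, pow_orderOf_eq_one]
  have inv : ∀ x : G, orderOf x = 2 → x⁻¹ = x := fun x hx => inv_eq_of_mul_eq_one_left (sq x hx)
  have hcomm : ∀ x ∈ K, orderOf x = 2 → (¬ ∃ k ∈ K, k * x * k⁻¹ = t) → x * t = t * x := by
    intro x hx hx2 hn
    have hz : x * t ∈ K := K.mul_mem hx ht
    have hodd : ¬ Odd (orderOf (x * t)) := by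
      rintro ⟨k, hk⟩
      refine hn ⟨(x * t) ^ k, K.pow_mem hz k, ?_⟩
      have h1 : x * ((x * t) ^ k)⁻¹ = (x * t) ^ k * x := by
        rw [mul_inv_eq_iff_eq_mul, mul_assoc]
        have h2 : x * (x * t) * x⁻¹ = (x * t)⁻¹ := by
          rw [mul_inv_rev, inv x hx2, inv t ht2, ← mul_assoc, sq x hx2, one_mul]
        have h3 := conj_pow (a := x) (b := x * t) (i := k)
        rw [h2, inv_pow] at h3
        rw [inv x hx2] at h3
        calc x = (x * t) ^ k * ((x * t) ^ k)⁻¹ * x := by group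
          _ = (x * t) ^ k * (x * (x * t) ^ k * x) * x := by rw [h3, mul_assoc]
          _ = (x * t) ^ k * (x * (x * t) ^ k) * (x * x) := by group
          _ = _ := by rw [sq x hx2, mul_one]
      rw [mul_assoc, h1, ← mul_assoc, ← pow_add]
      have h4 : (x * t) ^ (k + k) * (x * t) = 1 := by
        rw [← pow_succ, ← two_mul, ← hk, pow_orderOf_eq_one]
      rw [eq_inv_of_mul_eq_one_left h4, mul_inv_rev, inv x hx2, inv t ht2, mul_assoc, sq x hx2, mul_one]
    rcases h.ord _ hz with h1 | h1 | h1 | h1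
    · exact absurd (by rw [h1]; exact odd_one) hodd
    · have h2 := inv _ h1
      rw [mul_inv_rev, inv x hx2, inv t ht2] at h2
      exact h2.symm
    · exact absurd (h1 ▸ h.pb.odd_of_ne_two h.ab.symm) hodd
    · exact absurd (h1 ▸ h.pc.odd_of_ne_two h.ac.symm) hodd
  by_contra hn
  obtain ⟨T, hT, htT⟩ := IsPGroup.exists_le_sylIn h.pa (isPGroup_zpowers (p := 2) (k := 1) (x := t) (by rw [ht2, pow_one]))
    (Subgroup.zpowers_le.2 ht)
  have htT := htT (Subgroup.mem_zpowers t)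
  have ht1 : t ≠ 1 := by rintro rfl; simp at ht2
  have hs1 : s ≠ 1 := by rintro rfl; simp at hs2
  have hmem : ∀ g ∈ K, g * s * g⁻¹ ∈ T := by
    intro g hg
    rw [← h.cen_eq hT htT ht1]
    have hgs : g * s * g⁻¹ ∈ K := K.mul_mem (K.mul_mem hg hs) (K.inv_mem hg)
    refine Subgroup.mem_cen.2 ⟨hgs, hcomm _ hgs ?_ ?_⟩
    · rw [← MulAut.conj_apply, MulEquiv.orderOf_eq, hs2]
    · rintro ⟨k, hk, hkt⟩
      exact hn ⟨k * g, K.mul_mem hk hg, by rw [← hkt]; group⟩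
  have hsT : s ∈ T := by simpa using hmem 1 K.one_mem
  have hnorm : K ≤ Subgroup.normalizer (T : Set G) := by
    intro g hg
    refine (Subgroup.mem_inf.1 ((Subgroup.conjBy_eq_iff (P := T) hg).1 ?_)).2
    refine h.eq_of_mem (hT.conjBy hg) hT (Subgroup.conj_mem_conjBy.2 hsT) (hmem g hg) ?_
    rw [Ne, conj_eq_one_iff]
    exact hs1
  obtain ⟨B, hB⟩ := exists_sylIn h.pb K
  obtain ⟨C, hC⟩ := exists_sylIn h.pc K
  refine h.ns (isSolvable_of_normal (a := q) (b := r) (k := Nat.card B * Nat.card C) hT.le hnorm ?_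
    (by rw [h.card_eq hT hB hC, mul_assoc]) ?_)
  · exact Group.isSolvable_of_comm fun x y => Subtype.ext (h.comm hT x.2 y.2)
  · intro ℓ hℓ hd
    rw [hB.2, hC.2] at hd
    exact (hℓ.dvd_mul.1 hd).imp (fun h1 => (Nat.prime_dvd_prime_iff_eq hℓ h.pb).1 (hℓ.dvd_of_dvd_pow h1))
      (fun h1 => (Nat.prime_dvd_prime_iff_eq hℓ h.pc).1 (hℓ.dvd_of_dvd_pow h1))

theorem card_nor_two {q r : ℕ} (h : Triple 2 q r K) {T : Subgroup G} (hT : SylIn 2 T K) :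
    Nat.card (K.nor T) = (Nat.card T - 1) * Nat.card T ∧ 4 ≤ Nat.card T ∧
      (K.ordSet 2).ncard * Nat.card T = Nat.card K := by
  obtain ⟨t, htT, ht2⟩ := hT.isPGroup.exists_orderOf_eq_prime h.pa (h.ne_bot hT)
  have ht1 : t ≠ 1 := by rintro rfl; simp at ht2
  have hc := h.cen_eq hT htT ht1
  have h1 : (K.ordSet 2).ncard * Nat.card T = Nat.card K := by
    refine le_antisymm ?_ ?_
    · have := ncard_mul_card_le_of_conj (K := K) (N := T) (A := {t}) (U := K.ordSet 2) hT.le ?_ ?_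
      · simpa using this
      · rintro n hn _ rfl
        rw [Set.mem_singleton_iff, mul_inv_eq_iff_eq_mul]
        exact h.comm hT hn htT
      · rintro u ⟨hu, hu2⟩
        obtain ⟨k, hk, hku⟩ := h.conj_of_orderOf_eq_two (hT.le htT) hu ht2 hu2
        exact ⟨k, hk, t, rfl, hku.symm⟩
    · have := card_mul_le_ncard_of_conj (K := K) (N := T) (A := {t}) (U := K.ordSet 2) ?_ ?_
      · simpa using this
      · rintro k hk _ rfl
        refine ⟨K.mul_mem (K.mul_mem hk (hT.le htT)) (K.inv_mem hk), ?_⟩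
        rw [← MulAut.conj_apply, MulEquiv.orderOf_eq, ht2]
      · rintro k hk _ rfl h2
        rw [← hc]
        exact Subgroup.mem_cen.2 ⟨hk, mul_inv_eq_iff_eq_mul.1 h2⟩
  have h2 := h.ncard_ordSet_mul hT
  obtain ⟨w, hw2, hwd, hw⟩ := h.exists_card_nor hT
  have hpos : 0 < (K.ordSet 2).ncard := by
    rcases Nat.eq_zero_or_pos (K.ordSet 2).ncard with h3 | h3
    · rw [h3, zero_mul] at h1; exact absurd h1.symm Nat.card_pos.ne'
    · exact h3
  rw [← h1, mul_assoc] at h2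
  have h3 := Nat.eq_of_mul_eq_mul_left hpos h2
  refine ⟨by rw [h3, mul_comm], ?_, h1⟩
  rw [hw, mul_comm] at h3
  have h4 := Nat.eq_of_mul_eq_mul_left Nat.card_pos h3
  omega

end Triple

end TripleCount

section EvenTriple

set_option linter.unusedSectionVars false

universe u

variable {G : Type u} [Group G] [Finite G]

theorem SylIn.not_dvd_of_mul_eq {q k : ℕ} (hq : q.Prime) {M N : Subgroup G} (hM : SylIn q M N)
    (hk : k * Nat.card M = Nat.card N) : ¬ q ∣ k := by
  rintro ⟨v, rfl⟩
  have h1 : q ^ ((Nat.card N).factorization q + 1) ∣ Nat.card N := by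
    rw [pow_succ, ← hM.2]
    exact ⟨v, by rw [← hk]; ring⟩
  have := (hq.pow_dvd_iff_le_factorization Nat.card_pos.ne').1 h1
  omega

/-- A solution of the counting equation for three Sylow sizes has both indices equal to two. -/
theorem two_two_or_of_count {T Q R nq nr wq wr : ℕ} (hT : 4 ≤ T) (hQ : 3 ≤ Q) (hR : 3 ≤ R) (hwq : 2 ≤ wq)
    (hwr : 2 ≤ wr) (h1 : nq * wq + R * T = T * Q * R) (h2 : nr * wr + T * Q = T * Q * R)
    (h3 : T * Q * R = 1 + Q * R + nq + nr) :
    (wq = 2 ∧ wr = 2) ∨ (wq = 2 ∧ wr = 3 ∧ T < 6) ∨ (wq = 3 ∧ wr = 2 ∧ T < 6) := by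
  have hTQR : 4 * (Q * R) ≤ T * Q * R := by rw [mul_assoc]; exact Nat.mul_le_mul_right _ hT
  have hTQ : 4 * Q ≤ T * Q := Nat.mul_le_mul_right _ hT
  have hRT : 4 * R ≤ R * T := by rw [mul_comm R]; exact Nat.mul_le_mul_right _ hT
  have hT6 : 6 ≤ T → 6 * (Q * R) ≤ T * Q * R := fun h => by rw [mul_assoc]; exact Nat.mul_le_mul_right _ h
  rcases Nat.lt_or_ge wq 3 with ha | ha
  · obtain rfl : wq = 2 := by omega
    rcases Nat.lt_or_ge wr 4 with hb | hb
    · interval_cases wr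
      · simp
      · right; left
        refine ⟨rfl, rfl, ?_⟩
        by_contra! h6
        have := hT6 h6
        omega
    · have := Nat.mul_le_mul_left nr hb
      omega
  · rcases Nat.lt_or_ge wr 3 with hb | hb
    · obtain rfl : wr = 2 := by omega
      rcases Nat.lt_or_ge wq 4 with hc | hc
      · obtain rfl : wq = 3 := by omega
        right; right
        refine ⟨rfl, rfl, ?_⟩
        by_contra! h6
        have := hT6 h6
        omega
      · have := Nat.mul_le_mul_left nq hc
        omega
    · have e1 := Nat.mul_le_mul_left nr hb
      have e2 := Nat.mul_le_mul_left nq ha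
      omega

theorem eq_of_two_mul_add_two {T Q R : ℕ} (hT : 4 ≤ T) (hR : 3 ≤ R) (hQ : 0 < Q) (h : 2 * (Q * R) + 2 = T * (Q + R))
    (hd : T - 1 ∣ Q) : Q + 1 = T ∧ R = T + 1 := by
  obtain ⟨m, rfl⟩ : ∃ m, T = m + 1 := ⟨T - 1, by omega⟩
  rw [Nat.add_sub_cancel] at hd
  have h1 : m ≤ Q := Nat.le_of_dvd hQ hd
  obtain ⟨d, rfl⟩ := hd
  have h2 : m ∣ R - 2 := by
    zify [show 2 ≤ R by omega]
    have h' : (2 * (m * d * R) + 2 : ℤ) = (m + 1) * (m * d + R) := by exact_mod_cast h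
    exact ⟨2 * d * R - m * d - d - R, by linear_combination (-1) * h'⟩
  have h3 : m ≤ R - 2 := Nat.le_of_dvd (by omega) h2
  obtain ⟨x, hx⟩ : ∃ x, m * d = m + x := ⟨m * d - m, by omega⟩
  obtain ⟨y, rfl⟩ : ∃ y, R = m + 2 + y := ⟨R - (m + 2), by omega⟩
  rw [hx] at h ⊢
  have hm : 3 ≤ m := by omega
  have h5 : (m + 3) * x + (m - 1) * y + 2 * (x * y) = 0 := by
    zify [show 1 ≤ m by omega]
    have h' : (2 * ((m + x) * (m + 2 + y)) + 2 : ℤ) = (m + 1) * (m + x + (m + 2 + y)) := by exact_mod_cast h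
    linear_combination h'
  have h6 : x = 0 := by
    by_contra hx0
    have : 0 < (m + 3) * x := Nat.mul_pos (by omega) (by omega)
    omega
  have h7 : y = 0 := by
    by_contra hx0
    have : 0 < (m - 1) * y := Nat.mul_pos (by omega) (by omega)
    omega
  omega

namespace Triple

variable {a b c : ℕ} {K : Subgroup G}

theorem free_of_orderOf (h : Triple a b c K) {A : Subgroup G} (hA : SylIn a A K) {z : G} (hz : z ∈ K)
    (hz1 : z ∉ A) : ∀ v ∈ A, z * v = v * z → v = 1 := by
  intro v hv hc
  by_contra hv1
  exact hz1 ((h.cen_eq hA hv hv1).le (Subgroup.mem_cen.2 ⟨hz, hc⟩))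

theorem card_modEq (h : Triple a b c K) {A : Subgroup G} (hA : SylIn a A K) {ℓ : ℕ} (hℓ : ℓ.Prime)
    (hne : ℓ ≠ a) (hd : ℓ ∣ Nat.card (K.nor A)) : Nat.card A ≡ 1 [MOD ℓ] := by
  obtain ⟨z, hz, hzℓ⟩ := exists_mem_orderOf_eq_prime hℓ hd
  refine card_modEq_of_fixed_point_free hℓ (x := z) (by rw [← hzℓ, pow_orderOf_eq_one]) hz.2
    (h.free_of_orderOf hA hz.1 fun hzA => ?_)
  have h1 := Subgroup.orderOf_dvd_card hzA
  rw [hzℓ, hA.2] at h1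
  exact hne ((Nat.prime_dvd_prime_iff_eq hℓ h.pa).1 (hℓ.dvd_of_dvd_pow h1))

theorem not_dvd_and_dvd (h : Triple a b c K) {T : Subgroup G} (hT : SylIn a T K)
    (hb : b ∣ Nat.card (K.nor T)) (hc : c ∣ Nat.card (K.nor T)) : False := by
  set N := K.nor T with hN
  have hTN : T ≤ N := Subgroup.le_nor hT.le
  have hNK : N ≤ K := Subgroup.nor_le
  have hNT : N ≤ Subgroup.normalizer (T : Set G) := inf_le_right
  have hsq : ∀ q : ℕ, q.Prime → ∀ x ∈ K, orderOf x ≠ q ^ 2 := fun q hq x hx => by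
    rw [pow_two]; exact h.not_mul hq hq x hx
  have hQS : ∀ {q : ℕ} {M : Subgroup G}, q.Prime → q ≠ a → SylIn q M N → ∀ n ∈ N.nor M, ∀ x ∈ M, n * x = x * n :=
    fun {q M} hq hqa hM => (h.isolated.card_sylow_le_and_centralizes hq h.pa hqa hT.le hNK hT.isPGroup
      (h.ne_bot hT) hNT hM (hsq q hq) (fun m hm _ => hsq m hm)).2
  obtain ⟨M, hM⟩ := exists_sylIn h.pb N
  obtain ⟨Y, hYN, hNY, hcard⟩ := hM.exists_complement h.pb (hQS h.pb h.ab.symm hM)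
  have hcM : ¬ c ∣ Nat.card M := by
    rw [hM.2]
    exact fun hd => h.bc.symm ((Nat.prime_dvd_prime_iff_eq h.pc h.pb).1 (h.pc.dvd_of_dvd_pow hd))
  have hcY : c ∣ Nat.card Y := by
    rw [← hcard] at hc
    exact (h.pc.dvd_mul.1 hc).resolve_right hcM
  obtain ⟨R, hR⟩ := exists_sylIn h.pc Y
  have hR1 : R ≠ ⊥ := hR.ne_bot h.pc hcY
  have hRN : SylIn c R N := SylIn.of_normal h.pc hYN hR hcard hcM
  obtain ⟨z, hzM, hz⟩ := hM.isPGroup.exists_orderOf_eq_prime h.pb (hM.ne_bot h.pb hb)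
  obtain ⟨n, hnY, hnR⟩ := hR.exists_mul_mem_normalizer h.pc (hNY (hM.le hzM))
  have hnz : n * z ∈ N := N.mul_mem (hYN hnY) (hM.le hzM)
  have hcomm := hQS h.pc h.ac.symm hRN (n * z) ⟨hnz, hnR⟩
  obtain ⟨S, hS, hRS⟩ := IsPGroup.exists_le_sylIn h.pc hRN.isPGroup (hRN.le.trans hNK)
  obtain ⟨x, hx, hxc⟩ := hR.isPGroup.exists_orderOf_eq_prime h.pc hR1
  have hx1 : x ≠ 1 := by rintro rfl; rw [orderOf_one] at hxc; exact h.pc.one_lt.ne hxc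
  have hnS : n * z ∈ S := by
    rw [← h.rotate.rotate.cen_eq hS (hRS hx) hx1]
    exact Subgroup.mem_cen.2 ⟨hNK hnz, hcomm x hx⟩
  obtain ⟨k, hk⟩ := hS.isPGroup.orderOf_eq h.pc hnS
  have hnzY : n * z ∈ Y := by
    refine mem_of_normal_of_coprime hYN hNY hcard hnz ?_
    rw [hM.2, hk]
    exact Nat.Coprime.pow _ _ ((Nat.coprime_primes h.pb h.pc).2 h.bc)
  have hzY : z ∈ Y := by
    have := Y.mul_mem (Y.inv_mem hnY) hnzY
    rwa [inv_mul_cancel_left] at this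
  have := Subgroup.orderOf_dvd_card hzY
  rw [hz] at this
  exact hM.not_dvd_of_mul_eq h.pb hcard this

theorem not_three {q r : ℕ} (h : Triple 2 q r K) {T Q R : Subgroup G} (hT : SylIn 2 T K) (hQ : SylIn q Q K)
    (hR : SylIn r R K) {n : ℕ} (hr : ¬ r ∣ 3) (hT6 : Nat.card T < 6) (hT4 : 4 ≤ Nat.card T)
    (hw : Nat.card (K.nor R) = 3 * Nat.card R)
    (h1 : n * 2 + Nat.card R * Nat.card T = Nat.card T * Nat.card Q * Nat.card R) {m : ℕ}
    (h2 : m * 3 + Nat.card T * Nat.card Q = Nat.card T * Nat.card Q * Nat.card R)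
    (h3 : Nat.card T * Nat.card Q * Nat.card R = 1 + Nat.card Q * Nat.card R + n + m) : False := by
  have hd : 3 ∣ Nat.card (K.nor R) := Dvd.intro _ hw.symm
  have hq : 3 = q := by
    rcases h.prime_dvd Nat.prime_three (hd.trans (Subgroup.card_dvd_of_le Subgroup.nor_le)) with h4 | h4 | h4
    · omega
    · exact h4
    · exact absurd (h4 ▸ dvd_rfl) hr
  subst hq
  have hmod := h.rotate.rotate.card_modEq hR Nat.prime_three h.bc hd
  have hT2 : 2 ∣ Nat.card T := by
    obtain ⟨t, ht, ht2⟩ := hT.isPGroup.exists_orderOf_eq_prime h.pa (h.ne_bot hT)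
    exact ht2 ▸ Subgroup.orderOf_dvd_card ht
  have hT' : Nat.card T = 4 := by omega
  rw [hT'] at h1 h2 h3
  have hQ2 := hQ.2
  generalize Nat.card Q = x at *
  generalize Nat.card R = y at *
  have he : x * y + 3 = 6 * y + 4 * x := by
    rw [mul_assoc] at *
    omega
  have hy : 4 < y := by
    by_contra! hy
    interval_cases y <;> omega
  have hx : x ≤ 27 := by
    by_contra! hx
    obtain ⟨u, rfl⟩ : ∃ u, x = 28 + u := ⟨x - 28, by omega⟩
    obtain ⟨v, rfl⟩ : ∃ v, y = 5 + v := ⟨y - 5, by omega⟩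
    nlinarith [Nat.zero_le (u * v)]
  have hy3 : y % 3 = 1 := hmod
  have : x = 1 ∨ x = 3 ∨ x = 9 ∨ x = 27 := by
    generalize (Nat.card K).factorization 3 = k at hQ2
    have hk : k < 4 := by
      by_contra! hk
      have := Nat.pow_le_pow_right (n := 3) (by norm_num) hk
      omega
    interval_cases k <;> simp [hQ2]
  rcases this with rfl | rfl | rfl | rfl <;> omega

theorem card_nor_eq {q r : ℕ} (h : Triple 2 q r K) {T Q R : Subgroup G} (hT : SylIn 2 T K) (hQ : SylIn q Q K)
    (hR : SylIn r R K) : Nat.card (K.nor Q) = 2 * Nat.card Q ∧ Nat.card (K.nor R) = 2 * Nat.card R ∧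
      2 * (Nat.card Q * Nat.card R) + 2 = Nat.card T * (Nat.card Q + Nat.card R) := by
  have hq3 : 3 ≤ Nat.card Q := le_trans (by have := h.pb.two_le; have := h.ab; omega) (h.rotate.le_card hQ)
  have hr3 : 3 ≤ Nat.card R := le_trans (by have := h.pc.two_le; have := h.ac; omega) (h.rotate.rotate.le_card hR)
  obtain ⟨wq, hwq, hwqd, hQn, hq⟩ := h.rotate.exists_card_nor_ncard hQ hR hT
  obtain ⟨wr, hwr, hwrd, hRn, hr⟩ := h.rotate.rotate.exists_card_nor_ncard hR hT hQ
  obtain ⟨-, hT4, hn⟩ := h.card_nor_two hT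
  rw [h.card_eq hT hQ hR] at hn
  have hn2 : (K.ordSet 2).ncard = Nat.card Q * Nat.card R :=
    Nat.eq_of_mul_eq_mul_right (Nat.card_pos (α := T)) (by rw [hn]; ring)
  have hs := h.card_eq_sum
  rw [h.card_eq hT hQ hR, hn2] at hs
  rw [show Nat.card Q * Nat.card R * Nat.card T = Nat.card T * Nat.card Q * Nat.card R by ring] at hq
  rw [show Nat.card R * Nat.card T * Nat.card Q = Nat.card T * Nat.card Q * Nat.card R by ring] at hr
  rcases two_two_or_of_count hT4 hq3 hr3 hwq hwr hq hr hs with ⟨rfl, rfl⟩ | ⟨rfl, rfl, h6⟩ | ⟨rfl, rfl, h6⟩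
  · refine ⟨hQn, hRn, ?_⟩
    rw [mul_add]
    have : Nat.card R * Nat.card T = Nat.card T * Nat.card R := mul_comm _ _
    omega
  · exact (h.not_three hT hQ hR hwrd h6 hT4 hRn hq hr hs).elim
  · refine (h.swap.not_three hT hR hQ hwqd h6 hT4 hQn (n := (K.ordSet r).ncard) (m := (K.ordSet q).ncard) ?_ ?_ ?_).elim
    · linarith
    · linarith
    · linarith

end Triple

/-- A `Triple` with its Sylow sizes: `2 ^ n`, `2 ^ n - 1`, `2 ^ n + 1`. -/
structure EvenTriple (q r : ℕ) (K : Subgroup G) : Prop extends Triple 2 q r K where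
  four_le : ∀ T, SylIn 2 T K → 4 ≤ Nat.card T
  card_q : ∀ T Q, SylIn 2 T K → SylIn q Q K → Nat.card Q + 1 = Nat.card T
  card_r : ∀ T R, SylIn 2 T K → SylIn r R K → Nat.card R = Nat.card T + 1
  nor_two : ∀ T, SylIn 2 T K → Nat.card (K.nor T) = (Nat.card T - 1) * Nat.card T
  nor_q : ∀ Q, SylIn q Q K → Nat.card (K.nor Q) = 2 * Nat.card Q
  nor_r : ∀ R, SylIn r R K → Nat.card (K.nor R) = 2 * Nat.card R

namespace Triple

variable {a b c : ℕ} {K : Subgroup G}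

theorem evenTriple_of_not_dvd {q r : ℕ} (h : Triple 2 q r K) {T : Subgroup G} (hT : SylIn 2 T K)
    (hr : ¬ r ∣ Nat.card T - 1) : EvenTriple q r K := by
  have key : ∀ T Q R, SylIn 2 T K → SylIn q Q K → SylIn r R K → 4 ≤ Nat.card T ∧
      Nat.card Q + 1 = Nat.card T ∧ Nat.card R = Nat.card T + 1 ∧
      Nat.card (K.nor Q) = 2 * Nat.card Q ∧ Nat.card (K.nor R) = 2 * Nat.card R := by
    intro T' Q R hT' hQ hR
    rw [hT.card_eq hT'] at hr
    obtain ⟨h1, hT4, -⟩ := h.card_nor_two hT'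
    obtain ⟨h2, h3, h4⟩ := h.card_nor_eq hT' hQ hR
    have hd : Nat.card T' - 1 ∣ Nat.card Q := by
      have h5 : (Nat.card T' - 1) * Nat.card T' ∣ Nat.card Q * Nat.card R * Nat.card T' := by
        rw [← h1]
        refine (Subgroup.card_dvd_of_le Subgroup.nor_le).trans ?_
        rw [h.card_eq hT' hQ hR]
        exact dvd_of_eq (by ring)
      have h6 := Nat.dvd_of_mul_dvd_mul_right Nat.card_pos h5
      refine Nat.Coprime.dvd_of_dvd_mul_right ?_ h6
      rw [hR.2]
      exact ((Nat.Prime.coprime_iff_not_dvd h.pc).2 hr).symm.pow_right _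
    have hr3 : 3 ≤ Nat.card R :=
      le_trans (by have := h.pc.two_le; have := h.ac; omega) (h.rotate.rotate.le_card hR)
    obtain ⟨h7, h8⟩ := eq_of_two_mul_add_two hT4 hr3 Nat.card_pos h4 hd
    exact ⟨hT4, h7, h8, h2, h3⟩
  obtain ⟨Q₀, hQ₀⟩ := exists_sylIn h.pb K
  obtain ⟨R₀, hR₀⟩ := exists_sylIn h.pc K
  exact { h with
    four_le := fun T hT => (key T Q₀ R₀ hT hQ₀ hR₀).1
    card_q := fun T Q hT hQ => (key T Q R₀ hT hQ hR₀).2.1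
    card_r := fun T R hT hR => (key T Q₀ R hT hQ₀ hR).2.2.1
    nor_two := fun T hT => (h.card_nor_two hT).1
    nor_q := fun Q hQ => (key T Q R₀ hT hQ hR₀).2.2.2.1
    nor_r := fun R hR => (key T Q₀ R hT hQ₀ hR).2.2.2.2 }

theorem exists_evenTriple (h : Triple a b c K) : ∃ q r, EvenTriple q r K ∧
    ∀ n, (n = a ∨ n = b ∨ n = c) ↔ (n = 2 ∨ n = q ∨ n = r) := by
  have key : ∀ {q r : ℕ}, Triple 2 q r K → ∃ q' r', EvenTriple q' r' K ∧
      ∀ n, (n = 2 ∨ n = q ∨ n = r) ↔ (n = 2 ∨ n = q' ∨ n = r') := by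
    intro q r h
    obtain ⟨T, hT⟩ := exists_sylIn h.pa K
    have h1 := (h.card_nor_two hT).1
    by_cases hr : r ∣ Nat.card T - 1
    · have hq : ¬ q ∣ Nat.card T - 1 := fun hq =>
        h.not_dvd_and_dvd hT (h1 ▸ hq.mul_right _) (h1 ▸ hr.mul_right _)
      exact ⟨r, q, h.swap.evenTriple_of_not_dvd hT hq, fun n => by tauto⟩
    · exact ⟨q, r, h.evenTriple_of_not_dvd hT hr, fun n => Iff.rfl⟩
  rcases h.two_mem with rfl | rfl | rfl
  · exact key h
  · obtain ⟨q, r, h1, h2⟩ := key h.rotate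
    exact ⟨q, r, h1, fun n => by rw [← h2]; tauto⟩
  · obtain ⟨q, r, h1, h2⟩ := key h.rotate.rotate
    exact ⟨q, r, h1, fun n => by rw [← h2]; tauto⟩

end Triple

end EvenTriple

section AutTransitive

set_option linter.unusedSectionVars false

universe u

variable {G : Type u} [Group G]

/-- Any two elements of equal order are related by an automorphism. -/
def AutTransitive (G : Type*) [Group G] : Prop :=
  ∀ x y : G, orderOf x = orderOf y → ∃ φ : G ≃* G, φ x = y

theorem Subgroup.Characteristic.map_mem {K : Subgroup G} (hK : K.Characteristic) (φ : G ≃* G) {x : G} (hx : x ∈ K) :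
    φ x ∈ K := by
  have := Subgroup.characteristic_iff_map_le.1 hK φ
  exact this (Subgroup.mem_map_of_mem φ.toMonoidHom hx)

theorem Subgroup.characteristic_of_map_mem {K : Subgroup G} (h : ∀ φ : G ≃* G, ∀ x ∈ K, φ x ∈ K) :
    K.Characteristic := by
  refine Subgroup.characteristic_iff_map_le.2 fun φ => ?_
  rintro _ ⟨x, hx, rfl⟩
  exact h φ x hx

theorem Subgroup.Characteristic.conj_mem {K : Subgroup G} (hK : K.Characteristic) (g : G) {x : G} (hx : x ∈ K) :
    g * x * g⁻¹ ∈ K := by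
  have := hK.map_mem (MulAut.conj g) hx
  rwa [MulAut.conj_apply] at this

theorem Subgroup.Characteristic.le_normalizer [Finite G] {K : Subgroup G} (hK : K.Characteristic) (L : Subgroup G) :
    L ≤ Subgroup.normalizer (K : Set G) := by
  intro g _
  exact (Subgroup.mem_inf.1 (Subgroup.mem_nor_of_conj_mem (K := ⊤) (Subgroup.mem_top g)
    fun y hy => hK.conj_mem g hy)).2

namespace AutTransitive

theorem mem_of_orderOf_eq (h : AutTransitive G) {K : Subgroup G} (hK : K.Characteristic) {x y : G} (hx : x ∈ K)
    (hxy : orderOf x = orderOf y) : y ∈ K := by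
  obtain ⟨φ, rfl⟩ := h x y hxy
  exact hK.map_mem φ hx

theorem card_cen_eq [Finite G] (h : AutTransitive G) {K : Subgroup G} (hK : K.Characteristic) {x y : G}
    (hxy : orderOf x = orderOf y) : Nat.card (K.cen x) = Nat.card (K.cen y) := by
  have key : ∀ x y : G, orderOf x = orderOf y → Nat.card (K.cen x) ≤ Nat.card (K.cen y) := by
    intro x y hxy
    obtain ⟨φ, rfl⟩ := h x y hxy
    refine Nat.card_le_card_of_injective (fun z : K.cen x => (⟨φ z, Subgroup.mem_cen.2
      ⟨hK.map_mem φ (Subgroup.mem_cen.1 z.2).1, ?_⟩⟩ : K.cen (φ x))) ?_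
    · rw [← map_mul, ← map_mul, (Subgroup.mem_cen.1 z.2).2]
    · intro z w hzw
      exact Subtype.ext (φ.injective (congrArg Subtype.val hzw))
  exact le_antisymm (key x y hxy) (key y x hxy.symm)

end AutTransitive

/-- `S` is a nontrivial subgroup with no proper nontrivial subgroup normalized by `S`. -/
structure SimpleIn (S : Subgroup G) : Prop where
  ne_bot : S ≠ ⊥
  eq : ∀ M ≤ S, S ≤ Subgroup.normalizer (M : Set G) → M = ⊥ ∨ M = S

theorem SimpleIn.isSimpleGroup (h : SimpleIn (⊤ : Subgroup G)) : IsSimpleGroup G := by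
  have : Nontrivial G := by
    obtain ⟨x, -, hx⟩ := (Subgroup.bot_or_exists_ne_one (⊤ : Subgroup G)).resolve_left h.ne_bot
    exact ⟨x, 1, hx⟩
  refine ⟨fun H hH => h.eq H le_top ?_⟩
  rw [Subgroup.normalizer_eq_top]

theorem exists_minimal_characteristic [Finite G] [Nontrivial G] : ∃ N : Subgroup G, N.Characteristic ∧ N ≠ ⊥ ∧
    ∀ M : Subgroup G, M.Characteristic → M ≤ N → M = ⊥ ∨ M = N := by
  obtain ⟨N, -, hN⟩ := (Set.toFinite {N : Subgroup G | N.Characteristic ∧ N ≠ ⊥}).exists_le_minimal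
    (a := (⊤ : Subgroup G)) ⟨Subgroup.topCharacteristic, top_ne_bot⟩
  refine ⟨N, hN.prop.1, hN.prop.2, fun M hM hMN => ?_⟩
  by_contra! h
  exact h.2 (le_antisymm hMN (hN.le_of_le ⟨hM, h.1⟩ hMN))

theorem exists_elementary_of_minimal_characteristic [Finite G] (hat : AutTransitive G) {N : Subgroup G}
    (hN : N.Characteristic) (hN1 : N ≠ ⊥)
    (hmin : ∀ M : Subgroup G, M.Characteristic → M ≤ N → M = ⊥ ∨ M = N)
    (hcomm : ∀ x ∈ N, ∀ y ∈ N, x * y = y * x) :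
    ∃ p : ℕ, p.Prime ∧ ∀ x, x ∈ N ↔ x ^ p = 1 := by
  obtain ⟨p, hp, hpd⟩ := Nat.exists_prime_and_dvd (n := Nat.card N)
    (fun h => hN1 (Subgroup.card_eq_one.1 h))
  obtain ⟨x, hx, hxp⟩ := exists_mem_orderOf_eq_prime hp hpd
  let M : Subgroup G :=
    { carrier := {y | y ∈ N ∧ y ^ p = 1}
      mul_mem' := by
        rintro y z ⟨hy, hy1⟩ ⟨hz, hz1⟩
        refine ⟨N.mul_mem hy hz, ?_⟩
        have hc : Commute y z := hcomm y hy z hz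
        rw [hc.mul_pow, hy1, hz1, mul_one]
      one_mem' := ⟨N.one_mem, one_pow p⟩
      inv_mem' := by
        rintro y ⟨hy, hy1⟩
        exact ⟨N.inv_mem hy, by rw [inv_pow, hy1, inv_one]⟩ }
  have hMc : M.Characteristic := Subgroup.characteristic_of_map_mem fun φ y hy =>
    ⟨hN.map_mem φ hy.1, by rw [← map_pow, hy.2, map_one]⟩
  have hMN : M = N := by
    refine (hmin M hMc fun y hy => hy.1).resolve_left fun h => ?_
    have hxM : x ∈ M := ⟨hx, by rw [← hxp, pow_orderOf_eq_one]⟩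
    rw [h, Subgroup.mem_bot] at hxM
    rw [hxM, orderOf_one] at hxp
    exact hp.one_lt.ne hxp
  refine ⟨p, hp, fun y => ⟨fun hy => ?_, fun hy => ?_⟩⟩
  · rw [← hMN] at hy
    exact hy.2
  · rcases (Nat.dvd_prime hp).1 (orderOf_dvd_of_pow_eq_one hy) with h | h
    · rw [orderOf_eq_one_iff.1 h]
      exact N.one_mem
    · exact hat.mem_of_orderOf_eq hN hx (hxp.trans h.symm)

theorem comm_or_simpleIn_of_minimal_characteristic [Finite G] (hat : AutTransitive G) {N : Subgroup G}
    (hN : N.Characteristic) (hN1 : N ≠ ⊥)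
    (hmin : ∀ M : Subgroup G, M.Characteristic → M ≤ N → M = ⊥ ∨ M = N) :
    (∀ x ∈ N, ∀ y ∈ N, x * y = y * x) ∨ SimpleIn N := by
  obtain ⟨M, -, hM⟩ := (Set.toFinite {M : Subgroup G | M ≤ N ∧ N ≤ Subgroup.normalizer (M : Set G) ∧ M ≠ ⊥}).exists_le_minimal
    (a := N) ⟨le_rfl, Subgroup.le_normalizer, hN1⟩
  obtain ⟨⟨hMN, hNM, hM1⟩, hMmin⟩ := hM
  have hnor : ∀ φ : G ≃* G, N ≤ Subgroup.normalizer ((M.map φ.toMonoidHom : Subgroup G) : Set G) := by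
    intro φ n hn
    refine (Subgroup.mem_inf.1 (Subgroup.mem_nor_of_conj_mem (K := N) hn ?_)).2
    rintro _ ⟨y, hy, rfl⟩
    have hn' : φ.symm n ∈ N := hN.map_mem φ.symm hn
    refine ⟨φ.symm n * y * (φ.symm n)⁻¹, (Subgroup.mem_normalizer_iff.1 (hNM hn') y).1 hy, ?_⟩
    simp
  have hle : ∀ φ : G ≃* G, M.map φ.toMonoidHom ≤ N := by
    rintro φ _ ⟨y, hy, rfl⟩
    exact hN.map_mem φ (hMN hy)
  have hconj : ∀ φ : G ≃* G, ∀ x ∈ N, ∀ y ∈ M, x * φ y * x⁻¹ ∈ M.map φ.toMonoidHom := fun φ x hx y hy =>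
    (Subgroup.mem_normalizer_iff.1 (hnor φ hx) _).1 (Subgroup.mem_map_of_mem φ.toMonoidHom hy)
  have hcardmap : ∀ φ : G ≃* G, Nat.card (M.map φ.toMonoidHom) = Nat.card M := fun φ =>
    Nat.card_congr (φ.subgroupMap M).symm.toEquiv
  have htriv : ∀ φ ψ : G ≃* G, M.map φ.toMonoidHom ≠ M.map ψ.toMonoidHom →
      M.map φ.toMonoidHom ⊓ M.map ψ.toMonoidHom = ⊥ := by
    intro φ ψ hne
    by_contra hb
    let L : Subgroup G := (M.map φ.toMonoidHom ⊓ M.map ψ.toMonoidHom).comap φ.toMonoidHom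
    have hLM : L ≤ M := by
      intro y hy
      obtain ⟨z, hz, hzy⟩ := (Subgroup.mem_inf.1 (Subgroup.mem_comap.1 hy)).1
      rwa [← φ.injective hzy]
    have hL1 : L ≠ ⊥ := by
      intro hL
      refine hb ((Subgroup.eq_bot_iff_forall _).2 fun z hz => ?_)
      have : φ.symm z ∈ L := Subgroup.mem_comap.2 (by simpa using hz)
      rw [hL, Subgroup.mem_bot] at this
      simpa using this
    have hLn : N ≤ Subgroup.normalizer (L : Set G) := by
      intro n hn
      refine (Subgroup.mem_inf.1 (Subgroup.mem_nor_of_conj_mem (K := N) hn ?_)).2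
      intro y hy
      have hy := Subgroup.mem_comap.1 hy
      refine Subgroup.mem_comap.2 ?_
      have hn' : φ n ∈ N := hN.map_mem φ hn
      simp only [map_mul, map_inv]
      exact ⟨(Subgroup.mem_normalizer_iff.1 (hnor φ hn') _).1 hy.1,
        (Subgroup.mem_normalizer_iff.1 (hnor ψ hn') _).1 hy.2⟩
    have hML : M ≤ L := hMmin ⟨hLM.trans hMN, hLn, hL1⟩ hLM
    have h1 : M.map φ.toMonoidHom ≤ M.map ψ.toMonoidHom := by
      rintro _ ⟨y, hy, rfl⟩
      exact (Subgroup.mem_inf.1 (Subgroup.mem_comap.1 (hML hy))).2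
    exact hne (Subgroup.eq_of_le_of_card_ge h1 (by rw [hcardmap, hcardmap]))
  have hcommM : ∀ φ ψ : G ≃* G, M.map φ.toMonoidHom ≠ M.map ψ.toMonoidHom →
      ∀ x ∈ M, ∀ y ∈ M, φ x * ψ y = ψ y * φ x := by
    intro φ ψ hne x hx y hy
    have h1 : φ x * ψ y * (φ x)⁻¹ * (ψ y)⁻¹ ∈ M.map φ.toMonoidHom ⊓ M.map ψ.toMonoidHom := by
      refine ⟨?_, Subgroup.mul_mem _ (hconj ψ _ (hN.map_mem φ (hMN hx)) y hy)
        (Subgroup.inv_mem _ (Subgroup.mem_map_of_mem ψ.toMonoidHom hy))⟩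
      have h2 := hconj φ _ (hN.map_mem ψ (hMN hy)) x⁻¹ (M.inv_mem hx)
      rw [map_inv] at h2
      have h3 : φ x * (ψ y * (φ x)⁻¹ * (ψ y)⁻¹) ∈ M.map φ.toMonoidHom :=
        Subgroup.mul_mem _ (Subgroup.mem_map_of_mem φ.toMonoidHom hx) h2
      rwa [← mul_assoc, ← mul_assoc] at h3
    rw [htriv φ ψ hne, Subgroup.mem_bot, mul_inv_eq_one, mul_inv_eq_iff_eq_mul] at h1
    exact h1
  have hrefl : M.map (MulEquiv.refl G).toMonoidHom = M := Subgroup.map_id M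
  by_cases hall : ∀ φ : G ≃* G, M.map φ.toMonoidHom = M
  · right
    have hMN' := (hmin M (Subgroup.characteristic_iff_map_eq.2 hall) hMN).resolve_left hM1
    subst hMN'
    refine ⟨hN1, fun L hL hLn => ?_⟩
    by_contra! hc
    exact hc.2 (le_antisymm hL (hMmin ⟨hL, hLn, hc.1⟩ hL))
  · left
    push Not at hall
    obtain ⟨φ, hφ⟩ := hall
    have hφ' : M.map φ.toMonoidHom ≠ M.map (MulEquiv.refl G).toMonoidHom := by rwa [hrefl]
    have hMcomm : ∀ x ∈ M, ∀ y ∈ M, x * y = y * x := by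
      intro x hx y hy
      by_cases hx1 : x = 1
      · simp [hx1]
      have hinf := htriv φ (MulEquiv.refl G) hφ'
      rw [hrefl] at hinf
      have hc : ∀ z ∈ M, φ x * z = z * φ x := fun z hz => hcommM φ (MulEquiv.refl G) hφ' x hx z hz
      have hord : orderOf x = orderOf (x * φ x) := by
        refine orderOf_eq_orderOf_iff.2 fun n => ?_
        have hcx : Commute x (φ x) := (hc x hx).symm
        rw [hcx.mul_pow]
        constructor
        · intro h
          rw [← map_pow, h, map_one, mul_one]
        · intro h
          have h1 : x ^ n ∈ M.map φ.toMonoidHom ⊓ M := by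
            refine ⟨?_, M.pow_mem hx n⟩
            rw [eq_inv_of_mul_eq_one_left h, ← map_pow, ← map_inv]
            exact Subgroup.mem_map_of_mem φ.toMonoidHom (M.inv_mem (M.pow_mem hx n))
          rwa [hinf, Subgroup.mem_bot] at h1
      obtain ⟨ψ, hψ⟩ := hat _ _ hord
      have hne : M.map ψ.toMonoidHom ≠ M.map (MulEquiv.refl G).toMonoidHom := by
        intro h
        rw [hrefl] at h
        have h1 : x * φ x ∈ M := by
          rw [← hψ, ← h]
          exact Subgroup.mem_map_of_mem ψ.toMonoidHom hx
        have h2 : φ x ∈ M.map φ.toMonoidHom ⊓ M :=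
          ⟨Subgroup.mem_map_of_mem φ.toMonoidHom hx, (M.mul_mem_cancel_left hx).1 h1⟩
        rw [hinf, Subgroup.mem_bot] at h2
        exact hx1 (φ.map_eq_one_iff.1 h2)
      have h3 := hcommM ψ (MulEquiv.refl G) hne x hx y hy
      rw [hψ, MulEquiv.refl_apply] at h3
      have h4 := hc y hy
      have h5 : x * y * φ x = y * x * φ x := by rw [mul_assoc, ← h4, ← mul_assoc, h3, mul_assoc]
      exact mul_right_cancel h5
    let k : Set G := {z | ∃ ψ : G ≃* G, ∃ y ∈ M, ψ y = z}
    have hk : ∀ z ∈ k, ∀ w ∈ k, z * w = w * z := by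
      rintro _ ⟨ψ, y, hy, rfl⟩ _ ⟨χ, z, hz, rfl⟩
      by_cases he : M.map ψ.toMonoidHom = M.map χ.toMonoidHom
      · have h1 : χ z ∈ M.map ψ.toMonoidHom := by
          rw [he]
          exact Subgroup.mem_map_of_mem χ.toMonoidHom hz
        obtain ⟨w, hw, hwz⟩ := h1
        rw [← hwz]
        have := congrArg ψ (hMcomm y hy w hw)
        simpa using this
      · exact hcommM ψ χ he y hy z hz
    have hkchar : (Subgroup.closure k).Characteristic := by
      refine Subgroup.characteristic_iff_map_le.2 fun χ => ?_
      rw [MonoidHom.map_closure, Subgroup.closure_le]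
      rintro _ ⟨_, ⟨ψ, y, hy, rfl⟩, rfl⟩
      exact Subgroup.subset_closure ⟨ψ.trans χ, y, hy, rfl⟩
    have hkN : Subgroup.closure k ≤ N := by
      rw [Subgroup.closure_le]
      rintro _ ⟨ψ, y, hy, rfl⟩
      exact hN.map_mem ψ (hMN hy)
    have hMk : M ≤ Subgroup.closure k := fun y hy => Subgroup.subset_closure ⟨MulEquiv.refl G, y, hy, rfl⟩
    have hkeq : Subgroup.closure k = N :=
      (hmin _ hkchar hkN).resolve_left fun h => hM1 (le_bot_iff.1 (h ▸ hMk))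
    intro x hx y hy
    rw [← hkeq] at hx hy
    exact congrArg Subtype.val ((Subgroup.isMulCommutative_closure hk).is_comm.comm ⟨x, hx⟩ ⟨y, hy⟩)

end AutTransitive

section ElemCore

set_option linter.unusedSectionVars false

universe u

variable {G : Type u} [Group G] [Finite G]

theorem SylIn.comm_of_zpowers {ℓ : ℕ} (hℓ : ℓ.Prime) {M N : Subgroup G} (hM : SylIn ℓ M N) {x : G}
    (hx : M = Subgroup.zpowers x) (hNM : N ≤ Subgroup.normalizer (M : Set G)) (hd : ℓ ∣ Nat.card N)
    (hmin : ∀ m, m.Prime → m ∣ Nat.card N → ℓ ≤ m) : ∀ n ∈ N, ∀ y ∈ M, n * y = y * n := by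
  have := Fact.mk hℓ
  have h1 : Nat.card N ≠ 1 := fun h => hℓ.one_lt.ne' (Nat.dvd_one.1 (h ▸ hd))
  have h2 : (Nat.card N).minFac = ℓ :=
    le_antisymm (Nat.minFac_le_of_dvd hℓ.two_le hd) (hmin _ (Nat.minFac_prime h1) (Nat.minFac_dvd _))
  have hc : IsCyclic (hM.toSylow) := by
    have h3 : IsCyclic (M.subgroupOf N) := by
      have h4 : IsCyclic M := by rw [hx]; infer_instance
      exact (Subgroup.subgroupOfEquivOfLe hM.le).isCyclic.2 h4
    exact h3
  intro n hn y hy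
  have h5 : (⟨n, hn⟩ : N) ∈ Subgroup.normalizer (hM.toSylow : Set N) := by
    refine Subgroup.mem_normalizer_iff.2 fun z => ?_
    exact Subgroup.mem_normalizer_iff.1 (hNM hn) z
  have h6 := Subgroup.mem_centralizer_iff.1 (IsCyclic.normalizer_le_centralizer h2 hc h5) ⟨y, hM.le hy⟩ hy
  exact (congrArg Subtype.val h6).symm

theorem exists_pow_orderOf_eq_prime {q : ℕ} (hq : q.Prime) {M : Subgroup G} (hM : IsPGroup q M) {x : G}
    (hx : x ∈ M) (hx1 : x ≠ 1) : ∃ k, orderOf (x ^ k) = q := by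
  obtain ⟨k, hk⟩ := hM.orderOf_eq hq hx
  have hk0 : k ≠ 0 := by
    rintro rfl
    exact hx1 (orderOf_eq_one_iff.1 (by simpa using hk))
  obtain ⟨j, rfl⟩ := Nat.exists_eq_succ_of_ne_zero hk0
  refine ⟨q ^ j, ?_⟩
  rw [orderOf_pow, hk, pow_succ, Nat.gcd_mul_right_left, Nat.mul_div_cancel_left _ (pow_pos hq.pos j)]

theorem orderOf_mul_eq_of_comm {x y : G} {a b : ℕ} (ha : a.Prime) (hb : b.Prime) (hab : a ≠ b) (hx : orderOf x = a)
    (hy : orderOf y = b) (h : x * y = y * x) : orderOf (x * y) = a * b := by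
  have hc : Commute x y := h
  rw [hc.orderOf_mul_eq_mul_orderOf_of_coprime, hx, hy]
  rw [hx, hy]
  exact (Nat.coprime_primes ha hb).2 hab

theorem ncard_orders_ge (s : Finset ℕ) (hs : ∀ n ∈ s, ∃ x : G, orderOf x = n) :
    s.card ≤ (Set.range (orderOf : G → ℕ)).ncard := by
  rw [← Set.ncard_coe_finset]
  exact Set.ncard_le_ncard (fun n hn => hs n hn) (Set.finite_range _)

/-- `E` is a characteristic elementary abelian `p`-subgroup consisting of all elements of order
dividing `p`, in a nonsolvable group with elements of equal order fused. -/
structure ElemCore (p : ℕ) (E : Subgroup G) : Prop where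
  prime : p.Prime
  char : E.Characteristic
  mem : ∀ x, x ∈ E ↔ x ^ p = 1
  comm : ∀ x ∈ E, ∀ y ∈ E, x * y = y * x
  ne_bot : E ≠ ⊥
  trans : AutTransitive G
  ns : ¬ Group.IsSolvable G

namespace ElemCore

variable {p : ℕ} {E : Subgroup G}

theorem isPGroup (h : ElemCore p E) : IsPGroup p E := fun x =>
  ⟨1, Subtype.ext (by simpa using (h.mem x).1 x.2)⟩

theorem mem_of_orderOf (h : ElemCore p E) {x : G} (hx : orderOf x = p) : x ∈ E :=
  (h.mem x).2 (by rw [← hx, pow_orderOf_eq_one])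

theorem orderOf_eq (h : ElemCore p E) {x : G} (hx : x ∈ E) (hx1 : x ≠ 1) : orderOf x = p :=
  orderOf_eq_prime_iff (hp := ⟨h.prime⟩) |>.2 ⟨(h.mem x).1 hx, hx1⟩

theorem exists_mem (h : ElemCore p E) : ∃ x ∈ E, orderOf x = p :=
  h.isPGroup.exists_orderOf_eq_prime h.prime h.ne_bot

theorem le_normalizer (h : ElemCore p E) (K : Subgroup G) : K ≤ Subgroup.normalizer (E : Set G) :=
  h.char.le_normalizer K

/-- An element of `E` normalizing a subgroup of order prime to `p` centralizes it. -/
theorem comm_of_mem_normalizer (h : ElemCore p E) {M : Subgroup G} (hM : ¬ p ∣ Nat.card M) {e m : G} (he : e ∈ E)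
    (heM : e ∈ Subgroup.normalizer (M : Set G)) (hm : m ∈ M) : e * m = m * e := by
  have h1 : e * m * e⁻¹ * m⁻¹ ∈ M := M.mul_mem ((Subgroup.mem_normalizer_iff.1 heM m).1 hm) (M.inv_mem hm)
  have h2 : e * m * e⁻¹ * m⁻¹ ∈ E := by
    have := E.mul_mem he (h.char.conj_mem m (E.inv_mem he))
    convert this using 1
    group
  by_contra hne
  have h3 : e * m * e⁻¹ * m⁻¹ ≠ 1 := by
    rw [Ne, mul_inv_eq_one, mul_inv_eq_iff_eq_mul]
    exact hne
  exact hM (h.orderOf_eq h2 h3 ▸ Subgroup.orderOf_dvd_card h1)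

theorem eq_one_of_comm (h : ElemCore p E) {ℓ : ℕ} (hℓ : ℓ.Prime) (hne : ℓ ≠ p)
    (hfree : ∀ x : G, orderOf x ≠ p * ℓ) {x v : G} (hx : orderOf x = ℓ) (hv : v ∈ E) (hc : x * v = v * x) :
    v = 1 := by
  by_contra hv1
  exact hfree _ (orderOf_mul_eq_of_comm h.prime hℓ hne.symm (h.orderOf_eq hv hv1) hx hc.symm)

theorem freeOn (h : ElemCore p E) {ℓ : ℕ} (hℓ : ℓ.Prime) (hne : ℓ ≠ p) (hfree : ∀ x : G, orderOf x ≠ p * ℓ)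
    {M : Subgroup G} (hM : IsPGroup ℓ M) : FreeOn M E := by
  intro m hm v hv hc
  by_contra! hcon
  obtain ⟨k, hk⟩ := exists_pow_orderOf_eq_prime hℓ hM hm hcon.1
  have hc' : Commute m v := hc
  exact hcon.2 (h.eq_one_of_comm hℓ hne hfree hk hv (hc'.pow_left k))

theorem mem_zpowers_of_free (h : ElemCore p E) {ℓ : ℕ} (hℓ : ℓ.Prime) (hne : ℓ ≠ p)
    (hfree : ∀ x : G, orderOf x ≠ p * ℓ) {M : Subgroup G} (hM : IsPGroup ℓ M) :
    ∀ x ∈ M, ∀ y ∈ M, orderOf x = ℓ → orderOf y = ℓ → y ∈ Subgroup.zpowers x := fun _ hx _ hy =>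
  hM.mem_zpowers_of_free hℓ h.prime hne h.isPGroup h.ne_bot (h.le_normalizer M) (h.freeOn hℓ hne hfree hM) hx hy

theorem isSolvable_of_odd (h : ElemCore p E) (hfree : ∀ ℓ, ℓ.Prime → ℓ ≠ p → ∀ x : G, orderOf x ≠ p * ℓ) :
    ∀ (n : ℕ) (K : Subgroup G), Nat.card K = n → E ≤ K → (∀ ℓ, ℓ.Prime → ℓ ∣ Nat.card K → ℓ ≠ p → ℓ ≠ 2) →
      Group.IsSolvable K := by
  intro n
  induction n using Nat.strong_induction_on with
  | _ n ih =>
    intro K hK hEK hodd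
    by_cases hex : ∃ ℓ, ℓ.Prime ∧ ℓ ∣ Nat.card K ∧ ℓ ≠ p
    · classical
      set ℓ := Nat.find hex with hℓdef
      obtain ⟨hℓ, hℓK, hℓp⟩ := Nat.find_spec hex
      rw [← hℓdef] at hℓ hℓK hℓp
      have hmin : ∀ m, m.Prime → m ∣ Nat.card K → m ≠ p → ℓ ≤ m := fun m h1 h2 h3 =>
        Nat.find_min' hex ⟨h1, h2, h3⟩
      obtain ⟨M, hM⟩ := exists_sylIn hℓ K
      obtain ⟨x, -, hx⟩ := hM.isPGroup.eq_zpowers_of_unique hℓ (hodd ℓ hℓ hℓK hℓp)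
        (h.mem_zpowers_of_free hℓ hℓp (hfree ℓ hℓ hℓp) hM.isPGroup)
      have hpM : ¬ p ∣ Nat.card M := by
        rw [hM.2]
        exact fun hd => hℓp.symm ((Nat.prime_dvd_prime_iff_eq h.prime hℓ).1 (h.prime.dvd_of_dvd_pow hd))
      have hpN : ¬ p ∣ Nat.card (K.nor M) := by
        intro hd
        obtain ⟨e, he, hep⟩ := exists_mem_orderOf_eq_prime h.prime hd
        obtain ⟨y, hy, hyℓ⟩ := hM.isPGroup.exists_orderOf_eq_prime hℓ (hM.ne_bot hℓ hℓK)
        have h1 := h.eq_one_of_comm hℓ hℓp (hfree ℓ hℓ hℓp) hyℓ (h.mem_of_orderOf hep)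
          (h.comm_of_mem_normalizer hpM (h.mem_of_orderOf hep) he.2 hy).symm
        rw [h1, orderOf_one] at hep
        exact h.prime.one_lt.ne hep
      have hMN : SylIn ℓ M (K.nor M) := hM.of_le_of_le hℓ (Subgroup.le_nor hM.le) Subgroup.nor_le
      have hcN := hMN.comm_of_zpowers hℓ hx inf_le_right
        ((hM.isPGroup.exists_orderOf_eq_prime hℓ (hM.ne_bot hℓ hℓK)).elim fun y hy =>
          hy.2 ▸ Subgroup.orderOf_dvd_card (hMN.le hy.1))
        (fun m hm hmN => hmin m hm (hmN.trans (Subgroup.card_dvd_of_le Subgroup.nor_le))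
          (by rintro rfl; exact hpN hmN))
      obtain ⟨Y, hYK, hKY, hcard⟩ := hM.exists_complement hℓ hcN
      have hM1 : 1 < Nat.card M := by
        rcases Nat.lt_or_ge 1 (Nat.card M) with h1 | h1
        · exact h1
        · exact absurd (Subgroup.card_eq_one.1 (le_antisymm h1 Nat.card_pos)) (hM.ne_bot hℓ hℓK)
      refine isSolvable_of_normal hYK hKY (a := ℓ) (b := ℓ) (ih _ ?_ Y rfl ?_ ?_) hcard ?_
      · rw [← hK, ← hcard]
        exact lt_mul_of_one_lt_right Nat.card_pos hM1
      · intro e he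
        refine mem_of_normal_of_coprime hYK hKY hcard (hEK he) ?_
        by_cases he1 : e = 1
        · rw [he1, orderOf_one]
          exact Nat.coprime_one_right _
        · rw [h.orderOf_eq he he1]
          exact ((Nat.Prime.coprime_iff_not_dvd h.prime).2 hpM).symm
      · intro m hm hmY
        exact hodd m hm (hmY.trans (Subgroup.card_dvd_of_le hYK))
      · intro m hm hd
        rw [hM.2] at hd
        exact Or.inl ((Nat.prime_dvd_prime_iff_eq hm hℓ).1 (hm.dvd_of_dvd_pow hd))
    · push Not at hex
      exact isSolvable_of_prime_dvd_card_eq_or_eq (p := p) (q := p) fun ℓ hℓ hd => Or.inl (hex ℓ hℓ hd)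

end ElemCore

end ElemCore

section ElemCoreFree

set_option linter.unusedSectionVars false

universe u

variable {G : Type u} [Group G] [Finite G]

theorem isSolvable_of_top (h : Group.IsSolvable (⊤ : Subgroup G)) : Group.IsSolvable G :=
  Group.isSolvable_of_isSolvable_injective (f := (Subgroup.topEquiv (G := G)).symm.toMonoidHom)
    (Subgroup.topEquiv (G := G)).symm.injective

theorem conj_of_odd_orderOf_mul {x t : G} (hx : x * x = 1) (ht : t * t = 1) {k : ℕ}
    (hk : (x * t) ^ (2 * k + 1) = 1) : (x * t) ^ k * x * ((x * t) ^ k)⁻¹ = t := by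
  have hxi : x⁻¹ = x := inv_eq_of_mul_eq_one_left hx
  have hti : t⁻¹ = t := inv_eq_of_mul_eq_one_left ht
  have h1 : x * ((x * t) ^ k)⁻¹ = (x * t) ^ k * x := by
    rw [mul_inv_eq_iff_eq_mul, mul_assoc]
    have h2 : x * (x * t) * x⁻¹ = (x * t)⁻¹ := by
      rw [mul_inv_rev, hxi, hti, ← mul_assoc, hx, one_mul]
    have h3 := conj_pow (a := x) (b := x * t) (i := k)
    rw [h2, inv_pow] at h3
    rw [hxi] at h3
    calc x = (x * t) ^ k * ((x * t) ^ k)⁻¹ * x := by group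
      _ = (x * t) ^ k * (x * (x * t) ^ k * x) * x := by rw [h3, mul_assoc]
      _ = (x * t) ^ k * (x * (x * t) ^ k) * (x * x) := by group
      _ = _ := by rw [hx, mul_one]
  rw [mul_assoc, h1, ← mul_assoc, ← pow_add]
  have h4 : (x * t) ^ (k + k) * (x * t) = 1 := by
    rw [← pow_succ, ← two_mul, hk]
  rw [eq_inv_of_mul_eq_one_left h4, mul_inv_rev, hxi, hti, mul_assoc, hx, mul_one]

theorem isPGroup_of_prime_dvd {p : ℕ} (hp : p.Prime) {K : Subgroup G}
    (h : ∀ ℓ, ℓ.Prime → ℓ ∣ Nat.card K → ℓ = p) : IsPGroup p K :=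
  IsPGroup.of_card (Nat.eq_prime_pow_of_unique_prime_dvd Nat.card_pos.ne' fun {d} hd hdK => h d hd hdK)

theorem isSolvable_of_isPGroup {p : ℕ} (hp : p.Prime) {K : Subgroup G} (h : IsPGroup p K) :
    Group.IsSolvable K :=
  isSolvable_of_prime_dvd_card_eq_or_eq (p := p) (q := p) fun ℓ hℓ hd => by
    have := Fact.mk hp
    obtain ⟨k, hk⟩ := IsPGroup.iff_card.1 h
    rw [hk] at hd
    exact Or.inl ((Nat.prime_dvd_prime_iff_eq hℓ hp).1 (hℓ.dvd_of_dvd_pow hd))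

namespace ElemCore

variable {p : ℕ} {E : Subgroup G}

theorem conj_eq_inv_of_free (h : ElemCore p E) (hp2 : p ≠ 2) (hfree : ∀ x : G, orderOf x ≠ p * 2) {i v : G}
    (hi : orderOf i = 2) (hv : v ∈ E) : i * v * i⁻¹ = v⁻¹ := by
  have hii : i * i = 1 := by rw [← pow_two, ← hi, pow_orderOf_eq_one]
  have hinv : i⁻¹ = i := inv_eq_of_mul_eq_one_left hii
  have hw := h.char.conj_mem i hv
  have h1 := h.eq_one_of_comm Nat.prime_two hp2.symm hfree hi (E.mul_mem hv hw) (by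
    have h2 := h.comm _ hv _ hw
    have h3 : i * (v * (i * v * i⁻¹)) * i⁻¹ = v * (i * v * i⁻¹) := by
      calc i * (v * (i * v * i⁻¹)) * i⁻¹ = (i * v * i⁻¹) * (i * (i * v * i⁻¹) * i⁻¹) := by group
        _ = (i * v * i⁻¹) * v := by
          congr 1
          rw [hinv]
          calc i * (i * v * i) * i = (i * i) * v * (i * i) := by group
            _ = v := by rw [hii, one_mul, mul_one]
        _ = _ := h2.symm
    exact mul_inv_eq_iff_eq_mul.1 h3)
  exact eq_inv_of_mul_eq_one_right h1

theorem false_of_free_of_even (h : ElemCore p E) (hcard : (Set.range (orderOf : G → ℕ)).ncard ≤ 6)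
    (hfree : ∀ ℓ, ℓ.Prime → ℓ ≠ p → ∀ x : G, orderOf x ≠ p * ℓ) (hp2 : p ≠ 2) (h2 : 2 ∣ Nat.card G) : False := by
  obtain ⟨i, hi⟩ : ∃ i : G, orderOf i = 2 := by
    obtain ⟨i, -, hi⟩ := exists_mem_orderOf_eq_prime (K := (⊤ : Subgroup G)) Nat.prime_two (by simpa using h2)
    exact ⟨i, hi⟩
  have sq : ∀ x : G, orderOf x = 2 → x * x = 1 := fun x hx => by
    rw [← pow_two, ← hx, pow_orderOf_eq_one]
  have hinvert : ∀ j v : G, orderOf j = 2 → v ∈ E → j * v * j⁻¹ = v⁻¹ := fun j v hj hv =>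
    h.conj_eq_inv_of_free hp2 (hfree 2 Nat.prime_two hp2.symm) hj hv
  set C := Subgroup.centralizer (E : Set G) with hC
  have hCn : C.Normal := by
    refine ⟨fun c hc g => ?_⟩
    rw [hC, Subgroup.mem_centralizer_iff] at hc ⊢
    intro v hv
    have h1 := hc _ (h.char.conj_mem g⁻¹ hv)
    calc v * (g * c * g⁻¹) = g * (g⁻¹ * v * g⁻¹⁻¹ * c) * g⁻¹ := by group
      _ = g * (c * (g⁻¹ * v * g⁻¹⁻¹)) * g⁻¹ := by rw [h1]
      _ = _ := by group
  obtain ⟨e, he, hep⟩ := h.exists_mem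
  have he1 : e ≠ 1 := by rintro rfl; rw [orderOf_one] at hep; exact h.prime.one_lt.ne hep
  have hCp : IsPGroup p C := by
    refine isPGroup_of_prime_dvd h.prime fun ℓ hℓ hd => ?_
    by_contra hne
    obtain ⟨x, hx, hxℓ⟩ := exists_mem_orderOf_eq_prime hℓ hd
    exact he1 (h.eq_one_of_comm hℓ hne (hfree ℓ hℓ hne) hxℓ he (Subgroup.mem_centralizer_iff.1 hx e he).symm)
  have hmemC : ∀ j k : G, orderOf j = 2 → orderOf k = 2 → j * k ∈ C := by
    intro j k hj hk
    rw [hC, Subgroup.mem_centralizer_iff]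
    intro v hv
    have h1 := mul_inv_eq_iff_eq_mul.1 (hinvert k v hk hv)
    have h3 := mul_inv_eq_iff_eq_mul.1 (hinvert j v⁻¹ hj (E.inv_mem hv))
    rw [inv_inv] at h3
    rw [mul_assoc j, h1, ← mul_assoc j, h3, mul_assoc]
  set D := (⊤ : Subgroup G).cen i with hD
  have hprod : ∀ g : G, ∃ z ∈ C, z⁻¹ * g ∈ D := by
    intro g
    have hg : orderOf (g * i * g⁻¹) = 2 := by rw [← MulAut.conj_apply, MulEquiv.orderOf_eq, hi]
    have hz := hmemC i _ hi hg
    obtain ⟨m, hm⟩ := hCp.orderOf_eq h.prime hz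
    obtain ⟨k, hk⟩ : Odd (orderOf (i * (g * i * g⁻¹))) := by
      rw [hm]
      exact (h.prime.odd_of_ne_two hp2).pow
    have h3 := conj_of_odd_orderOf_mul (sq _ hi) (sq _ hg) (k := k) (by rw [← hk, pow_orderOf_eq_one])
    set z := (i * (g * i * g⁻¹)) ^ k with hzd
    refine ⟨z, C.pow_mem hz k, Subgroup.mem_cen.2 ⟨Subgroup.mem_top _, ?_⟩⟩
    calc z⁻¹ * g * i = z⁻¹ * (g * i * g⁻¹) * g := by group
      _ = z⁻¹ * (z * i * z⁻¹) * g := by rw [h3]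
      _ = _ := by group
  have hDns : ¬ Group.IsSolvable D := by
    intro hDs
    refine h.ns ((Group.isSolvable_iff_subgroup_quotient C).2 ⟨isSolvable_of_isPGroup h.prime hCp, ?_⟩)
    refine Group.isSolvable_of_surjective (f := (QuotientGroup.mk' C).comp D.subtype) ?_
    intro y
    obtain ⟨g, rfl⟩ := QuotientGroup.mk'_surjective C y
    obtain ⟨z, hz, hzD⟩ := hprod g
    refine ⟨⟨_, hzD⟩, ?_⟩
    simp only [MonoidHom.comp_apply, Subgroup.coe_subtype, map_mul, map_inv]
    rw [(QuotientGroup.eq_one_iff z).2 hz |> (show QuotientGroup.mk' C z = 1 from ·), inv_one, one_mul]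
  have hpD : ¬ p ∣ Nat.card D := by
    intro hd
    obtain ⟨x, hx, hxp⟩ := exists_mem_orderOf_eq_prime h.prime hd
    have h1 := h.eq_one_of_comm Nat.prime_two hp2.symm (hfree 2 Nat.prime_two hp2.symm) hi (h.mem_of_orderOf hxp)
      (Subgroup.mem_cen.1 hx).2.symm
    rw [h1, orderOf_one] at hxp
    exact h.prime.one_lt.ne hxp
  obtain ⟨a, ha, haD, ha2⟩ : ∃ a, a.Prime ∧ a ∣ Nat.card D ∧ a ≠ 2 := by
    by_contra! hcon
    exact hDns (isSolvable_of_prime_dvd_card_eq_or_eq (p := 2) (q := 2) fun ℓ h1 h2 => Or.inl (hcon ℓ h1 h2))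
  obtain ⟨b, hb, hbD, hb2, hba⟩ : ∃ b, b.Prime ∧ b ∣ Nat.card D ∧ b ≠ 2 ∧ b ≠ a := by
    by_contra! hcon
    exact hDns (isSolvable_of_prime_dvd_card_eq_or_eq (p := 2) (q := a) fun ℓ h1 h2 => or_iff_not_imp_left.2 (hcon ℓ h1 h2))
  obtain ⟨x, hx, hxa⟩ := exists_mem_orderOf_eq_prime ha haD
  obtain ⟨y, hy, hyb⟩ := exists_mem_orderOf_eq_prime hb hbD
  have hxi := orderOf_mul_eq_of_comm Nat.prime_two ha ha2.symm hi hxa (Subgroup.mem_cen.1 hx).2.symm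
  have hyi := orderOf_mul_eq_of_comm Nat.prime_two hb hb2.symm hi hyb (Subgroup.mem_cen.1 hy).2.symm
  have hap : a ≠ p := by rintro rfl; exact hpD haD
  have hbp : b ≠ p := by rintro rfl; exact hpD hbD
  have hnp : ∀ m ℓ : ℕ, m.Prime → ℓ.Prime → 2 * m ≠ ℓ := by
    rintro m ℓ h1 h3 rfl
    exact Nat.not_prime_mul (by norm_num) h1.ne_one h3
  have h7 : ({1, p, 2, a, b, 2 * a, 2 * b} : Finset ℕ).card = 7 := by
    have e1 := hnp a p ha h.prime
    have e2 := hnp b p hb h.prime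
    have e3 := hnp a a ha ha
    have e4 := hnp a b ha hb
    have e5 := hnp b a hb ha
    have e6 := h.prime.one_lt
    have e7 := ha.one_lt
    have e8 := hb.one_lt
    repeat rw [Finset.card_insert_of_notMem]
    · simp
    all_goals
      simp only [Finset.mem_insert, Finset.mem_singleton]
      omega
  have := ncard_orders_ge (G := G) {1, p, 2, a, b, 2 * a, 2 * b} (by
    intro n hn
    simp only [Finset.mem_insert, Finset.mem_singleton] at hn
    rcases hn with rfl | rfl | rfl | rfl | rfl | rfl | rfl
    exacts [⟨1, orderOf_one⟩, ⟨e, hep⟩, ⟨i, hi⟩, ⟨x, hxa⟩, ⟨y, hyb⟩, ⟨_, hxi⟩, ⟨_, hyi⟩])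
  omega

theorem exists_orderOf_eq_mul (h : ElemCore p E) (hcard : (Set.range (orderOf : G → ℕ)).ncard ≤ 6) :
    ∃ ℓ, ℓ.Prime ∧ ℓ ≠ p ∧ ∃ x : G, orderOf x = p * ℓ := by
  by_contra! hfree
  by_cases h2 : p ≠ 2 ∧ 2 ∣ Nat.card G
  · exact h.false_of_free_of_even hcard hfree h2.1 h2.2
  · refine h.ns (isSolvable_of_top (h.isSolvable_of_odd hfree _ ⊤ rfl le_top ?_))
    rintro ℓ - hd hne rfl
    exact h2 ⟨hne.symm, by simpa using hd⟩

end ElemCore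

end ElemCoreFree

section ElemQuotient

set_option linter.unusedSectionVars false

universe u

variable {G : Type u} [Group G] [Finite G]

namespace ElemCore

variable {p : ℕ} {E : Subgroup G} [E.Normal]


theorem pow_mul_eq_one (h : ElemCore p E) (x : G) : x ^ (p * orderOf (QuotientGroup.mk' E x)) = 1 := by
  rw [mul_comm, pow_mul]
  refine (h.mem _).1 ((QuotientGroup.eq_one_iff (N := E) _).1 ?_)
  exact (map_pow (QuotientGroup.mk' E) x _).trans (pow_orderOf_eq_one _)

theorem exists_lift (h : ElemCore p E) {y : G ⧸ E} (hy : ¬ p ∣ orderOf y) :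
    ∃ x, QuotientGroup.mk' E x = y ∧ orderOf x = orderOf y := by
  obtain ⟨x, rfl⟩ := QuotientGroup.mk'_surjective E y
  set n := orderOf (QuotientGroup.mk' E x) with hn
  have hc : Nat.Coprime p n := (Nat.Prime.coprime_iff_not_dvd h.prime).2 hy
  obtain ⟨k, hk⟩ := exists_pow_eq_self_of_coprime (x := QuotientGroup.mk' E x) (n := p) (by rwa [← hn])
  have h1 : QuotientGroup.mk' E (x ^ (p * k)) = QuotientGroup.mk' E x := by
    rw [map_pow, pow_mul, hk]
  refine ⟨x ^ (p * k), h1, Nat.dvd_antisymm ?_ ?_⟩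
  · refine orderOf_dvd_of_pow_eq_one ?_
    rw [← pow_mul, mul_right_comm, pow_mul, h.pow_mul_eq_one, one_pow]
  · have := orderOf_map_dvd (QuotientGroup.mk' E) (x ^ (p * k))
    rwa [h1, ← hn] at this

theorem orderOf_lift (h : ElemCore p E) {x : G} (hx : p ∣ orderOf (QuotientGroup.mk' E x)) :
    orderOf x = p * orderOf (QuotientGroup.mk' E x) := by
  obtain ⟨k, hk⟩ := orderOf_map_dvd (QuotientGroup.mk' E) x
  set n := orderOf (QuotientGroup.mk' E x) with hn
  have hn0 : 0 < n := orderOf_pos _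
  have h1 : n * k ∣ n * p := by
    rw [← hk, mul_comm n]
    exact orderOf_dvd_of_pow_eq_one (h.pow_mul_eq_one x)
  rcases (Nat.dvd_prime h.prime).1 (Nat.dvd_of_mul_dvd_mul_left hn0 h1) with rfl | rfl
  · exfalso
    rw [mul_one] at hk
    obtain ⟨j, hj⟩ := hx
    have h2 : x ^ j ∈ E := (h.mem _).2 (by rw [← pow_mul, mul_comm, ← hj, ← hk, pow_orderOf_eq_one])
    have h3 : (QuotientGroup.mk' E x) ^ j = 1 := by
      rw [← map_pow]
      exact (QuotientGroup.eq_one_iff (N := E) _).2 h2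
    have h4 := Nat.le_of_dvd (Nat.pos_of_ne_zero (by rintro rfl; omega)) (orderOf_dvd_of_pow_eq_one h3)
    rw [← hn, hj] at h4
    have := h.prime.two_le
    have : 2 * j ≤ p * j := Nat.mul_le_mul_right _ this
    have : j = 0 := by omega
    subst this
    omega
  · rw [hk, mul_comm]

theorem autTransitive_quotient (h : ElemCore p E) : AutTransitive (G ⧸ E) := by
  intro y y' hyy
  obtain ⟨x, x', hx, hx', hxx⟩ : ∃ x x' : G, QuotientGroup.mk' E x = y ∧ QuotientGroup.mk' E x' = y' ∧
      orderOf x = orderOf x' := by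
    by_cases hd : p ∣ orderOf y
    · obtain ⟨x, rfl⟩ := QuotientGroup.mk'_surjective E y
      obtain ⟨x', rfl⟩ := QuotientGroup.mk'_surjective E y'
      exact ⟨x, x', rfl, rfl, by rw [h.orderOf_lift hd, h.orderOf_lift (hyy ▸ hd), hyy]⟩
    · obtain ⟨x, hx, hx2⟩ := h.exists_lift hd
      obtain ⟨x', hx', hx2'⟩ := h.exists_lift (y := y') (hyy ▸ hd)
      exact ⟨x, x', hx, hx', by rw [hx2, hx2', hyy]⟩
  obtain ⟨φ, hφ⟩ := h.trans x x' hxx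
  refine ⟨QuotientGroup.congr E E φ (Subgroup.characteristic_iff_map_eq.1 h.char φ), ?_⟩
  rw [← hx, ← hx', ← hφ]
  rfl

theorem not_isSolvable_quotient (h : ElemCore p E) : ¬ Group.IsSolvable (G ⧸ E) := fun hs =>
  h.ns ((Group.isSolvable_iff_subgroup_quotient E).2 ⟨isSolvable_of_isPGroup h.prime h.isPGroup, hs⟩)

end ElemCore

/-- An `ElemCore` with a nontrivial element order `p * ℓ`, together with the structure of the quotient. -/
structure ElemQuot (p ℓ q r : ℕ) (E : Subgroup G) [E.Normal] : Prop extends ElemCore p E where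
  even : EvenTriple q r (⊤ : Subgroup (G ⧸ E))
  orders : ∀ x : G, orderOf x = 1 ∨ orderOf x = p ∨ orderOf x = p * p ∨ orderOf x = p * ℓ ∨ orderOf x = 2 ∨
    orderOf x = q ∨ orderOf x = r
  prime' : ℓ.Prime
  ne : ℓ ≠ p

theorem mem_of_card_le_ncard_orders (s : Finset ℕ) (hs : ∀ n ∈ s, ∃ x : G, orderOf x = n)
    (hcard : (Set.range (orderOf : G → ℕ)).ncard ≤ s.card) (x : G) : orderOf x ∈ s := by
  have h1 : (s : Set ℕ) = Set.range (orderOf : G → ℕ) :=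
    Set.eq_of_subset_of_ncard_le (fun n hn => hs n hn) (by rwa [Set.ncard_coe_finset]) (Set.finite_range _)
  have h2 : orderOf x ∈ (s : Set ℕ) := h1 ▸ Set.mem_range_self x
  exact h2

theorem ElemCore.exists_elemQuot {p : ℕ} {E : Subgroup G} [E.Normal] (h : ElemCore p E)
    (hcard : (Set.range (orderOf : G → ℕ)).ncard ≤ 6) : ∃ ℓ q r, ElemQuot p ℓ q r E := by
  obtain ⟨ℓ, hℓ, hne, x, hx⟩ := h.exists_orderOf_eq_mul hcard
  have hns : ¬ Group.IsSolvable (⊤ : Subgroup (G ⧸ E)) := fun hs => h.not_isSolvable_quotient (isSolvable_of_top hs)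
  have hcen : ∀ a b : G ⧸ E, orderOf a = orderOf b →
      Nat.card ((⊤ : Subgroup (G ⧸ E)).cen a) = Nat.card ((⊤ : Subgroup (G ⧸ E)).cen b) :=
    fun a b hab => h.autTransitive_quotient.card_cen_eq inferInstance hab
  have hlift : ∀ n, n.Prime → n ≠ p → n ∣ Nat.card (⊤ : Subgroup (G ⧸ E)) → ∃ x : G, orderOf x = n := by
    intro n hn hnp hd
    obtain ⟨y, -, hy⟩ := exists_mem_orderOf_eq_prime hn hd
    obtain ⟨x, -, hx⟩ := h.exists_lift (y := y) (by
      rw [hy, Nat.prime_dvd_prime_iff_eq h.prime hn]; exact hnp.symm)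
    exact ⟨x, hx.trans hy⟩
  obtain ⟨e, -, he⟩ := h.exists_mem
  suffices hT : ∃ a b c, Triple a b c (⊤ : Subgroup (G ⧸ E)) ∧ ∀ x : G, orderOf x = 1 ∨ orderOf x = p ∨
      orderOf x = p * p ∨ orderOf x = p * ℓ ∨ orderOf x = a ∨ orderOf x = b ∨ orderOf x = c by
    obtain ⟨a, b, c, hT, hO⟩ := hT
    obtain ⟨q, r, hE, hqr⟩ := hT.exists_evenTriple
    refine ⟨ℓ, q, r, { toElemCore := h, even := hE, orders := fun x => ?_, prime' := hℓ, ne := hne }⟩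
    rw [← hqr]
    exact hO x
  have hp1 := h.prime.one_lt
  have hl1 := hℓ.one_lt
  have hmul : ∀ a b c : ℕ, a.Prime → b.Prime → c.Prime → a * b ≠ c := by
    rintro a b c ha hb hc rfl
    exact Nat.not_prime_mul ha.ne_one hb.ne_one hc
  have hpp : p < p * p := by nlinarith
  have hpl : p < p * ℓ := by nlinarith
  have hpl2 : p * p ≠ p * ℓ := fun h' => hne (Nat.eq_of_mul_eq_mul_left h.prime.pos h').symm
  by_cases hpH : p ∣ Nat.card (⊤ : Subgroup (G ⧸ E))
  · obtain ⟨a, ha, had, hap⟩ : ∃ a, a.Prime ∧ a ∣ Nat.card (⊤ : Subgroup (G ⧸ E)) ∧ a ≠ p := by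
      by_contra! hcon
      exact hns (isSolvable_of_prime_dvd_card_eq_or_eq (p := p) (q := p) fun n h1 h2 => Or.inl (hcon n h1 h2))
    obtain ⟨b, hb, hbd, hbp, hba⟩ : ∃ a', a'.Prime ∧ a' ∣ Nat.card (⊤ : Subgroup (G ⧸ E)) ∧ a' ≠ p ∧ a' ≠ a := by
      by_contra! hcon
      exact hns (isSolvable_of_prime_dvd_card_eq_or_eq (p := p) (q := a) fun n h1 h2 =>
        or_iff_not_imp_left.2 (hcon n h1 h2))
    have ha1 := ha.one_lt
    have hb1 := hb.one_lt
    have e1 := hmul p p a h.prime h.prime ha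
    have e2 := hmul p p b h.prime h.prime hb
    have e3 := hmul p ℓ a h.prime hℓ ha
    have e4 := hmul p ℓ b h.prime hℓ hb
    obtain ⟨z, -, hz⟩ := exists_mem_orderOf_eq_prime h.prime hpH
    obtain ⟨w, rfl⟩ := QuotientGroup.mk'_surjective E z
    have hw := h.orderOf_lift (x := w) (by rw [hz])
    rw [hz] at hw
    have hO := mem_of_card_le_ncard_orders (G := G) {1, p, p * p, p * ℓ, a, b} (by
      intro n hn
      simp only [Finset.mem_insert, Finset.mem_singleton] at hn
      rcases hn with rfl | rfl | rfl | rfl | rfl | rfl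
      exacts [⟨1, orderOf_one⟩, ⟨e, he⟩, ⟨w, hw⟩, ⟨x, hx⟩, hlift _ ha hap had, hlift _ hb hbp hbd]) (by
      refine hcard.trans (le_of_eq ?_)
      repeat rw [Finset.card_insert_of_notMem]
      · simp
      all_goals
        simp only [Finset.mem_insert, Finset.mem_singleton]
        omega)
    simp only [Finset.mem_insert, Finset.mem_singleton] at hO
    refine ⟨p, a, b, ⟨h.prime, ha, hb, hap.symm, hbp.symm, hba.symm, ?_, hns, fun a _ b _ hab => hcen a b hab⟩, ?_⟩
    · intro y _
      by_cases hd : p ∣ orderOf y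
      · obtain ⟨v, rfl⟩ := QuotientGroup.mk'_surjective E y
        have hv := h.orderOf_lift hd
        set n := orderOf (QuotientGroup.mk' E v) with hn
        right; left
        obtain ⟨k, hk⟩ := hd
        have hk0 : k ≠ 0 := by
          rintro rfl
          exact (orderOf_pos (QuotientGroup.mk' E v)).ne' (by rw [← hn, hk, mul_zero])
        have hpn : p * p ∣ orderOf v := by rw [hv, hk, ← mul_assoc]; exact dvd_mul_right _ _
        rcases hO v with h1 | h1 | h1 | h1 | h1 | h1
        · rw [h1] at hpn; have := Nat.le_of_dvd one_pos hpn; omega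
        · rw [h1] at hpn; have := Nat.le_of_dvd h.prime.pos hpn; omega
        · exact Nat.eq_of_mul_eq_mul_left h.prime.pos (hv.symm.trans h1)
        · rw [h1] at hpn
          have := (Nat.prime_dvd_prime_iff_eq h.prime hℓ).1 (Nat.dvd_of_mul_dvd_mul_left h.prime.pos hpn)
          exact absurd this.symm hne
        · rw [h1] at hpn
          exact absurd ((Nat.prime_dvd_prime_iff_eq h.prime ha).1 ((dvd_mul_right _ _).trans hpn)).symm hap
        · rw [h1] at hpn
          exact absurd ((Nat.prime_dvd_prime_iff_eq h.prime hb).1 ((dvd_mul_right _ _).trans hpn)).symm hbp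
      · obtain ⟨v, -, hv⟩ := h.exists_lift hd
        rw [← hv] at hd ⊢
        rcases hO v with h1 | h1 | h1 | h1 | h1 | h1
        · exact Or.inl h1
        · exact absurd h1.symm.dvd hd
        · exact absurd ((dvd_mul_right _ _).trans h1.symm.dvd) hd
        · exact absurd ((dvd_mul_right _ _).trans h1.symm.dvd) hd
        · exact Or.inr (Or.inr (Or.inl h1))
        · exact Or.inr (Or.inr (Or.inr h1))
    · intro v
      have := hO v
      tauto
  · obtain ⟨a, ha, had⟩ : ∃ a, a.Prime ∧ a ∣ Nat.card (⊤ : Subgroup (G ⧸ E)) := by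
      by_contra! hcon
      exact hns (isSolvable_of_prime_dvd_card_eq_or_eq (p := p) (q := p) fun n h1 h2 => absurd h2 (hcon n h1))
    obtain ⟨b, hb, hbd, hba⟩ : ∃ b, b.Prime ∧ b ∣ Nat.card (⊤ : Subgroup (G ⧸ E)) ∧ b ≠ a := by
      by_contra! hcon
      exact hns (isSolvable_of_prime_dvd_card_eq_or_eq (p := a) (q := a) fun n h1 h2 => Or.inl (hcon n h1 h2))
    obtain ⟨c, hc, hcd, hca, hcb⟩ : ∃ c, c.Prime ∧ c ∣ Nat.card (⊤ : Subgroup (G ⧸ E)) ∧ c ≠ a ∧ c ≠ b := by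
      by_contra! hcon
      exact hns (isSolvable_of_prime_dvd_card_eq_or_eq (p := a) (q := b) fun n h1 h2 =>
        or_iff_not_imp_left.2 (hcon n h1 h2))
    have hap : a ≠ p := by rintro rfl; exact hpH had
    have hbp : b ≠ p := by rintro rfl; exact hpH hbd
    have hcp : c ≠ p := by rintro rfl; exact hpH hcd
    have ha1 := ha.one_lt
    have hb1 := hb.one_lt
    have hc1 := hc.one_lt
    have e3 := hmul p ℓ a h.prime hℓ ha
    have e4 := hmul p ℓ b h.prime hℓ hb
    have e5 := hmul p ℓ c h.prime hℓ hc
    have hO := mem_of_card_le_ncard_orders (G := G) {1, p, p * ℓ, a, b, c} (by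
      intro n hn
      simp only [Finset.mem_insert, Finset.mem_singleton] at hn
      rcases hn with rfl | rfl | rfl | rfl | rfl | rfl
      exacts [⟨1, orderOf_one⟩, ⟨e, he⟩, ⟨x, hx⟩, hlift _ ha hap had, hlift _ hb hbp hbd, hlift _ hc hcp hcd]) (by
      refine hcard.trans (le_of_eq ?_)
      repeat rw [Finset.card_insert_of_notMem]
      · simp
      all_goals
        simp only [Finset.mem_insert, Finset.mem_singleton]
        omega)
    simp only [Finset.mem_insert, Finset.mem_singleton] at hO
    refine ⟨a, b, c, ⟨ha, hb, hc, hba.symm, hca.symm, hcb.symm, ?_, hns, fun a _ b _ hab => hcen a b hab⟩, ?_⟩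
    · intro y hy
      have hd : ¬ p ∣ orderOf y := fun hd => hpH (hd.trans (Subgroup.orderOf_dvd_card hy))
      obtain ⟨v, -, hv⟩ := h.exists_lift hd
      rw [← hv] at hd ⊢
      rcases hO v with h1 | h1 | h1 | h1 | h1 | h1
      · exact Or.inl h1
      · exact absurd h1.symm.dvd hd
      · exact absurd ((dvd_mul_right _ _).trans h1.symm.dvd) hd
      · exact Or.inr (Or.inl h1)
      · exact Or.inr (Or.inr (Or.inl h1))
      · exact Or.inr (Or.inr (Or.inr h1))
    · intro v
      have := hO v
      tauto

end ElemQuotient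

section ElemQuotientSylow

set_option linter.unusedSectionVars false

universe u

variable {G : Type u} [Group G] [Finite G]

theorem Subgroup.card_comap_mk' (E : Subgroup G) [E.Normal] (L : Subgroup (G ⧸ E)) :
    Nat.card (L.comap (QuotientGroup.mk' E)) = Nat.card L * Nat.card E := by
  have h1 := (L.comap (QuotientGroup.mk' E)).card_mul_index
  rw [Subgroup.index_comap_of_surjective _ (QuotientGroup.mk'_surjective E),
    Subgroup.card_eq_card_quotient_mul_card_subgroup E, ← L.card_mul_index] at h1
  refine Nat.eq_of_mul_eq_mul_right (Nat.pos_of_ne_zero L.index_ne_zero_of_finite) (h1.trans ?_)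
  ring

theorem Subgroup.card_map_mk'_mul {E : Subgroup G} [E.Normal] {K : Subgroup G} (h : E ≤ K) :
    Nat.card (K.map (QuotientGroup.mk' E)) * Nat.card E = Nat.card K := by
  rw [← Subgroup.card_comap_mk', Subgroup.comap_map_eq_self (by rwa [QuotientGroup.ker_mk'])]

namespace ElemCore

variable {p : ℕ} {E : Subgroup G} [E.Normal]

theorem eq_one_of_mem (h : ElemCore p E) {m : ℕ} (hm : m.Prime) (hmp : m ≠ p) {M : Subgroup G} (hM : IsPGroup m M)
    {x : G} (hx : x ∈ M) (hxE : x ∈ E) : x = 1 := by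
  by_contra hx1
  obtain ⟨k, hk⟩ := hM.orderOf_eq hm hx
  rw [h.orderOf_eq hxE hx1] at hk
  exact hmp ((Nat.prime_dvd_prime_iff_eq h.prime hm).1 (h.prime.dvd_of_dvd_pow hk.dvd)).symm

theorem card_map (h : ElemCore p E) {m : ℕ} (hm : m.Prime) (hmp : m ≠ p) {M : Subgroup G} (hM : IsPGroup m M) :
    Nat.card (M.map (QuotientGroup.mk' E)) = Nat.card M := by
  refine (Nat.card_congr (Equiv.ofBijective
    (fun x : M => (⟨QuotientGroup.mk' E x, Subgroup.mem_map_of_mem _ x.2⟩ : M.map (QuotientGroup.mk' E))) ⟨?_, ?_⟩)).symm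
  · intro x y hxy
    have h1 : QuotientGroup.mk' E (x : G) = QuotientGroup.mk' E (y : G) := congrArg Subtype.val hxy
    have h2 : (x : G)⁻¹ * y ∈ E := QuotientGroup.eq.1 h1
    exact Subtype.ext (inv_mul_eq_one.1 (h.eq_one_of_mem hm hmp hM (M.mul_mem (M.inv_mem x.2) y.2) h2))
  · rintro ⟨_, x, hx, rfl⟩
    exact ⟨⟨x, hx⟩, rfl⟩

theorem sylIn_map (h : ElemCore p E) {m : ℕ} (hm : m.Prime) (hmp : m ≠ p) {M : Subgroup G} (hM : SylIn m M ⊤) :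
    SylIn m (M.map (QuotientGroup.mk' E)) ⊤ := by
  refine ⟨le_top, ?_⟩
  rw [h.card_map hm hmp hM.isPGroup, hM.2, Subgroup.card_top, Subgroup.card_top,
    Subgroup.card_eq_card_quotient_mul_card_subgroup E, Nat.factorization_mul Nat.card_pos.ne' Nat.card_pos.ne',
    Finsupp.add_apply]
  have := Fact.mk h.prime
  obtain ⟨k, hk⟩ := IsPGroup.iff_card.1 h.isPGroup
  rw [Nat.factorization_eq_zero_of_not_dvd (n := Nat.card E), add_zero]
  rw [hk]
  exact fun hd => hmp ((Nat.prime_dvd_prime_iff_eq hm h.prime).1 (hm.dvd_of_dvd_pow hd))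

theorem exists_mem_nor (h : ElemCore p E) {m : ℕ} (hm : m.Prime) (hmp : m ≠ p) {M : Subgroup G} (hM : SylIn m M ⊤)
    {y : G ⧸ E} (hy : y ∈ (⊤ : Subgroup (G ⧸ E)).nor (M.map (QuotientGroup.mk' E))) :
    ∃ x ∈ (⊤ : Subgroup G).nor M, QuotientGroup.mk' E x = y := by
  obtain ⟨g, rfl⟩ := QuotientGroup.mk'_surjective E y
  set N := (M.map (QuotientGroup.mk' E)).comap (QuotientGroup.mk' E) with hN
  have hMN : M ≤ N := Subgroup.le_comap_map _ _
  have hg : g ∈ Subgroup.normalizer (N : Set G) := by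
    refine Subgroup.mem_normalizer_iff.2 fun z => ?_
    rw [hN, Subgroup.mem_comap, Subgroup.mem_comap, map_mul, map_mul, map_inv]
    exact Subgroup.mem_normalizer_iff.1 hy.2 _
  obtain ⟨n, hn, hng⟩ := (hM.of_le_of_le hm hMN le_top).exists_mul_mem_normalizer hm hg
  obtain ⟨z, hz, hzn⟩ := Subgroup.mem_map.1 (Subgroup.mem_comap.1 hn)
  refine ⟨z⁻¹ * (n * g), ⟨Subgroup.mem_top _, (Subgroup.normalizer (M : Set G)).mul_mem
    (Subgroup.le_normalizer (M.inv_mem hz)) hng⟩, ?_⟩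
  rw [map_mul, map_mul, map_inv, hzn, inv_mul_cancel_left]

theorem card_nor_map_dvd (h : ElemCore p E) {m : ℕ} (hm : m.Prime) (hmp : m ≠ p) {M : Subgroup G} (hM : SylIn m M ⊤) :
    Nat.card ((⊤ : Subgroup (G ⧸ E)).nor (M.map (QuotientGroup.mk' E))) ∣ Nat.card ((⊤ : Subgroup G).nor M) := by
  refine (Subgroup.card_dvd_of_le (K := ((⊤ : Subgroup G).nor M).map (QuotientGroup.mk' E)) ?_).trans
    (Subgroup.card_map_dvd _ _)
  intro y hy
  obtain ⟨x, hx, rfl⟩ := h.exists_mem_nor hm hmp hM hy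
  exact Subgroup.mem_map_of_mem _ hx

theorem exists_comm_of_dvd_card_nor (h : ElemCore p E) {m : ℕ} (hm : m.Prime) (hmp : m ≠ p) {M : Subgroup G}
    (hM : SylIn m M ⊤) (hd : p ∣ Nat.card ((⊤ : Subgroup (G ⧸ E)).nor (M.map (QuotientGroup.mk' E)))) :
    ∃ e ∈ E, e ≠ 1 ∧ ∀ x ∈ M, e * x = x * e := by
  obtain ⟨e, he, hep⟩ := exists_mem_orderOf_eq_prime h.prime (hd.trans (h.card_nor_map_dvd hm hmp hM))
  have heE := h.mem_of_orderOf hep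
  refine ⟨e, heE, ?_, fun x hx => h.comm_of_mem_normalizer ?_ heE he.2 hx⟩
  · rintro rfl
    exact h.prime.one_lt.ne (orderOf_one.symm.trans hep)
  · have := Fact.mk hm
    obtain ⟨k, hk⟩ := IsPGroup.iff_card.1 hM.isPGroup
    rw [hk]
    exact fun hd => hmp ((Nat.prime_dvd_prime_iff_eq h.prime hm).1 (h.prime.dvd_of_dvd_pow hd)).symm

end ElemCore

namespace ElemQuot

variable {p ℓ q r : ℕ} {E : Subgroup G} [E.Normal]

theorem orderOf_ne (h : ElemQuot p ℓ q r E) {a b : ℕ} (ha : a.Prime) (hb : b.Prime) (h1 : a * b ≠ p * p)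
    (h2 : a * b ≠ p * ℓ) (x : G) : orderOf x ≠ a * b := by
  intro he
  have hnp : ¬ (a * b).Prime := Nat.not_prime_mul ha.ne_one hb.ne_one
  have h3 := h.orders x
  rw [he] at h3
  rcases h3 with h3 | h3 | h3 | h3 | h3 | h3 | h3
  · exact ha.ne_one (Nat.eq_one_of_mul_eq_one_right h3)
  · exact hnp (h3 ▸ h.prime)
  · exact h1 h3
  · exact h2 h3
  · exact hnp (h3 ▸ Nat.prime_two)
  · exact hnp (h3 ▸ h.even.pb)
  · exact hnp (h3 ▸ h.even.pc)

theorem orderOf_ne_mul (h : ElemQuot p ℓ q r E) {a : ℕ} (ha : a.Prime) (hap : a ≠ p) (hal : a ≠ ℓ) (x : G) :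
    orderOf x ≠ p * a :=
  h.orderOf_ne h.prime ha (fun h1 => hap (Nat.eq_of_mul_eq_mul_left h.prime.pos h1))
    (fun h1 => hal (Nat.eq_of_mul_eq_mul_left h.prime.pos h1)) x

theorem orderOf_ne_of_ne (h : ElemQuot p ℓ q r E) {a b : ℕ} (ha : a.Prime) (hb : b.Prime) (hap : a ≠ p) (hbp : b ≠ p)
    (x : G) : orderOf x ≠ a * b := by
  have key : ∀ c, a * b ≠ p * c := by
    intro c hc
    rcases (Nat.Prime.dvd_mul h.prime).1 (dvd_of_mul_right_eq c hc.symm) with h1 | h1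
    · exact hap ((Nat.prime_dvd_prime_iff_eq h.prime ha).1 h1).symm
    · exact hbp ((Nat.prime_dvd_prime_iff_eq h.prime hb).1 h1).symm
  exact h.orderOf_ne ha hb (key _) (key _) x

theorem eq_two (h : ElemQuot p ℓ q r E) (hp2 : p ≠ 2) : ℓ = 2 := by
  by_contra hl
  obtain ⟨T, hT⟩ := exists_sylIn Nat.prime_two (⊤ : Subgroup G)
  have h4 := h.even.four_le _ (h.sylIn_map Nat.prime_two hp2.symm hT)
  rw [h.card_map Nat.prime_two hp2.symm hT.isPGroup] at h4
  have hTb : T ≠ ⊥ := by rintro rfl; rw [Subgroup.card_bot] at h4; omega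
  have := hT.isPGroup.card_eq_of_unique_of_exponent Nat.prime_two hTb (fun x hx => ?_)
    (h.mem_zpowers_of_free Nat.prime_two hp2.symm
      (h.orderOf_ne_mul Nat.prime_two hp2.symm (Ne.symm hl)) hT.isPGroup)
  · omega
  · obtain ⟨k, hk⟩ := hT.isPGroup.orderOf_eq Nat.prime_two hx
    refine orderOf_dvd_iff_pow_eq_one.1 ?_
    rw [hk]
    match k with
    | 0 => simp
    | 1 => simp
    | k + 2 =>
      exfalso
      refine h.orderOf_ne_of_ne Nat.prime_two Nat.prime_two hp2.symm hp2.symm (x ^ 2 ^ k) ?_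
      rw [orderOf_pow, hk, pow_add, Nat.gcd_mul_right_left, Nat.mul_div_cancel_left _ (by positivity)]
      norm_num

theorem ne_two (h : ElemQuot p ℓ q r E) : p ≠ 2 := by
  rintro rfl
  have key : ∀ m, m.Prime → m ≠ 2 → m ≠ ℓ → (∀ M : Subgroup (G ⧸ E), SylIn m M ⊤ →
      2 ∣ Nat.card ((⊤ : Subgroup (G ⧸ E)).nor M) ∧ M ≠ ⊥) → False := by
    intro m hm hm2 hml hd
    obtain ⟨M, hM⟩ := exists_sylIn hm (⊤ : Subgroup G)
    obtain ⟨h1, h2⟩ := hd _ (h.sylIn_map hm hm2 hM)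
    obtain ⟨e, he, he1, hc⟩ := h.exists_comm_of_dvd_card_nor hm hm2 hM h1
    have hMb : M ≠ ⊥ := by rintro rfl; exact h2 (Subgroup.map_bot _)
    obtain ⟨x, hx, hxm⟩ := hM.isPGroup.exists_orderOf_eq_prime hm hMb
    exact h.orderOf_ne_mul hm hm2 hml _ (orderOf_mul_eq_of_comm Nat.prime_two hm hm2.symm (h.orderOf_eq he he1) hxm (hc x hx))
  by_cases hq : q = ℓ
  · exact key r h.even.pc h.even.ac.symm (fun hr => h.even.bc (hq.trans hr.symm)) fun R hR =>
      ⟨(dvd_mul_right _ _).trans (h.even.nor_r R hR).symm.dvd, h.even.rotate.rotate.ne_bot hR⟩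
  · exact key q h.even.pb h.even.ab.symm hq fun Q hQ =>
      ⟨(dvd_mul_right _ _).trans (h.even.nor_q Q hQ).symm.dvd, h.even.rotate.ne_bot hQ⟩

end ElemQuot

end ElemQuotientSylow

section ElemQuotientFinal

set_option linter.unusedSectionVars false

universe u

variable {G : Type u} [Group G] [Finite G]

theorem Subgroup.Characteristic.mem_normalizer {E : Subgroup G} (hE : E.Characteristic) (g : G) :
    g ∈ Subgroup.normalizer (E : Set G) :=
  hE.le_normalizer ⊤ (Subgroup.mem_top g)

namespace ElemQuot

variable {p ℓ q r : ℕ} {E : Subgroup G} [E.Normal]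

theorem prime_eq (h : ElemQuot p ℓ q r E) : p = q := by
  by_contra hpq
  have hp2 := h.ne_two
  have hl := h.eq_two hp2
  have hq := h.even.pb
  have hq2 : q ≠ 2 := h.even.ab.symm
  have hqfree := h.orderOf_ne_mul hq (Ne.symm hpq) (by rw [hl]; exact hq2)
  have h2q := h.orderOf_ne_of_ne Nat.prime_two hq hp2.symm (Ne.symm hpq)
  obtain ⟨T, hT⟩ := exists_sylIn Nat.prime_two (⊤ : Subgroup G)
  obtain ⟨Q, hQ⟩ := exists_sylIn hq (⊤ : Subgroup G)
  have hT' := h.sylIn_map Nat.prime_two hp2.symm hT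
  have hQ' := h.sylIn_map hq (Ne.symm hpq) hQ
  have hQb' := h.even.rotate.ne_bot hQ'
  have hQb : Q ≠ ⊥ := by rintro rfl; exact hQb' (Subgroup.map_bot _)
  have h4 := h.even.four_le _ hT'
  have hTE : ∀ v ∈ E, ∀ t ∈ T, t * v = v * t := by
    have hd : q ∣ Nat.card ((⊤ : Subgroup G).nor T) := by
      refine dvd_trans ?_ (h.card_nor_map_dvd Nat.prime_two hp2.symm hT)
      rw [h.even.nor_two _ hT', ← h.even.card_q _ _ hT' hQ', Nat.add_sub_cancel]
      obtain ⟨x, hx, hxq⟩ := hQ'.isPGroup.exists_orderOf_eq_prime hq hQb'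
      exact (hxq ▸ Subgroup.orderOf_dvd_card hx).mul_right _
    obtain ⟨g, hg, hgq⟩ := exists_mem_orderOf_eq_prime hq hd
    have hgq1 : g ^ q = 1 := by rw [← hgq, pow_orderOf_eq_one]
    intro v hv t ht
    refine commute_of_regular h.comm (IsPGroup.coprime_card Nat.prime_two h.prime hp2.symm hT.isPGroup h.isPGroup)
      hq.pos (h.char.mem_normalizer g) (h.char.le_normalizer T) hg.2 ?_
      (fun v hv => mul_pow_eq_pow_of_free h.comm (h.char.mem_normalizer g) (by simp [hgq1])
        (fun v hv hc => h.eq_one_of_comm hq (Ne.symm hpq) hqfree hgq hv hc) hv) hv ht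
    intro m hm i hi hiq hc
    by_contra hm1
    obtain ⟨k, hk⟩ := exists_pow_orderOf_eq_prime Nat.prime_two hT.isPGroup hm hm1
    have hgi : orderOf (g ^ i) = q := by
      rw [← hgq]
      refine Nat.Coprime.orderOf_pow ?_
      rw [hgq]
      exact (Nat.Prime.coprime_iff_not_dvd hq).2 fun hd => absurd (Nat.le_of_dvd hi hd) (by omega)
    have hc' : m ^ k * g ^ i = g ^ i * m ^ k := (Commute.pow_left (show Commute m (g ^ i) from hc) k)
    exact h2q _ (orderOf_mul_eq_of_comm Nat.prime_two hq hq2.symm hk hgi hc')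
  have htE : ∀ t : G, orderOf t = 2 → ∀ v ∈ E, t * v = v * t := by
    intro t ht v hv
    obtain ⟨k, -, hk⟩ := (isPGroup_zpowers (p := 2) (k := 1) (by simpa using ht)).exists_conjBy_le Nat.prime_two le_top hT
    have h1 : k * t * k⁻¹ ∈ T := by
      refine hk (Subgroup.conj_mem_conjBy.2 (Subgroup.mem_zpowers t))
    have h2 := hTE _ (h.char.conj_mem k hv) _ h1
    have h3 : k * (t * v) * k⁻¹ = k * (v * t) * k⁻¹ := by
      calc k * (t * v) * k⁻¹ = k * t * k⁻¹ * (k * v * k⁻¹) := by group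
        _ = _ := h2
        _ = _ := by group
    exact mul_left_cancel (mul_right_cancel h3)
  obtain ⟨t, ht, ht2⟩ : ∃ t ∈ (⊤ : Subgroup G).nor Q, orderOf t = 2 := by
    refine exists_mem_orderOf_eq_prime Nat.prime_two ?_
    refine dvd_trans ?_ (h.card_nor_map_dvd hq (Ne.symm hpq) hQ)
    rw [h.even.nor_q _ hQ']
    exact dvd_mul_right _ _
  obtain ⟨y, hy, hyq⟩ := hQ.isPGroup.exists_orderOf_eq_prime hq hQb
  obtain ⟨e, he, hep⟩ := h.exists_mem
  have he1 : e ≠ 1 := by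
    rintro rfl
    exact h.prime.one_lt.ne (orderOf_one.symm.trans hep)
  have hc : t * y * t⁻¹ * y⁻¹ = 1 := by
    have h1 : t * y * t⁻¹ * y⁻¹ ∈ Q := Q.mul_mem ((Subgroup.mem_normalizer_iff.1 ht.2 y).1 hy) (Q.inv_mem hy)
    have h2 : (t * y * t⁻¹ * y⁻¹) * e = e * (t * y * t⁻¹ * y⁻¹) := by
      have c1 : Commute t e := htE t ht2 e he
      have c2 : Commute (y * t * y⁻¹) e := htE _ (by rw [← MulAut.conj_apply, MulEquiv.orderOf_eq, ht2]) e he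
      have c3 : t * y * t⁻¹ * y⁻¹ = t * (y * t * y⁻¹)⁻¹ := by group
      rw [c3]
      exact c1.mul_left c2.inv_left
    exact (h.freeOn hq (Ne.symm hpq) hqfree hQ.isPGroup _ h1 e he h2).resolve_right he1
  have hty : t * y = y * t := by
    rw [mul_inv_eq_one] at hc
    exact mul_inv_eq_iff_eq_mul.1 hc
  exact h2q _ (orderOf_mul_eq_of_comm Nat.prime_two hq hq2.symm ht2 hyq hty)

theorem absurd (h : ElemQuot p ℓ q r E) : False := by
  have hp2 := h.ne_two
  have hl := h.eq_two hp2
  obtain rfl := h.prime_eq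
  have hp := h.prime
  have hr := h.even.pc
  have hrp : r ≠ p := h.even.bc.symm
  have hr2 : r ≠ 2 := h.even.ac.symm
  set π := QuotientGroup.mk' E with hπ
  obtain ⟨T, hT⟩ := exists_sylIn Nat.prime_two (⊤ : Subgroup G)
  obtain ⟨P, hP⟩ := exists_sylIn hp (⊤ : Subgroup G)
  obtain ⟨Q', hQ'⟩ := exists_sylIn hp (⊤ : Subgroup (G ⧸ E))
  obtain ⟨R', hR'⟩ := exists_sylIn hr (⊤ : Subgroup (G ⧸ E))
  have hT' := h.sylIn_map Nat.prime_two hp2.symm hT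
  have hcT := h.card_map Nat.prime_two hp2.symm hT.isPGroup
  have h4 := h.even.four_le _ hT'
  have hcQ := h.even.card_q _ _ hT' hQ'
  have hcR := h.even.card_r _ _ hT' hR'
  have hcH := h.even.card_eq hT' hQ' hR'
  rw [hcT] at h4 hcQ hcR hcH
  have hpQ : p ∣ Nat.card Q' := by
    obtain ⟨x, hx, hxq⟩ := hQ'.isPGroup.exists_orderOf_eq_prime hp (h.even.rotate.ne_bot hQ')
    exact (hxq ▸ Subgroup.orderOf_dvd_card hx)
  set C : G → Subgroup G := fun e => (⊤ : Subgroup G).cen e with hC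
  have hEC : ∀ e ∈ E, E ≤ C e := fun e he x hx => Subgroup.mem_cen.2 ⟨Subgroup.mem_top _, h.comm x hx e he⟩
  have hconst : ∀ e ∈ E, e ≠ 1 → ∀ f ∈ E, f ≠ 1 → Nat.card (C e) = Nat.card (C f) := fun e he he1 f hf hf1 =>
    h.trans.card_cen_eq (K := ⊤) inferInstance (by rw [h.orderOf_eq he he1, h.orderOf_eq hf hf1])
  obtain ⟨f, hf, hf1, hfT⟩ := h.exists_comm_of_dvd_card_nor Nat.prime_two hp2.symm hT (by
    rw [h.even.nor_two _ hT', hcT, ← hcQ, Nat.add_sub_cancel]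
    exact hpQ.mul_right _)
  have hPb : P ≠ ⊥ := by
    rintro rfl
    obtain ⟨k, -, hk⟩ := h.isPGroup.exists_conjBy_le hp le_top hP
    refine h.ne_bot (Subgroup.card_eq_one.1 ?_)
    rw [← Subgroup.card_conjBy (k := k), le_bot_iff.1 hk, Subgroup.card_bot]
  obtain ⟨z, hz, hzp, hzc⟩ := hP.isPGroup.mem_center_exists_orderOf_eq_prime hp hPb
  have hzE := h.mem_of_orderOf hzp
  have hz1 : z ≠ 1 := by
    rintro rfl
    exact hp.one_lt.ne (orderOf_one.symm.trans hzp)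
  have hcard : ∀ e ∈ E, e ≠ 1 → Nat.card ((C e).map π) = Nat.card T * Nat.card Q' := by
    intro e he he1
    have hmulE := Subgroup.card_map_mk'_mul (hEC e he)
    have hGE := Subgroup.card_eq_card_quotient_mul_card_subgroup E
    have hTd : Nat.card T ∣ Nat.card (C e) := by
      rw [hconst e he he1 f hf hf1]
      exact Subgroup.card_dvd_of_le fun t ht => Subgroup.mem_cen.2 ⟨Subgroup.mem_top _, (hfT t ht).symm⟩
    have hPd : Nat.card P ∣ Nat.card (C e) := by
      rw [hconst e he he1 z hzE hz1]
      exact Subgroup.card_dvd_of_le fun t ht => Subgroup.mem_cen.2 ⟨Subgroup.mem_top _, hzc t ht⟩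
    have hcopTE : Nat.Coprime (Nat.card T) (Nat.card E) :=
      IsPGroup.coprime_card Nat.prime_two hp hp2.symm hT.isPGroup h.isPGroup
    have hPE : Nat.card P = Nat.card Q' * Nat.card E := by
      have := Fact.mk hp
      obtain ⟨k, hk⟩ := IsPGroup.iff_card.1 h.isPGroup
      rw [hP.2, hQ'.2, Subgroup.card_top, Subgroup.card_top, hGE, Nat.factorization_mul Nat.card_pos.ne' Nat.card_pos.ne',
        Finsupp.add_apply, pow_add, hk, hp.factorization_pow]
      simp
    have hQd : Nat.card Q' ∣ Nat.card ((C e).map π) := by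
      rw [hPE, ← hmulE] at hPd
      exact Nat.dvd_of_mul_dvd_mul_right Nat.card_pos hPd
    have hTd' : Nat.card T ∣ Nat.card ((C e).map π) := by
      rw [← hmulE] at hTd
      exact hcopTE.dvd_of_dvd_mul_right hTd
    have hrd : ¬ r ∣ Nat.card ((C e).map π) := by
      intro hd
      obtain ⟨x, hx, hxr⟩ := exists_mem_orderOf_eq_prime hr (hd.trans ((dvd_mul_right _ _).trans hmulE.dvd))
      refine h.orderOf_ne_mul hr hrp (by rw [hl]; exact hr2) _ (orderOf_mul_eq_of_comm hp hr hrp.symm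
        (h.orderOf_eq he he1) hxr (Subgroup.mem_cen.1 hx).2.symm)
    refine Nat.dvd_antisymm ?_ ?_
    · have h1 : Nat.card ((C e).map π) ∣ Nat.card T * Nat.card Q' * Nat.card R' := by
        rw [← hcH]
        exact Subgroup.card_dvd_of_le le_top
      refine Nat.Coprime.dvd_of_dvd_mul_right ?_ h1
      rw [hR'.2]
      exact ((Nat.Prime.coprime_iff_not_dvd hr).2 hrd).symm.pow_right _
    · refine Nat.Coprime.mul_dvd_of_dvd_of_dvd ?_ hTd' hQd
      rw [← hcT]
      exact IsPGroup.coprime_card Nat.prime_two hp hp2.symm hT'.isPGroup hQ'.isPGroup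
  have huniq : ∀ e ∈ E, e ≠ 1 → ∀ A B : Subgroup (G ⧸ E), SylIn 2 A ⊤ → SylIn 2 B ⊤ → A ≤ (C e).map π →
      B ≤ (C e).map π → A = B := by
    intro e he he1 A B hA hB hAe hBe
    by_contra hAB
    have h1 : Nat.card (A × B) ≤ Nat.card ((C e).map π) := by
      refine Nat.card_le_card_of_injective (fun x : A × B =>
        (⟨(x.1 : G ⧸ E) * x.2, ((C e).map π).mul_mem (hAe x.1.2) (hBe x.2.2)⟩ : (C e).map π)) ?_
      rintro ⟨a, b⟩ ⟨a', b'⟩ hab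
      have h2 : (a : G ⧸ E) * b = a' * b' := congrArg Subtype.val hab
      have h3 : (a' : G ⧸ E)⁻¹ * a = b' * (b : G ⧸ E)⁻¹ := by
        rw [inv_mul_eq_iff_eq_mul, ← mul_assoc, ← h2, mul_inv_cancel_right]
      have h4 : (a' : G ⧸ E)⁻¹ * a = 1 := by
        by_contra hne
        exact hAB (h.even.eq_of_mem hA hB (A.mul_mem (A.inv_mem a'.2) a.2)
          (h3 ▸ B.mul_mem b'.2 (B.inv_mem b.2)) hne)
      rw [h4] at h3
      exact Prod.ext (Subtype.ext (inv_mul_eq_one.1 h4).symm) (Subtype.ext (mul_inv_eq_one.1 h3.symm).symm)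
    rw [Nat.card_prod, hcard e he he1, hA.card_eq hT', hB.card_eq hT', hcT] at h1
    have := Nat.le_of_mul_le_mul_left h1 (by omega)
    omega
  set N := ((⊤ : Subgroup (G ⧸ E)).nor (T.map π)).comap π with hN
  set CT := E ⊓ Subgroup.centralizer (T : Set G) with hCT
  have hmCT : ∀ {x}, x ∈ CT ↔ x ∈ E ∧ ∀ t ∈ T, t * x = x * t := by
    intro x
    rw [hCT, Subgroup.mem_inf, Subgroup.mem_centralizer_iff]
    rfl
  have c1 := ncard_mul_card_le_of_conj (A := (CT : Set G) \ {1}) (U := (E : Set G) \ {1}) (N := N) (K := ⊤) le_top (by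
    rintro n hn a ⟨ha, ha1⟩
    refine ⟨?_, fun h1 => ha1 (conj_eq_one_iff.1 h1)⟩
    rw [SetLike.mem_coe, hmCT] at ha
    obtain ⟨n', hn', hnn⟩ := h.exists_mem_nor Nat.prime_two hp2.symm hT (Subgroup.mem_comap.1 hn)
    have he : n'⁻¹ * n ∈ E := QuotientGroup.eq.1 hnn
    have h5 : n * a * n⁻¹ = n' * a * n'⁻¹ := by
      have h6 := h.comm _ he _ ha.1
      calc n * a * n⁻¹ = n' * (n'⁻¹ * n * a) * n⁻¹ := by group
        _ = n' * (a * (n'⁻¹ * n)) * n⁻¹ := by rw [h6]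
        _ = _ := by group
    rw [h5, SetLike.mem_coe, hmCT]
    refine ⟨h.char.conj_mem _ ha.1, fun t ht => ?_⟩
    have h7 := ha.2 (n'⁻¹ * t * n') (by
      have := (Subgroup.mem_normalizer_iff.1 (inv_mem hn'.2) t).1 ht
      rwa [inv_inv] at this)
    calc t * (n' * a * n'⁻¹) = n' * (n'⁻¹ * t * n' * a) * n'⁻¹ := by group
      _ = n' * (a * (n'⁻¹ * t * n')) * n'⁻¹ := by rw [h7]
      _ = _ := by group) (by
    rintro u ⟨hu, hu1⟩
    obtain ⟨S, hS⟩ := exists_sylIn Nat.prime_two (C u)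
    have hcS : Nat.card S = Nat.card T := by
      have h8 : T ≤ C f := fun t ht => Subgroup.mem_cen.2 ⟨Subgroup.mem_top _, (hfT t ht).symm⟩
      rw [hS.2, hconst u hu hu1 f hf hf1, ← (hT.of_le_of_le Nat.prime_two h8 le_top).2]
    have hS' : SylIn 2 S ⊤ := ⟨le_top, hcS.trans hT.2⟩
    obtain ⟨k, -, hk⟩ := hS'.exists_conjBy_eq Nat.prime_two hT
    refine ⟨k⁻¹, Subgroup.mem_top _, k * u * k⁻¹, ⟨?_, fun h1 => hu1 (conj_eq_one_iff.1 h1)⟩, by group⟩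
    rw [SetLike.mem_coe, hmCT]
    refine ⟨h.char.conj_mem _ hu, fun t ht => ?_⟩
    rw [← hk, Subgroup.mem_conjBy] at ht
    have h9 := (Subgroup.mem_cen.1 (hS.le ht)).2
    calc t * (k * u * k⁻¹) = k * (k⁻¹ * t * k * u) * k⁻¹ := by group
      _ = k * (u * (k⁻¹ * t * k)) * k⁻¹ := by rw [h9]
      _ = _ := by group)
  have c2 := card_mul_le_ncard_of_conj (A := (CT : Set G) \ {1}) (U := (E : Set G) \ {1}) (N := N) (K := ⊤) (by
    rintro k - a ⟨ha, ha1⟩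
    exact ⟨h.char.conj_mem _ (hmCT.1 ha).1, fun h1 => ha1 (conj_eq_one_iff.1 h1)⟩) (by
    rintro k - a ⟨ha, ha1⟩ ⟨hka, -⟩
    rw [SetLike.mem_coe, hmCT] at ha hka
    have h1 : T.map π ≤ (C a).map π := Subgroup.map_mono fun t ht =>
      Subgroup.mem_cen.2 ⟨Subgroup.mem_top _, ha.2 t ht⟩
    have h2 : (T.conjBy k⁻¹).map π ≤ (C a).map π := Subgroup.map_mono fun t ht => by
      refine Subgroup.mem_cen.2 ⟨Subgroup.mem_top _, ?_⟩
      rw [Subgroup.mem_conjBy, inv_inv] at ht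
      have h3 := hka.2 _ ht
      have h4 : k * (t * a) * k⁻¹ = k * (a * t) * k⁻¹ := by
        calc k * (t * a) * k⁻¹ = k * t * k⁻¹ * (k * a * k⁻¹) := by group
          _ = _ := h3
          _ = _ := by group
      exact mul_left_cancel (mul_right_cancel h4)
    have h3 := huniq a ha.1 ha1 _ _ hT' (h.sylIn_map Nat.prime_two hp2.symm (hT.conjBy (Subgroup.mem_top _))) h1 h2
    rw [hN, Subgroup.mem_comap]
    have h5 : (T.map π).conjBy (π k)⁻¹ = T.map π := by
      conv_rhs => rw [h3]
      ext y
      rw [Subgroup.mem_conjBy, inv_inv, Subgroup.mem_map, Subgroup.mem_map]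
      constructor
      · rintro ⟨t, ht, hty⟩
        refine ⟨k⁻¹ * t * k, ?_, ?_⟩
        · rw [Subgroup.mem_conjBy]
          convert ht using 1
          group
        · rw [map_mul, map_mul, map_inv, hty]
          change (π k)⁻¹ * (π k * y * (π k)⁻¹) * π k = y
          group
      · rintro ⟨t, ht, rfl⟩
        refine ⟨k * t * k⁻¹, ?_, by rw [map_mul, map_mul, map_inv]⟩
        rw [Subgroup.mem_conjBy] at ht
        simpa using ht
    have h6 := (Subgroup.conjBy_eq_iff (K := ⊤) (Subgroup.mem_top _)).1 h5
    simpa using inv_mem h6)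
  have hcN : Nat.card N = (Nat.card T - 1) * Nat.card T * Nat.card E := by
    rw [hN, Subgroup.card_comap_mk', h.even.nor_two _ hT', hcT]
  have hcG : Nat.card (⊤ : Subgroup G) = (Nat.card T + 1) * Nat.card N := by
    rw [Subgroup.card_top, Subgroup.card_eq_card_quotient_mul_card_subgroup E, hcN, ← hcR, ← hcQ, Nat.add_sub_cancel]
    rw [Subgroup.card_top] at hcH
    rw [hcH, ← hcQ]
    ring
  rw [Subgroup.ncard_diff_one, Subgroup.ncard_diff_one] at c1 c2
  rw [hcG] at c1 c2
  have hN0 : 0 < Nat.card N := Nat.card_pos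
  have c3 : (Nat.card E - 1) = (Nat.card T + 1) * (Nat.card CT - 1) := by
    refine Nat.eq_of_mul_eq_mul_right hN0 ?_
    rw [le_antisymm c1 (c2.trans le_rfl)]
    ring
  have hpE : p ∣ Nat.card E := hzp ▸ Subgroup.orderOf_dvd_card hzE
  have hpC : p ∣ Nat.card CT := by
    rw [← h.orderOf_eq hf hf1]
    exact Subgroup.orderOf_dvd_card (hmCT.2 ⟨hf, fun t ht => (hfT t ht).symm⟩)
  obtain ⟨a, ha⟩ := hpE
  obtain ⟨b, hb⟩ := hpC
  obtain ⟨c, hc⟩ := hpQ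
  have ha0 : 0 < Nat.card E := Nat.card_pos
  have hb0 : 0 < Nat.card CT := Nat.card_pos
  refine hp.one_lt.ne' (Nat.dvd_one.1 ?_)
  zify [ha0, hb0] at c3 ha hb hc hcQ ⊢
  rw [ha, hb, ← hcQ, hc] at c3
  exact ⟨(p * c + 2) * b - c - a, by linear_combination c3⟩

end ElemQuot

theorem ElemCore.absurd {p : ℕ} {E : Subgroup G} (h : ElemCore p E)
    (hcard : (Set.range (orderOf : G → ℕ)).ncard ≤ 6) : False := by
  have : E.Normal := ⟨fun _ hx g => h.char.conj_mem g hx⟩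
  obtain ⟨ℓ, q, r, h'⟩ := h.exists_elemQuot hcard
  exact h'.absurd

end ElemQuotientFinal

section OuterCase

set_option linter.unusedSectionVars false

universe u

variable {G : Type u} [Group G] [Finite G]

/-- `S` is a proper characteristic subgroup which is nonabelian simple. -/
structure OuterCase (S : Subgroup G) : Prop where
  trans : AutTransitive G
  char : S.Characteristic
  simple : SimpleIn S
  ns : ¬ Group.IsSolvable S
  ne_top : S ≠ ⊤

theorem SimpleIn.exists_not_comm {S : Subgroup G} (h : SimpleIn S) (hns : ¬ Group.IsSolvable S) {q : ℕ} (hq : q.Prime)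
    {L : Subgroup G} (hL : SylIn q L S) (hL1 : L ≠ ⊥) : ¬ ∀ n ∈ S.nor L, ∀ x ∈ L, n * x = x * n := by
  intro hc
  obtain ⟨Y, hYS, hSY, hcard⟩ := hL.exists_complement hq hc
  rcases h.eq Y hYS hSY with rfl | rfl
  · rw [Subgroup.card_bot, one_mul] at hcard
    have h1 := Subgroup.eq_of_le_of_card_ge hL.le hcard.ge
    subst h1
    exact hns (isSolvable_of_isPGroup hq hL.isPGroup)
  · exact hL1 (Subgroup.card_eq_one.1 (Nat.eq_of_mul_eq_mul_left Nat.card_pos (hcard.trans (mul_one _).symm)))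

theorem SimpleIn.exists_prime_dvd_card_nor {S : Subgroup G} (h : SimpleIn S) (hns : ¬ Group.IsSolvable S) {q : ℕ}
    (hq : q.Prime) {L : Subgroup G} (hL : SylIn q L S) (hL1 : L ≠ ⊥) (hcomm : ∀ x ∈ L, ∀ y ∈ L, x * y = y * x) :
    ∃ m, m.Prime ∧ m ≠ q ∧ m ∣ Nat.card (S.nor L) := by
  by_contra! hcon
  have h1 : IsPGroup q (S.nor L) := isPGroup_of_prime_dvd hq fun m hm hd => by
    by_contra hne
    exact hcon m hm hne hd
  have h2 := hL.le_of_isPGroup_of_le_nor hq h1 le_rfl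
  exact h.exists_not_comm hns hq hL hL1 fun n hn x hx => hcomm n (h2 hn) x hx

theorem exists_mem_of_dvd_index {S C : Subgroup G} [S.Normal] (hC : ∀ g : G, ∃ s ∈ S, s * g ∈ C) {ℓ : ℕ} (hℓ : ℓ.Prime)
    (hd : ℓ ∣ S.index) : ∃ y ∈ C, orderOf y = ℓ := by
  apply exists_mem_orderOf_eq_prime hℓ
  let f : C →* G ⧸ S := (QuotientGroup.mk' S).comp C.subtype
  have hf : Function.Surjective f := by
    intro x
    obtain ⟨g, rfl⟩ := QuotientGroup.mk'_surjective S x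
    obtain ⟨s, hs, hg⟩ := hC g
    refine ⟨⟨s * g, hg⟩, ?_⟩
    change QuotientGroup.mk' S (s * g) = QuotientGroup.mk' S g
    rw [map_mul, show QuotientGroup.mk' S s = 1 from (QuotientGroup.eq_one_iff s).2 hs, one_mul]
  exact hd.trans (Subgroup.index_eq_card S ▸ Subgroup.card_dvd_of_surjective f hf)

theorem commute_of_normalizing {a b : ℕ} (ha : a.Prime) (hb : b.Prime) (hab : a ≠ b) {L M : Subgroup G} (hL : IsPGroup a L)
    (hM : IsPGroup b M) {x y : G} (hx : x ∈ L) (hy : y ∈ M) (hxM : x ∈ Subgroup.normalizer (M : Set G))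
    (hyL : y ∈ Subgroup.normalizer (L : Set G)) : x * y = y * x := by
  have h1 : x * y * x⁻¹ * y⁻¹ ∈ L ⊓ M := by
    refine Subgroup.mem_inf.2 ⟨?_, M.mul_mem ((Subgroup.mem_normalizer_iff.1 hxM y).1 hy) (M.inv_mem hy)⟩
    have := (Subgroup.mem_normalizer_iff.1 hyL x⁻¹).1 (L.inv_mem hx)
    have h2 := L.mul_mem hx this
    simpa [mul_assoc] using h2
  rw [(Subgroup.disjoint_of_coprime_natCard (IsPGroup.coprime_card ha hb hab hL hM)).eq_bot, Subgroup.mem_bot] at h1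
  rw [← mul_inv_eq_one, mul_inv_rev]
  simpa [mul_assoc] using h1

namespace OuterCase

variable {S : Subgroup G}

theorem normal (h : OuterCase S) : S.Normal := ⟨fun _ hx g => h.char.conj_mem g hx⟩

theorem orderOf_ne (h : OuterCase S) {x y : G} (hx : x ∈ S) (hy : y ∉ S) : orderOf y ≠ orderOf x :=
  fun he => hy (h.trans.mem_of_orderOf_eq h.char hx he.symm)

theorem not_dvd_index (h : OuterCase S) {ℓ : ℕ} (hℓ : ℓ.Prime) (hd : ℓ ∣ Nat.card S) {L : Subgroup G}
    (hL : SylIn ℓ L S) (hcomm : ∀ x ∈ L, ∀ y ∈ L, x * y = y * x)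
    (hmul : ∀ m, m.Prime → m ≠ ℓ → ∀ x ∈ S, orderOf x ≠ ℓ * m) : ¬ ℓ ∣ S.index := by
  intro hi
  have := h.normal
  obtain ⟨m, hm, hmℓ, hmd⟩ := h.simple.exists_prime_dvd_card_nor h.ns hℓ hL (hL.ne_bot hℓ hd) hcomm
  obtain ⟨M, hM⟩ := exists_sylIn hm (S.nor L)
  obtain ⟨y, k, hyS, hyk, hyL, hyM⟩ := exists_not_mem_normalizing hℓ hℓ hm hi hL hM
  have hk : k ≠ 0 := by
    rintro rfl
    rw [pow_zero, orderOf_eq_one_iff] at hyk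
    exact hyS (hyk ▸ S.one_mem)
  obtain ⟨j, rfl⟩ := Nat.exists_eq_succ_of_ne_zero hk
  have h0 : orderOf (y ^ ℓ ^ j) = ℓ := by
    rw [orderOf_pow' _ (pow_ne_zero _ hℓ.ne_zero), hyk, Nat.succ_eq_add_one, pow_succ,
      Nat.gcd_eq_right (dvd_mul_right _ _), Nat.mul_div_cancel_left _ (pow_pos hℓ.pos _)]
  obtain ⟨x, hx, hxo⟩ := exists_mem_orderOf_eq_prime hℓ hd
  have h0S : y ^ ℓ ^ j ∈ S := by
    by_contra hc
    exact h.orderOf_ne hx hc (h0.trans hxo.symm)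
  have h0L : y ^ ℓ ^ j ∈ L := hL.mem_of_mem_nor hℓ (k := 1) (by rw [h0, pow_one])
    (Subgroup.mem_nor.2 ⟨h0S, Subgroup.pow_mem _ hyL _⟩)
  obtain ⟨z, hz, hzo⟩ := hM.isPGroup.exists_orderOf_eq_prime hm (hM.ne_bot hm hmd)
  have hzn := Subgroup.mem_nor.1 (hM.le hz)
  have hc := commute_of_normalizing hℓ hm hmℓ.symm hL.isPGroup hM.isPGroup h0L hz (Subgroup.pow_mem _ hyM _) hzn.2
  exact hmul m hm hmℓ _ (S.mul_mem h0S hzn.1)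
    (orderOf_mul_eq_of_comm hℓ hm hmℓ.symm h0 hzo hc)

/-- If `V` is a Sylow subgroup of the normalizer of a Sylow subgroup of `S` then elements of `S` with the order of an
element of `V` are conjugate into `V`. -/
theorem exists_conj_of_sylIn_nor (h : OuterCase S) {p q : ℕ} (hp : p.Prime) (hq : q.Prime) {Q V : Subgroup G}
    (hQ : SylIn q Q S) (hv : SylIn p V (S.nor Q)) {u w : G} (hu : u ∈ S) (hw : w ∈ V) (huw : orderOf u = orderOf w) :
    ∃ k ∈ S, ∃ a ∈ V, u = k * a * k⁻¹ := by
  obtain ⟨φ, rfl⟩ := h.trans w u huw.symm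
  have hQ' : SylIn q (Q.map φ.toMonoidHom) S := by
    refine ⟨?_, ?_⟩
    · rintro _ ⟨x, hx, rfl⟩
      exact h.char.map_mem φ (hQ.le hx)
    · rw [Subgroup.card_map_of_injective φ.injective, hQ.2]
  obtain ⟨g, hg, hgQ⟩ := hQ'.exists_conjBy_eq hq hQ
  have hn : g * φ w * g⁻¹ ∈ S.nor Q := by
    refine Subgroup.mem_nor_of_conj_mem (S.mul_mem (S.mul_mem hg hu) (S.inv_mem hg)) fun x hx => ?_
    rw [← hgQ, Subgroup.mem_conjBy] at hx ⊢
    obtain ⟨x', hx', he⟩ := hx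
    refine ⟨w * x' * w⁻¹, ((Subgroup.mem_nor.1 (hv.le hw)).2 x').1 hx', ?_⟩
    have he' : φ x' = g⁻¹ * x * g := he
    change φ (w * x' * w⁻¹) = _
    rw [map_mul, map_mul, map_inv, he']
    group
  obtain ⟨j, hj⟩ := hv.isPGroup.orderOf_eq hp hw
  obtain ⟨b, hb, hbv⟩ := IsPGroup.exists_conjBy_le hp
    (isPGroup_zpowers (x := g * φ w * g⁻¹) (p := p) (k := j) (by
      rw [← MulAut.conj_apply, MulEquiv.orderOf_eq, MulEquiv.orderOf_eq, hj])) (Subgroup.zpowers_le.2 hn) hv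
  have h1 : b * (g * φ w * g⁻¹) * b⁻¹ ∈ V :=
    hbv (Subgroup.conj_mem_conjBy.2 (Subgroup.mem_zpowers _))
  refine ⟨(b * g)⁻¹, S.inv_mem (S.mul_mem (Subgroup.nor_le hb) hg), _, h1, ?_⟩
  group

end OuterCase

end OuterCase

section OuterTriple

set_option linter.unusedSectionVars false

universe u

variable {G : Type u} [Group G] [Finite G] {S : Subgroup G}

namespace OuterCase

theorem index_ne_one (h : OuterCase S) : S.index ≠ 1 := fun hi => h.ne_top (Subgroup.index_eq_one.1 hi)

theorem not_dvd_index_of_triple (h : OuterCase S) {a b c : ℕ} (ht : Triple a b c S) {ℓ : ℕ} (hℓ : ℓ.Prime)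
    (hd : ℓ ∣ Nat.card S) : ¬ ℓ ∣ S.index := by
  have key : ∀ {a b c : ℕ}, Triple a b c S → ¬ a ∣ S.index := by
    intro a b c ht
    obtain ⟨A, hA⟩ := exists_sylIn ht.pa S
    exact h.not_dvd_index ht.pa ht.dvd hA (fun x hx y hy => ht.comm hA hx hy) fun m hm _ => ht.not_mul ht.pa hm
  rcases ht.prime_dvd hℓ hd with rfl | rfl | rfl
  · exact key ht
  · exact key ht.rotate
  · exact key ht.rotate.rotate

theorem absurd_triple (h : OuterCase S) {a b c : ℕ} (hT : Triple a b c S)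
    (hcard : (Set.range (orderOf : G → ℕ)).ncard ≤ 6) : False := by
  obtain ⟨q, r, ht, -⟩ := hT.exists_evenTriple
  have := h.normal
  obtain ⟨ℓ, hℓ, hℓi⟩ := Nat.exists_prime_and_dvd h.index_ne_one
  have hℓS : ¬ ℓ ∣ Nat.card S := fun hd => h.not_dvd_index_of_triple hT hℓ hd hℓi
  have h2S := ht.dvd
  have hqS := ht.toTriple.rotate.dvd
  have hrS := ht.toTriple.rotate.rotate.dvd
  have h2ℓ : ℓ ≠ 2 := by rintro rfl; exact hℓS h2S
  have hqℓ : ℓ ≠ q := by rintro rfl; exact hℓS hqS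
  have hrℓ : ℓ ≠ r := by rintro rfl; exact hℓS hrS
  obtain ⟨t, htS, ht2⟩ := exists_mem_orderOf_eq_prime Nat.prime_two h2S
  obtain ⟨y, hyC, hy⟩ := exists_mem_of_dvd_index (S := S) (C := Subgroup.centralizer {t}) (fun g => by
    obtain ⟨k, hk, hkt⟩ := ht.toTriple.conj_of_orderOf_eq_two (h.char.conj_mem g htS) htS
      (by rw [← MulAut.conj_apply, MulEquiv.orderOf_eq, ht2]) ht2
    refine ⟨k, hk, Subgroup.mem_centralizer_singleton_iff.2 ?_⟩
    nth_rewrite 2 [← hkt]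
    group) hℓ hℓi
  have hyt : orderOf (t * y) = 2 * ℓ := orderOf_mul_eq_of_comm Nat.prime_two hℓ h2ℓ.symm ht2 hy
    (Subgroup.mem_centralizer_singleton_iff.1 hyC).symm
  obtain ⟨xq, -, hxq⟩ := exists_mem_orderOf_eq_prime ht.pb hqS
  obtain ⟨xr, -, hxr⟩ := exists_mem_orderOf_eq_prime ht.pc hrS
  obtain ⟨T, hTS⟩ := exists_sylIn ht.pa S
  obtain ⟨R, hR⟩ := exists_sylIn ht.pc S
  obtain ⟨z, hzR, hz⟩ := exists_mem_of_dvd_index (S := S) (C := Subgroup.normalizer (R : Set G)) (fun g =>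
    hR.exists_mul_mem_normalizer ht.pc (h.char.le_normalizer ⊤ (Subgroup.mem_top g))) hℓ hℓi
  have hnp : ∀ n, n.Prime → ¬ (n * ℓ).Prime := fun n hn => Nat.not_prime_mul hn.ne_one hℓ.ne_one
  have hnp1 : ∀ n, n.Prime → n * ℓ ≠ 1 := fun n hn he => hn.ne_one (Nat.eq_one_of_mul_eq_one_right he)
  have hs : ({1, 2, q, r, ℓ, 2 * ℓ} : Finset ℕ).card = 6 := by
    have h2ℓq : q ≠ 2 * ℓ := fun he => hnp 2 Nat.prime_two (he ▸ ht.pb)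
    have h2ℓr : r ≠ 2 * ℓ := fun he => hnp 2 Nat.prime_two (he ▸ ht.pc)
    have h2ℓ2 : ℓ ≠ 2 * ℓ := fun he => hnp 2 Nat.prime_two (he ▸ hℓ)
    have h22 : 2 ≠ 2 * ℓ := fun he => hnp 2 Nat.prime_two (he ▸ Nat.prime_two)
    rw [Finset.card_insert_of_notMem, Finset.card_insert_of_notMem, Finset.card_insert_of_notMem,
      Finset.card_insert_of_notMem, Finset.card_insert_of_notMem, Finset.card_singleton]
    · simpa using h2ℓ2
    · simpa using ⟨hrℓ.symm, h2ℓr⟩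
    · simpa using ⟨ht.bc, hqℓ.symm, h2ℓq⟩
    · simp only [Finset.mem_insert, Finset.mem_singleton, not_or]
      exact ⟨ht.ab, ht.ac, h2ℓ.symm, h22⟩
    · simp only [Finset.mem_insert, Finset.mem_singleton, not_or]
      exact ⟨by decide, ht.pb.ne_one.symm, ht.pc.ne_one.symm, hℓ.ne_one.symm, (hnp1 2 Nat.prime_two).symm⟩
  have hmem := mem_of_card_le_ncard_orders (G := G) {1, 2, q, r, ℓ, 2 * ℓ} (by
    intro n hn
    simp only [Finset.mem_insert, Finset.mem_singleton] at hn
    rcases hn with rfl | rfl | rfl | rfl | rfl | rfl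
    · exact ⟨1, orderOf_one⟩
    · exact ⟨t, ht2⟩
    · exact ⟨xq, hxq⟩
    · exact ⟨xr, hxr⟩
    · exact ⟨y, hy⟩
    · exact ⟨_, hyt⟩) (hs ▸ hcard)
  have hfree : ∀ v ∈ R, z * v = v * z → v = 1 := by
    intro v hv hzv
    by_contra hv1
    have hvr := ht.rotate.rotate.isolated.orderOf_eq ht.pc hR.le hR.isPGroup hv hv1
    have h1 := hmem (v * z)
    rw [orderOf_mul_eq_of_comm ht.pc hℓ hrℓ.symm hvr hz hzv.symm] at h1
    simp only [Finset.mem_insert, Finset.mem_singleton] at h1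
    rcases h1 with h1 | h1 | h1 | h1 | h1 | h1
    · exact hnp1 r ht.pc h1
    · exact hnp r ht.pc (h1 ▸ Nat.prime_two)
    · exact hnp r ht.pc (h1 ▸ ht.pb)
    · exact hnp r ht.pc (h1.symm ▸ ht.pc)
    · exact hnp r ht.pc (h1.symm ▸ hℓ)
    · exact ht.ac (Nat.eq_of_mul_eq_mul_right hℓ.pos h1).symm
  have hmod := card_modEq_of_fixed_point_free hℓ (by rw [← hz, pow_orderOf_eq_one]) hzR hfree
  rw [ht.card_r T R hTS hR] at hmod
  have h1 : ℓ ∣ Nat.card T := by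
    have := (Nat.modEq_iff_dvd' (by omega)).1 hmod.symm
    simpa using this
  exact hℓS (h1.trans (Subgroup.card_dvd_of_le hTS.le))

end OuterCase

end OuterTriple

section OuterPow

set_option linter.unusedSectionVars false

universe u

variable {G : Type u} [Group G] [Finite G] {S : Subgroup G}

/-- All elements outside of `S` have order `ℓ ^ k`. -/
structure OuterPow (ℓ k : ℕ) (S : Subgroup G) : Prop extends OuterCase S where
  prime : ℓ.Prime
  dvd_index : ℓ ∣ S.index
  outer : ∀ y ∉ S, orderOf y = ℓ ^ k

namespace OuterPow

variable {ℓ k : ℕ}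

theorem k_ne_zero (h : OuterPow ℓ k S) : k ≠ 0 := by
  rintro rfl
  obtain ⟨y, -, hy⟩ := SetLike.exists_of_lt h.ne_top.lt_top
  have h1 := h.outer y hy
  rw [pow_zero, orderOf_eq_one_iff] at h1
  exact hy (h1 ▸ S.one_mem)

theorem orderOf_dvd (h : OuterPow ℓ k S) {x y : G} (hx : x ∈ S) (hy : y ∉ S) (hxy : x * y = y * x) :
    orderOf x ∣ ℓ ^ k := by
  have h1 : x * y ∉ S := fun hc => hy ((S.mul_mem_cancel_left hx).1 hc)
  have h2 := pow_orderOf_eq_one (x * y)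
  rw [Commute.mul_pow hxy, h.outer _ h1] at h2
  have h3 := pow_orderOf_eq_one y
  rw [h.outer y hy] at h3
  rw [h3, mul_one] at h2
  exact orderOf_dvd_of_pow_eq_one h2

theorem isPGroup_of_comm (h : OuterPow ℓ k S) {x y : G} {m : ℕ} (hm : m.Prime) (hmℓ : m ≠ ℓ) {M : Subgroup G}
    (hMS : M ≤ S) (hM : IsPGroup m M) (hx : x ∈ M) (hy : y ∉ S) (hxy : x * y = y * x) : x = 1 := by
  obtain ⟨j, hj⟩ := hM.orderOf_eq hm hx
  have h1 := h.orderOf_dvd (hMS hx) hy hxy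
  have h2 : Nat.Coprime (orderOf x) (ℓ ^ k) := by
    rw [hj]
    exact Nat.Coprime.pow _ _ ((Nat.coprime_primes hm h.prime).2 hmℓ)
  exact orderOf_eq_one_iff.1 (Nat.eq_one_of_dvd_coprimes h2 dvd_rfl h1)

theorem comm_of_goodPrime (h : OuterPow ℓ k S) {r p : ℕ} (hg : GoodPrime r p S) {R : Subgroup G} (hR : SylIn r R S) :
    ∀ x ∈ R, ∀ y ∈ R, x * y = y * x := by
  intro x hx y hy
  by_cases hy1 : y = 1
  · simp [hy1]
  · rw [← hg.cen_eq (fun x _ y _ h1 h2 => h.trans.card_cen_eq h.char (h1.trans h2.symm)) hR hy hy1] at hx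
    exact (Subgroup.mem_cen.1 hx).2

theorem not_dvd_card_of_goodPrime (h : OuterPow ℓ k S) {p : ℕ} (hg : GoodPrime ℓ p S) : ¬ ℓ ∣ Nat.card S := by
  intro hd
  obtain ⟨L, hL⟩ := exists_sylIn h.prime S
  refine h.not_dvd_index h.prime hd hL (h.comm_of_goodPrime hg hL) (fun m hm _ x hx hxm => ?_) h.dvd_index
  have h1 := hg.isolated x hx (hxm ▸ dvd_mul_right _ _)
  rw [hxm] at h1
  exact hm.ne_one (Nat.eq_of_mul_eq_mul_left h.prime.pos (h1.trans (mul_one _).symm))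

theorem dvd_card_of_goodPrime (h : OuterPow ℓ k S) {r p : ℕ} (hg : GoodPrime r p S) (hr : r ∣ Nat.card S) :
    ℓ ∣ Nat.card S := by
  by_contra hℓS
  have := h.normal
  have hpow : ∀ y ∉ S, y ^ ℓ = 1 := by
    obtain ⟨y, -, hy⟩ := exists_mem_orderOf_eq_prime h.prime (K := (⊤ : Subgroup G)) (by
      rw [Subgroup.card_top, ← S.card_mul_index]
      exact h.dvd_index.mul_left _)
    have hyS : y ∉ S := fun hc => hℓS (hy ▸ Subgroup.orderOf_dvd_card hc)
    have h1 := h.outer y hyS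
    intro z hz
    rw [← hy, h1, ← h.outer z hz, pow_orderOf_eq_one]
  obtain ⟨R, hR⟩ := exists_sylIn hg.prime S
  have hRc := h.comm_of_goodPrime hg hR
  obtain ⟨m, hm, hmr, hmd⟩ := h.simple.exists_prime_dvd_card_nor h.ns hg.prime hR (hR.ne_bot hg.prime hr) hRc
  obtain ⟨M, hM⟩ := exists_sylIn hm (S.nor R)
  have hMS : M ≤ S := hM.le.trans Subgroup.nor_le
  obtain ⟨y, -, hyS, -, hyR, hyM⟩ := exists_not_mem_normalizing h.prime hg.prime hm h.dvd_index hR hM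
  have hmℓ : m ≠ ℓ := by
    rintro rfl
    exact hℓS (hmd.trans (Subgroup.card_dvd_of_le Subgroup.nor_le))
  obtain ⟨v, hv, hvr⟩ := hR.isPGroup.exists_orderOf_eq_prime hg.prime (hR.ne_bot hg.prime hr)
  obtain ⟨w, hw, hwm⟩ := hM.isPGroup.exists_orderOf_eq_prime hm (hM.ne_bot hm hmd)
  have hc := commute_of_regular hRc (IsPGroup.coprime_card hm hg.prime hmr hM.isPGroup hR.isPGroup) h.prime.pos hyR
    (fun x hx => (Subgroup.mem_nor.1 (hM.le hx)).2) hyM (fun x hx i hi hiℓ hxi => by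
      refine h.isPGroup_of_comm hm hmℓ hMS hM.isPGroup hx (fun hyi => hyS ?_) hxi
      refine mem_of_pow_mem_of_coprime (a := i) (b := ℓ) ?_ hyi (by rw [hpow y hyS]; exact S.one_mem)
      exact (Nat.coprime_of_lt_prime hi.ne' hiℓ h.prime).symm)
    (fun x hx => by
      rw [hpow y hyS, hpow]
      exact fun hcon => hyS ((S.mul_mem_cancel_left (hR.le hx)).1 hcon)) hv hw
  have h1 := orderOf_mul_eq_of_comm hg.prime hm hmr.symm hvr hwm hc.symm
  have h2 := hg.isolated (v * w) (S.mul_mem (hR.le hv) (hMS hw)) (h1 ▸ dvd_mul_right _ _)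
  rw [h1] at h2
  exact hm.ne_one (Nat.eq_of_mul_eq_mul_left hg.prime.pos (h2.trans (mul_one _).symm))

theorem goodPrime_of_ord {u v r : ℕ} (pu : u.Prime) (pv : v.Prime) (hr : r.Prime) (hru : r ≠ u) (hrv : r ≠ v)
    (hord : ∀ x ∈ S, orderOf x = 1 ∨ (orderOf x).Prime ∨ orderOf x = u * v) : GoodPrime r u S where
  prime := hr
  prime' := pu
  ne := hru.symm
  isolated x hx hd := by
    rcases hord x hx with h1 | h1 | h1
    · rw [h1] at hd
      exact absurd (Nat.dvd_one.1 hd) hr.ne_one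
    · exact ((Nat.prime_dvd_prime_iff_eq hr h1).1 hd).symm
    · rw [h1] at hd
      rcases hr.dvd_mul.1 hd with h2 | h2
      · exact absurd ((Nat.prime_dvd_prime_iff_eq hr pu).1 h2) hru
      · exact absurd ((Nat.prime_dvd_prime_iff_eq hr pv).1 h2) hrv
  sq q hq hqr hqu x hx hx2 := by
    rcases hord x hx with h1 | h1 | h1
    · rw [h1] at hx2
      exact hq.ne_one (Nat.eq_one_of_mul_eq_one_right ((pow_two q).symm.trans hx2.symm))
    · rw [hx2] at h1
      exact Nat.Prime.not_prime_pow le_rfl h1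
    · rw [h1] at hx2
      have h2 : u ∣ q ^ 2 := hx2 ▸ dvd_mul_right _ _
      exact hqu ((Nat.prime_dvd_prime_iff_eq pu hq).1 (pu.dvd_of_dvd_pow h2)).symm
  mul q m hq hm hqr hqu := by
    rintro ⟨x, hx, hxo⟩ z hz hz2
    have hnp : ¬ (q * m).Prime := Nat.not_prime_mul hq.ne_one hm.ne_one
    have h1 : q * m = u * v := by
      rcases hord x hx with h1 | h1 | h1
      · rw [h1] at hxo
        exact absurd (Nat.eq_one_of_mul_eq_one_right hxo.symm) hq.ne_one
      · exact absurd (hxo ▸ h1) hnp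
      · exact hxo.symm.trans h1
    have h2 : m * m = u * v := by
      rw [pow_two] at hz2
      rcases hord z hz with h1 | h1 | h1
      · rw [h1] at hz2
        exact absurd (Nat.eq_one_of_mul_eq_one_right hz2.symm) hm.ne_one
      · exact absurd (hz2 ▸ h1) (Nat.not_prime_mul hm.ne_one hm.ne_one)
      · exact hz2.symm.trans h1
    have h3 : q = m := Nat.eq_of_mul_eq_mul_right hm.pos (h1.trans h2.symm)
    subst h3
    have h4 : u ∣ q * q := h1 ▸ dvd_mul_right _ _
    rcases pu.dvd_mul.1 h4 with h5 | h5 <;> exact hqu ((Nat.prime_dvd_prime_iff_eq pu hq).1 h5).symm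

theorem eq_or_eq_of_ord (h : OuterPow ℓ k S) {u v : ℕ} (pu : u.Prime) (pv : v.Prime)
    (hord : ∀ x ∈ S, orderOf x = 1 ∨ (orderOf x).Prime ∨ orderOf x = u * v) : ℓ = u ∨ ℓ = v := by
  by_contra! hne
  refine h.not_dvd_card_of_goodPrime (goodPrime_of_ord pu pv h.prime hne.1 hne.2 hord) ?_
  by_contra hℓS
  refine h.ns (isSolvable_of_prime_dvd_card_eq_or_eq (p := u) (q := v) fun r hr hrS => ?_)
  by_contra! hcon
  exact hℓS (h.dvd_card_of_goodPrime (goodPrime_of_ord pu pv hr hcon.1 hcon.2 hord) hrS)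

end OuterPow

end OuterPow

section OrderEight

set_option linter.unusedSectionVars false

universe u

variable {G : Type u} [Group G] [Finite G] {S : Subgroup G}

theorem eq_zpowers_sq_of_orderOf_eq_eight {M : Subgroup G} (hM : IsPGroup 2 M) (hMS : M ≤ S) {y : G} (hyS : y ∉ S)
    (h8 : ∀ z ∉ S, orderOf z = 8) (hyM : y ∈ Subgroup.normalizer (M : Set G)) (hv : y ^ 2 ∈ M)
    (h4 : ∀ x ∈ M, x ^ 4 = 1) (hU : ∀ x ∈ M, x ^ 2 = 1 → x ≠ 1 → x = y ^ 4) : M = Subgroup.zpowers (y ^ 2) := by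
  have := Fact.mk Nat.prime_two
  have hy8 : y ^ 8 = 1 := by rw [← h8 y hyS, pow_orderOf_eq_one]
  refine le_antisymm (fun m hm => ?_) (Subgroup.zpowers_le.2 hv)
  have hle : Subgroup.zpowers y ≤ Subgroup.normalizer (M : Set G) := Subgroup.zpowers_le.2 hyM
  have key : M ≤ Subgroup.zpowers y := by
    by_contra hMy
    have hlt : Subgroup.zpowers y < M ⊔ Subgroup.zpowers y :=
      lt_of_le_of_ne le_sup_right fun he => hMy (he ▸ le_sup_left)
    have hW : IsPGroup 2 (M ⊔ Subgroup.zpowers y : Subgroup G) :=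
      hM.to_sup_of_normal_left' (isPGroup_zpowers (k := 3) (by rw [h8 y hyS]; rfl)) hle
    obtain ⟨w, hw, hwy⟩ := SetLike.exists_of_lt (hW.lt_nor Nat.prime_two hlt)
    obtain ⟨hwW, hwn⟩ := Subgroup.mem_inf.1 hw
    have hwW' := SetLike.mem_coe.2 hwW
    rw [Subgroup.coe_mul_of_right_le_normalizer_left _ _ hle] at hwW'
    obtain ⟨g, hg, b, hb, rfl⟩ := Set.mem_mul.1 hwW'
    have hgy : g ∉ Subgroup.zpowers y := fun hc => hwy (Subgroup.mul_mem _ hc hb)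
    have hgc : g * y * g⁻¹ ∈ Subgroup.zpowers y := by
      have h1 := (Subgroup.mem_normalizer_iff.1 hwn y).1 (Subgroup.mem_zpowers y)
      have h2 : b * y * b⁻¹ = y := by
        obtain ⟨i, rfl⟩ := Subgroup.mem_zpowers_iff.1 hb
        rw [((Commute.refl y).zpow_left i).eq, mul_inv_cancel_right]
      rwa [show g * b * y * (g * b)⁻¹ = g * (b * y * b⁻¹) * g⁻¹ by group, h2] at h1
    have hne : ∀ x ∈ M, x ∉ Subgroup.zpowers y → x ^ 2 ≠ 1 := by
      intro x hx hxy hx2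
      by_cases hx1 : x = 1
      · exact hxy (hx1 ▸ Subgroup.one_mem _)
      · exact hxy (hU x hx hx2 hx1 ▸ Subgroup.pow_mem _ (Subgroup.mem_zpowers y) 4)
    have hg2 : g ^ 2 = y ^ 4 := hU _ (M.pow_mem hg 2) (by rw [← pow_mul]; exact h4 g hg) (hne g hg hgy)
    obtain ⟨j, hj⟩ := Subgroup.mem_zpowers_iff.1 hgc
    have hy8z : ∀ i : ℤ, y ^ (8 * i) = 1 := fun i => by
      rw [zpow_mul, show y ^ (8 : ℤ) = 1 from mod_cast hy8, one_zpow]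
    have hconj : ∀ i : ℤ, g * y ^ i * g⁻¹ = y ^ (j * i) := fun i => by
      rw [zpow_mul, hj, conj_zpow]
    have hj4 : j % 2 = 1 := by
      by_contra hj2
      have h1 : y ^ (4 : ℤ) = 1 := by
        rw [← conj_eq_one_iff (a := g), hconj, show j * 4 = 8 * (j / 2) by omega, hy8z]
      have h2 : orderOf y ∣ 4 := orderOf_dvd_of_pow_eq_one (mod_cast h1)
      rw [h8 y hyS] at h2
      omega
    rcases show j % 4 = 1 ∨ j % 4 = 3 by omega with h | h
    · have h1 : g * y ^ 2 * g⁻¹ = y ^ 2 := by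
        have h1 := hconj 2
        rw [show j * 2 = 8 * (j / 4) + 2 by omega, zpow_add, hy8z, one_mul] at h1
        exact_mod_cast h1
      have h2 : Commute g ((y ^ 2)⁻¹) := Commute.inv_right (mul_inv_eq_iff_eq_mul.1 h1)
      refine hne (g * (y ^ 2)⁻¹) (M.mul_mem hg (M.inv_mem hv)) (fun hc => hgy ?_) ?_
      · exact (Subgroup.mul_mem_cancel_right _ (Subgroup.inv_mem _ (Subgroup.pow_mem _
          (Subgroup.mem_zpowers y) 2))).1 hc
      · rw [h2.mul_pow, hg2, inv_pow, ← pow_mul, mul_inv_cancel]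
    · have h1 : g * y = y ^ j * g := by rw [hj, inv_mul_cancel_right]
      have h2 : (g * y) ^ 2 = y ^ (j + 5) := by
        rw [pow_two]
        nth_rewrite 1 [h1]
        rw [show y ^ j * g * (g * y) = y ^ j * g ^ 2 * y by rw [pow_two]; group, hg2, add_comm j 5,
          show (5 : ℤ) + j = j + (4 : ℕ) + 1 by push_cast; ring, zpow_add_one, zpow_add, zpow_natCast]
      have h3 : (g * y) ^ 4 = 1 := by
        rw [show 4 = 2 * 2 from rfl, pow_mul, h2, ← zpow_natCast, ← zpow_mul,
          show (j + 5) * ((2 : ℕ) : ℤ) = 8 * (j / 4 + 2) by push_cast; omega, hy8z]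
      have h4 := orderOf_dvd_of_pow_eq_one h3
      rw [h8 _ fun hc => hyS ((S.mul_mem_cancel_left (hMS hg)).1 hc)] at h4
      omega
  obtain ⟨i, rfl⟩ := Subgroup.mem_zpowers_iff.1 (key hm)
  have hi : i % 2 = 0 := by
    by_contra hi
    refine hyS ?_
    have h1 : y ^ i ∈ S := hMS hm
    have h2 : y ^ 2 ∈ S := hMS hv
    have h3 : y = y ^ i * ((y ^ 2) ^ (i / 2))⁻¹ := by
      rw [← zpow_natCast y 2, ← zpow_mul, ← zpow_neg, ← zpow_add,
        show i + -(((2 : ℕ) : ℤ) * (i / 2)) = 1 by push_cast; omega, zpow_one]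
    rw [h3]
    exact S.mul_mem h1 (S.inv_mem (S.zpow_mem h2 _))
  refine Subgroup.mem_zpowers_iff.2 ⟨i / 2, ?_⟩
  rw [← zpow_natCast y 2, ← zpow_mul, show ((2 : ℕ) : ℤ) * (i / 2) = i by push_cast; omega]

end OrderEight

section SquareCase

set_option linter.unusedSectionVars false

universe u

variable {G : Type u} [Group G] [Finite G] {S : Subgroup G}

/-- The orders of elements of `S` are `1`, `p`, `p ^ 2`, `q` and `r`. -/
structure SquareCase (p q r k : ℕ) (S : Subgroup G) : Prop extends OuterPow p k S where
  pq : q.Prime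
  pr : r.Prime
  neq : p ≠ q
  ner : p ≠ r
  qr : q ≠ r
  ord : ∀ x ∈ S, orderOf x = 1 ∨ orderOf x = p ∨ orderOf x = p ^ 2 ∨ orderOf x = q ∨ orderOf x = r
  sq : ∃ x ∈ S, orderOf x = p ^ 2

namespace SquareCase

variable {p q r k : ℕ}

theorem swap (h : SquareCase p q r k S) : SquareCase p r q k S :=
  { h with
    pq := h.pr, pr := h.pq, neq := h.ner, ner := h.neq, qr := h.qr.symm
    ord := fun x hx => by have := h.ord x hx; tauto }

theorem goodPrime (h : SquareCase p q r k S) : GoodPrime q p S :=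
  OuterPow.goodPrime_of_ord h.prime h.prime h.pq h.neq.symm h.neq.symm fun x hx => by
    rcases h.ord x hx with h1 | h1 | h1 | h1 | h1
    · exact Or.inl h1
    · exact Or.inr (Or.inl (h1 ▸ h.prime))
    · exact Or.inr (Or.inr (h1.trans (pow_two p)))
    · exact Or.inr (Or.inl (h1 ▸ h.pq))
    · exact Or.inr (Or.inl (h1 ▸ h.pr))

theorem dvd_p (h : SquareCase p q r k S) : p ∣ Nat.card S := by
  obtain ⟨x, hx, hxo⟩ := h.sq
  exact (dvd_pow_self p two_ne_zero).trans (hxo ▸ Subgroup.orderOf_dvd_card hx)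

theorem dvd_q (h : SquareCase p q r k S) : q ∣ Nat.card S := by
  by_contra hd
  refine h.ns (isSolvable_of_prime_dvd_card_eq_or_eq (p := p) (q := r) fun ℓ hℓ hℓS => ?_)
  obtain ⟨x, hx, hxℓ⟩ := exists_mem_orderOf_eq_prime hℓ hℓS
  have hp2 : ¬ (p ^ 2).Prime := Nat.Prime.not_prime_pow le_rfl
  rcases h.ord x hx with h1 | h1 | h1 | h1 | h1 <;> rw [hxℓ] at h1
  · exact absurd h1 hℓ.ne_one
  · exact Or.inl h1
  · exact absurd (h1 ▸ hℓ) hp2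
  · exact absurd (h1 ▸ hℓS) hd
  · exact Or.inr h1

theorem not_comm (h : SquareCase p q r k S) {P : Subgroup G} (hP : SylIn p P S) : ¬ ∀ x ∈ P, ∀ y ∈ P, x * y = y * x := by
  intro hc
  refine h.not_dvd_index h.prime h.dvd_p hP hc (fun m hm hmp x hx hxm => ?_) h.dvd_index
  have hnp : ¬ (p * m).Prime := Nat.not_prime_mul h.prime.ne_one hm.ne_one
  rcases h.ord x hx with h1 | h1 | h1 | h1 | h1 <;> rw [hxm] at h1
  · exact h.prime.ne_one (Nat.eq_one_of_mul_eq_one_right h1)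
  · exact hnp (h1.symm ▸ h.prime)
  · rw [pow_two] at h1
    exact hmp (Nat.eq_of_mul_eq_mul_left h.prime.pos h1)
  · exact hnp (h1.symm ▸ h.pq)
  · exact hnp (h1.symm ▸ h.pr)

theorem orderOf_of_isPGroup (h : SquareCase p q r k S) {x : G} {j : ℕ} (hx : x ∈ S) (hj : orderOf x = p ^ j) :
    orderOf x ∣ p ^ 2 := by
  have key : ∀ q, q.Prime → p ≠ q → orderOf x ≠ q := fun q hq hpq h1 => by
    have h2 : q ∣ p ^ j := by rw [← hj, h1]
    exact hpq ((Nat.prime_dvd_prime_iff_eq hq h.prime).1 (hq.dvd_of_dvd_pow h2)).symm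
  rcases h.ord x hx with h1 | h1 | h1 | h1 | h1
  · rw [h1]; exact one_dvd _
  · rw [h1]; exact dvd_pow_self p two_ne_zero
  · rw [h1]
  · exact absurd h1 (key q h.pq h.neq)
  · exact absurd h1 (key r h.pr h.ner)

theorem k_eq (h : SquareCase p q r k S) : k = 3 := by
  obtain ⟨y, -, hy⟩ := SetLike.exists_of_lt h.ne_top.lt_top
  have hyo := h.outer y hy
  have h0 := h.k_ne_zero
  obtain ⟨x, hx, hxo⟩ := h.sq
  have h2 : k ≠ 2 := by
    rintro rfl
    exact h.orderOf_ne hx hy (hyo.trans hxo.symm)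
  have h1 : k ≠ 1 := by
    rintro rfl
    obtain ⟨z, hz, hzp⟩ := exists_mem_orderOf_eq_prime h.prime h.dvd_p
    exact h.orderOf_ne hz hy (by rw [hyo, hzp, pow_one])
  have hyp : orderOf (y ^ p) = p ^ (k - 1) := by
    rw [orderOf_pow' _ h.prime.ne_zero, hyo, Nat.gcd_eq_right (dvd_pow_self p h0)]
    exact Nat.div_eq_of_eq_mul_left h.prime.pos (by rw [← pow_succ, Nat.sub_add_cancel (by omega)])
  by_cases hS : y ^ p ∈ S
  · have h3 := h.orderOf_of_isPGroup hS hyp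
    rw [hyp] at h3
    have := (Nat.pow_dvd_pow_iff_le_right h.prime.one_lt).1 h3
    omega
  · have h3 := h.outer _ hS
    rw [hyp] at h3
    have := Nat.pow_right_injective h.prime.two_le h3
    omega

theorem orderOf_outer (h : SquareCase p q r k S) {y : G} (hy : y ∉ S) : orderOf y = p ^ 3 := by
  rw [h.outer y hy, h.k_eq]

theorem exists_sylIn_zpowers (h : SquareCase p q r k S) {Q : Subgroup G} (hQ : SylIn q Q S) :
    ∃ v ∈ S, orderOf v = p ^ 2 ∧ SylIn p (Subgroup.zpowers v) (S.nor Q) := by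
  have := h.normal
  have hp := h.prime
  obtain ⟨M, hM⟩ := exists_sylIn h.prime (S.nor Q)
  have hMS : M ≤ S := hM.le.trans Subgroup.nor_le
  obtain ⟨y, -, hyS, -, hyQ, hyM⟩ := exists_not_mem_normalizing h.prime h.pq h.prime h.dvd_index hQ hM
  have hyo := h.orderOf_outer hyS
  have hvo : orderOf (y ^ p) = p ^ 2 := by
    rw [orderOf_pow' _ h.prime.ne_zero, hyo, Nat.gcd_eq_right (dvd_pow_self p three_ne_zero), pow_succ p 2,
      Nat.mul_div_cancel _ h.prime.pos]
  have hvS : y ^ p ∈ S := by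
    by_contra hc
    have h1 := h.orderOf_outer hc
    rw [hvo] at h1
    have := Nat.pow_right_injective h.prime.two_le h1
    omega
  have hvM : y ^ p ∈ M := hM.mem_of_mem_nor h.prime hvo
    (Subgroup.mem_inf.2 ⟨Subgroup.mem_inf.2 ⟨hvS, Subgroup.pow_mem _ hyQ _⟩, Subgroup.pow_mem _ hyM _⟩)
  have hMQ : M ≤ Subgroup.normalizer (Q : Set G) := hM.le.trans inf_le_right
  have hfree := h.goodPrime.isolated.freeOn hp h.pq h.neq hQ.le hMS hQ.isPGroup hM.isPGroup
  have hU : ∀ x ∈ M, ∀ y ∈ M, orderOf x = p → orderOf y = p → y ∈ Subgroup.zpowers x := fun x hx y hy h1 h2 =>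
    hM.isPGroup.mem_zpowers_of_free hp h.pq h.neq hQ.isPGroup (hQ.ne_bot h.pq h.dvd_q) hMQ hfree hx hy h1 h2
  refine ⟨y ^ p, hvS, hvo, ?_⟩
  suffices hs : M = Subgroup.zpowers (y ^ p) by rwa [← hs]
  by_cases hp2 : p = 2
  · subst hp2
    have h4 : ∀ x ∈ M, x ^ 4 = 1 := fun x hx => by
      obtain ⟨j, hj⟩ := hM.isPGroup.orderOf_eq hp hx
      exact orderOf_dvd_iff_pow_eq_one.1 (h.orderOf_of_isPGroup (hMS hx) hj)
    refine eq_zpowers_sq_of_orderOf_eq_eight hM.isPGroup hMS hyS (fun z hz => h.orderOf_outer hz) hyM hvM h4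
      fun x hx hx2 hx1 => ?_
    have hyo4 : orderOf (y ^ 4) = 2 := by
      rw [orderOf_pow' _ four_ne_zero, hyo]; rfl
    have h5 := hU (y ^ 4) (by rw [show 4 = 2 * 2 from rfl, pow_mul]; exact M.pow_mem hvM 2) x hx hyo4
      (orderOf_eq_prime hx2 hx1)
    obtain ⟨i, hi⟩ := Subgroup.mem_zpowers_iff.1 h5
    have h8 : (y ^ 4) ^ (2 : ℤ) = 1 := by
      have := pow_orderOf_eq_one (y ^ 4)
      rw [hyo4] at this
      exact_mod_cast this
    rcases Int.emod_two_eq_zero_or_one i with h6 | h6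
    · refine absurd ?_ hx1
      rw [← hi, show i = 2 * (i / 2) by omega, zpow_mul, h8, one_zpow]
    · rw [← hi, show i = 2 * (i / 2) + 1 by omega, zpow_add_one, zpow_mul, h8, one_zpow, one_mul]
  · obtain ⟨x, hx, hMx⟩ := hM.isPGroup.eq_zpowers_of_unique hp hp2 hU
    obtain ⟨j, hj⟩ := hM.isPGroup.orderOf_eq hp hx
    refine (Subgroup.eq_of_le_of_card_ge (Subgroup.zpowers_le.2 hvM) ?_).symm
    rw [Nat.card_zpowers, hvo, hMx, Nat.card_zpowers]
    exact Nat.le_of_dvd (pow_pos hp.pos 2) (h.orderOf_of_isPGroup (hMS hx) hj)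

theorem ncard_ordSet_lt (h : SquareCase p q r k S) : (S.ordSet q).ncard * p ^ 2 < Nat.card S := by
  obtain ⟨Q, hQ⟩ := exists_sylIn h.pq S
  obtain ⟨v, -, hvo, hv⟩ := h.exists_sylIn_zpowers hQ
  have h1 := hQ.ncard_ordSet_mul_le h.pq one_ne_zero
  rw [pow_one] at h1
  have h2 : p ^ 2 * Nat.card Q ≤ Nat.card (S.nor Q) := by
    refine Nat.le_of_dvd Nat.card_pos (Nat.Coprime.mul_dvd_of_dvd_of_dvd ?_ ?_ (Subgroup.card_dvd_of_le (Subgroup.le_nor hQ.le)))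
    · rw [hQ.2]
      exact Nat.Coprime.pow _ _ ((Nat.coprime_primes h.prime h.pq).2 h.neq)
    · rw [← hvo]
      exact Subgroup.orderOf_dvd_card (hv.le (Subgroup.mem_zpowers v))
  have h3 : 0 < Nat.card Q := Nat.card_pos
  have h4 : 0 < Nat.card S := Nat.card_pos
  refine Nat.lt_of_mul_lt_mul_right (a := Nat.card Q) ?_
  calc (S.ordSet q).ncard * p ^ 2 * Nat.card Q ≤ (S.ordSet q).ncard * Nat.card (S.nor Q) := by
        rw [mul_assoc]; exact Nat.mul_le_mul_left _ h2
    _ ≤ Nat.card S * (Nat.card Q - 1) := h1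
    _ < Nat.card S * Nat.card Q := Nat.mul_lt_mul_of_pos_left (by omega) h4

theorem exists_card_nor (h : SquareCase p q r k S) : ∃ v ∈ S, orderOf v = p ^ 2 ∧
    (∀ u ∈ S, ∀ w ∈ Subgroup.zpowers v, orderOf u = orderOf w → ∃ k ∈ S, ∃ a ∈ Subgroup.zpowers v, u = k * a * k⁻¹) ∧
    p ^ 3 ≤ Nat.card (S.nor (Subgroup.zpowers v)) := by
  have := Fact.mk h.prime
  obtain ⟨Q, hQ⟩ := exists_sylIn h.pq S
  obtain ⟨v, hvS, hvo, hv⟩ := h.exists_sylIn_zpowers hQ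
  refine ⟨v, hvS, hvo, ?_, ?_⟩
  · intro u hu w hw huw
    exact h.exists_conj_of_sylIn_nor h.prime h.pq hQ hv hu hw huw
  · obtain ⟨P, hP, hvP⟩ := IsPGroup.exists_le_sylIn h.prime (isPGroup_zpowers hvo) (Subgroup.zpowers_le.2 hvS)
    have hlt : Subgroup.zpowers v < P := by
      refine lt_of_le_of_ne hvP ?_
      rintro rfl
      refine h.not_comm hP fun x hx y hy => ?_
      obtain ⟨i, rfl⟩ := Subgroup.mem_zpowers_iff.1 hx
      obtain ⟨j, rfl⟩ := Subgroup.mem_zpowers_iff.1 hy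
      exact (Commute.refl v).zpow_zpow i j
    have h1 := hP.isPGroup.lt_nor h.prime hlt
    have h2 : P.nor (Subgroup.zpowers v) ≤ S.nor (Subgroup.zpowers v) := inf_le_inf_right _ hP.le
    refine le_trans ?_ (Nat.le_of_dvd Nat.card_pos (Subgroup.card_dvd_of_le h2))
    obtain ⟨n, hn⟩ := (hP.isPGroup.to_le (Subgroup.nor_le (P := Subgroup.zpowers v))).exists_card_eq
    have h3 := lt_of_not_ge fun hc => h1.ne (Subgroup.eq_of_le_of_card_ge h1.le hc)
    rw [Nat.card_zpowers, hvo, hn] at h3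
    rw [hn]
    exact Nat.pow_le_pow_right h.prime.pos ((Nat.pow_lt_pow_iff_right h.prime.one_lt).1 h3)

theorem absurd (h : SquareCase p q r k S) : False := by
  obtain ⟨v, hvS, hvo, hconj, hcard⟩ := h.exists_card_nor
  have hp := h.prime.two_le
  have hq1 := h.ncard_ordSet_lt
  have hr1 := h.swap.ncard_ordSet_lt
  have hp12 : p ≠ p ^ 2 := fun he => by
    have := Nat.pow_right_injective hp ((pow_one p).trans he)
    omega
  have hp2 : 1 ≠ p ^ 2 := fun he => by
    have := Nat.pow_right_injective hp ((pow_zero p).trans he)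
    omega
  have hA : ∀ n, n ≠ 1 → (∃ w ∈ Subgroup.zpowers v, orderOf w = n) →
      (S.ordSet n).ncard * p ^ 3 ≤ Nat.card S * ((Subgroup.zpowers v).ordSet n).ncard := by
    rintro n - ⟨w, hw, rfl⟩
    refine (Nat.mul_le_mul_left _ hcard).trans (ncard_mul_card_le_of_conj Subgroup.nor_le ?_ ?_)
    · rintro n hn a ⟨ha, hao⟩
      exact ⟨((Subgroup.mem_nor.1 hn).2 a).1 ha, by rw [← MulAut.conj_apply, MulEquiv.orderOf_eq, hao]⟩
    · rintro u ⟨hu, huo⟩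
      obtain ⟨k, hk, a, ha, rfl⟩ := hconj u hu w hw huo
      refine ⟨k, hk, a, ⟨ha, ?_⟩, rfl⟩
      rw [← MulAut.conj_apply, MulEquiv.orderOf_eq] at huo
      exact huo
  have hv1 := Subgroup.mem_zpowers v
  have hA1 := hA p h.prime.ne_one ⟨v ^ p, Subgroup.pow_mem _ hv1 p, by
    rw [orderOf_pow' _ h.prime.ne_zero, hvo, Nat.gcd_eq_right (dvd_pow_self p two_ne_zero), pow_two,
      Nat.mul_div_cancel _ h.prime.pos]⟩
  have hA2 := hA (p ^ 2) hp2.symm ⟨v, hv1, hvo⟩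
  have hz : p ^ 2 = 1 + (((Subgroup.zpowers v).ordSet p).ncard + ((Subgroup.zpowers v).ordSet (p ^ 2)).ncard) := by
    have h1 := Subgroup.card_eq_sum_ordSet (K := Subgroup.zpowers v) {1, p, p ^ 2} (fun x hx => by
      have h1 := Subgroup.orderOf_dvd_card hx
      rw [Nat.card_zpowers, hvo, Nat.dvd_prime_pow h.prime] at h1
      obtain ⟨i, hi, hxi⟩ := h1
      interval_cases i <;> simp [hxi])
    rw [Nat.card_zpowers, hvo, Finset.sum_insert, Finset.sum_insert, Finset.sum_singleton,
      Subgroup.ncard_ordSet_one] at h1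
    · exact h1
    · simpa using hp12
    · simpa using ⟨h.prime.ne_one.symm, hp2⟩
  have hS : Nat.card S = 1 + ((S.ordSet p).ncard + ((S.ordSet (p ^ 2)).ncard + ((S.ordSet q).ncard + (S.ordSet r).ncard))) := by
    have h1 := Subgroup.card_eq_sum_ordSet (K := S) {1, p, p ^ 2, q, r} (fun x hx => by
      simpa using h.ord x hx)
    have hp2n : ¬ (p ^ 2).Prime := Nat.Prime.not_prime_pow le_rfl
    rw [Finset.sum_insert, Finset.sum_insert, Finset.sum_insert, Finset.sum_insert, Finset.sum_singleton,
      Subgroup.ncard_ordSet_one] at h1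
    · exact h1
    · simpa using h.qr
    · simp only [Finset.mem_insert, Finset.mem_singleton, not_or]
      exact ⟨fun he => hp2n (he ▸ h.pq), fun he => hp2n (he ▸ h.pr)⟩
    · simp only [Finset.mem_insert, Finset.mem_singleton, not_or]
      exact ⟨hp12, h.neq, h.ner⟩
    · simp only [Finset.mem_insert, Finset.mem_singleton, not_or]
      exact ⟨h.prime.ne_one.symm, hp2, h.pq.ne_one.symm, h.pr.ne_one.symm⟩
  have hSp : p ^ 3 ≤ Nat.card S :=
    hcard.trans (Nat.le_of_dvd Nat.card_pos (Subgroup.card_dvd_of_le Subgroup.nor_le))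
  generalize Nat.card S = s at *
  generalize (S.ordSet p).ncard = x1 at *
  generalize (S.ordSet (p ^ 2)).ncard = x2 at *
  generalize (S.ordSet q).ncard = x3 at *
  generalize (S.ordSet r).ncard = x4 at *
  generalize ((Subgroup.zpowers v).ordSet p).ncard = y1 at *
  generalize ((Subgroup.zpowers v).ordSet (p ^ 2)).ncard = y2 at *
  have h5 : (x1 + x2) * p ^ 3 + s ≤ s * p ^ 2 := by
    calc (x1 + x2) * p ^ 3 + s = x1 * p ^ 3 + x2 * p ^ 3 + s := by ring
      _ ≤ s * y1 + s * y2 + s := by gcongr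
      _ = s * p ^ 2 := by rw [hz]; ring
  have h6 : (x3 + x4) * p ^ 3 + 2 * p ≤ 2 * p * s := by
    calc (x3 + x4) * p ^ 3 + 2 * p = p * (x3 * p ^ 2 + 1) + p * (x4 * p ^ 2 + 1) := by ring
      _ ≤ p * s + p * s := by gcongr <;> omega
      _ = 2 * p * s := by ring
  have h7 : s * p ^ 3 + s + 2 * p ≤ p ^ 3 + s * p ^ 2 + 2 * p * s := by
    calc s * p ^ 3 + s + 2 * p = p ^ 3 + ((x1 + x2) * p ^ 3 + s) + ((x3 + x4) * p ^ 3 + 2 * p) := by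
          nth_rewrite 1 [hS]; ring
      _ ≤ _ := by gcongr
  have h8 : p ^ 2 + 2 * p ≤ p ^ 3 := by
    calc p ^ 2 + 2 * p ≤ p * p + p * p := by
          rw [pow_two]; exact Nat.add_le_add_left (Nat.mul_le_mul_right _ hp) _
      _ = 2 * p ^ 2 := by ring
      _ ≤ p * p ^ 2 := Nat.mul_le_mul_right _ hp
      _ = p ^ 3 := by ring
  have h9 : s * (p ^ 2 + 2 * p) ≤ s * p ^ 3 := Nat.mul_le_mul_left _ h8
  have h10 : s * (p ^ 2 + 2 * p) = s * p ^ 2 + 2 * p * s := by ring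
  omega

end SquareCase

end SquareCase

section MulCase

set_option linter.unusedSectionVars false

universe u

variable {G : Type u} [Group G] [Finite G] {S : Subgroup G}

/-- The orders of elements of `S` are `1`, `p`, `q`, `r` and `p * q`. -/
structure MulCase (p q r k : ℕ) (S : Subgroup G) : Prop extends OuterPow p k S where
  pq : q.Prime
  pr : r.Prime
  neq : p ≠ q
  ner : p ≠ r
  qr : q ≠ r
  ord : ∀ x ∈ S, orderOf x = 1 ∨ orderOf x = p ∨ orderOf x = q ∨ orderOf x = r ∨ orderOf x = p * q
  mul : ∃ x ∈ S, orderOf x = p * q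

namespace MulCase

variable {p q r k : ℕ}

theorem goodPrime (h : MulCase p q r k S) : GoodPrime r p S :=
  OuterPow.goodPrime_of_ord h.prime h.pq h.pr h.ner.symm h.qr.symm fun x hx => by
    rcases h.ord x hx with h1 | h1 | h1 | h1 | h1
    · exact Or.inl h1
    · exact Or.inr (Or.inl (h1 ▸ h.prime))
    · exact Or.inr (Or.inl (h1 ▸ h.pq))
    · exact Or.inr (Or.inl (h1 ▸ h.pr))
    · exact Or.inr (Or.inr h1)

theorem dvd_p (h : MulCase p q r k S) : p ∣ Nat.card S := by
  obtain ⟨x, hx, hxo⟩ := h.mul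
  exact (dvd_mul_right p q).trans (hxo ▸ Subgroup.orderOf_dvd_card hx)

theorem prime_dvd (h : MulCase p q r k S) {ℓ : ℕ} (hℓ : ℓ.Prime) (hℓS : ℓ ∣ Nat.card S) : ℓ = p ∨ ℓ = q ∨ ℓ = r := by
  obtain ⟨x, hx, hxℓ⟩ := exists_mem_orderOf_eq_prime hℓ hℓS
  have hnp : ¬ (p * q).Prime := Nat.not_prime_mul h.prime.ne_one h.pq.ne_one
  rcases h.ord x hx with h1 | h1 | h1 | h1 | h1 <;> rw [hxℓ] at h1
  · exact absurd h1 hℓ.ne_one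
  · exact Or.inl h1
  · exact Or.inr (Or.inl h1)
  · exact Or.inr (Or.inr h1)
  · exact absurd (h1 ▸ hℓ) hnp

theorem dvd_r (h : MulCase p q r k S) : r ∣ Nat.card S := by
  by_contra hd
  refine h.ns (isSolvable_of_prime_dvd_card_eq_or_eq (p := p) (q := q) fun ℓ hℓ hℓS => ?_)
  rcases h.prime_dvd hℓ hℓS with h1 | h1 | h1
  · exact Or.inl h1
  · exact Or.inr h1
  · exact absurd (h1 ▸ hℓS) hd

theorem orderOf_dvd_p (h : MulCase p q r k S) {x : G} {j : ℕ} (hx : x ∈ S) (hj : orderOf x = p ^ j) :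
    orderOf x ∣ p := by
  have key : ∀ ℓ, ℓ.Prime → p ≠ ℓ → ¬ ℓ ∣ orderOf x := fun ℓ hℓ hpℓ h1 => by
    rw [hj] at h1
    exact hpℓ ((Nat.prime_dvd_prime_iff_eq hℓ h.prime).1 (hℓ.dvd_of_dvd_pow h1)).symm
  rcases h.ord x hx with h1 | h1 | h1 | h1 | h1
  · rw [h1]; exact one_dvd _
  · rw [h1]
  · exact absurd h1.symm.dvd (key q h.pq h.neq)
  · exact absurd h1.symm.dvd (key r h.pr h.ner)
  · exact absurd (h1 ▸ dvd_mul_left q p) (key q h.pq h.neq)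

theorem k_eq (h : MulCase p q r k S) : k = 2 := by
  obtain ⟨y, -, hy⟩ := SetLike.exists_of_lt h.ne_top.lt_top
  have hyo := h.outer y hy
  have h0 := h.k_ne_zero
  have h1 : k ≠ 1 := by
    rintro rfl
    obtain ⟨z, hz, hzp⟩ := exists_mem_orderOf_eq_prime h.prime h.dvd_p
    exact h.orderOf_ne hz hy (by rw [hyo, hzp, pow_one])
  have hyp : orderOf (y ^ p) = p ^ (k - 1) := by
    rw [orderOf_pow' _ h.prime.ne_zero, hyo, Nat.gcd_eq_right (dvd_pow_self p h0)]
    exact Nat.div_eq_of_eq_mul_left h.prime.pos (by rw [← pow_succ, Nat.sub_add_cancel (by omega)])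
  by_cases hS : y ^ p ∈ S
  · have h3 := h.orderOf_dvd_p hS hyp
    rw [hyp] at h3
    have := (Nat.pow_dvd_pow_iff_le_right h.prime.one_lt).1 (h3.trans (pow_one p).symm.dvd)
    omega
  · have h3 := h.outer _ hS
    rw [hyp] at h3
    have := Nat.pow_right_injective h.prime.two_le h3
    omega

theorem orderOf_outer (h : MulCase p q r k S) {y : G} (hy : y ∉ S) : orderOf y = p ^ 2 := by
  rw [h.outer y hy, h.k_eq]

theorem orderOf_outer_pow (h : MulCase p q r k S) {y : G} (hy : y ∉ S) : orderOf (y ^ p) = p := by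
  rw [orderOf_pow' _ h.prime.ne_zero, h.orderOf_outer hy, Nat.gcd_eq_right (dvd_pow_self p two_ne_zero), pow_two,
    Nat.mul_div_cancel _ h.prime.pos]

theorem outer_pow_mem (h : MulCase p q r k S) {y : G} (hy : y ∉ S) : y ^ p ∈ S := by
  by_contra hc
  have h1 := h.orderOf_outer hc
  rw [h.orderOf_outer_pow hy] at h1
  have := Nat.pow_right_injective h.prime.two_le ((pow_one p).trans h1)
  omega

theorem exists_sylIn_zpowers (h : MulCase p q r k S) {R : Subgroup G} (hR : SylIn r R S) :
    ∃ a ∈ S, orderOf a = p ∧ SylIn p (Subgroup.zpowers a) (S.nor R) := by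
  have := h.normal
  have hp := h.prime
  obtain ⟨M, hM⟩ := exists_sylIn h.prime (S.nor R)
  have hMS : M ≤ S := hM.le.trans Subgroup.nor_le
  obtain ⟨y, -, hyS, -, hyR, hyM⟩ := exists_not_mem_normalizing h.prime h.pr h.prime h.dvd_index hR hM
  have hao := h.orderOf_outer_pow hyS
  have haS := h.outer_pow_mem hyS
  have haM : y ^ p ∈ M := hM.mem_of_mem_nor h.prime (hao.trans (pow_one p).symm)
    (Subgroup.mem_inf.2 ⟨Subgroup.mem_inf.2 ⟨haS, Subgroup.pow_mem _ hyR _⟩, Subgroup.pow_mem _ hyM _⟩)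
  have hMR : M ≤ Subgroup.normalizer (R : Set G) := hM.le.trans inf_le_right
  have hfree := h.goodPrime.isolated.freeOn hp h.pr h.ner hR.le hMS hR.isPGroup hM.isPGroup
  refine ⟨y ^ p, haS, hao, ?_⟩
  suffices hs : M = Subgroup.zpowers (y ^ p) by rwa [← hs]
  refine le_antisymm (fun x hx => ?_) (Subgroup.zpowers_le.2 haM)
  obtain ⟨j, hj⟩ := hM.isPGroup.orderOf_eq hp hx
  rcases (Nat.dvd_prime hp).1 (h.orderOf_dvd_p (hMS hx) hj) with h1 | h1
  · rw [orderOf_eq_one_iff.1 h1]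
    exact Subgroup.one_mem _
  · exact hM.isPGroup.mem_zpowers_of_free hp h.pr h.ner hR.isPGroup (hR.ne_bot h.pr h.dvd_r) hMR hfree haM hx hao h1

end MulCase

end MulCase

section MulCase

set_option linter.unusedSectionVars false

universe u

variable {G : Type u} [Group G] [Finite G] {S : Subgroup G}

theorem ncard_sdiff_add_card_inf (B S : Subgroup G) :
    ((B : Set G) \ S).ncard + Nat.card (S ⊓ B : Subgroup G) = Nat.card B := by
  have h1 := Set.ncard_sdiff_add_ncard_of_subset (s := ((S ⊓ B : Subgroup G) : Set G)) (t := (B : Set G))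
    (fun x hx => hx.2)
  have h2 : (B : Set G) \ ((S ⊓ B : Subgroup G) : Set G) = (B : Set G) \ S := by
    ext x
    simp only [Subgroup.coe_inf, Set.mem_sdiff, Set.mem_inter_iff, SetLike.mem_coe]
    tauto
  rw [h2] at h1
  exact h1

theorem ncard_sdiff_add_card_inf_le (B S : Subgroup G) [S.Normal] :
    ((B : Set G) \ S).ncard + Nat.card (S ⊓ B : Subgroup G) ≤ S.index * Nat.card (S ⊓ B : Subgroup G) := by
  rw [ncard_sdiff_add_card_inf]
  have h1 := Subgroup.card_mul_index ((S ⊓ B).subgroupOf B)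
  have h2 : ((S ⊓ B).subgroupOf B).index = S.relIndex B := by
    rw [← Subgroup.inf_relIndex_right]; rfl
  rw [h2, Nat.card_congr (Subgroup.subgroupOfEquivOfLe (inf_le_right : S ⊓ B ≤ B)).toEquiv] at h1
  rw [← h1, mul_comm]
  exact Nat.mul_le_mul_right _ (Nat.le_of_dvd (Nat.pos_of_ne_zero Subgroup.index_ne_zero_of_finite)
    (Subgroup.relIndex_dvd_index_of_normal S B))

theorem Set.ncard_eq_mul_of_forall_fiber {α β : Type*} [Finite α] [Finite β] {T : Set α} {D : Set β} (f : α → β)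
    (hf : ∀ x ∈ T, f x ∈ D) {m : ℕ} (hm : ∀ b ∈ D, {x | x ∈ T ∧ f x = b}.ncard = m) : T.ncard = D.ncard * m := by
  classical
  rw [Set.ncard_eq_toFinset_card _ T.toFinite, Set.ncard_eq_toFinset_card _ D.toFinite,
    Finset.card_eq_sum_card_fiberwise (f := f) (t := D.toFinite.toFinset) (fun x hx => by simpa using hf x (by simpa using hx)),
    Finset.sum_const_nat]
  intro b hb
  rw [← hm b (by simpa using hb), ← Set.ncard_coe_finset]
  congr 1
  ext x
  simp

namespace MulCase

variable {p q r k : ℕ}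

theorem ncard_outer_fiber_eq (h : MulCase p q r k S) {b c : G} (hbc : orderOf b = orderOf c) :
    {z | z ∉ S ∧ z ^ p = b}.ncard = {z | z ∉ S ∧ z ^ p = c}.ncard := by
  have key : ∀ b c : G, orderOf b = orderOf c → {z | z ∉ S ∧ z ^ p = b}.ncard ≤ {z | z ∉ S ∧ z ^ p = c}.ncard := by
    intro b c hbc
    obtain ⟨φ, rfl⟩ := h.trans b c hbc
    refine Set.ncard_le_ncard_of_injOn φ ?_ φ.injective.injOn
    rintro z ⟨hz, rfl⟩
    refine ⟨fun hc => hz ?_, (map_pow φ z p).symm⟩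
    have := h.char.map_mem φ.symm hc
    rwa [MulEquiv.symm_apply_apply] at this
  exact le_antisymm (key _ _ hbc) (key _ _ hbc.symm)

/-- An element `a` of order `p` such that all elements of order `p` of `S` are conjugate in `S` to powers of `a`. -/
structure Gen (a : G) (p : ℕ) (S : Subgroup G) : Prop where
  mem : a ∈ S
  ord : orderOf a = p
  conj : ∀ u ∈ S, orderOf u = p → ∃ k ∈ S, ∃ w ∈ Subgroup.zpowers a, u = k * w * k⁻¹

theorem exists_gen (h : MulCase p q r k S) : ∃ a, Gen a p S ∧ (S.ordSet r).ncard * p < Nat.card S := by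
  obtain ⟨R, hR⟩ := exists_sylIn h.pr S
  obtain ⟨a, haS, hao, ha⟩ := h.exists_sylIn_zpowers hR
  refine ⟨a, ⟨haS, hao, fun u hu huo => h.exists_conj_of_sylIn_nor h.prime h.pr hR ha hu (Subgroup.mem_zpowers a)
    (huo.trans hao.symm)⟩, ?_⟩
  have h1 := hR.ncard_ordSet_mul_le h.pr one_ne_zero
  rw [pow_one] at h1
  have h2 : p * Nat.card R ≤ Nat.card (S.nor R) := by
    refine Nat.le_of_dvd Nat.card_pos (Nat.Coprime.mul_dvd_of_dvd_of_dvd ?_ ?_ (Subgroup.card_dvd_of_le (Subgroup.le_nor hR.le)))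
    · rw [hR.2]
      exact Nat.Coprime.pow_right _ ((Nat.coprime_primes h.prime h.pr).2 h.ner)
    · rw [← hao]
      exact Subgroup.orderOf_dvd_card (ha.le (Subgroup.mem_zpowers a))
  have h3 : 0 < Nat.card R := Nat.card_pos
  have h4 : 0 < Nat.card S := Nat.card_pos
  refine Nat.lt_of_mul_lt_mul_right (a := Nat.card R) ?_
  calc (S.ordSet r).ncard * p * Nat.card R ≤ (S.ordSet r).ncard * Nat.card (S.nor R) := by
        rw [mul_assoc]; exact Nat.mul_le_mul_left _ h2
    _ ≤ Nat.card S * (Nat.card R - 1) := h1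
    _ < Nat.card S * Nat.card R := Nat.mul_lt_mul_of_pos_left (by omega) h4

theorem Gen.orderOf_eq (hp : p.Prime) {a : G} (ha : Gen a p S) {w : G} (hw : w ∈ Subgroup.zpowers a) (hw1 : w ≠ 1) :
    orderOf w = p := by
  have h1 := Subgroup.orderOf_dvd_card hw
  rw [Nat.card_zpowers, ha.ord] at h1
  exact ((Nat.dvd_prime hp).1 h1).resolve_left fun hc => hw1 (orderOf_eq_one_iff.1 hc)

theorem Gen.ncard_mul_le {a : G} (ha : Gen a p S) (hp : p.Prime) :
    (S.ordSet p).ncard * Nat.card (S.cen a) ≤ Nat.card S * (p - 1) := by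
  have h1 := Subgroup.ncard_diff_one (Subgroup.zpowers a)
  rw [Nat.card_zpowers, ha.ord] at h1
  rw [← h1]
  refine ncard_mul_card_le_of_conj Subgroup.cen_le ?_ ?_
  · rintro n hn w ⟨hw, hw1⟩
    obtain ⟨i, rfl⟩ := Subgroup.mem_zpowers_iff.1 hw
    have h2 : n * a ^ i = a ^ i * n := (Commute.zpow_right (Subgroup.mem_cen.1 hn).2 i)
    rw [h2, mul_inv_cancel_right]
    exact ⟨hw, hw1⟩
  · rintro u ⟨hu, huo⟩
    obtain ⟨k, hk, w, hw, rfl⟩ := ha.conj u hu huo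
    refine ⟨k, hk, w, ⟨hw, ?_⟩, rfl⟩
    rintro rfl
    rw [mul_one, mul_inv_cancel, orderOf_one] at huo
    exact hp.ne_one huo.symm

/-- The counting argument: the centralizer of `a` covers `G ⧸ S`, and all outer elements centralizing `a` are roots of
powers of `a`. -/
theorem Gen.counting {a : G} (ha : Gen a p S) (h : MulCase p q r k S) :
    (S.ordSet p).ncard * Nat.card (S.cen a) = Nat.card S * (p - 1) ∧
    (((Subgroup.centralizer {a} : Subgroup G) : Set G) \ S).ncard + Nat.card (S.cen a) = S.index * Nat.card (S.cen a) ∧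
    ∀ z ∈ Subgroup.centralizer {a}, z ∉ S → z ^ p ∈ Subgroup.zpowers a ∧ z ^ p ≠ 1 := by
  have := h.normal
  have hp := h.prime
  set B : Subgroup G := Subgroup.centralizer {a} with hB
  have h1 := ha.ncard_mul_le hp
  have h2 := ncard_sdiff_add_card_inf_le B S
  change ((B : Set G) \ S).ncard + Nat.card (S.cen a) ≤ S.index * Nat.card (S.cen a) at h2
  obtain ⟨f, hf⟩ : ∃ f, ∀ b, orderOf b = p → {z | z ∉ S ∧ z ^ p = b}.ncard = f :=
    ⟨_, fun b hb => h.ncard_outer_fiber_eq (hb.trans ha.ord.symm)⟩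
  have h3 : ((⊤ : Subgroup G) \ S : Set G).ncard = (S.ordSet p).ncard * f := by
    refine Set.ncard_eq_mul_of_forall_fiber (fun z => z ^ p) ?_ ?_
    · rintro z ⟨-, hz⟩
      exact ⟨h.outer_pow_mem hz, h.orderOf_outer_pow hz⟩
    · rintro b ⟨-, hb⟩
      rw [← hf b hb]
      congr 1
      ext z
      simp
  have h4 := ncard_sdiff_add_card_inf (⊤ : Subgroup G) S
  rw [h3, inf_top_eq, Subgroup.card_top, ← S.index_mul_card] at h4
  let E : Set G := {z | z ∉ S ∧ z ^ p ∈ (Subgroup.zpowers a : Set G) \ {1}}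
  have h5 : E.ncard = (p - 1) * f := by
    have h6 := Subgroup.ncard_diff_one (Subgroup.zpowers a)
    rw [Nat.card_zpowers, ha.ord] at h6
    rw [← h6]
    refine Set.ncard_eq_mul_of_forall_fiber (fun z => z ^ p) (fun z hz => hz.2) ?_
    rintro b ⟨hb, hb1⟩
    rw [← hf b (ha.orderOf_eq hp hb hb1)]
    congr 1
    ext z
    simp only [Set.mem_ofPred_eq, E]
    constructor
    · rintro ⟨⟨h1, -⟩, h2⟩
      exact ⟨h1, h2⟩
    · rintro ⟨h1, rfl⟩
      exact ⟨⟨h1, hb, hb1⟩, rfl⟩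
  have hEB : E ⊆ (B : Set G) \ S := by
    rintro z ⟨hz, hza, hz1⟩
    refine ⟨?_, hz⟩
    have h6 : Subgroup.zpowers (z ^ p) = Subgroup.zpowers a := by
      refine Subgroup.eq_of_le_of_card_ge (Subgroup.zpowers_le.2 hza) ?_
      rw [Nat.card_zpowers, Nat.card_zpowers, ha.ord, ha.orderOf_eq hp hza hz1]
    have h7 : a ∈ Subgroup.zpowers z :=
      Subgroup.zpowers_le.2 (Subgroup.pow_mem _ (Subgroup.mem_zpowers z) p) (h6 ▸ Subgroup.mem_zpowers a)
    obtain ⟨i, hi⟩ := Subgroup.mem_zpowers_iff.1 h7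
    rw [SetLike.mem_coe, hB, Subgroup.mem_centralizer_singleton_iff, ← hi]
    exact (Commute.refl z).zpow_right i
  have h6 := Set.ncard_le_ncard hEB
  have hm : 1 < S.index := by
    have h7 : S.index ≠ 0 := Subgroup.index_ne_zero_of_finite
    have h8 := h.index_ne_one
    omega
  have hS : 0 < Nat.card S := Nat.card_pos
  have hC : 0 < Nat.card (S.cen a) := Nat.card_pos
  have hnp : 0 < (S.ordSet p).ncard := (Set.ncard_pos (Set.toFinite _)).2 ⟨a, ha.mem, ha.ord⟩
  suffices hs : (S.ordSet p).ncard * Nat.card (S.cen a) = Nat.card S * (p - 1) ∧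
      ((B : Set G) \ S).ncard + Nat.card (S.cen a) = S.index * Nat.card (S.cen a) ∧ ((B : Set G) \ S).ncard ≤ E.ncard by
    refine ⟨hs.1, hs.2.1, fun z hz hzS => ?_⟩
    have h7 := Set.eq_of_subset_of_ncard_le hEB hs.2.2
    have h8 : z ∈ E := h7 ▸ ⟨hz, hzS⟩
    exact h8.2
  rw [h5] at h6 ⊢
  generalize Nat.card S = s at *
  generalize (S.ordSet p).ncard = n at *
  generalize Nat.card (S.cen a) = c at *
  generalize ((B : Set G) \ S).ncard = e at *
  obtain ⟨m, hm'⟩ := Nat.exists_eq_add_of_lt hm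
  rw [hm'] at h2 h4 ⊢
  generalize p - 1 = P at *
  clear hf h5 hEB this
  have k1 : n * f = (m + 1) * s := by nlinarith
  have k2 : e ≤ (m + 1) * c := by nlinarith
  have k3 : n * (P * f) = (m + 1) * (P * s) := by
    calc n * (P * f) = P * (n * f) := by ring
      _ = _ := by rw [k1]; ring
  have k4 : n * (P * f) ≤ n * e := Nat.mul_le_mul_left _ h6
  have k5 : n * e ≤ n * ((m + 1) * c) := Nat.mul_le_mul_left _ k2
  have k6 : n * ((m + 1) * c) ≤ (m + 1) * (P * s) := by
    calc n * ((m + 1) * c) = (m + 1) * (n * c) := by ring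
      _ ≤ (m + 1) * (s * P) := Nat.mul_le_mul_left _ h1
      _ = _ := by ring
  refine ⟨?_, ?_, ?_⟩
  · refine Nat.eq_of_mul_eq_mul_left (Nat.succ_pos m) ?_
    calc (m + 1) * (n * c) = n * ((m + 1) * c) := by ring
      _ = (m + 1) * (P * s) := by omega
      _ = (m + 1) * (s * P) := by ring
  · have : n * e = n * ((m + 1) * c) := by omega
    have := Nat.eq_of_mul_eq_mul_left hnp this
    rw [this]; ring
  · exact Nat.le_of_mul_le_mul_left (by omega) hnp

end MulCase

end MulCase

section MulCase

set_option linter.unusedSectionVars false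

universe u

variable {G : Type u} [Group G] [Finite G] {S : Subgroup G}

theorem Subgroup.mem_normalizer_conjBy {K : Subgroup G} {c y : G} :
    y ∈ Subgroup.normalizer (K.conjBy c : Set G) ↔ c⁻¹ * y * c ∈ Subgroup.normalizer (K : Set G) := by
  simp only [Subgroup.mem_normalizer_iff, Subgroup.mem_conjBy]
  constructor
  · intro h x
    have := h (c * x * c⁻¹)
    rw [show c⁻¹ * (c * x * c⁻¹) * c = x by group] at this
    rw [this]
    have h2 : c⁻¹ * (y * (c * x * c⁻¹) * y⁻¹) * c = c⁻¹ * y * c * x * (c⁻¹ * y * c)⁻¹ := by group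
    rw [h2]
  · intro h x
    rw [h]
    have h2 : c⁻¹ * y * c * (c⁻¹ * x * c) * (c⁻¹ * y * c)⁻¹ = c⁻¹ * (y * x * y⁻¹) * c := by group
    rw [h2]

theorem Subgroup.eq_of_forall_sylIn {N C : Subgroup G} (hNC : N ≤ C)
    (h : ∀ ℓ, ℓ.Prime → ℓ ∣ Nat.card C → ∃ P, SylIn ℓ P C ∧ Nat.card P ∣ Nat.card N) : N = C := by
  refine Subgroup.eq_of_le_of_card_ge hNC ?_
  obtain ⟨i, hi⟩ := Subgroup.card_dvd_of_le hNC
  suffices hs : i = 1 by rw [hi, hs, mul_one]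
  by_contra hne
  obtain ⟨ℓ, hℓ, hd⟩ := Nat.exists_prime_and_dvd hne
  obtain ⟨P, hP, hPN⟩ := h ℓ hℓ (hi ▸ hd.mul_left _)
  refine Nat.pow_succ_factorization_not_dvd Nat.card_pos.ne' hℓ (n := Nat.card C) ?_
  rw [pow_succ, ← hP.2]
  rw [hi]
  exact mul_dvd_mul hPN hd

namespace MulCase

variable {p q r k : ℕ} {a : G}

theorem Gen.sq_dvd_card_cen (ha : Gen a p S) (h : MulCase p q r k S) : p ^ 2 ∣ Nat.card (S.cen a) := by
  have hp := h.prime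
  have h1 := (ha.counting h).1
  obtain ⟨P, hP, haP⟩ := IsPGroup.exists_le_sylIn hp
    (isPGroup_zpowers (x := a) (p := p) (k := 1) (ha.ord.trans (pow_one p).symm)) (Subgroup.zpowers_le.2 ha.mem)
  have hPb := hP.ne_bot hp h.dvd_p
  obtain ⟨x, hx, hxo, hxc⟩ := IsPGroup.mem_center_exists_orderOf_eq_prime hp hP.isPGroup hPb
  have h2 : P ≤ S.cen x := fun y hy => Subgroup.mem_cen.2 ⟨hP.le hy, hxc y hy⟩
  have h3 := Subgroup.card_dvd_of_le h2
  rw [h.trans.card_cen_eq h.char (hxo.trans ha.ord.symm)] at h3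
  refine dvd_trans ?_ h3
  by_contra hn
  have hPc := hP.2
  have h4 : Nat.card P = p := by
    rw [hPc] at hn ⊢
    generalize (Nat.card S).factorization p = j at *
    have h5 : j < 2 := lt_of_not_ge fun hc => hn (pow_dvd_pow _ hc)
    interval_cases j
    · exact absurd (Subgroup.card_eq_one.1 (hPc.trans (pow_zero p))) hPb
    · exact pow_one p
  have h5 : Subgroup.zpowers a = P := Subgroup.eq_of_le_of_card_ge haP (by rw [h4, Nat.card_zpowers, ha.ord])
  have h6 := hP.ncard_ordSet_mul_le hp one_ne_zero
  rw [pow_one, h4, ← h1] at h6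
  have hnp : 0 < (S.ordSet p).ncard := (Set.ncard_pos (Set.toFinite _)).2 ⟨a, ha.mem, ha.ord⟩
  have h7 := Nat.le_of_mul_le_mul_left h6 hnp
  have hcomm : ∀ n ∈ S.cen a, ∀ x ∈ P, n * x = x * n := by
    intro n hn x hx
    rw [← h5] at hx
    obtain ⟨i, rfl⟩ := Subgroup.mem_zpowers_iff.1 hx
    exact Commute.zpow_right (Subgroup.mem_cen.1 hn).2 i
  have h8 : S.cen a ≤ S.nor P := fun n hn => Subgroup.mem_nor_of_conj_mem (Subgroup.cen_le hn) fun y hy => by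
    rw [hcomm n hn y hy, mul_inv_cancel_right]
    exact hy
  have h9 := Subgroup.eq_of_le_of_card_ge h8 h7
  exact h.simple.exists_not_comm h.ns hp hP hPb (h9 ▸ hcomm)

theorem Gen.prime_dvd_card_cen (ha : Gen a p S) (h : MulCase p q r k S) {ℓ : ℕ} (hℓ : ℓ.Prime)
    (hd : ℓ ∣ Nat.card (S.cen a)) : ℓ = p ∨ ℓ = q := by
  rcases h.prime_dvd hℓ (hd.trans (Subgroup.card_dvd_of_le Subgroup.cen_le)) with h1 | h1 | h1
  · exact Or.inl h1
  · exact Or.inr h1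
  · subst h1
    obtain ⟨x, hx, hxo⟩ := exists_mem_orderOf_eq_prime hℓ hd
    have h1 := orderOf_mul_eq_of_comm hℓ h.prime h.ner.symm hxo ha.ord (Subgroup.mem_cen.1 hx).2
    have h2 := h.goodPrime.isolated _ (S.mul_mem (Subgroup.cen_le hx) ha.mem) (h1 ▸ dvd_mul_right _ _)
    rw [h1] at h2
    exact absurd (Nat.eq_of_mul_eq_mul_left hℓ.pos (h2.trans (mul_one _).symm)) h.prime.ne_one

theorem Gen.mem_cen_iff (ha : Gen a p S) (h : MulCase p q r k S) {z : G} (hz : z ∈ Subgroup.centralizer {a}) (hzS : z ∉ S)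
    {w : G} : w ∈ S.cen a ↔ w ∈ S ∧ w * z ^ p = z ^ p * w := by
  obtain ⟨h1, h2⟩ := (ha.counting h).2.2 z hz hzS
  have h3 : Subgroup.zpowers (z ^ p) = Subgroup.zpowers a := by
    refine Subgroup.eq_of_le_of_card_ge (Subgroup.zpowers_le.2 h1) ?_
    rw [Nat.card_zpowers, Nat.card_zpowers, ha.ord, ha.orderOf_eq h.prime h1 h2]
  rw [Subgroup.mem_cen]
  refine and_congr_right fun _ => ⟨fun hw => ?_, fun hw => ?_⟩
  · obtain ⟨i, hi⟩ := Subgroup.mem_zpowers_iff.1 h1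
    rw [← hi]
    exact Commute.zpow_right hw i
  · obtain ⟨i, hi⟩ := Subgroup.mem_zpowers_iff.1 (h3 ▸ Subgroup.mem_zpowers a : a ∈ Subgroup.zpowers (z ^ p))
    rw [← hi]
    exact Commute.zpow_right hw i

theorem Gen.ncard_normalizing_eq (ha : Gen a p S) (h : MulCase p q r k S) {K : Subgroup G} (hK : SylIn q K (S.cen a))
    {z z' : G} (hz : z ∈ Subgroup.centralizer {a}) (hzS : z ∉ S) (hz' : z' ∈ Subgroup.centralizer {a}) (hzS' : z' ∉ S) :
    {c | c ∈ S.cen a ∧ c⁻¹ * z * c ∈ Subgroup.normalizer (K : Set G)}.ncard =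
      {c | c ∈ S.cen a ∧ c⁻¹ * z' * c ∈ Subgroup.normalizer (K : Set G)}.ncard := by
  have key : ∀ z z' : G, z ∈ Subgroup.centralizer {a} → z ∉ S → z' ∈ Subgroup.centralizer {a} → z' ∉ S →
      {c | c ∈ S.cen a ∧ c⁻¹ * z * c ∈ Subgroup.normalizer (K : Set G)}.ncard ≤
      {c | c ∈ S.cen a ∧ c⁻¹ * z' * c ∈ Subgroup.normalizer (K : Set G)}.ncard := by
    intro z z' hz hzS hz' hzS'
    obtain ⟨φ, rfl⟩ := h.trans z z' ((h.orderOf_outer hzS).trans (h.orderOf_outer hzS').symm)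
    have hC : ∀ c ∈ S.cen a, φ c ∈ S.cen a := fun c hc => by
      rw [ha.mem_cen_iff h hz hzS] at hc
      rw [ha.mem_cen_iff h hz' hzS']
      refine ⟨h.char.map_mem φ hc.1, ?_⟩
      rw [← map_pow, ← map_mul, ← map_mul, hc.2]
    have hφK : SylIn q (K.map φ.toMonoidHom) (S.cen a) := by
      refine ⟨?_, ?_⟩
      · rintro _ ⟨x, hx, rfl⟩
        exact hC x (hK.le hx)
      · rw [Subgroup.card_map_of_injective φ.injective, hK.2]
    obtain ⟨d, hd, hdK⟩ := hK.exists_conjBy_eq h.pq hφK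
    refine Set.ncard_le_ncard_of_injOn (fun c => φ c * d) ?_ ?_
    · rintro c ⟨hc, hcK⟩
      refine ⟨(S.cen a).mul_mem (hC c hc) hd, ?_⟩
      have h1 : (φ c * d)⁻¹ * φ z * (φ c * d) = d⁻¹ * φ (c⁻¹ * z * c) * d := by
        simp only [map_mul, map_inv]; group
      rw [h1, ← Subgroup.mem_normalizer_conjBy, hdK]
      refine (Subgroup.mem_nor_of_conj_mem (K := ⊤) (Subgroup.mem_top _) ?_ : _ ∈ (⊤ : Subgroup G).nor _).2
      rintro _ ⟨x, hx, rfl⟩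
      refine ⟨_, (Subgroup.mem_normalizer_iff.1 hcK x).1 hx, ?_⟩
      simp
    · intro c _ c' _ hcc
      exact φ.injective (mul_right_cancel hcc)
  exact le_antisymm (key z z' hz hzS hz' hzS') (key z' z hz' hzS' hz hzS)

end MulCase

end MulCase

section MulCase

set_option linter.unusedSectionVars false

universe u

variable {G : Type u} [Group G] [Finite G] {S : Subgroup G}

namespace MulCase

variable {p q r k : ℕ} {a : G}

theorem ncard_mul_eq_of_conj {B C N : Subgroup G} (hCB : C ≤ B) [S.Normal] (hNB : N ≤ B) {f : ℕ}
    (hf : ∀ z ∈ (B : Set G) \ S, {c | c ∈ C ∧ c⁻¹ * z * c ∈ N}.ncard = f) :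
    ((B : Set G) \ S).ncard * f = Nat.card C * ((N : Set G) \ S).ncard := by
  let T : Set (G × G) := {x | x.1 ∈ (B : Set G) \ S ∧ x.2 ∈ C ∧ x.2⁻¹ * x.1 * x.2 ∈ N}
  have h1 : T.ncard = ((B : Set G) \ S).ncard * f := by
    refine Set.ncard_eq_mul_of_forall_fiber Prod.fst (fun x hx => hx.1) fun b hb => ?_
    rw [← hf b hb]
    refine (Set.ncard_congr (fun c _ => (b, c)) ?_ ?_ ?_).symm
    · rintro c ⟨hc, hcN⟩
      exact ⟨⟨hb, hc, hcN⟩, rfl⟩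
    · rintro c c' _ _ hcc
      exact congrArg Prod.snd hcc
    · rintro ⟨z, c⟩ ⟨⟨-, hc, hcN⟩, rfl⟩
      exact ⟨c, ⟨hc, hcN⟩, rfl⟩
  have h2 : T.ncard = (C : Set G).ncard * ((N : Set G) \ S).ncard := by
    refine Set.ncard_eq_mul_of_forall_fiber Prod.snd (fun x hx => hx.2.1) fun c hc => ?_
    refine (Set.ncard_congr (fun z _ => (c * z * c⁻¹, c)) ?_ ?_ ?_).symm
    · rintro z ⟨hz, hzS⟩
      refine ⟨⟨⟨B.mul_mem (B.mul_mem (hCB hc) (hNB hz)) (B.inv_mem (hCB hc)), fun hcon => hzS ?_⟩, hc, ?_⟩, rfl⟩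
      · have := Subgroup.Normal.conj_mem ‹S.Normal› _ hcon c⁻¹
        simpa [mul_assoc] using this
      · simpa [mul_assoc] using hz
    · rintro z z' _ _ hzz
      have := congrArg Prod.fst hzz
      exact mul_left_cancel (mul_right_cancel this)
    · rintro ⟨z, c⟩ ⟨⟨hz, hc, hcN⟩, rfl⟩
      refine ⟨c⁻¹ * z * c, ⟨hcN, fun hcon => hz.2 ?_⟩, ?_⟩
      · have := Subgroup.Normal.conj_mem ‹S.Normal› _ hcon c
        simpa [mul_assoc] using this
      · simp [mul_assoc]
  rw [← h1, h2]
  rfl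

theorem Gen.mem_nor_of_normalizing (ha : Gen a p S) (h : MulCase p q r k S) {K : Subgroup G} (hK : SylIn q K (S.cen a))
    {y : G} (hy : y ∈ Subgroup.centralizer {a}) (hyS : y ∉ S) (hyK : y ∈ Subgroup.normalizer (K : Set G)) {c : G}
    (hc : c ∈ S.cen a) (hyc : c⁻¹ * y * c ∈ Subgroup.normalizer (K : Set G)) : c ∈ (S.cen a).nor K := by
  have := h.normal
  set B : Subgroup G := Subgroup.centralizer {a} with hB
  have hCB : S.cen a ≤ B := inf_le_right
  have hset : ∀ z ∈ (B : Set G) \ S, {c | c ∈ S.cen a ∧ c⁻¹ * z * c ∈ B.nor K} =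
      {c | c ∈ S.cen a ∧ c⁻¹ * z * c ∈ Subgroup.normalizer (K : Set G)} := by
    rintro z ⟨hz, -⟩
    ext c
    refine and_congr_right fun hc => ⟨fun h => h.2, fun h => ⟨?_, h⟩⟩
    exact B.mul_mem (B.mul_mem (B.inv_mem (hCB hc)) hz) (hCB hc)
  have h1 := ncard_mul_eq_of_conj (S := S) (N := B.nor K) hCB Subgroup.nor_le
    (f := {c | c ∈ S.cen a ∧ c⁻¹ * y * c ∈ Subgroup.normalizer (K : Set G)}.ncard) fun z hz => by
      rw [hset z hz]
      exact ha.ncard_normalizing_eq h hK hz.1 hz.2 hy hyS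
  have h2 := ncard_sdiff_add_card_inf_le (B.nor K) S
  have h3 : S ⊓ B.nor K = (S.cen a).nor K := (inf_assoc _ _ _).symm
  rw [h3] at h2
  have h4 := (ha.counting h).2.1
  rw [← hB] at h4
  have hsub : (((S.cen a).nor K : Subgroup G) : Set G) ⊆
      {c | c ∈ S.cen a ∧ c⁻¹ * y * c ∈ Subgroup.normalizer (K : Set G)} := by
    rintro c ⟨hc, hcK⟩
    exact ⟨hc, Subgroup.mul_mem _ (Subgroup.mul_mem _ (Subgroup.inv_mem _ hcK) hyK) hcK⟩
  have h5 : {c | c ∈ S.cen a ∧ c⁻¹ * y * c ∈ Subgroup.normalizer (K : Set G)}.ncard ≤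
      (((S.cen a).nor K : Subgroup G) : Set G).ncard := by
    change _ ≤ Nat.card ((S.cen a).nor K)
    have hpos : 0 < ((B : Set G) \ S).ncard := (Set.ncard_pos (Set.toFinite _)).2 ⟨y, hy, hyS⟩
    refine Nat.le_of_mul_le_mul_left ?_ hpos
    rw [h1]
    generalize ((B : Set G) \ S).ncard = e at *
    generalize Nat.card (S.cen a) = c at *
    generalize Nat.card ((S.cen a).nor K) = d at *
    generalize (((B.nor K : Subgroup G) : Set G) \ S).ncard = e' at *
    have h6 : c * e' + c * d ≤ e * d + c * d := by
      calc c * e' + c * d = c * (e' + d) := by ring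
        _ ≤ c * (S.index * d) := Nat.mul_le_mul_left _ h2
        _ = (S.index * c) * d := by ring
        _ = _ := by rw [← h4]; ring
    omega
  have h6 := Set.eq_of_subset_of_ncard_le hsub h5
  have h7 : c ∈ (((S.cen a).nor K : Subgroup G) : Set G) := h6 ▸ ⟨hc, hyc⟩
  exact h7

theorem Gen.le_normalizer (ha : Gen a p S) (h : MulCase p q r k S) {K : Subgroup G} (hK : SylIn q K (S.cen a)) :
    S.cen a ≤ Subgroup.normalizer (K : Set G) := by
  have := h.normal
  have hp := h.prime
  set B : Subgroup G := Subgroup.centralizer {a} with hB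
  have hCB : S.cen a ≤ B := inf_le_right
  have hconj : ∀ b ∈ B, ∀ c ∈ S.cen a, b * c * b⁻¹ ∈ S.cen a := fun b hb c hc =>
    ⟨Subgroup.Normal.conj_mem ‹S.Normal› _ hc.1 _, B.mul_mem (B.mul_mem hb hc.2) (B.inv_mem hb)⟩
  have hBn : B ≤ Subgroup.normalizer (S.cen a : Set G) := fun b hb =>
    (Subgroup.mem_nor_of_conj_mem (K := B) hb (hconj b hb)).2
  obtain ⟨y, hy, hyS⟩ : ∃ y ∈ B.nor K, y ∉ S := by
    have h4 := (ha.counting h).2.1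
    rw [← hB] at h4
    have h5 : ((B : Set G) \ S).Nonempty := by
      rw [← Set.ncard_pos (Set.toFinite _)]
      have h6 := h.index_ne_one
      have h7 : 0 < Nat.card (S.cen a) := Nat.card_pos
      by_contra hc
      rw [Nat.eq_zero_of_not_pos hc, zero_add] at h4
      exact h6 (Nat.eq_of_mul_eq_mul_right h7 (h4.symm.trans (one_mul _).symm))
    obtain ⟨z, hz, hzS⟩ := h5
    obtain ⟨n, hn, hnz⟩ := hK.exists_mul_mem_nor h.pq hCB hBn hz
    exact ⟨n * z, hnz, fun hc => hzS ((S.mul_mem_cancel_left hn.1).1 hc)⟩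
  have hyo := h.orderOf_outer hyS
  obtain ⟨D, hD, hyD⟩ := IsPGroup.exists_le_sylIn hp (isPGroup_zpowers hyo) (Subgroup.zpowers_le.2 hy)
  replace hyD := hyD (Subgroup.mem_zpowers y)
  obtain ⟨E, hE, hDE⟩ := IsPGroup.exists_le_sylIn hp hD.isPGroup (hD.le.trans Subgroup.nor_le)
  rcases hDE.eq_or_lt with rfl | hlt
  · suffices hs : (S.cen a).nor K = S.cen a by
      rw [← hs]
      exact inf_le_right
    refine Subgroup.eq_of_forall_sylIn Subgroup.nor_le fun ℓ hℓ hd => ?_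
    rcases ha.prime_dvd_card_cen h hℓ hd with rfl | rfl
    · obtain ⟨P, hP⟩ := exists_sylIn hℓ (S.cen a)
      obtain ⟨b, hb, hbP⟩ := IsPGroup.exists_conjBy_le hℓ hP.isPGroup (hP.le.trans hCB) hE
      refine ⟨P, hP, ?_⟩
      rw [← Subgroup.card_conjBy b P]
      refine Subgroup.card_dvd_of_le fun x hx => ⟨?_, (hD.le (hbP hx)).2⟩
      rw [Subgroup.mem_conjBy] at hx
      have := hconj b hb _ (hP.le hx)
      simpa [mul_assoc] using this
    · exact ⟨K, hK, Subgroup.card_dvd_of_le (Subgroup.le_nor hK.le)⟩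
  · obtain ⟨e, he, heD⟩ := SetLike.exists_of_lt (hE.isPGroup.lt_nor hp hlt)
    have heB : e ∈ B := hE.le he.1
    refine absurd ?_ heD
    have h1 : K.conjBy e ≤ S.cen a := fun x hx => by
      rw [Subgroup.mem_conjBy] at hx
      have := hconj e heB _ (hK.le hx)
      simpa [mul_assoc] using this
    obtain ⟨c, hc, hcK⟩ := hK.exists_conjBy_eq h.pq (⟨h1, by rw [Subgroup.card_conjBy, hK.2]⟩ : SylIn q (K.conjBy e) _)
    have h2 : e⁻¹ * y * e ∈ D := by
      have := ((Subgroup.mem_nor.1 (Subgroup.inv_mem _ he)).2 y).1 hyD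
      simpa using this
    have h3 : y ∈ Subgroup.normalizer (K.conjBy e : Set G) := Subgroup.mem_normalizer_conjBy.2 (hD.le h2).2
    rw [← hcK, Subgroup.mem_normalizer_conjBy] at h3
    have h4 := ha.mem_nor_of_normalizing h hK hy.1 hyS hy.2 hc h3
    rw [(Subgroup.conjBy_eq_iff hc).2 h4] at hcK
    have h5 : e ∈ B.nor K := (Subgroup.conjBy_eq_iff heB).1 hcK.symm
    have h6 : IsPGroup p (E ⊓ B.nor K : Subgroup G) := hE.isPGroup.to_le inf_le_left
    rw [hD.eq_of_le hp h6 (le_inf hDE hD.le) inf_le_right]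
    exact ⟨he.1, h5⟩

end MulCase

end MulCase

section MulCase

set_option linter.unusedSectionVars false

universe u

variable {G : Type u} [Group G] [Finite G] {S : Subgroup G}

namespace MulCase

variable {p q r k : ℕ} {a : G}

theorem Gen.comm_of_comm (ha : Gen a p S) (hp : p.Prime) {w t : G} (hw : w ∈ Subgroup.zpowers a) (hw1 : w ≠ 1)
    (h : t * w = w * t) : t * a = a * t := by
  have h3 : Subgroup.zpowers w = Subgroup.zpowers a := by
    refine Subgroup.eq_of_le_of_card_ge (Subgroup.zpowers_le.2 hw) ?_
    rw [Nat.card_zpowers, Nat.card_zpowers, ha.ord, ha.orderOf_eq hp hw hw1]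
  obtain ⟨i, hi⟩ := Subgroup.mem_zpowers_iff.1 (h3 ▸ Subgroup.mem_zpowers a : a ∈ Subgroup.zpowers w)
  rw [← hi]
  exact Commute.zpow_right h i

theorem conj_comm {t w k : G} (h : t * (k * w * k⁻¹) = k * w * k⁻¹ * t) : k⁻¹ * t * k * w = w * (k⁻¹ * t * k) := by
  calc k⁻¹ * t * k * w = k⁻¹ * (t * (k * w * k⁻¹)) * k := by group
    _ = _ := by rw [h]; group

theorem Gen.ncard_dvd_mul_le (ha : Gen a p S) (h : MulCase p q r k S) {K : Subgroup G} (hK : SylIn q K (S.cen a)) :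
    {u | u ∈ S ∧ p ∣ orderOf u}.ncard * Nat.card (S.cen a) ≤ Nat.card S * ((p - 1) * Nat.card K) := by
  have hp := h.prime
  have hn := ha.le_normalizer h hK
  have hpq := (Nat.coprime_primes hp h.pq).2 h.neq
  let A : Set G := (fun x : G × G => x.1 * x.2) '' (((Subgroup.zpowers a : Set G) \ {1}) ×ˢ (K : Set G))
  have hA : A.ncard ≤ (p - 1) * Nat.card K := by
    refine (Set.ncard_image_le (Set.toFinite _)).trans ?_
    rw [Set.ncard_prod, Subgroup.ncard_diff_one, Nat.card_zpowers, ha.ord]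
    exact le_rfl
  refine le_trans ?_ (Nat.mul_le_mul_left _ hA)
  refine ncard_mul_card_le_of_conj Subgroup.cen_le ?_ ?_
  · rintro n hnC _ ⟨⟨w, v⟩, ⟨⟨hw, hw1⟩, hv⟩, rfl⟩
    refine ⟨(w, n * v * n⁻¹), ⟨⟨hw, hw1⟩, (Subgroup.mem_normalizer_iff.1 (hn hnC) v).1 hv⟩, ?_⟩
    obtain ⟨i, rfl⟩ := Subgroup.mem_zpowers_iff.1 hw
    have h2 : n * a ^ i = a ^ i * n := Commute.zpow_right (Subgroup.mem_cen.1 hnC).2 i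
    change a ^ i * (n * v * n⁻¹) = n * (a ^ i * v) * n⁻¹
    rw [← mul_assoc, ← mul_assoc, ← h2]
    group
  · rintro u ⟨hu, hd⟩
    have hupq : u ^ (p * q) = 1 := by
      rw [← orderOf_dvd_iff_pow_eq_one]
      rcases h.ord u hu with h1 | h1 | h1 | h1 | h1 <;> rw [h1] at hd ⊢
      · exact one_dvd _
      · exact dvd_mul_right _ _
      · exact dvd_mul_left _ _
      · exact _root_.absurd ((Nat.prime_dvd_prime_iff_eq hp h.pr).1 hd) h.ner
    have h1 : orderOf (u ^ q) = p := by
      have := Fact.mk hp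
      refine orderOf_eq_prime (by rw [← pow_mul, mul_comm, hupq]) fun hc => h.neq ?_
      exact (Nat.prime_dvd_prime_iff_eq hp h.pq).1 (hd.trans (orderOf_dvd_of_pow_eq_one hc))
    obtain ⟨k, hk, w, hw, hwu⟩ := ha.conj _ (S.pow_mem hu q) h1
    refine ⟨k, hk, k⁻¹ * u * k, ?_, by group⟩
    have hw1 : w ≠ 1 := by
      rintro rfl
      rw [mul_one, mul_inv_cancel] at hwu
      rw [hwu, orderOf_one] at h1
      exact hp.ne_one h1.symm
    set t := k⁻¹ * u * k with ht
    have hut : u = k * t * k⁻¹ := by rw [ht]; group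
    have htq : t ^ q = w := by
      rw [hut, conj_pow] at hwu
      exact mul_left_cancel (mul_right_cancel hwu)
    have htC : t ∈ S.cen a := Subgroup.mem_cen.2 ⟨S.mul_mem (S.mul_mem (S.inv_mem hk) hu) hk,
      ha.comm_of_comm hp hw hw1 (by rw [← htq]; exact (Commute.refl t).pow_right q)⟩
    have htK : t ^ p ∈ K := by
      have h3 : orderOf (t ^ p) ∣ q := by
        refine orderOf_dvd_of_pow_eq_one ?_
        rw [← pow_mul]
        rw [hut, conj_pow] at hupq
        exact conj_eq_one_iff.1 hupq
      obtain ⟨j, -, hj⟩ := (Nat.dvd_prime_pow h.pq).1 (h3.trans (pow_one q).symm.dvd)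
      exact hK.mem_of_mem_nor h.pq hj ⟨Subgroup.pow_mem _ htC p, hn (Subgroup.pow_mem _ htC p)⟩
    have hbez : t = w ^ (p.gcdB q) * (t ^ p) ^ (p.gcdA q) := by
      rw [← htq, ← zpow_natCast, ← zpow_natCast, ← zpow_mul, ← zpow_mul, ← zpow_add, add_comm, ← Nat.gcd_eq_gcd_ab,
        hpq.gcd_eq_one, Nat.cast_one, zpow_one]
    refine ⟨(w ^ (p.gcdB q), (t ^ p) ^ (p.gcdA q)), ⟨⟨Subgroup.zpow_mem _ hw _, fun hc => ?_⟩, K.zpow_mem htK _⟩, hbez.symm⟩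
    rw [show w ^ (p.gcdB q) = 1 from hc, one_mul] at hbez
    have h4 : t ∈ K := hbez ▸ K.zpow_mem htK _
    have h5 : p ∣ Nat.card K := by
      rw [hut, ← MulAut.conj_apply, MulEquiv.orderOf_eq] at hd
      exact hd.trans (Subgroup.orderOf_dvd_card h4)
    rw [hK.2] at h5
    exact h.neq ((Nat.prime_dvd_prime_iff_eq hp h.pq).1 (hp.dvd_of_dvd_pow h5))

theorem Gen.ncard_ordSet_mul_le (ha : Gen a p S) (h : MulCase p q r k S) {K : Subgroup G} (hK : SylIn q K (S.cen a)) :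
    (S.ordSet q).ncard * Nat.card (S.cen a) ≤ Nat.card S * (Nat.card K - 1) := by
  have hp := h.prime
  have hn := ha.le_normalizer h hK
  rw [← Subgroup.ncard_diff_one]
  refine ncard_mul_card_le_of_conj Subgroup.cen_le ?_ ?_
  · rintro n hnC v ⟨hv, hv1⟩
    exact ⟨(Subgroup.mem_normalizer_iff.1 (hn hnC) v).1 hv, fun hc => hv1 (conj_eq_one_iff.1 hc)⟩
  · rintro u ⟨hu, huo⟩
    obtain ⟨x, hx, hxo⟩ := h.mul
    have h1 : orderOf (x ^ p) = q := by
      rw [orderOf_pow' _ hp.ne_zero, hxo, Nat.gcd_eq_right (dvd_mul_right _ _), Nat.mul_div_cancel_left _ hp.pos]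
    have h2 : orderOf (x ^ q) = p := by
      rw [orderOf_pow' _ h.pq.ne_zero, hxo, Nat.gcd_eq_right (dvd_mul_left _ _), Nat.mul_div_cancel _ h.pq.pos]
    obtain ⟨φ, rfl⟩ := h.trans (x ^ p) u (h1.trans huo.symm)
    have h3 : φ (x ^ p) * φ (x ^ q) = φ (x ^ q) * φ (x ^ p) := by
      rw [← map_mul, ← map_mul, ← pow_add, ← pow_add, add_comm]
    obtain ⟨k, hk, w, hw, hwu⟩ := ha.conj _ (h.char.map_mem φ (S.pow_mem hx q)) (by rw [MulEquiv.orderOf_eq, h2])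
    have hw1 : w ≠ 1 := by
      rintro rfl
      rw [mul_one, mul_inv_cancel, MulEquiv.map_eq_one_iff] at hwu
      rw [hwu, orderOf_one] at h2
      exact hp.ne_one h2.symm
    rw [hwu] at h3
    generalize φ (x ^ p) = u at *
    have hto : orderOf (k⁻¹ * u * k) = q := by
      rw [← huo]
      have := MulEquiv.orderOf_eq (MulAut.conj k⁻¹) u
      rwa [MulAut.conj_apply, inv_inv] at this
    have htC : k⁻¹ * u * k ∈ S.cen a := Subgroup.mem_cen.2 ⟨S.mul_mem (S.mul_mem (S.inv_mem hk) hu) hk,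
      ha.comm_of_comm hp hw hw1 (conj_comm h3)⟩
    refine ⟨k, hk, k⁻¹ * u * k, ⟨hK.mem_of_mem_nor h.pq (hto.trans (pow_one q).symm) ⟨htC, hn htC⟩, fun hc => ?_⟩, by group⟩
    rw [show k⁻¹ * u * k = 1 from hc, orderOf_one] at hto
    exact h.pq.ne_one hto.symm

theorem absurd (h : MulCase p q r k S) : False := by
  obtain ⟨a, ha, hr⟩ := h.exists_gen
  have hp := h.prime.two_le
  obtain ⟨K, hK⟩ := exists_sylIn h.pq (S.cen a)
  have h1 := ha.ncard_dvd_mul_le h hK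
  have h2 := ha.ncard_ordSet_mul_le h hK
  have h3 := ha.sq_dvd_card_cen h
  have h4 : p ^ 2 * Nat.card K ≤ Nat.card (S.cen a) := by
    refine Nat.le_of_dvd Nat.card_pos (Nat.Coprime.mul_dvd_of_dvd_of_dvd ?_ h3 (Subgroup.card_dvd_of_le hK.le))
    rw [hK.2]
    exact Nat.Coprime.pow _ _ ((Nat.coprime_primes h.prime h.pq).2 h.neq)
  have h5 : p ^ 2 ∣ Nat.card S := h3.trans (Subgroup.card_dvd_of_le Subgroup.cen_le)
  have hppq : p ≠ p * q := fun he =>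
    h.pq.ne_one (Nat.eq_of_mul_eq_mul_left h.prime.pos (he.symm.trans (mul_one p).symm))
  have h6 : {u | u ∈ S ∧ p ∣ orderOf u}.ncard = (S.ordSet p).ncard + (S.ordSet (p * q)).ncard := by
    rw [← Set.ncard_union_eq]
    · congr 1
      ext u
      constructor
      · rintro ⟨hu, hd⟩
        rcases h.ord u hu with h1 | h1 | h1 | h1 | h1
        · exact _root_.absurd (Nat.dvd_one.1 (h1 ▸ hd)) h.prime.ne_one
        · exact Or.inl ⟨hu, h1⟩
        · exact _root_.absurd ((Nat.prime_dvd_prime_iff_eq h.prime h.pq).1 (h1 ▸ hd)) h.neq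
        · exact _root_.absurd ((Nat.prime_dvd_prime_iff_eq h.prime h.pr).1 (h1 ▸ hd)) h.ner
        · exact Or.inr ⟨hu, h1⟩
      · rintro (⟨hu, h1⟩ | ⟨hu, h1⟩)
        · exact ⟨hu, h1.symm.dvd⟩
        · exact ⟨hu, h1 ▸ dvd_mul_right _ _⟩
    · rw [Set.disjoint_left]
      rintro u ⟨-, h1⟩ ⟨-, h2⟩
      exact hppq (h1.symm.trans h2)
  have hS : Nat.card S = 1 + ((S.ordSet p).ncard + ((S.ordSet q).ncard + ((S.ordSet r).ncard + (S.ordSet (p * q)).ncard))) := by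
    have h1 := Subgroup.card_eq_sum_ordSet (K := S) {1, p, q, r, p * q} (fun x hx => by
      simpa using h.ord x hx)
    have hpqn : ¬ (p * q).Prime := Nat.not_prime_mul h.prime.ne_one h.pq.ne_one
    rw [Finset.sum_insert, Finset.sum_insert, Finset.sum_insert, Finset.sum_insert, Finset.sum_singleton,
      Subgroup.ncard_ordSet_one] at h1
    · exact h1
    · simp only [Finset.mem_singleton]
      exact fun he => hpqn (he ▸ h.pr)
    · simp only [Finset.mem_insert, Finset.mem_singleton, not_or]
      exact ⟨h.qr, fun he => hpqn (he ▸ h.pq)⟩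
    · simp only [Finset.mem_insert, Finset.mem_singleton, not_or]
      exact ⟨h.neq, h.ner, hppq⟩
    · simp only [Finset.mem_insert, Finset.mem_singleton, not_or]
      exact ⟨h.prime.ne_one.symm, h.pq.ne_one.symm, h.pr.ne_one.symm,
        fun he => h.prime.ne_one (Nat.eq_one_of_mul_eq_one_right he.symm)⟩
  rw [h6] at h1
  have hKpos : 0 < Nat.card K := Nat.card_pos
  have hSpos : 0 < Nat.card S := Nat.card_pos
  generalize Nat.card S = s at *
  generalize (S.ordSet p).ncard = x1 at *
  generalize (S.ordSet (p * q)).ncard = x2 at *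
  generalize (S.ordSet q).ncard = x3 at *
  generalize (S.ordSet r).ncard = x4 at *
  generalize Nat.card (S.cen a) = c at *
  generalize Nat.card K = m at *
  have k1 : (x1 + x2) * p ^ 2 ≤ s * (p - 1) := by
    refine Nat.le_of_mul_le_mul_right (c := m) ?_ hKpos
    calc (x1 + x2) * p ^ 2 * m ≤ (x1 + x2) * c := by rw [mul_assoc]; exact Nat.mul_le_mul_left _ h4
      _ ≤ s * ((p - 1) * m) := h1
      _ = _ := by ring
  have k2 : x3 * p ^ 2 < s := by
    refine Nat.lt_of_mul_lt_mul_right (a := m) ?_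
    calc x3 * p ^ 2 * m ≤ x3 * c := by rw [mul_assoc]; exact Nat.mul_le_mul_left _ h4
      _ ≤ s * (m - 1) := h2
      _ < s * m := Nat.mul_lt_mul_of_pos_left (by omega) hSpos
  obtain ⟨d, rfl⟩ := h5
  have k3 : x3 + 1 ≤ d := by
    rw [mul_comm x3] at k2
    exact Nat.lt_of_mul_lt_mul_left k2
  have k4 : x4 + 1 ≤ p * d := by
    rw [mul_comm x4, pow_two, mul_assoc] at hr
    exact Nat.lt_of_mul_lt_mul_left hr
  have k5 : x1 + x2 ≤ d * (p - 1) := by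
    refine Nat.le_of_mul_le_mul_left (c := p ^ 2) ?_ (pow_pos h.prime.pos 2)
    calc p ^ 2 * (x1 + x2) = (x1 + x2) * p ^ 2 := by ring
      _ ≤ _ := k1
      _ = _ := by ring
  obtain ⟨e, rfl⟩ := Nat.exists_eq_add_of_le hp
  rw [show 2 + e - 1 = e + 1 by omega] at k5
  have hd : 0 < d := by omega
  nlinarith [Nat.zero_le (d * e), Nat.zero_le (d * e ^ 2)]

end MulCase

end MulCase

section OuterCase

set_option linter.unusedSectionVars false

universe u

variable {G : Type u} [Group G] [Finite G] {S : Subgroup G}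

theorem exists_three_primes_dvd_card (hns : ¬ Group.IsSolvable G) : ∃ a b c : ℕ, a.Prime ∧ b.Prime ∧ c.Prime ∧
    a ≠ b ∧ a ≠ c ∧ b ≠ c ∧ a ∣ Nat.card G ∧ b ∣ Nat.card G ∧ c ∣ Nat.card G := by
  have key : ∀ p q : ℕ, ∃ ℓ : ℕ, ℓ.Prime ∧ ℓ ∣ Nat.card G ∧ ℓ ≠ p ∧ ℓ ≠ q := by
    intro p q
    by_contra! hcon
    refine hns (isSolvable_of_prime_dvd_card_eq_or_eq (p := p) (q := q) fun ℓ hℓ hd => ?_)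
    by_contra! h
    exact h.2 (hcon ℓ hℓ hd h.1)
  obtain ⟨a, pa, da, -, -⟩ := key 0 0
  obtain ⟨b, pb, db, hba, -⟩ := key a a
  obtain ⟨c, pc, dc, hca, hcb⟩ := key a b
  exact ⟨a, b, c, pa, pb, pc, hba.symm, hca.symm, hcb.symm, da, db, dc⟩

theorem SimpleIn.comm_of_isSolvable (h : SimpleIn S) (hs : Group.IsSolvable S) :
    ∀ x ∈ S, ∀ y ∈ S, x * y = y * x := by
  by_contra! hcon
  obtain ⟨x, hx, y, hy, hxy⟩ := hcon
  have hsimple : IsSimpleGroup S := by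
    have : Nontrivial S := (Subgroup.nontrivial_iff_ne_bot S).2 h.ne_bot
    refine ⟨fun H hH => ?_⟩
    have h1 : S ≤ Subgroup.normalizer ((H.map S.subtype : Subgroup G) : Set G) := by
      have h2 := Subgroup.le_normalizer_map (H := H) S.subtype
      rw [Subgroup.normalizer_eq_top_iff.2 hH, ← MonoidHom.range_eq_map, Subgroup.range_subtype] at h2
      exact h2
    rcases h.eq _ (Subgroup.map_subtype_le H) h1 with h3 | h3
    · exact Or.inl ((Subgroup.map_eq_bot_iff_of_injective H S.subtype_injective).1 h3)
    · refine Or.inr ((Subgroup.eq_top_iff' H).2 fun z => ?_)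
      obtain ⟨w, hw, hwz⟩ := (h3.symm.le z.2 : (z : G) ∈ H.map S.subtype)
      rwa [← Subtype.ext hwz]
  exact hxy (congrArg Subtype.val (IsSimpleGroup.comm_iff_isSolvable.2 hs ⟨x, hx⟩ ⟨y, hy⟩))

theorem OuterPow.absurd_of_ord {ℓ k : ℕ} (h : OuterPow ℓ k S) {a b c v : ℕ} (pa : a.Prime) (pb : b.Prime)
    (pc : c.Prime) (ab : a ≠ b) (ac : a ≠ c) (bc : b ≠ c) (hℓ : ℓ = a ∨ ℓ = b ∨ ℓ = c) (hv : v = a ∨ v = b ∨ v = c)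
    (hS : ∀ x ∈ S, orderOf x = 1 ∨ orderOf x = a ∨ orderOf x = b ∨ orderOf x = c ∨ orderOf x = ℓ * v)
    (hz : ∃ z ∈ S, orderOf z = ℓ * v) : False := by
  have hsq : ∀ q r : ℕ, q.Prime → r.Prime → ℓ ≠ q → ℓ ≠ r → q ≠ r → v = ℓ →
      (∀ n, (n = a ∨ n = b ∨ n = c) → n = ℓ ∨ n = q ∨ n = r) → False := by
    intro q r pq pr h1 h2 h3 hvℓ hn
    subst hvℓ
    rw [← pow_two] at hS hz
    exact SquareCase.absurd (p := v) (q := q) (r := r) (k := k) (S := S)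
      ⟨h, pq, pr, h1, h2, h3, fun x hx => by
        have h4 := hn (orderOf x)
        rcases hS x hx with h5 | h5 | h5 | h5 | h5
        · exact Or.inl h5
        · rcases h4 (Or.inl h5) with h6 | h6 | h6 <;> simp [h6]
        · rcases h4 (Or.inr (Or.inl h5)) with h6 | h6 | h6 <;> simp [h6]
        · rcases h4 (Or.inr (Or.inr h5)) with h6 | h6 | h6 <;> simp [h6]
        · simp [h5], hz⟩
  have hmul : ∀ r : ℕ, v.Prime → r.Prime → ℓ ≠ v → ℓ ≠ r → v ≠ r →
      (∀ n, (n = a ∨ n = b ∨ n = c) → n = ℓ ∨ n = v ∨ n = r) → False := fun r pv pr h1 h2 h3 hn =>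
    MulCase.absurd (p := ℓ) (q := v) (r := r) (k := k) (S := S)
      ⟨h, pv, pr, h1, h2, h3, fun x hx => by
        have h4 := hn (orderOf x)
        rcases hS x hx with h5 | h5 | h5 | h5 | h5
        · exact Or.inl h5
        · rcases h4 (Or.inl h5) with h6 | h6 | h6 <;> simp [h6]
        · rcases h4 (Or.inr (Or.inl h5)) with h6 | h6 | h6 <;> simp [h6]
        · rcases h4 (Or.inr (Or.inr h5)) with h6 | h6 | h6 <;> simp [h6]
        · simp [h5], hz⟩
  clear hS hz
  rcases hℓ with rfl | rfl | rfl <;> rcases hv with rfl | rfl | rfl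
  · exact hsq b c pb pc ab ac bc rfl (by rintro n (h | h | h) <;> simp [h])
  · exact hmul c pb pc ab ac bc (by rintro n (h | h | h) <;> simp [h])
  · exact hmul b pc pb ac ab bc.symm (by rintro n (h | h | h) <;> simp [h])
  · exact hmul c pa pc ab.symm bc ac (by rintro n (h | h | h) <;> simp [h])
  · exact hsq a c pa pc ab.symm bc ac rfl (by rintro n (h | h | h) <;> simp [h])
  · exact hmul a pc pa bc ab.symm ac.symm (by rintro n (h | h | h) <;> simp [h])
  · exact hmul b pa pb ac.symm bc.symm ab (by rintro n (h | h | h) <;> simp [h])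
  · exact hmul a pb pa bc.symm ac.symm ab.symm (by rintro n (h | h | h) <;> simp [h])
  · exact hsq a b pa pb ac.symm bc.symm ab rfl (by rintro n (h | h | h) <;> simp [h])

namespace OuterCase

theorem absurd_of_primes (h : OuterCase S) (hcard : (Set.range (orderOf : G → ℕ)).ncard ≤ 6) {a b c : ℕ}
    (pa : a.Prime) (pb : b.Prime) (pc : c.Prime) (ab : a ≠ b) (ac : a ≠ c) (bc : b ≠ c) (da : a ∣ Nat.card S)
    (db : b ∣ Nat.card S) (dc : c ∣ Nat.card S) : False := by
  have := h.normal
  by_cases hT : ∀ x ∈ S, orderOf x = 1 ∨ orderOf x = a ∨ orderOf x = b ∨ orderOf x = c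
  · exact h.absurd_triple (a := a) (b := b) (c := c)
      ⟨pa, pb, pc, ab, ac, bc, hT, h.ns, fun x _ y _ hxy => h.trans.card_cen_eq h.char hxy⟩ hcard
  push Not at hT
  obtain ⟨z, hz, z1, za, zb, zc⟩ := hT
  obtain ⟨ℓ, hℓ, hd⟩ := Nat.exists_prime_and_dvd h.index_ne_one
  obtain ⟨y, k, hy, hyk⟩ := exists_not_mem_of_dvd_index hℓ hd
  obtain ⟨xa, hxa, oa⟩ := exists_mem_orderOf_eq_prime pa da
  obtain ⟨xb, hxb, ob⟩ := exists_mem_orderOf_eq_prime pb db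
  obtain ⟨xc, hxc, oc⟩ := exists_mem_orderOf_eq_prime pc dc
  have y1 := h.orderOf_ne S.one_mem hy
  have ya := h.orderOf_ne hxa hy
  have yb := h.orderOf_ne hxb hy
  have yc := h.orderOf_ne hxc hy
  have yz := h.orderOf_ne hz hy
  rw [orderOf_one] at y1
  rw [oa] at ya
  rw [ob] at yb
  rw [oc] at yc
  have a1 := pa.one_lt
  have b1 := pb.one_lt
  have c1 := pc.one_lt
  have hO := mem_of_card_le_ncard_orders (G := G) {1, a, b, c, orderOf z, orderOf y} (by
    intro n hn
    simp only [Finset.mem_insert, Finset.mem_singleton] at hn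
    rcases hn with rfl | rfl | rfl | rfl | rfl | rfl
    exacts [⟨1, orderOf_one⟩, ⟨xa, oa⟩, ⟨xb, ob⟩, ⟨xc, oc⟩, ⟨z, rfl⟩, ⟨y, rfl⟩]) (by
    refine hcard.trans (le_of_eq ?_)
    repeat rw [Finset.card_insert_of_notMem]
    · simp
    all_goals
      simp only [Finset.mem_insert, Finset.mem_singleton]
      omega)
  simp only [Finset.mem_insert, Finset.mem_singleton] at hO
  have hS : ∀ x ∈ S, orderOf x = 1 ∨ orderOf x = a ∨ orderOf x = b ∨ orderOf x = c ∨ orderOf x = orderOf z := by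
    intro x hx
    have h1 := h.orderOf_ne hx hy
    have h2 := hO x
    omega
  have hP : OuterPow ℓ k S := ⟨h, hℓ, hd, fun w hw => by
    have w1 := h.orderOf_ne S.one_mem hw
    have wa := h.orderOf_ne hxa hw
    have wb := h.orderOf_ne hxb hw
    have wc := h.orderOf_ne hxc hw
    have wz := h.orderOf_ne hz hw
    rw [orderOf_one] at w1
    have h2 := hO w
    omega⟩
  by_cases pz : (orderOf z).Prime
  · have hord : ∀ x ∈ S, orderOf x = 1 ∨ (orderOf x).Prime := by
      intro x hx
      rcases hS x hx with h | h | h | h | h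
      · exact Or.inl h
      all_goals exact Or.inr (by rw [h]; assumption)
    have h1 := hP.eq_or_eq_of_ord pa pa fun x hx => (hord x hx).imp_right Or.inl
    have h2 := hP.eq_or_eq_of_ord pb pb fun x hx => (hord x hx).imp_right Or.inl
    omega
  obtain ⟨u, hu, hv⟩ := Nat.exists_prime_and_dvd z1
  obtain ⟨v, hv⟩ := hv
  have hz0 : 0 < orderOf z := orderOf_pos z
  have ho : ∀ i j : ℕ, i.Prime → orderOf z = i * j → j ≠ 1 → j = a ∨ j = b ∨ j = c := by
    intro i j hi hij hj1
    have h1 : orderOf (z ^ i) = j := by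
      rw [orderOf_pow_of_dvd hi.ne_zero ⟨j, hij⟩, hij, Nat.mul_div_cancel_left _ hi.pos]
    have h2 := hS _ (S.pow_mem hz i)
    rw [h1] at h2
    have h3 : j ≠ orderOf z := by
      intro h4
      have := hi.two_le
      have : 0 < j := by omega
      nlinarith
    omega
  have hv1 : v ≠ 1 := by
    rintro rfl
    exact pz (by rw [hv, mul_one]; exact hu)
  have hvm := ho u v hu hv hv1
  have pv : v.Prime := by rcases hvm with rfl | rfl | rfl <;> assumption
  have hum := ho v u pv (hv.trans (mul_comm _ _)) hu.one_lt.ne'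
  have hord := hP.eq_or_eq_of_ord hu pv (by
    intro x hx
    rcases hS x hx with h | h | h | h | h
    · exact Or.inl h
    all_goals first | exact Or.inr (Or.inl (by rw [h]; assumption)) | exact Or.inr (Or.inr (h.trans hv)))
  rw [hv] at hS
  rcases hord with rfl | rfl
  · exact hP.absurd_of_ord pa pb pc ab ac bc hum hvm hS ⟨z, hz, hv⟩
  · rw [mul_comm] at hv hS
    exact hP.absurd_of_ord pa pb pc ab ac bc hvm hum hS ⟨z, hz, hv⟩

theorem absurd (h : OuterCase S) (hcard : (Set.range (orderOf : G → ℕ)).ncard ≤ 6) : False := by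
  obtain ⟨a, b, c, pa, pb, pc, ab, ac, bc, da, db, dc⟩ := exists_three_primes_dvd_card h.ns
  exact h.absurd_of_primes hcard pa pb pc ab ac bc da db dc

end OuterCase

theorem AutTransitive.isSimpleGroup (hat : AutTransitive G) (hns : ¬ Group.IsSolvable G)
    (hcard : (Set.range (orderOf : G → ℕ)).ncard ≤ 6) : IsSimpleGroup G := by
  have : Nontrivial G := by
    rcases subsingleton_or_nontrivial G with hss | hnt
    · exact _root_.absurd (Group.isSolvable_of_comm fun x y => Subsingleton.elim _ _) hns
    · exact hnt
  obtain ⟨N, hN, hN1, hmin⟩ := exists_minimal_characteristic (G := G)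
  by_cases hcomm : ∀ x ∈ N, ∀ y ∈ N, x * y = y * x
  · obtain ⟨p, hp, hmem⟩ := exists_elementary_of_minimal_characteristic hat hN hN1 hmin hcomm
    exact (ElemCore.absurd (p := p) (E := N) ⟨hp, hN, hmem, hcomm, hN1, hat, hns⟩ hcard).elim
  have hs := (comm_or_simpleIn_of_minimal_characteristic hat hN hN1 hmin).resolve_left hcomm
  by_cases htop : N = ⊤
  · subst htop
    exact hs.isSimpleGroup
  · exact (OuterCase.absurd (S := N) ⟨hat, hN, hs, fun h => hcomm (hs.comm_of_isSolvable h), htop⟩ hcard).elim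

/-- The order of the elements of an orbit of the automorphism group. -/
noncomputable def orbitOrder (G : Type*) [Group G] : MulAction.orbitRel.Quotient (MulAut G) G → ℕ :=
  Quotient.lift orderOf (by
    rintro x y ⟨φ, rfl⟩
    exact MulEquiv.orderOf_eq φ y)

theorem range_orbitOrder : Set.range (orbitOrder G) = Set.range (orderOf : G → ℕ) := by
  ext n
  constructor
  · rintro ⟨q, rfl⟩
    induction q using Quotient.inductionOn with
    | _ x => exact ⟨x, rfl⟩
  · rintro ⟨x, rfl⟩
    exact ⟨Quotient.mk'' x, rfl⟩

theorem autTransitive_of_injective_orbitOrder (h : Function.Injective (orbitOrder G)) : AutTransitive G := by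
  intro x y hxy
  have h1 : (Quotient.mk'' y : MulAction.orbitRel.Quotient (MulAut G) G) = Quotient.mk'' x := h hxy.symm
  obtain ⟨φ, hφ⟩ := Quotient.exact h1
  exact ⟨φ, hφ⟩

end OuterCase

/-- A finite nonsolvable group whose spectrum (set of element orders) has at least
6 values is simple or has at least 7 automorphism orbits. -/
theorem stmt_7 (G : Type*) [Group G] [Finite G] (hns : ¬ IsSolvable G)
    (hspec : 6 ≤ (Set.range (orderOf : G → ℕ)).ncard) :
    IsSimpleGroup G ∨ 7 ≤ omegaAut G := by
  by_contra! hcon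
  obtain ⟨h1, h2⟩ := hcon
  have h3 : Nat.card (MulAction.orbitRel.Quotient (MulAut G) G) ≤ (Set.range (orbitOrder G)).ncard := by
    rw [range_orbitOrder]
    unfold omegaAut at h2
    omega
  have h4 : (Set.range (orbitOrder G)).ncard ≤ Nat.card (MulAction.orbitRel.Quotient (MulAut G) G) := by
    rw [← Set.image_univ, ← Set.ncard_univ]
    exact Set.ncard_image_le (Set.toFinite _)
  have h5 : Function.Injective (orbitOrder G) := by
    rw [← Set.injOn_univ, ← Set.ncard_image_iff (Set.toFinite _), Set.image_univ, Set.ncard_univ]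
    omega
  refine h1 ((autTransitive_of_injective_orbitOrder h5).isSimpleGroup hns ?_)
  rw [← range_orbitOrder]
  unfold omegaAut at h2
  omega
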